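/- Let S = {a, a', b, b'} be a four-letter alphabet with the complementation a ↦ a', b ↦ b', and let V, W ⊆ S^6 be nonempty disjoint equivalent polybox codes without twin pairs. Suppose that for every i ∈ {1,…,6} it is not the case that (|V^{i,a}| = |V^{i,a'}| = 5 and |V^{i,b}| = |V^{i,b'}| = 1) and not the case that (|V^{i,a}| = |V^{i,a'}| = 1 and |V^{i,b}| = |V^{i,b'}| = 5). Then |V| > 12. -/

import Mathlib

variable {S : Type}

/-- Two words are dichotomous: at some position they carry complementary letters. -/
def Dicho {d : ℕ} (c : S → S) (u v : Fin d → S) : Prop := ∃ j, v j = c (u j)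

/-- Two words form a twin pair. -/
def TwinPair {d : ℕ} (c : S → S) (u v : Fin d → S) : Prop :=
  ∃ j, v j = c (u j) ∧ ∀ i, i ≠ j → v i = u i

/-- A polybox code: a set of pairwise dichotomous words. -/
def PolyboxCode {d : ℕ} (c : S → S) (V : Set (Fin d → S)) : Prop :=
  ∀ u ∈ V, ∀ v ∈ V, u ≠ v → Dicho c u v

/-- The code contains no twin pair. -/
def NoTwinPair {d : ℕ} (c : S → S) (V : Set (Fin d → S)) : Prop :=
  ∀ u ∈ V, ∀ v ∈ V, ¬ TwinPair c u v

/-- `ES`: sets containing exactly one of `s`, `s'` for every letter `s`. -/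
def ESet (c : S → S) : Set (Set S) := {B | ∀ s, Xor' (s ∈ B) (c s ∈ B)}

/-- `Es`: members of `ES` containing the letter `s`. -/
def ELetter (c : S → S) (s : S) : Set (Set S) := {B | B ∈ ESet c ∧ s ∈ B}

/-- The equicomplementary realization `v̌ ⊆ (ES)^d` of a word `v`. -/
def Realize {d : ℕ} (c : S → S) (v : Fin d → S) : Set (Fin d → Set S) :=
  {x | ∀ i, x i ∈ ELetter c (v i)}

/-- The union `⋃_{v ∈ V} v̌`. -/
def RealizeSet {d : ℕ} (c : S → S) (V : Set (Fin d → S)) : Set (Fin d → Set S) :=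
  ⋃ v ∈ V, Realize c v

/-- Two codes are equivalent if their realizations coincide. -/
def EquivCodes {d : ℕ} (c : S → S) (V W : Set (Fin d → S)) : Prop :=
  RealizeSet c V = RealizeSet c W

/-- A partition code: a polybox code whose realization is the whole box `(ES)^d`. -/
def PartitionCode {d : ℕ} (c : S → S) (U : Set (Fin d → S)) : Prop :=
  PolyboxCode c U ∧ RealizeSet c U = {x | ∀ i, x i ∈ ESet c}

/-- `V^{i,l}`: the words of `V` with letter `l` at position `i`. -/
def Subcode {d : ℕ} (V : Set (Fin d → S)) (i : Fin d) (l : S) : Set (Fin d → S) :=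
  {v | v ∈ V ∧ v i = l}

namespace Cube

/-! ### The checker

Letters are the elements of `ℤ/4`, complementary letters differing by two; the letter `l` covers the
coordinates `l` and `l + 1`. A word of the first or second code, or a cell covered by such words, is
stored as its base-four value, increased by 4096 for the second code, and a set of words or cells as
a bit mask. Everything is written with recursors and binary natural number arithmetic so that the
kernel evaluates it quickly. -/

section Checker

set_option exponentiation.threshold 10000

/-- The number `k`, marked with a tag that keeps cached terms of the kernel apart. -/
def tagged (_t k : Nat) : Nat := k

noncomputable section

/-- Evaluate `f` at the value of `e`, marked with the tag `t`. -/
def force (t e : Nat) (f : Nat → Bool) : Bool :=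
  @Nat.rec (fun _ => Bool) false (fun k _ => f (tagged t k)) (Nat.succ e)

/-- Evaluate `f` at the value of `e`. -/
def force0 (e : Nat) (f : Nat → Bool) : Bool :=
  @Nat.rec (fun _ => Bool) false (fun k _ => f k) (Nat.succ e)

local notation "IF(" c "," x "," y ")" => @Bool.rec (fun _ => Bool) y x c

def full : Nat := 2 ^ 8192 - 1

/-- Indices whose `i`-th base-four digit is `l`. -/
def digitMask (i l : Nat) : Nat :=
  Nat.shiftLeft ((2 ^ (4 ^ i) - 1) * ((2 ^ 8192 - 1) / (2 ^ (4 ^ (i + 1)) - 1)))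
    (Nat.mul l (Nat.pow 4 i))

def digit (q i : Nat) : Nat := Nat.land (Nat.shiftRight q (Nat.mul 2 i)) 3

def sideMask (s : Nat) : Nat := Nat.shiftLeft (2 ^ 4096 - 1) (Nat.mul 4096 s)

def coverMask (i l : Nat) : Nat :=
  Nat.lor (digitMask i l) (digitMask i (Nat.land (Nat.add l 3) 3))

def cellMask (i l : Nat) : Nat :=
  Nat.lor (digitMask i l) (digitMask i (Nat.land (Nat.add l 1) 3))

def nonOppMask (i l : Nat) : Nat := Nat.xor full (digitMask i (Nat.xor l 2))

def loMask (f : Nat → Nat → Nat) (q : Nat) : Nat :=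
  Nat.land (f 0 (digit q 0)) (Nat.land (f 1 (digit q 1)) (f 2 (digit q 2)))

def hiMask (f : Nat → Nat → Nat) (q : Nat) : Nat :=
  Nat.land (sideMask (digit q 3))
    (Nat.land (f 3 (digit q 0)) (Nat.land (f 4 (digit q 1)) (f 5 (digit q 2))))

def prodMask (f : Nat → Nat → Nat) (q : Nat) (k : Nat → Bool) : Bool :=
  force0 (Nat.land q 63) fun a => force0 (Nat.shiftRight q 6) fun b =>
    k (Nat.land (loMask f a) (hiMask f b))

def hasBit (x c : Nat) : Bool := Nat.beq (Nat.land (Nat.shiftRight x c) 1) 1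

/-- Certificates: refutations of a partial pair of codes. A node `r` restricts the admissible words to
those covering packed cells, `f` contradicts the bound on the size of a code, `n c` branches over the
words covering the uncovered cell `c` (`kid` adds the word, `s` skips it by symmetry, `o` ends the
list), and `d` reports an excluded distribution of letters. -/
inductive T where
  | o : T
  | kid : T → T → T
  | s : T → T
  | r : Nat → T → T
  | f : Nat → T
  | n : Nat → T → T
  | d : T

/-- The state of the checker: the tag, the chosen words, the admissible words, the covered cells, the
cells to be covered, the sizes of the two codes, the transpositions of positions that fix all chosen
words, and the packed cells of the two codes. -/
structure St where
  t : Nat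
  P : List Nat
  A : Nat
  C : Nat
  D : Nat
  m0 : Nat
  m1 : Nat
  E : List (Nat × Nat)
  Q0 : List Nat
  Q1 : List Nat

def tryCell (t U A used c : Nat) (no : Bool) (yes : Nat → Bool) : Bool :=
  IF(Nat.ble c 8191,
    IF(hasBit U c, prodMask coverMask c fun m => force t (Nat.land m A) fun o =>
      IF(Nat.beq o 0, true,
        IF(Nat.beq (Nat.land o used) 0, force t (Nat.lor used o) yes, no)), no), no)

/-- Keep those cells of an earlier packing that still need different words. -/
def packOld (t U A : Nat) (k : Nat → Nat → List Nat → Bool) (Q : List Nat) :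
    Nat → Nat → List Nat → Bool :=
  @List.rec Nat (fun _ => Nat → Nat → List Nat → Bool) (fun l used L => k l used L)
    (fun c _ ih l used L => @Nat.rec (fun _ => Bool) (k 0 used L)
      (fun l' _ => tryCell t U A used c (ih l used L) fun used => ih l' used (c :: L)) l) Q

def packNew (t U A base : Nat) (Q : List Nat) (k : Nat → Nat → List Nat → Bool) (l : Nat) :
    Nat → Nat → List Nat → Bool :=
  @Nat.rec (fun _ => Nat → Nat → List Nat → Bool) (fun _ used L => k 0 used L)
    (fun l' ih z used L => IF(Nat.beq z 0, packOld t U A k Q (Nat.succ l') used L,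
      force0 (Nat.xor (Nat.land z 4095) base) fun c =>
        tryCell t U A used c false fun used =>
          force0 (Nat.shiftRight z 12) fun z => ih z used (c :: L))) l

def uncovered (C D : Nat) : Nat := Nat.xor (Nat.lor C D) C

/-- Collect a packing: uncovered cells no two of which are covered by the same admissible word. -/
def gather (s : St) (m sd lim z : Nat) (Q : List Nat) (k : Nat → Nat → List Nat → Bool) : Bool :=
  force s.t (Nat.land (uncovered s.C s.D) (sideMask sd)) fun U =>
    force0 (Nat.shiftRight z 1) fun z => force0 (Nat.add (Nat.mul 4096 sd) 5) fun base =>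
      packNew s.t U s.A base Q k (Nat.sub lim m) z 0 []

def keepEq (w : Nat) (E : List (Nat × Nat)) : (List (Nat × Nat) → Bool) → Bool :=
  @List.rec (Nat × Nat) (fun _ => (List (Nat × Nat) → Bool) → Bool) (fun k => k [])
    (fun e _ ih k => IF(Nat.beq (digit w e.1) (digit w e.2), ih fun E => k (e :: E), ih k)) E

def skip (w : Nat) (E : List (Nat × Nat)) : Bool :=
  @List.rec (Nat × Nat) (fun _ => Bool) false
    (fun e _ ih => IF(Nat.ble (digit w e.2) (digit w e.1), ih, true)) E

/-- Words whose difference pattern from `w` lies in `ps`, added to the mask. -/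
def killMask (w : Nat) (ps : List Nat) : Nat → Nat :=
  @List.rec Nat (fun _ => Nat → Nat) (fun a => a)
    (fun p _ ih a => ih (Nat.lor a (Nat.shiftLeft 1 (Nat.xor w p)))) ps

/-- Add the word `w`. -/
def put (ps : List Nat) (w : Nat) (s : St) (k : St → Bool) : Bool :=
  force0 (Nat.add (Nat.mul s.t 8209) w) fun t =>
  prodMask nonOppMask w fun non => prodMask cellMask w fun cub =>
  force0 (Nat.mod (Nat.add w 4096) 8192) fun w' => prodMask cellMask w' fun cub' =>
  force t (killMask w ps non) fun kill =>
  force0 (Nat.shiftRight w 12) fun b =>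
  force t (Nat.xor s.A (Nat.land s.A kill)) fun A =>
  force t (Nat.lor s.C cub) fun C => force t (Nat.lor s.D cub') fun D =>
  force0 (Nat.add s.m0 (Nat.sub 1 b)) fun m0 => force0 (Nat.add s.m1 b) fun m1 =>
  keepEq w s.E fun E => k ⟨t, w :: s.P, A, C, D, m0, m1, E, s.Q0, s.Q1⟩

/-- Tables for the discrete logarithm to base two modulo 101 and 167. -/
def tabA : Nat := 184524490601497804477001716745513781652882035627580263237558034602568308107765439916142398389133470403688953843700318132821622932895082612889596673706444978748297985495733133218581106019264481371265342967300026678815666113916437316748968485862415914260521280724597518536802331274674553650410607976403359540540499307173037687571542708303481066423917301263066198875523343936776742580510512354873345587716844046066246633895538777141002297262137663307852822492518298761945036099111878656000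
def tabB : Nat := 4838626604449907583322895398633690549684755418883439105126912457471357887501885320214436667629498508154280632389005999788136672605769979801202705190794032409059989631137093349475738703300426891003153346180338940106791580357141917871936185626121756842512009385166644136806269023546894009271526507264587749605920441494702880641734939748234150943470418722604139961204203777105727918006411118580543013786771436995141053738663555974077137392831441227740893790990146103317497252861874828439911816615826507580055811235831766941008468018057770277725245889192851565169660780071014447980749362295726244490400952517857990795155035943359193418452651532826525250606196191195611876770283158212957194586070384812559720449202687355539522668785892259971397416370900340915498918242822216654242237644800

/-- The exponent of a power of two below `2 ^ 8192`. -/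
def expo (p : Nat) : Nat :=
  Nat.mod (Nat.land (Nat.add (Nat.shiftRight tabA (Nat.mul 16 (Nat.mod p 101)))
    (Nat.shiftRight tabB (Nat.mul 16 (Nat.mod p 167)))) 65535) 8300

/-- Evaluate `k` at the position of the lowest bit of `X`. -/
def lowBit (t X : Nat) (k : Nat → Bool) : Bool :=
  force t (Nat.xor X (Nat.land X (Nat.sub X 1))) fun p => force0 (expo p) k

def count (i l : Nat) (P : List Nat) : Nat :=
  @List.rec Nat (fun _ => Nat) 0
    (fun w _ ih => @Bool.rec (fun _ => Nat) ih (Nat.succ ih)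
      (Bool.and (Nat.ble w 4095) (Nat.beq (digit w i) l))) P

def pattern (P : List Nat) (i x y : Nat) : Bool :=
  Bool.and (Bool.and (Nat.beq (count i 0 P) x) (Nat.beq (count i 2 P) x))
    (Bool.and (Nat.beq (count i 1 P) y) (Nat.beq (count i 3 P) y))

/-- Some position carries one of the two excluded distributions of letters. -/
def exceptional (P : List Nat) : List Nat → Bool :=
  @List.rec Nat (fun _ => Bool) false
    (fun i _ ih => IF(pattern P i 5 1, true, IF(pattern P i 1 5, true, ih)))

def withA (s : St) (A : Nat) : St := ⟨s.t, s.P, A, s.C, s.D, s.m0, s.m1, s.E, s.Q0, s.Q1⟩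

def setQ (s : St) (sd : Nat) (Q : List Nat) : St :=
  @Nat.rec (fun _ => St) ⟨s.t, s.P, s.A, s.C, s.D, s.m0, s.m1, s.E, Q, s.Q1⟩
    (fun _ _ => ⟨s.t, s.P, s.A, s.C, s.D, s.m0, s.m1, s.E, s.Q0, Q⟩) sd

def sel {α : Type} (x y : α) (sd : Nat) : α := @Nat.rec (fun _ => α) x (fun _ _ => y) sd

/-- Check a certificate. -/
def chk (ps : List Nat) (c : T) : St → List (Nat × Nat) → Nat → Bool :=
  @T.rec (fun _ => St → List (Nat × Nat) → Nat → Bool)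
    (fun _ _ X => Nat.beq X 0)
    (fun _ _ body sib s F X => lowBit s.t X fun w =>
      IF(hasBit s.A w, force s.t (Nat.shiftLeft 1 w) fun b =>
        IF(put ps w s fun s' => body s' [] b, force s.t (Nat.xor X b) fun X => sib s F X, false),
        false))
    (fun _ sib s F X => lowBit s.t X fun w =>
      IF(skip w F, force s.t (Nat.xor X (Nat.shiftLeft 1 w)) fun X => sib s F X, false))
    (fun z _ body s F X => force0 (Nat.land z 1) fun sd =>
      gather s (sel s.m0 s.m1 sd) sd 12 z (sel s.Q0 s.Q1 sd) fun l used L =>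
        @Nat.rec (fun _ => Bool)
          (force s.t (Nat.land s.A (Nat.lor used (sideMask (Nat.sub 1 sd)))) fun A =>
            body (setQ (withA s A) sd L) F X)
          (fun _ _ => body (setQ s sd L) F X) l)
    (fun z s _ _ => force0 (Nat.land z 1) fun sd =>
      gather s (sel s.m0 s.m1 sd) sd 13 z (sel s.Q0 s.Q1 sd) fun l _ _ => Nat.beq l 0)
    (fun c _ kids s _ _ =>
      IF(Bool.and (Nat.ble c 8191) (hasBit (uncovered s.C s.D) c),
        prodMask coverMask c fun m => force s.t (Nat.land m s.A) fun o =>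
          keepEq c s.E fun F => kids s F o, false))
    (fun s _ _ => Bool.and (Nat.beq s.m0 12) (exceptional s.P [0, 1, 2, 3, 4, 5]))
    c

def swapPairs : List (Nat × Nat) :=
  [(0,1),(0,2),(0,3),(0,4),(0,5),(1,2),(1,3),(1,4),(1,5),(2,3),(2,4),(2,5),(3,4),(3,5),(4,5)]

def init : St := ⟨1, [], full, 0, 0, 0, 0, swapPairs, [], []⟩

/-- Start the checker from the words `ws`. -/
def root (ps ws : List Nat) : (St → Bool) → St → Bool :=
  @List.rec Nat (fun _ => (St → Bool) → St → Bool) (fun k s => k s)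
    (fun w _ ih k s => put ps w s fun s => ih k s) ws

def twins : List Nat := [2, 8, 32, 128, 512, 2048]

end

end Checker

/-- Excluded differences of twin pairs and of equal words. -/
def bans0 : List Nat := twins ++ [4096]

def bans1 : List Nat := twins ++ [4096, 4097, 4099, 4100, 4108, 4112, 4144, 4160, 4288, 4352, 4864,
  5120, 7168]

def bans2 : List Nat := twins ++ [4096, 4097, 4099, 4100, 4101, 4103, 4108, 4109, 4111, 4112, 4113,
  4115, 4116, 4124, 4144, 4145, 4147, 4148, 4156, 4160, 4161, 4163, 4164, 4172, 4176, 4208, 4288,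
  4289, 4291, 4292, 4300, 4304, 4336, 4352, 4353, 4355, 4356, 4364, 4368, 4400, 4416, 4544, 4864,
  4865, 4867, 4868, 4876, 4880, 4912, 4928, 5056, 5120, 5121, 5123, 5124, 5132, 5136, 5168, 5184,
  5312, 5376, 5888, 7168, 7169, 7171, 7172, 7180, 7184, 7216, 7232, 7360, 7424, 7936]

namespace T

noncomputable section

local infixr:60 "~" => fun z sib => T.kid (T.f z) sib
local infixr:60 "~~" => T.kid
local prefix:60 "§" => T.s

def ta0 : T := (r 6477628324 (r 1148937571285463493291 (n 471 ((r 24365263791 (f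
  55955908866125002546061110461))~~261646804186084838810697522135943~5923957686890725909744391~
  685174567418383268~205211593001892~(r 7077 (r 15606664100 (n 1495 (12110252~3499~3491~o))))~~
  5913507~o))))~~(r 6476112804 (r 514711956967090741 (n 1499 (6076987868465388051251723~(r 3885067
  (n 5510 (20560345626500440255628430679~o)))~~12200506~(r 5053 (r 2978 (n 4096
  (16655350817412704007122301~o))))~~49435781690~50855657957~43926670244~o))))~~(r
  117685953308705700 (r 929696774296062055 (n 1046 (5016632528743926681601861413462637928621~o))))~~
  63839918305791517442827315783~(r 26346702340 (r 259256685421067 (n 4356 ((r 2741 (r 17752499204 (n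
  4107 (15298078~o))))~~5227053~59658648046239~49605518756~49428016060~44604769164~44597520922~(r
  2573 (r 458101786592260 (n 4427 ((n 5392 (581~2699~o))~~31~o))))~~10601111~113853252194~
  113752253154~15069660580~9566692772~15236211308~9029821026~o))))~~(r 26340337156 (r
  1259064036530101166091 (n 1799 ((r 6342827 (r 6301212 (n 4367 (10261129268126233927338659~
  12798998~o))))~~272843742947501~274527368096421~94571118773~15216156~(r 5637 (r 3586 (n 5200
  (10261119925382255468866211~o))))~~9154178~o))))~~(r 442024291316580548 (r 734079539428245127271
  (n 1046 (705062552443852144540606117121273821~o))))~~11957729064411458697863301~(r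
  442024296686601732 (r 224128638413488267 (n 1046 (1016577681690729304350312443312980525~o))))~~
  521495937158367493~1810531521427874783308~3124432621444268173475~(r 6154 (r 2059 (n 5123 ((r
  11233285 (r 320345043181604 (n 5140 (2691~2179~2563~41387437596~o))))~~15587319678076291551479851~
  591275443473787397~3427339531867334920333~618120467247188509~5761762541964650621548~
  774230227368323587~4312124095558091680395~762247191470450877~607115336412450404~188474112092205~
  694366648385286020~179532652955703~688072351259570148~4747164113073906722924~o))))~~(r 25174042 (r
  2743 (n 88 (12256520707~5277067811~2990395~6531099~6529115~1287867~894651~(r 6835 (r 6172 (n 5124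
  ((r 4106 (n 4112 (651~139~523~235526217045622181010773650229269~o)))~~o))))~~26065587~1292979~
  2996915~28915737237~900667~32225563~1782732909263298618~o))))~~(r 86046929602605 (r
  425099790696644 (n 5770 ((r 3838 (n 3431 ((n 886 (714~706~o))~~o)))~~o))))~~
  2298056923856285018015907~(r 89014578119361195 (r 422906137461668 (n 5707 (12698630~(r 3390 (n 662
  (1340~3388~1327~3364~o)))~~15714022~o))))~~280553357100327205~7132090113451264099236~
  771982791364591779~(r 74554265485963 (r 422926006535684 (n 4731 ((r 3198 (n 3927 ((n 566 (1148~
  1148~o))~~o)))~~11912006~2759~2759~o))))~~257056988865155~7132414451789271974084~189041442570413~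
  7095520963647222892036~143177751369760933~1810531521427874783308~3171120241413020860459~o
def ta1 : T := (r 134 (r 1255 (n 86 ((r 362150955406484167 (n 4116 ((r 11247642 (r 11233973 (n 4106
  (10862647~9683095~10863389~15319575~115863023902974~4640093145293534094878~581763186058932627070~
  (r 2071 (r 6174 (n 5150 (2173~2207~2591~2333~o))))~~11526749~17156399421~7228959883793254539322~
  15328957~115863023902974~424300726806046~424280861402654~o))))~~(r 1107607748 (r 10865283 (n 103
  ((r 13756143 (f 675703656827611628856214632197656472773))~~15477067~1322691~180460737841348~
  11847649476~(r 6341 (r 3255617732 (n 1127 (11323468~2379~2371~o))))~~1325253~o))))~~(r 1107534020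
  (r 86080472763071 (n 107 (21582586179~(r 213 (n 6062 (1798999025111698215299325~o)))~~11283130~(r
  6341 (r 796868 (n 4176 (12420262724873069721054397~o))))~~37617412316~26067157~2992348~o))))~~
  ta0)))~~(r 8939558 (r 55944962663 (n 22 (2086~o))))~~(r 8939558 (r 25321543 (n 70 ((r
  1484451179358449134211 (n 1046 ((r 10250631 (n 4096 (10706979~929305350839167651~2615~
  26532374004132~43866834947~26532362199148~2623~107448386093~44000919715~6736326969572~2709~
  26532368105892~180191226415141~27214557398532~106384394207250~459974413309956~43831050403~
  431834836424708~2069~26532386980260~180184827346981~27214557403140~423043743006738~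
  107916111660548~2312373~6736345843204~431861310865426~27316065419684~425262631665682~
  6736345843204~106384394207250~o)))~~o)))~~o))))~~(r 9070726 (r 8649205646907010169137667 (n 1094
  ((r 74734199687 (n 1110 ((r 14837823 (n 4096 (2744509~11520581~663~26532371907492~671~
  26532362199148~663~125681960837803~11117045949~6736326967524~2581~26532371908100~565~
  27214557398532~106384394207250~459974413309956~11117576349~6736345841892~663~26532386980772~671~
  27214557403140~423043743006738~107916111660548~45492362979371~7524856119524~431861310865426~
  26532386981380~425262631665682~6736345843204~106384394207250~o)))~~o)))~~o))))~~134~o))))~~(r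
  34997955206 (r 25714951 (n 1350 ((r 13529735 (n 1094 ((r 1830416864220045983 (n 4167 (8612525~
  929340525436715051~2103~821047428441664035~202070539389101~18420612384996~17733417281764~
  107916101174916~107890029381252~7481906972900~1846909880548~117377195886212~116690000651908~
  15534567999716~15533192268004~431251450256036~431249143478948~431936338534508~431249143767066~
  17734124591780~17732211989156~17734122217708~431150326489242~422513689675396~422513683310212~
  422488987584132~422488987248260~117377195886212~116690000651908~18420612384388~17733417281156~
  o)))~~o)))~~o))))~~(r 551558 (r 5143175 (n 70 (2694~2694~(r 2214 (r 131646775559 (n 4100 ((r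
  11266731 (f 8416851625943721026025238518568682638333))~~1443593977862109257773~20224944360127~
  2234736769975095968115997692866882189~32519699034471837578414635~26532362199148~46011654275~
  107916101699076~107890029905412~7484053930212~1849056837860~108583250871812~107896054588932~
  27214557398532~26527362295300~431251450256036~431249143478948~422488987582692~422488987246820~
  422493820601252~422493819085732~26532362199148~422493819379738~422513689675268~422513683310084~
  6736326967524~6734951235812~108583250871812~107896054588932~27214557398532~26527362295300~o))))~~
  o))))~~o
def ta2 : T := (r 45206364710 (r 19033127 (n 22 ((r 678 (r 6447175 (n 278 ((r 407059686343993349 (n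
  342 ((r 63282762149022735834030844471 (n 4100 (614957~2607275~151~26532374004132~26526166434212~
  26532362199148~797~14928523~151~115175487620612~114488292517380~26532368105892~26526160535972~
  27214557398532~26527362295300~459845732030980~459836982671876~6736347939556~6734972207844~
  26532389077412~26526181507492~27214557403652~26527362300420~424712712930820~424712706565636~
  115175487620612~114488292517380~26532368105892~26526160535972~27214557398532~26527362295300~o)))~~
  o)))~~o))))~~(r 2779302 (r 523436261352774789831 (n 278 ((r 7591 (n 4119 ((r 90165 (r 11247642 (n
  342 (3695424080574829624062740477298939517085~9480898668464402301547231343796811317469~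
  163857082339586124983548473099549~o))))~~(r 2438054106265543010438 (r 10315505188965 (n 1350
  (1277~4349~o))))~~(r 379800069 (r 270394 (n 4164 (171~o))))~~3735151648099811311779~
  15299181294839211049363981~29413043653540~28725848812452~281022279584465957~
  3512833633909538310317~107916086747212~119048474206266~108602611736972~107915416969242~
  28731922194508~107896591622202~459845733996580~459845060935706~460524177596492~459836982829114~
  457775399838092~457775399837722~28731922194508~424693379375162~424712712930820~424712712765466~
  107916086747212~424712706727994~108602611736972~107915416969242~28731922194508~107896591622202~
  o)))~~o))))~~(§(§(r 9069222 (r 131644811959 (n 1046 ((r 11821898060919981605412877 (n 1110 ((r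
  224785835650695 (n 278 (2778295189041272510395891077277156230109~o)))~~o)))~~o))))~~550~o))))))~~
  (§(r 152156307483174 (r 48438602919 (n 1302 ((r 38 (r 1063 (n 1350 ((r 134 (r 13788391 (n 342 ((r
  8939558 (r 327 (n 22 ((r 31616039 (n 70 (17768363063249037594524115808838119094471359~o)))~~
  o))))~~o))))~~(r 134 (r 21655687 (n 22 ((r 678 (r 71 (n 342 ((r 1287 (n 4096 (11264003~
  36440367147~46137516035~3191455885~46137909251~26532362199148~8994869~107916101699076~46139482115~
  6736335881732~8604181~26532368105892~2312373~27214557398532~106384394207250~431251450255524~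
  43831042597~422488987583204~2312341~422493820600740~10699413~26532362199148~423043743006738~
  107916112315908~2312341~115175487620612~431861310865426~26532368105892~423063608410130~
  27214557398532~106384394207250~o)))~~o))))~~2214~(r 2086 (r 14240782707734889824872973 (n 4096
  (10494135~427068840987179~37381915165~3882581398777434327693~3054152195~26532362199148~2310293~
  1057475400447967910~183~433619659331093126~181~105834471803300~183~26532362199148~106384394207250~
  424652772104196~183~6736323696644~183~26532389214212~183~27214557403140~423043743006738~
  107916092790788~183~105829638789124~106483178455058~105834471806980~425262631665682~
  27214557403140~423043743006738~o))))~~o))))~~o))))~~(§o)))))~~o)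
def ta3 : T := (r 4329620228 (r 6215822035938795529052423 (n 391 (232843272938255~199892724132717~
  316998432213068643~160679192611588~13458656004~(r 6917 (r 12921654020 (n 1415 (11716876~9447692~
  11675906~o))))~~22140691715~o))))~~(r 4329153284 (r 25460007059861159084783345667 (n 391 ((r
  3197109 (r 3154716 (n 5396 (3850636~o))))~~4097620015814378940589~317139204057738407~21738049309~
  13466878748~(r 6941 (r 3156740 (n 5396 (2731~o))))~~47684135684~o))))~~851066631416557093092~
  1118106328814856333~(r 25809702436 (r 1016733667099724967 (n 1815 (15559935498557734479490607~
  16428611~(r 26346702886 (r 231354434602503 (n 22 (2086~o))))~~6563747~1020742778724470284~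
  258173216761378~(r 5669 (r 248687941011494 (n 791 (6997516~1611~1603~550~o))))~~23211587~2598~
  o))))~~(r 25803468324 (r 6216043235470522410082335 (n 4356 ((r 2219 (r 17217668132 (n 4363
  (1151995641301552253~o))))~~51743998690~15895548450650915435430435~51744746372~12797436079516~
  44765856644~36981321739236~9128613~352558275516025509~19531219682~508284585255578~15606662020~
  112142722436~10404373476~120328693244~o))))~~(r 4312243062709298946093 (f
  1006154460994839072254391221408196605))~~8142684106350463432141957~(r 10079933 (r 114514767913228
  (n 4416 (293818686586532552774379853990621~o))))~~63876299850358957059936608397~169112662231213~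
  591810759303507077~(r 6154 (r 2061 (n 5123 ((r 8611843 (r 424617992989222 (n 5140 (2691~261~2563~
  261~o))))~~2505182606278892349485~771278038278195243~41273018509~618121016331324077~
  685258293517888484~150943213674525~248234696665611~726207401080572093~604291764251578084~
  5780588103485485~1012351321012973092~179532661383189~685278103886768236~4747308228257284958612~
  o))))~~(r 25174042 (r 2077 (n 8 (2057895991~1812529~1679483~6400049~1025691~6400057~6398363~(r
  6835 (r 6172 (n 4121 ((r 6174 (n 5466 ((r 4126 (n 5707 ((r 1062 (n 22 ((r 3132 (n 2398 ((n 535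
  (1086~3134~1071~3110~o))~~o)))~~6183~550~o)))~~(r 15714022 (n 2398 ((n 5120 ((n 2384 ((n 887
  (1790~3838~1775~3814~o))~~o))~~o))~~o)))~~(r 13747462 (n 2398 ((n 5120 ((n 2384 ((n 647 (1310~
  3358~1295~3334~o))~~o))~~o))~~o)))~~o)))~~o)))~~o))))~~105151275701~7442997387~28948603~
  131457950381~32094459~26983963~424145637187642~o))))~~(r 50347293319851 (r 422901304443108 (n 5150
  ((n 4112 ((r 1107607748 (n 5120 (261~2699~o)))~~o))~~11364574~o))))~~193274442687139~(r
  116025179147102861 (r 431700082475780 (n 5787 (159~(r 3358 (n 3479 ((n 646 (810~802~o))~~o)))~~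
  1797~o))))~~591820663524188821~851066631416557093092~7233637266168382243044~(r 116335707341445 (r
  1741310609491904550 (n 5150 ((r 7844 (n 4368 ((r 1732267530246045734 (n 5120 (2173~261~o)))~~
  o)))~~2613~o))))~~1061903255644160151~7095511954244111876324~36448726661~6919278213~
  591660575063949483~7243121944429585285348~189118577514115590275~o
def ta4 : T := (r 11385464966 (r 4135 (n 1350 ((r 518 (r 263 (n 1286 ((r 4711 (n 262 ((r 29519367 (n
  4116 (100270831395578015~200567930112643~413015025838560291045~1029839318389591944071~9849527~
  4536772739652~4536470749764~114649896898084~114649890663972~108577880854052~107890686012964~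
  26532371910180~26526164340260~4536770645540~4536468655652~424652772497412~424549391292420~
  425237229650500~424550034809412~425242599675908~424555403393028~64597415739972~63910220898884~
  114649896900612~114649890666500~107916086747212~424575267774522~106384227620868~105697031337988~
  107916086747212~424575267774522~o)))~~o)))~~o))))~~(§(r 2121862 (r 21586659391 (n 1094 ((r
  73126535735 (n 262 ((r 9366988896895311392888884289699072532995 (n 70
  (3019159162879946796401392889640939896815799~o)))~~2566~o)))~~o))))~~(r 2121862 (r 4327 (n 1286
  ((r 5127 (n 4116 ((r 11266731 (r 11247642 (n 6651 ((r 7142 (n 6475 (2981507848780615940326~o)))~~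
  o))))~~(r 11878539340 (r 8768131 (n 5883 (1510~5638~o))))~~(r 11878539322 (r 46785546935 (n 1368
  (2754~o))))~~5614864130420805197965~40352377535~1226991653154996395~46137360437~255422315374092~
  255422315372570~35914531371~46146469989~105716527931788~169625473523738~248805912223820~
  248805912223802~(r 103674992644 (r 20563979 (n 3392 (6291~o))))~~20466359~425248000581708~
  424560805814330~425242599675908~424555403393028~424652744958028~28828391186490~425261931747332~
  424574730745860~424652744958028~107993228386362~106384227620868~105697031337988~424652744958028~
  28828391186490~o)))~~o))))~~(§2182~o))))))~~(§(r 176336971261990 (r 9728167 (n 262 ((r 2777222 (r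
  1031 (n 1094 ((r 24013639 (n 70 ((r 6904587558382289844391 (n 4100 (11233973~1217141551026028587~
  2751~132223188197515~2743~27214557399940~26527362296708~105716532792996~105690997870244~
  106379394597092~105692199493860~106384227616292~105697031333412~26532362199148~105697031626778~
  431251450256004~431249143478916~6736348463332~6734972731620~422493820601220~422493819085700~
  27214557397892~26527362294660~422513152673316~422513146439204~106379394597092~105692199493860~
  106384227616292~105697031333412~26532362199148~105697031626778~o)))~~o)))~~o))))~~(§(r
  185173858082854 (r 2055577017401303717 (n 1046 ((r 102117960383 (n 70 (38~2182~o)))~~o))))~~(r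
  11375504006 (r 122507283975 (n 1094 (2694~o))))~~(§(r 27682919 (n 1286 ((r 646 (r 97217770310791
  (n 1094 ((r 134 (r 11450673157 (n 4096 (2761367~9422883~663~1982738072072874115~663~
  27214557399940~663~433166137264980614~663~106379394598628~663~105716527931788~663~26532362199148~
  106384394207250~431251452483588~11115610115~431834836424708~663~26532389214212~663~27214557403140~
  458228115095570~431859001513988~663~6736327890948~431859163381778~106384227620868~423063071539218~
  27214557403140~106384394207250~o))))~~o))))~~(§o))))~~o))))))~~(§(§(§(r 46634864502822 (r 11825831
  (n 4100 ((r 11247642 (r 11266731 (n 4096 ((r 53 (f 2837681192921904041277))~~(§(r 606251 (f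
  6120751223124286885029))~~(§(§(§25972752492~(r 2069 (f 4275725730693856349373))~~(r 11051565 (f
  3907009079718605212893))~~(§111872098412~(§(§(§25972752492~o))))))))))))~~(r 460642374935863339 (r
  401516 (n 4432 (35~2595~(§3261~2091~228048954524578298461392292422199~o)))))~~(r 54339816127 (r
  401434 (n 4116 (2699~o))))~~(§(§280375609166012524~911688974499063843~
  (§(§(§(§(§(§435749796310294636~188987185045539~(r 103174257324 (r 364788829964451 (n 343
  (6096089806212342118439~(§1884097049101099046~(§(§(§o))))))))~~(r 88662042787 (r 103174250522 (n
  4435 (13028020612353278101956613~o))))~~587460215340323568140963~149304851833507~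
  (§(§280375609166012524~1730576607892348954~(§(§(§(§(§(§435749796310294636~1730613853848739866~
  o))))))))))))))))))))~~o))))
def ta5 : T := (r 71 (n 1350 ((r 2566 (r 263 (n 262 (2566~o))))~~(§(r 10512518 (r 13659655 (n 70
  (2182~o))))~~(r 2566 (r 4231 (n 70 ((r 646 (r 2235800175912823047 (n 1286 ((r 518 (r
  66995075800120469885605300895 (n 4116 ((r 11051071 (r 11247642 (n 4395 ((n 4170 (285~535~2079~
  1565~o))~~o))))~~(r 9289741 (r 270412 (n 262 ((n 4390 ((n 4106 ((n 4160 (285~523~2059~1053~o))~~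
  o))~~o))~~o))))~~(r 63 (r 270394 (n 4100 (2731~o))))~~8121860269~10469431~25944395907868845~
  34429607999~476792543433343531~218109657104447~15164523299373~10764343~433014898978988428~
  442584360992383002~147096799857197~2375735~106930227243~26198071~206193933112353479~45667835909~
  118246022583965700~118246016376395780~25906839204162091~1130204036882595~1768896806476896260~
  1766082056703555588~6357158371461~2900031~435752132605958148~432937382837336068~
  1739623390135984204~1739623390135984186~o))))~~o))))~~o))))~~(§2182~o)))))~~(§(r 8939558 (r 327 (n
  1286 ((n 70 (2182~o))~~(§(r 4743 (n 22 ((r 2598 (r 136919642123226090850864065197 (n 1046 (2598~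
  o))))~~(r 31068521263119855558408431779 (n 1094 ((r 4359 (n 262 ((n 70
  (188703467425720168062001637446124725455383~o))~~907311851195588161110379329799107771005~o)))~~
  o)))~~o)))~~(§(r 317073855212077 (n 22 (2598~(r 9401022543079218548465695 (n 70 (2694~26109703~
  o)))~~o)))~~o))))))~~(§(§(§(r 3433639 (n 262 ((r 550 (r 18901131927 (n 86 ((r 10643590 (n 70
  (2182~o)))~~(r 38 (n 4164 ((r 11247642 (r 8612523 (n 4186 (8898591~10076703~
  3348703878592220864862~6933047~118061518807262~1693~127022417535198~(r 2711 (r 6174 (n 5130 (2173~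
  287~2615~287~o))))~~637~48286515591~435281347174622~1565~425952140419294~433100616720662~
  127022417535198~o))))~~(r 1644609764 (r 269226661148781554709584146753571 (n 1143
  (254874749946095~175676689729899~66464499472201543537602892835525~10243451628~11455202~(r 4325 (r
  9316588 (n 119 (443116~1771~1763~o))))~~15610085~o))))~~(r 1644273892 (r 1406854172897005674527 (n
  123 (122773285218851~(r 373 (n 5998 (13019378294658985490107021~o)))~~11414170~(r 6397 (r 927972
  (n 5440 (154860209672340856017884301501~o))))~~38154414332~1530109~3123452~o))))~~ta3)))~~(r
  8939558 (r 6183 (n 70 ((r 6407 (n 278 ((r 29519015 (r 2598 (n 1302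
  (737099731957940507191829714360063609399~o))))~~o)))~~o))))~~(r 646604934 (r 6279 (n 1110 ((r 2598
  (r 72052391981 (n 1302 ((r 5159 (f 14876501736756660438128752409538151891986495))~~o))))~~2182~
  o))))~~134~o))))~~(§(r 9238505990 (r 77426577138367 (n 1350 ((r 2214 (r 4359 (n 1302 ((r 2743 (n
  1110 ((r 5831 (r 166 (n 1286 (6441114713198039662911010092946395275837463~o))))~~o)))~~(r 38 (r
  4679 (n 278 (17926939098962815426249356475457923734169021~o))))~~(r 508444790645399 (r 2086 (n
  6267 (726266208526820408700967487564854708247~4334128591192593698265780658226061236861~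
  11101779661137400158893145644744727~o))))~~2566~o))))~~(r 2182 (r 4871 (n 1286 ((r
  6225969412373953895096983 (r 2086 (n 1046 (2182~2182~18449613009579453398924260196443157201537087~
  o))))~~o))))~~o))))~~(§(r 11450486120998 (r 23734147591 (n 86 (550~(§550~(§(r 37145305126 (r
  2317912299888551588503338221166043431 (n 1286 ((r 4839 (r 2182 (n 326
  (2779429253287037606733734789506540885472413~o))))~~(§o)))))~~o))))))~~o)))))~~ta4))))
def ta6 : T := (r 548902 (r 6543532063 (n 1366 ((r 2694 (r 71 (n 70 ((r 646 (r 6840583 (n 326 (2694~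
  o))))~~(§(r 8938118 (r 105334202631 (n 326 (2182~o))))~~o)))))~~(§(r 11037222 (r 22414027548677 (n
  22 ((r 550 (r 3623 (n 278 (2598~o))))~~(§(r 8544806 (r 31225075100359 (n 278 (2086~o))))~~o)))))~~
  (r 8938118 (r 1063 (n 326 ta1)))~~(§(r 46910019994149414 (r 3433639 (n 326 ((r 2182 (r 25714951 (n
  1350 ((r 5255 (n 1094 ((r 125780599667747015397206289027 (n 1302 ((r 3513071045041454213687 (r 38
  (n 278 (15673911644893263114828171501664989786529245~o))))~~1113558071520750860721583657715919519~
  o)))~~o)))~~o))))~~(r 134 (r 27812999 (n 70 (2694~2694~(r 2214 (r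
  578579876477969581347971848036877 (n 1302 ((r 38 (r 57662732066919 (n 22 (550~o))))~~(r
  69019003567747772080871539697795 (r 2086 (n 1046 (550~(n 278
  (186933857196061667676299211573807661087~o))~~o))))~~o))))~~o))))~~o))))~~(§(§(§ta2)))))))))~~
  (§(§(§(r 8691146790 (r 105971976658975 (n 1366 ta5)))~~(§(§(§(§(§(§(§(r 141158496362534 (r
  1731177078747193375 (n 4100 ((r 11247642 (r 11233963 (n 4106 ((r 507959 (r 118 (n 4190 (2615~567~
  (§1948578047484042324173367~o)))))~~(§28314505404471~(§(§(§281363678322806~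
  (§(§(§(§(§(§(§423750434119798~o)))))))))))))))~~(r 401516 (r 449091253176839578157 (n 22 ((r
  9192007 (n 263 ((r 325578355911844037 (n 70 (2054~o)))~~(r 4604541 (n 1079 ((r 2694 (r 23739788933
  (n 1399 ((r 4869 (n 70 ((n 5238 ((r 64 (n 4174 ((n 4112 (683~2731~2603~16801622012807672588550829~
  o))~~o)))~~o))~~o)))~~o))))~~o)))~~(§o))))~~(r 934566 (r 33301667170885 (n 1286 ((r 2214 (r
  25182783 (n 1031 ((r 134 (r 63956478055 (n 70 (108018690471~o))))~~o))))~~(r 7088597575 (n 1079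
  ((r 11421862 (r 5795463 (n 70 (6311~236317760778497749947579707581111~o))))~~o)))~~(§(§518~(r 5221
  (r 682084 (n 262 (11422374~o))))~~o))))))~~(§(r 112432150372837 (r 64218353805453316 (n 4116
  (2219~683~(§(§2603~2469~o))))))~~(§(§(§o))))))))~~(r 401434 (r 11231267 (n 4106 ((r 118 (r 55 (n
  4150 ((r 2089445 (r 262222 (n 5440 (2723~o))))~~(§8563189349~(§(§(§105195128447~o))))))))~~(r
  1687703 (r 1917459076052596685817860 (n 5440 (2723~o))))~~(r 28039527885466 (r 6912434327 (n 506
  (2558~o))))~~(§(§107484176015511~281363678322806~(§(§(§(§(§(§558517922652566~423750434119798~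
  o))))))))))))~~(§(§(r 26532362199148 (r 433479994856090243 (n 262 (3687012~10371972~(§(r 2532 (r
  70139358102147 (n 1030 (2598~2694~(§o)))))~~3687012~40873380486~(§o))))))~~(r 6476406810 (r
  46003658787 (n 262 (42483597924~32292498173~(§(r 2532 (r 1031 (n 1030 (11037222~
  1845605517303365645~(§o)))))~~147624940784166~466624701908893~(§o))))))~~
  (§(§(§(§(§(§1773629023881640943724~(r 1145145902290575386 (r 188437429231651 (n 5456 (2738~76~
  (§(§o))))))~~(§(§(§(§(§(§(§(§(§(§(§(§(§(§1773629023881640943724~771945269691949091~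
  o))))))))))))))))))))))))))~~o))))))))))
def ta7 : T := (r 28086116620 (r 1568153110660965905489931 (n 4432 ((r 7357450 (r 3164195 (n 4096
  (10568093~213504636660196~113027064080490~(r 2059 (r 6154 (n 5124 (2091~2091~o))))~~
  106979641040946~103247421540~103247421458~o))))~~47186061987~11429923~84396948630228~
  906475089622639412~11430757~233969051018036~(r 10660485 (r 111844279306 (n 4487 (2083~o))))~~
  1876435632283263668~84501940445764~84397351183028~(r 55978568469165 (r 114557987114 (n 5494
  (8807012~(r 2926 (n 5444 (2083~2714~o)))~~o))))~~1912396665597207348~1919743190776326402~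
  471436215755572~o))))~~(r 2651943570651882728101 (r 114490977394876 (n 4116
  (13931364565070660457187477~(r 9972282 (n 5391 ((r 15747764 (n 4436 (2691~2691~o)))~~o)))~~
  12829346850735214450426381~o))))~~(r 11013559603081431212648453 (r 115040733536524 (n 5183 ((r
  3054 (n 5204 ((r 2858 (n 4416 (658~6794~o)))~~o)))~~o))))~~49336788800967583841886365573765~
  (§(§(§(§(§(§(§(§(r 25208330 (r 2672771 (n 4352 ((r 1034 (r 2091 (n 5120 (144998576769061~
  91205361076201635~670097121544683669~49460431149~17024154563992025907276180~
  4257499447895525837292~19894865953318899928181132~o))))~~(r 1008748587 (r 1961706285677765410860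
  (n 5396 (643~79952521370~o))))~~(r 212802514542797517 (r 352523916639879726 (n 5120 (103700416738~
  o))))~~125267062644568867371~(r 54748050376747 (r 1933279786387033868846 (n 5456 (157~
  103667648810~o))))~~1015194149~1305551353211914863204~35066593835~(r 1205425140014271505076 (r
  52544966050365 (n 4315 (2366~1798~o))))~~(r 7946413942330622878308 (r 3948623165407948622176805 (n
  4491 (318~2534~o))))~~973842235170534572587~(r 1629907989519958287244 (r 54750163780359 (n 5242
  (2326~o))))~~4937849242131578071753612~1628405966248796373900~31533641709691930319168404~o))))~~(r
  422375707484348 (r 71111913678979231 (n 91 ((r 315 (r 630842 (n 4427 (2077~699~o))))~~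
  52532758825863~478060810586398778~(§(§449667099626456732~449350441907136164~o))))))~~(r
  422925597843556 (r 410508896522186269189 (n 55 ((r 801274466948071467 (r 226 (n 4247 (11583758~
  11780414~12345798~o))))~~12161370646325895974392834189~121248745005282~(§(§1730937897896822276~
  29621108962~o))))))~~(r 6279456673602348893167829141 (r 1730050901210669156 (n 5243 (9292414~
  20331693973429699712243790781596189~2383~o))))~~(r 431723838972172 (r 6423155141267421908513611787
  (n 131 ((r 17460820697363 (r 298 (n 4436 (779~2341~779~o))))~~224178665779513507~30810325290~
  (§(§107448817964~30810325290~o))))))~~(r 1684185657359322715873285 (r 1766088494860050620 (n 4491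
  (13660522642812717056904101~o))))~~(r 290765531556019192197 (r 1768340844429877516 (n 4263 ((r
  2858 (n 4023 (5891~(§o))))~~12337606~186203642556626074896864220193485~(§(§o))))))~~
  866672290258193842936414850198890629~o))))))))
def ta8 : T := (r 4329447578 (r 226802658809185510412663573225475 (n 4180 ((r 46204756036 (r
  177892278550639 (n 39 (5033536451~14958685~44057764420~(§(§8667716~8667716~o))))))~~1821597~(r
  11706570 (n 5443 ((r 43 (r 46204887058 (n 5380 ((r 8987194 (n 160 (363~451~307~o)))~~o))))~~555~(r
  4760332 (r 1 (n 1380 (2411~o))))~~(§(§220669323681986~79637818124~o)))))~~10658467~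
  478511491679895772~55813210303173~(r 2725 (r 28488507580 (n 4195 (3295565~o))))~~
  (§(§(§(§1741312692008034372~108132848877660~9192101~9061027~o))))))))~~(r 1546 (r 685 (n 4420 ((r
  17651835580 (r 1578151311091671467991563 (n 4368 (58037560470261~240580617218956~52951294890~(r
  2571 (r 27304970 (n 5392 (2699~2699~o))))~~20630381258~111874319252~112377635402~o))))~~(r
  226802763999844 (r 3086038924036968049187 (n 4435 (52951198388~1229355~91045424702292~(r 2733 (r
  1885403798875447876 (n 5392 (2109~301~o))))~~112376095444~468551477633834~114558149300~o))))~~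
  289666135659816102933400220653462027~(r 56450263820 (r 3986595045557090159567371 (n 4352
  (9093497373~107942932554724~71768939604498~(r 2571 (r 1876400447912157964 (n 5380 (2603~2603~
  o))))~~71803324154386~118181241828~111839093354~o))))~~1028675223685650017031~
  13242231241126375725220069~(r 939265119000814568167 (f 1416972988297449494536637))~~(r 27304970 (r
  2731 (n 5376 (37152515934885~789404038686722595~13282373484179803561617557~158617515879043~
  14609382193286870548556692~5439099929359189330916~15022573700038296617429908~o))))~~(r
  52545099745957 (r 74604054422204 (n 4571 ((r 2366 (n 5380 (4618~2658~o)))~~o))))~~(r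
  91250441046483053 (r 319103351120110180 (n 4375 ((r 1876396599620706884 (n 5376 (2077~773~o)))~~
  o))))~~13279954197697749133836831~(r 3759977588907437648815013 (r 88352513762060 (n 5242 ((r 2326
  (n 5456 (4618~2762~o)))~~o))))~~215240675494052743~2966564670535462877684423~
  54550266203575693091317342919~o))))~~(r 25803464892 (r 4230572095 (n 91 ((r 1286843 (r 630842 (n
  4372 (2059~20848583260~2059~2691~2747~2779~o))))~~(r 670741447836387349 (r 116851504038074 (n 4436
  (16807527793430644653650831933~o))))~~60566110558050429627414824495125~(r 764092 (r 6333 (n 1115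
  (39639032325~257623360521916~250442706167866~o))))~~5293982395~7300516956099800745997~
  1061270366878058684~o))))~~(r 25938010212 (r 39972193005 (n 4119 ((r 46204756036 (r 40344644327 (n
  4355 (43959050885~237831871540108~219137857102740~(r 2699 (r 27304970 (n 5376 (629~773~o))))~~
  78455981884050~111706383340~112006865812~o))))~~14037051947~751707928785210149~
  3180020434008035991717~2097141387609747912647307~(r 838984997646527117 (r 2255585668243745294894
  (n 5204 (2928748176438441124471525~o))))~~11077113835800341351466445093~93598035273869349~
  1919707866689086172~776363929397413931~776336989751920675~(r 425127875747908 (r 1362125 (n 39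
  (32577271259715~12866539077~119049721749698~25970788~796772~25970788~796772~o))))~~
  424713142903004~1075308184148852123691~426362411819066~o))))~~(r 1530764072826859008706719 (r
  105694346977380 (n 4420 (40774757058921050973185460389~503499637179787964~2157~
  9964966503178185932917551~2813~117647196930~o))))~~ta7
def ta9 : T := (r 46741758052 (r 11777930811142566908289059 (n 55 ((r 226 (r 635 (n 4195 ((r 2757 (r
  1242251314 (n 4426 (11001982~11616534~o))))~~(r 2603 (r 47950078242 (n 4112 (2595~547~(§25339428~
  o)))))~~145045946802341~(r 581 (r 26475241546 (n 4368 (91~451~2595~451~o))))~~41817464995~805~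
  8642853~(§(§(§(§(r 2934981 (r 425125158330442 (n 4372 (2091~o))))~~117339212038194~5981749931~
  433923399262388~o))))))))~~(r 46875943524 (r 1637 (n 4134 (2575055~10477775~629~16671343~
  1042774796230107358~567636821149624814~629~(r 106403621476 (r 2159 (n 311 (635~6766~o))))~~
  428684421251678~427039717213126~7634779251149799572094~106945209966~106945208542~136472617454~
  3687~o))))~~(r 2053513375 (r 44594766436 (n 311 (311115528706577650906908315975820415~6751~6755~
  o))))~~(§(§(r 6707301 (r 192003870966372 (n 8170 ((r 5702 (n 2086 (6140~5700~o)))~~(§o)))))~~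
  112392349016187~o))))))~~(r 3791757412 (r 2735323912866749358733 (n 4110 ((r 2686 (r
  1530349592892268104166095 (n 4146 (12050631~(r 29226339042 (r 623 (n 4450 (878~6766~o))))~~
  61985294830~(§(§436397780377672~27617165806~o))))))~~(r 244509711935889469 (r
  768485940792159354934 (n 5194 (805736177935108213~o))))~~3786861~8630739066120501070504651423~
  8866423~206577661468831~4167349630776870683030~(§(§(§(§1735690612969275582~36306151447~
  1746940815944679830~465989939698966934~o))))))))~~(r 47950340364 (r 1568153110660998520397835 (n
  4246 ((r 318 (r 1564975 (n 154 ((r 2745 (r 47279997226 (n 5479 (10764358~2863~345~o))))~~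
  48194356030~(r 1855 (r 830 (n 5402 ((r 2748 (n 347 (952~2750~o)))~~o))))~~(§(§7385377086~7600447~
  o))))))~~(r 454 (r 559671909967283833971463 (n 230 ((r 208770276001903 (r 320 (n 5539 (12468708~
  o))))~~206715837744070~(r 4039 (r 966 (n 486 (1837888~7105~7111~o))))~~(§(§5378958278~27027399~
  o))))))~~177352227968411711~(r 30177018126 (r 5604762375 (n 1411 (1483027~15919372~3220747~(r 780
  (r 4367 (n 131 (275~1838~o))))~~53511032195464~267110575039244~13062155010~o))))~~26301275595055~
  609855030443270959~148896828252223~(§(§(§(§(r 440247144988942 (r 22957112976135 (n 131 (1483027~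
  1838~(§1838~o)))))~~6419112863~33218311185131943~442446695391550~o))))))))~~(r 4329152700 (r
  1193336753074731479506947 (n 91 ((r 48386386739 (r 11542818 (n 5591 ((r 396 (n 4176 (2699~651~
  (§26429100~o))))~~o))))~~(r 762556 (r 7061725 (n 347 (39798549299~(r 6845 (r 2748 (n 1371 (2867~
  o))))~~11184876348~o))))~~3362440414110776077221~(§(§(r 25937597 (r 3129721532 (n 4259 (2595~
  o))))~~435042680283355~o))))))~~(r 4329480460 (r 16781209420495 (n 4198 ((r 38522972894 (r 2845 (n
  106 (345~o))))~~(r 822126 (r 1341187471554310346825991 (n 4242 (1567495~(r 30175036162 (r 775 (n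
  4498 (822~6918~o))))~~65206421814~(§(§442998071501096~108147704118~o))))))~~11651877~
  148894103562951~263783873112166~22851082660711~202175354267855~(§(§(§(§1760457663348768838~
  439671373815934~198236473024815~130263238541662~o))))))))~~ta8
def ta10 : T := (r 8577710 (r 847010641048605155339 (n 1106 ((r 43721615526 (r 3432759 (n 86 (2214~
  o))))~~(r 11200678 (r 27215716503 (n 86 (2214~o))))~~(r 46 (r 335 (n 338 ((r 5399599 (n 4180 ((r
  83292244929195 (r 46070341820 (n 91 (315~6333~315~o))))~~(r 22275120982757 (f
  3315996964069304607892593257422207175327))~~8822815636314399196072631~15399393337738274115085191~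
  (r 370612155634591779 (r 4329152700 (n 4356 (2699~o))))~~197450595564120259354576485638381~
  15395298343078478555562725~(r 347920423922876941 (f 3313538491534223299085884646722739039919))~~
  478059134984536252~303025169675578087~54610157585580220~59668706740045~478059138871042236~
  2688952036381767671949~36135315379760969864555700357~(r 6154 (r 2059 (n 5120 (43453597701~
  9875810347~156449353320607~1415688057475615660~170046659447180~167299354511460~
  1185997735258925548~1634147157556768292~249237296326836~1883364775512033380~1195037509693648404~
  249218205273636~249212036008332~253753154226668~253748454697460~o))))~~(r 2077 (r 103112876220 (n
  4432 (75138953437417944802811701911~o))))~~394110991926046634308015065324495079~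
  1738965738670276796~370443888993912971~17363448184835~516838399828050469~1775029174198345916~
  75654448038405~478059134984536252~1741312646514360388~54610157585580220~1768343067243323660~
  478059138871042236~62881153155~1775097893675081916~o)))~~(r 10676910 (r 22139823151 (n 1362 ((r
  4911 (n 1298 (12798203264481370814431271071084780171645013~o)))~~o))))~~(r 2288302 (r
  394026259020652545100895728343376557 (n 1362 ((r 28504623 (r 2094 (n 274
  (12798102910327021139398015032015567331775541~o))))~~o))))~~o))))~~(r 190630 (r
  23494821975522815648226517509 (n 86 (2214~o))))~~(r 190630 (r 4143 (n 1110 ((r 4287 (n 82 (166~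
  166~(r 1814553093672200615 (n 4475 (63~(r 901342 (n 106 (220~o)))~~63~o)))~~166~o)))~~o))))~~(r
  2214 (r 9760943 (n 1110 ((r 4287 (n 86 ((r 2210716212330686981 (n 5515 ((r 1294654 (n 154 (316~
  o)))~~447~4319~o)))~~o)))~~o))))~~(r 782952614 (r 17335860405048189136300677 (n 1110 ((r
  301713031455397 (n 86 ((r 1370735 (n 6059 ((r 7063230 (n 858 (1724~o)))~~1191~1319~o)))~~o)))~~
  o))))~~(r 715438 (r 9760943 (n 1362 ((r 5399599 (n 86 ((r 26077919 (n 5595 ((r 9685310 (n 1178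
  (2364~o)))~~159~866274782581060931334871933096019293~2952811245880429427127291510532100311933~
  o)))~~o)))~~(r 371313237927029327 (r 558 (n 5339 ((r 2366 (n 86 ((r 2364 (n 1178 (2364~o)))~~
  o)))~~159~2973~159~o))))~~(r 916318048363999919 (r 10674862 (n 86 ((r 174 (n 7339 ((r 17551550 (n
  2138 (4284~o)))~~o)))~~o))))~~o))))~~2214~o))))~~(§(§(r 43730494118 (r 48572820655 (n 82 ((r 686
  (r 26689039111 (n 1298 ((n 338 ((r 6967 (n 5667 (837940366227090209358395062625195213~(r 13323446
  (n 1630 (3252~o)))~~1719~97429679142~o)))~~o))~~(r 4663 (r 558 (n 4539 ((r 2782 (n 274 ((r 2780 (n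
  1386 (2780~o)))~~o)))~~49234143966~1102065333310019489679821331289424501~
  2273703829645163169674664357757644947877~263~o))))~~o))))~~(r 189102 (n 342 ((r 1343 (n 338
  (1103280070707046463~o)))~~o)))~~(r 774561958 (r 118072922139815 (n 1110 ((r 71910322863 (n 86 ((n
  6823 (227835951778078065884208018291541839~(r 13356222 (n 1626 (3260~o)))~~
  933794576499697149263307004563667796797~o))~~o)))~~o))))~~(§(§(§(r 143907955073710 (r 7727 (n 338
  ((r 6967 (n 274 (853501485751270114538939583989778039677~o)))~~o))))~~(r 780853934 (r 7855 (n 1110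
  ((r 3775 (n 342 (6524093796596138860409422831898703691101~o)))~~o))))~~(r 9101998 (r 7855 (n 18
  (686~2222~(§o)))))~~o)))))))~~(r 45877977766 (r 13143128514209379472498699 (n 1362 ((r 2606 (r
  11821367 (n 342 (2214~o))))~~(r 13788207 (n 342 ((r 714798 (r 13361375 (n 1110 ((r 23783759 (n
  5595 ((r 9685310 (n 1178 (2364~o)))~~159~o)))~~o))))~~o)))~~(r 558 (r 821426873806547103 (n 1110
  (678~678~(r 54751061167 (r 174 (n 342 ((n 7275 (4391~(r 17551550 (n 2138 (4284~o)))~~o))~~o))))~~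
  o))))~~(§(§(r 8577582 (r 268639935271437352424937839749259 (n 86 ((r 5651746977587827765807 (n 342
  (4913760012607462739529817687455234886982989~o)))~~(r 2222 (r
  1591037621585712948624210345181962251 (n 342 ((r 847 (n 5563 ((r 2999006 (n 362 (732~o)))~~
  14867612382~447~o)))~~o))))~~(§(§678~(r 7847 (n 342 (14863536507328556875454896628603697346494687~
  o)))~~o))))))~~o))))))~~o))
def ta11 : T := (r 2286214 (r 3997075094845959228746411 (n 4164 ((r 39207056427654 (r 28387827725 (n
  347 (3384029~3005117~11247802~o))))~~(r 191454243078372 (r 235469779784562404855377673634503 (n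
  1399 (16086090597~o))))~~(r 50715412545764 (r 973242669842217191563 (n 1350
  (94951173721757036946941911952285~o))))~~(r 47950340876 (r 23176676115145425666722373643 (n 327
  ((r 3229 (n 4794 (38859271412~1727~1727~o)))~~2694~o))))~~(r 57514388545727 (r 4329153212 (n 4160
  (2595~o))))~~421096754903457969685261014891140499627~7993543781336974919090317~(r 27957151372 (r
  97525620780020134389263442141859 (n 1350 ((r 2943 (n 82 (915933663309348232285424935923540207~
  3922327391026660861581281280397050964279~6191~6319~o)))~~646~o))))~~(r
  300114263897961027024063873625443493 (r 27957149722 (n 4112 (1197~o))))~~469043140979376356~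
  1094413203018269913531556522040543269~(r 114490977863308 (r 133961395773928754623834251258405517
  (n 1872 (2346~o))))~~(r 5771007042979279649001095 (r 27951898778 (n 326 (797~2694~o))))~~
  72636628852064484~521488342790588557~(r 6154 (r 2053 (n 5124 (212228396157917293263491312953515~
  1219782991017298148~191489416612068~964028885574136383621~235509764740786339~202483727485836~
  318618300066788~1622888156878220940~285661001920028~246601635907812~255284744923388~
  1262565551530060172~309854988249474~148081959553124~167298018691172~o))))~~(r
  49929495424924126165975477510669 (r 103112876732 (n 4176 (53353129816145386534771574935~o))))~~(r
  422901440725220 (r 8151466395248696387191331 (n 372 (6252~o))))~~1729995922276237540~(r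
  269148088091992619 (r 105395528460 (n 5188 (55836148342121235799788765189~o))))~~
  2135867222855911096469~1768243537250402532~1766024723185639652~
  1231261830631834626422708207956496394251~66410656154516899528493798867459~469043140979376356~
  1730059719348953316~1768340294674204300~1097949104245876869~72636628852064484~1766088494860050660~
  o))))~~(r 35134300806 (r 3007655 (n 326 (2694~o))))~~(r 45869097606 (r 4743 (n 342 ((r 2285742 (r
  75479619608733400977357955619 (n 4096 (45936091828~46777385188~327425725210781~50098348940~
  15737103244~1782104676~1778459532~27957151372~28622005900~1785250020~1778460300~25838494092~
  25971204492~1780007012~1778459020~111761971852~329826996~114020466916~1778465420~111737840524~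
  15737103244~1782104676~1778459532~27957151372~28622005900~1785250020~1778460300~25838494092~
  25971204492~1780007012~1778459020~o))))~~646~o))))~~(r 9101998 (r
  259715451841352362843369665456165 (n 4112 (9437784756~1252280516~1241721524~50098350988~
  50096843660~7013182020~50097070130~27957153420~62981746316~26374088900~62981972018~25838496140~
  60330944908~7013181508~41507135538~114045376676~114549112850~105830981828~114521579570~
  112274711436~111870550924~7013179972~15737331762~27957151372~105428100748~26374086852~28622233650~
  25838494092~25971204492~7013179460~7147397170~o))))~~(r 191150 (r 11399847 (n 342 (2694~(r 2285742
  (r 16381698864473743644069227159 (n 1362 ((r 20083247 (n 4571 ((r 3392318 (n 410 (828~o)))~~2461~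
  o)))~~(r 88691437743 (r 2094 (n 5595 ((r 3392318 (n 410 (828~o)))~~o))))~~(r 20083247 (r 2094 (n
  4571 ((r 3392318 (n 410 (828~o)))~~2461~o))))~~o))))~~o))))~~o
def ta12 : T := (r 686 (r 3791 (n 4164 ((r 2709436673999334107199 (r 36945766588 (n 4106 (383~
  135527123818185007587850383376645~1693~14805398~2711~383~o))))~~(r 156278469836900 (r
  6896007696036544810089357935 (n 1362 (1079~823~o))))~~(r 15531049369700 (r 1066394063687565543 (n
  1352 (2658~o))))~~(r 47950340364 (r 4397322683126666945415 (n 339 ((r 47279416108 (r 1071 (n 1042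
  (469~o))))~~54562057037~11192878~11201158~4938415~o))))~~(r 2652380544026186140197 (r 4329152700
  (n 4100 (12231052~o))))~~(r 17733562286348 (r 107003102807746563 (n 1366
  (2866377811288408821165688425348666221247~o))))~~137229021941650407078342274107909~(r 27957151372
  (r 2978114937655434396983821 (n 19 ((r 47089247111 (n 5987 (1895~4449232672131139440853069~o)))~~
  6637103~10676270~14862380~o))))~~46078840538612858597230756483~469043140979376228~
  469043142985883748~(r 114490983629068 (r 194934008345102525262822268512519 (n 1168 (3754~o))))~~(r
  503457443343376555 (f 12429186104001882338520228469))~~468955044757684492~(r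
  12609380773871338966237415 (f 2805389050513385009487363815077240654727))~~(r 6154 (r 2061 (n 5123
  (71092090425296901~1217522523960133732~36562729609349~296478217710592920909915341998221~
  1273859716281346452~202492316534884~1327860575243414004~1631898106488573580~258007592683700~
  255260283522700~1186003786196397804~1271607916337580428~247156753639828~167299353299436~
  254298210511340~o))))~~(r 70962210653979199 (r 103112876220 (n 4432 (2207~o))))~~(r
  1939968020542016134 (r 33696862268614869449374704367 (n 116 (6154~o))))~~7115895185558185855622~(r
  549807642989735838791810077358055979 (r 105395527948 (n 5440 (190675340777846954080843211620741~
  o))))~~291274406814757306527~7233646271728199322246~7494053439060745013894~(r 422927616984716 (r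
  8219025483859371287921189 (n 1350 (1183~o))))~~1730059719348953276~469043140979376228~
  469043142985883748~1768340294679970060~1766088494860050620~468955044757684492~1766088494860345498~
  o))))~~(r 45877979782 (r 5544694001868037098717339819 (n 1350 ((r 20183727 (n 326 ((r 7399 (n 1110
  (4595188098282254146239505009350928705574701~14973550251215485233996984254339417988525919~o)))~~
  o)))~~646~o))))~~(r 179085884680838 (r 1055640763972347897176075 (n 326 ((r
  182516434596550592805666679939717 (n 1110 (2694~(r 1067225553409339567 (f
  11489121041189081005245647662052648425081095))~~(r 73653230279330928040922442403 (n 4096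
  (61499041898499~1778797284~161619175322855429~45476462733~2491427499~6644211812~6644211730~
  28124923556~186129228251691~25837346916~28119048210~25838494092~25972752402~6644211812~6644211730~
  105822443652~36853424291~1804091492~114018394130~103684776332~111872098322~6644211812~6644211730~
  25862620836~105434890258~1804091492~28119048210~25838494092~25972752402~6644211812~6644211730~
  o)))~~o)))~~o))))~~(r 2812070 (r 7141551 (n 342 ((r 2222 (r 435806080783281356590248108666053143
  (n 1110 ((r 17561775 (n 5247 ((r 868566 (n 110 (212~o)))~~63~564836542088061551444576987375118853~
  49328152854~842621202760096733349072570799909277~o)))~~o))))~~(r 9104006 (n 326 (2694~o)))~~(r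
  9104006 (r 1247 (n 326 (2694~o))))~~(r 2252493254782291013044411697154218189103 (r 2694 (n 1350
  ((n 5814 (1693~8398170421158368434863497814208410665589~o))~~o))))~~646~o))))~~(r 43722139814 (r
  1055640763972347897176075 (n 1110 ((r 8579718 (r 11031050239995523045187587 (n 1350 ((r 4839 (f
  25995252215513720334816011330784725952485693))~~o))))~~(r 2694 (r 34017807992473759778457936421 (n
  1350 ((r 2058358323223952954152589395208104107 (n 1362 ((r 2871 (r 46 (n 18 (1591~6607~1591~
  o))))~~(r 7070767 (r 2094 (n 82 (2383~9778367991901765789433638562604091117390653~o))))~~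
  28969231535~(r 4279 (r 558 (n 82 (311~1591~o))))~~28977097775~28969233583~o)))~~o))))~~(r 11200558
  (r 560139193662431504022642887938286191 (n 4096 (11048003764~1789804644~512448048195084447~
  50098350476~41506908556~1788395620~1778461068~27957153420~317245620~1793638500~1778462348~
  25838496140~41506908556~1788395620~1778461068~105957087268~105957081106~105428459620~105428459538~
  103684776332~103280615820~1780007012~1778459020~27957151372~105428100748~1785249892~1778460300~
  25838494092~25971204492~1780007012~1778459020~o))))~~o))))~~o
def ta13 : T := (r 8938118 (r 105334202631 (n 1366 ((r 2214 (r 1159 (n 1110 ((r 8577198 (r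
  11214660634394153190091375 (n 4099 (45936093364~46783676644~909034167163962027~50098350476~
  41506908556~1788397668~1778461068~27957153420~317245620~62487150820~1778462348~25838496140~
  41506908556~1788397668~1778461068~105285441676~105931421836~1804124388~1778464908~103147905420~
  103280615820~1780007012~1778459020~25843783820~308861068~28144353508~308861068~25838494092~
  103280615820~1780007012~1778459020~o))))~~2182~o))))~~(r 9362401446 (r 20503061295 (n 326 ((r
  14601020591 (n 1094 ((r 17725607 (n 6071 (938719246714992309323691634224519037~2431~(r 2270 (n
  1110 (4303~o)))~~o)))~~o)))~~(r 2694 (r 4230806475680630545474187 (n 1110 ((r 4303 (n 1350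
  (34478103326244441218886835973118123373479117~o)))~~2543645425096191732623445306836042351~o))))~~
  o))))~~(r 35134302374 (r 3007655 (n 326 ((r 2694 (r 143111271597358929457941930501 (n 1110 ((r
  4362287802453539186311 (f 3167164953134881708847679650559272541565))~~(r 2182 (r
  99464266592852702357031788503211 (n 274 ((r 463 (r 2222 (n 338 (2222~1207~o))))~~(r 3255 (r 190638
  (n 1106 (311~4151~o))))~~12379191~(r 25914047 (r 10676398 (n 1106
  (14819991877691731750317638549602425831680815~3639~o))))~~112577014335~87841586510543~4416463~
  o))))~~o))))~~o))))~~(§(§(§(r 9069222 (r 88149221911 (n 1094 ((r 40790286575 (n 1110 ((r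
  5352778031 (f 5678398395282140728112025560036511042493))~~o)))~~o))))~~(r 733676495503516326 (r
  11859111 (n 1350 ((r 936230683509680165 (n 1094 (2214~o)))~~(§o)))))~~(r 9069222 (r
  6095126148050149073519 (n 342 ((r 2285742 (r 127420108303239 (n 1110 (4303~o))))~~o))))~~
  o)))))))~~(r 2793955974 (r 2290338460329095569769785893 (n 86 ((r 71693563551211557 (n 326 (2182~
  o)))~~(r 11198638 (r 256714766915674955787 (n 326 (2182~o))))~~(r 686 (r 7466671 (n 1094 ((r 2726
  (r 19784886935855 (n 326 ((r 441777847848763744463 (n 5146 ((r 9158846 (n 91 (2238~6327~o)))~~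
  115582079868867024489855397360329629~9238906980478492404044836124961238633223~o)))~~o))))~~o))))~~
  (r 10674350 (r 256714766915674955787 (n 326 (2182~2182~(r 2726 (r 1794381401159264879 (n 1366 ((r
  198439277261487 (f 3018400978581603846984150198034776705215))~~(r 2783 (n 1106 ((r 2895 (r 46 (n
  18 (1623~6231~1623~o))))~~(r 1623 (r 2288302 (n 1362 (2895~
  34998358470429896204446016628410165766116405~o))))~~(r 20083247 (r 2809902 (n 18 (439~1623~439~
  o))))~~32332657643818518640158885~63739949103~63877867855~o)))~~o))))~~o))))~~(§(§(r 9101998 (r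
  1774012974425104647 (n 4096 (43789131956~46741758052~116278935691819~50098348428~7147168140~
  1780007012~1778459020~27957151372~308854964~1785249892~1778460300~25838494092~7147168140~
  1780007012~1778459020~(§(§(§(§(§(§(§(§25862653580~105434890420~105434890340~327730828~25838494092~
  7147168140~1780007012~1778459020~o))))))))))))~~o))))))~~o
def ta14 : T := (r 166 (r 647967119612322367 (n 1366 ((r 2895 (n 4167 ((r 35335545020 (r 47188068503
  (n 1371 ((r 630842 (r 5278982317 (n 4096 ((r 2603 (r 10920170 (n 5548 (43~219~219~o))))~~(r 2701
  (r 1745292 (n 4200 (339~85058131948626037~85211889134944613~o))))~~55975981785749~(r 691 (r 1546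
  (n 4352 (109~2699~109~2731~o))))~~39966394479~22862187651221~3334381~(§(§(§(§(r 2140341 (r
  25208330 (n 4432 (2059~o))))~~7563379261963~422925599154572~422925597843852~o))))))))~~(r 8495802
  (r 6466223390334371245116743691 (n 91 (13744810303710472538677901~(r 6333 (r 43386644668 (n 1115
  (2363~o))))~~153521894959292~o))))~~(r 3386555 (r 9151034 (n 91 (1759~1759~6331~o))))~~(§(§(r
  13357757 (r 1832785789628 (n 4571 ((n 4122 (383~2591~(§(§o))))~~o))))~~48231068349~o))))))~~
  ta9)))~~(r 9101870 (r 11857063 (n 86 ((r 174 (r 8154049062736005058020231 (n 82 ((n 4099 ((r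
  675199534469046949 (r 2996906676 (n 351 (723~6837~723~o))))~~25659923639822744621136243363~(r
  63857215639 (r 434194 (n 5136 (13291474714165397286707549~o))))~~(r 205202837258668 (r
  975886800731408951427 (n 1219 (491~879065947975967015595040669034441103~1811~o))))~~
  43883161419122395480316224303~3279517935010484372109~35404819600735203281279822367~
  514795512095623683~1657057936798786739365037~65860760785936476821904697389~2024739068517393459277~
  444273897481847212~254157981292847344141~435749791446122596~73583566020083541533520085515~(r 6154
  (r 2733 (n 5120 (9070439077~2902053~621~1415689568769329580~205231568275884~148071191071332~
  1330154302525746164~1912731104371592740~1598121219073945100~1217522936280696932~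
  1222032583215885932~247156627360172~249237296328628~148083704383972~148056429382124~o))))~~(r
  35243204765 (r 103247061684 (n 4372 (3837105274586364846131517~o))))~~6262858904966495127741159~
  35872402394272016054127469207~43916828026734926929438722093~1732261465852264876~
  1732223534177501284~8302739472092130810307077~30684137007~514553611611678733~91214671920545827~
  33978362728320683452898920461~444273897481847212~1732305471982870956~435749791446122596~
  1732303386205823372~o))~~(r 8579246 (r 6191 (n 1106 ((r 15918639 (n 1042
  (1082676364275484810959675022025311115093~o)))~~o))))~~(r 190638 (r 6319 (n 1106 ((r 7532079 (r
  2606 (n 18 (7119~o))))~~o))))~~o))))~~(r 190630 (r 6319 (n 1110 ((r 4287 (n 1106 ((r 26406959 (f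
  4432143289543637636886723590528521925873207))~~o)))~~o))))~~(r 714918 (r
  560309655230149189794629842870919685 (n 82 (2214~2214~(r 515533977229124099 (r 2094 (n 1042 (4527~
  4527~o))))~~o))))~~o))))~~ta10))))~~(r 12000913156742 (r 6840583 (n 1366 ta11)))~~(r 680582 (r
  441462567769796075533 (n 86 ((r 2694 (r 1691712429835591573135983 (n 326 (2694~o))))~~(r
  45869623942 (r 256418655240175345675 (n 326 (2694~o))))~~ta12))))~~(§(§ta13))
def ta15 : T := (r 678 (r 1799 (n 1286 ((r 32318058151 (n 4103 ((r 149304513913495 (r 11247642 (n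
  4251 (11649798~9716038~16500646~3975~o))))~~(r 46741758180 (r 1443511237284121698347 (n 1143
  (9349218~o))))~~(r 1644273892 (r 174051335457511 (n 1143 (738~o))))~~(r 6477628292 (r
  132253151248525 (n 4230 (2846~o))))~~(r 6476112772 (r 157 (n 1304 (2972~o))))~~26532362232708~
  26527362294660~(r 25809700388 (r 116305644577291 (n 1106 (3754~4143~o))))~~(r 25803466276 (r 1053
  (n 1112 (3644~o))))~~105716526784740~105692199493860~106384227616292~105697031333412~
  106384227614826~105697031626778~(r 6154 (r 2059 (n 5120 (2627823619~332431047960804~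
  318147599968402~41013619588~431215062075410~42624101348~44736522740~62493044260~282953030650002~
  38300339940~38294072940~40850476580~35208646156~41013489260~42622955028~o))))~~(r 2077 (r 25174042
  (n 4432 (53968848763741712127633377951~o))))~~(r 103247421668 (r 33298556403781 (n 372 (6252~
  o))))~~422351548293348~422906137461636~422356380132228~26532362232708~26527362294660~
  422925469533732~422375707485732~105716526784740~105692199493860~106384227616292~105697031333412~
  106384227614826~105697031626778~o)))~~(r 11166342 (r 3807489254921427640869 (n 262 ((r 7047 (n
  5259 (11651846~16500646~1460582~11651846~o)))~~o))))~~(r 2694 (r 4615 (n 262 ((r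
  396019616426361293486713964489253 (n 5275 (3261190~9716038~16500646~5095~o)))~~o))))~~o))))~~(r
  2779654 (r 11761879181827 (n 262 ((r 76878568009944948857178417795 (n 1286 ((r 974499846068789991
  (n 4571 (3261190~9718598~3261190~o)))~~o)))~~2566~o))))~~(r 9071110 (r 149436525732415 (n 262 ((r
  141253036854816731420899041827 (n 1286 ((r 20472199 (n 5883 (5883270~14142726~23582214~o)))~~
  o)))~~2566~o))))~~(r 2726 (r 15757447 (n 70 ((r 2566 (r 149396358457919 (n 262 ((r 120363579527 (n
  1286 ((r 4188927 (n 7515 (19034118~20042502~29913638~o)))~~o)))~~o))))~~(r 682502 (r 14998954735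
  (n 1350 ((r 5127 (f 20420341631435037752641305658233048720197743))~~o))))~~(r 166 (r
  20133372201535078757857472569995 (n 18 ((r 7039551 (r 11199022 (n 86
  (21236358478042019073079872044508775024286525~o))))~~35054296558191~(r 2222 (r 6199 (n 86
  (9095973637415134806626852277195731237198141~o))))~~50457699247~454726580658659911~110299931199~
  o))))~~o))))~~(r 2214 (r 15757447 (n 262 ((r 165349232240799 (n 70 ((r 678 (r 7498335 (n 1042 ((r
  6513175 (r 558 (n 1110 (10083976223018828549730631032366844622133021~o))))~~
  5069778973618654982700976696738799692351~2055843297170873304985603497102239399~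
  2295955031707028854597687~63200092823~16478287~o))))~~o)))~~(r 11037190 (r
  1871356373056665257170983084622800907 (n 70 (678~o))))~~(r
  5793234657267452424122738992287488141835 (r 2566 (n 18 (1591~1591~
  3629630335672660097272000107277339973813~1197708468506219059122309132366269700533~1591~1591~
  o))))~~o))))~~o
def ta16 : T := (r 11035142 (r 747290130332147875 (n 326 ((r 48406590048073397799202873407 (n 262
  ((r 3511976463618994628839 (n 4116 ((r 1176731490250255409183 (r 11247642 (n 4683 (12829734~
  13518054~15845126~o))))~~(r 3265571524 (r 61832959625825324890484828165 (n 359 (2368202~o))))~~(r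
  1107534532 (r 856996069326889093 (n 1368 (2754~o))))~~(r 15235424644 (r 30523227130019 (n 338
  (74093876236350172820629958833654861~2222~o))))~~(r 7012983172 (r 206994271152291 (n 1227 (898~
  o))))~~13583922378185315348815883~1176742774665424546347~(r 25809700388 (r 26241919523 (n 338
  (3754~2222~o))))~~(r 25803466276 (r 11754547371 (n 1112 (3644~o))))~~1178354540900965040683~
  116686779033124~106384769302916~28725183922564~64499158988130677800567201893~28725848811044~(r
  6154 (r 2701 (n 5120 (36317031043~297805057239780~291749151287442~49603553668~318145486702610~
  36016409060~44736523252~62325313060~282955172359820~62319930892~36818038420~41382596516~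
  41018279954~36153249764~34670554644~o))))~~(r 2717 (r 25174042 (n 4112
  (11844583456174268323034253463~o))))~~(r 103784161988 (r 4231938671 (n 5456 (112812929666~o))))~~
  424550034809540~422914895257988~422356917002628~8195230705142523947054~424555940421690~
  422925469533732~422375707485732~425127171106340~116686779033124~106384769302916~28725183922564~
  425105696269860~28725848811044~o)))~~2566~o)))~~(r 2779654 (r 48958401671 (n 262 (2566~o))))~~(r
  2566 (r 27812263 (n 1286 ((r 3463 (n 1350 ((r 91577331016909150542526833183 (r 9069222 (n 6539
  (423~935~11946854~17332998~30530310~o))))~~o)))~~o))))~~(r 2726 (r 7743065224321247660302959 (n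
  1286 ((r 974587766466046527 (n 1350 ((r 23454360243948185203032639 (n 18 (97232524828683~
  13403120047~(r 5794215 (f 3783661170907866480264284049758476916813))~~110299212199~23729498535~
  26681565615~o)))~~o)))~~(r 1947290420669147147 (n 262 ((r 33279372243300362614333443 (n 5643
  (12829734~5129446~1767~o)))~~o)))~~518~o))))~~(r 678 (r 3570311 (n 262 ((r 2159 (n 1350 ((r
  547493966397622085617401265906415 (r 2214 (n 5515 (631044~9552134~5500326~11946854~o))))~~o)))~~
  o))))~~o))))~~(r 549382 (r 1543 (n 1094 ((r 2566 (r 3591 (n 262 (2566~o))))~~(r 682502 (r 2407 (n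
  262 (2566~o))))~~ta15))))~~(§(§(r 8413702 (r 105981128237087 (n 1350 ((r 2182 (n 1094 ((r 2726 (r
  3847 (n 1042 ((r 7229909587250047611047 (r 558 (n 1030 (2559~o))))~~(r 135175619899047 (f
  4044658077533267870523952747577412227646495))~~(r 299534895083175 (n 1030
  (305734335499780413834831830301406753463~o)))~~(r 77451799883431 (f
  306442460461587303584189609009849815989))~~(r 72180198959 (f
  20624831491543938714322293199132996676448309))~~2222~o))))~~2054~o)))~~(r 2182 (r
  4927310744297579800793981679 (n 1094 ((r 98886771879 (n 1042 ((r 686 (r 6513343 (n 86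
  (12697522873432410960770950678331356537016509~o))))~~123407418777591967~(r 686 (r 4175 (n 86
  (1061391849588162054191168951366640583359~3102587715953397073195064797824424329919~o))))~~
  41725256383~61052609215~2222~o)))~~(r 2214 (r 24143015 (n 262 (2054~(r 7295 (n 6267 (7047~
  179872340398809509689337328830110597~26335494~o)))~~o))))~~o))))~~(r 2779270 (r 48958401447 (n 262
  ((r 2566 (r 484251246553511 (n 1094 ((r 202200193101479 (f
  15313737627814340221287438216736563228569373))~~(r 16147975 (r 2054 (n 8059 ((r 5638 (n 1030
  (5756~o)))~~26335494~30399622~543~o))))~~o))))~~o))))~~(§(§(§(r 8938118 (r 86000708099 (n 326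
  (2726~518~o))))~~152156305384070~(r 2648198 (r 21523303 (n 326 (2726~o))))~~o)))))))~~(r
  2256560646 (r 700401608870506569891 (n 70 ((r 43294448052927 (n 262 (2054~o)))~~(r 166 (r
  1003788931207398433303 (n 262 (2054~o))))~~(r 678 (r 569334708031285543 (n 1030 ((r 2694 (n 342
  ((r 39576901123479068988199331903 (r 713262 (n 262 (14819992150353820798217080858852458559953661~
  o))))~~(r 241366238441356823605857177722883 (n 262 ((r 7399 (n 4331 (9716038~4079964~4178918~
  o)))~~o)))~~518~41986471662421814010245488765562575772467775~(r 116614128351 (r 2726 (n 18 (1623~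
  471~6735~471~1623~471~o))))~~o)))~~o))))~~(r 166 (r 3060359803341874290839 (n 1030 ((r 2694 (r
  293699481310117947403 (n 262 ((r 132476221779591 (n 7419 (28957574~23582214~26728710~o)))~~o))))~~
  o))))~~(§(§(r 9069222 (r 37266798419300681049835202671 (n 18 ((r 6513175 (r 558 (n 274
  (9100549546162810901984532003563985984540109~6743~6743~o))))~~17295379766954054775759039~
  (§(§1789725547331937839~35133776046~o))))))~~o))))))~~o))
def ta17 : T := (r 176380055282214 (r 66401675378132342565221764876439 (n 4112 (2460164788~
  11853406276~43790934228~40839588236~7157653908~15611503044~35209388970~28527611394~36815552692~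
  26508828740~37763596468~25809830284~853721484~41514877380~35198904236~105956694156~114523579060~
  112944521284~112409747636~112409059724~103819714956~112411189316~9429105580~105434457612~
  25996992692~28522094660~1267376308~7153566092~7153467796~110133690436~110797039148~o))))~~(r
  682158 (r 1276591 (n 1362 ((r 8940070 (r 560341805728468002037803 (n 4096 (43789134004~
  46741760100~122364586877417807815280747181~50098348428~7147168140~1787183500~1778459020~
  62887306764~25971206324~25971566692~25971564562~25972711820~7147168140~1787183500~1778459020~
  105957087276~105453371410~105428459620~105428459538~103818994060~7147168140~1778794892~1778459020~
  103823713804~103823753234~25971564644~25971564562~25972711820~7147168140~1778794892~1778459020~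
  o))))~~(r 185141655922854 (r 15902779079636080921241711 (n 1110 ((r 2271 (f
  3240841759927029685451423945991856970581))~~(r 13923975 (f
  15542968888956700421021205391038469992956757))~~2222~o))))~~(r 3375 (n 1094 (2222~(r 678 (r
  40366106703 (n 86 (2222~147585809992459754163697191249975~o))))~~(r 165382581444749 (n 1106 ((r
  19755175 (n 4122 ((r 9160894 (n 1114 (2236~o)))~~437~50444452246~o)))~~o)))~~2222~(r 40788357767
  (r 45745201286 (n 1106 (15365155899442039341094794289796675243459157~o))))~~2222~(r 97149935727 (r
  134 (n 1106 ((n 5423 ((r 9259222 (n 1134 (2260~o)))~~247~o))~~o))))~~o)))~~o))))~~(r 43061535270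
  (r 173057916986095 (n 1362 ((r 8937638 (r 170716711 (n 82 ((r 194166565436052681880420138518995607
  (n 86 (14234357177804590101651774767517895750900055~o)))~~o))))~~(r 10849247398 (r
  22774145384826816150662695 (n 86 ((r 223 (r 134 (n 82
  (12448938175133609524356837040249137679949517~o))))~~(r 32105775 (r 2214 (n 82
  (4390503251936956123715505881149610703150805~o))))~~174~o))))~~(r 2726 (r 371207712710716111 (n 70
  ((r 172498746567047 (r 2566 (n 1366 (4447~6689454213713291197520487419597747579081821~o))))~~(r
  1767 (f 6523284919277425546372720306655884802277757))~~101201153521967183~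
  15518175346214519217875607~29656643719~o))))~~o))))~~(r 2734 (r 7890729647 (n 1362 ((r
  45952130379918120329284706895 (r 11383892518 (n 1302 (1503~5511~3167~o))))~~(r 2214 (r 39572138047
  (n 82 ((r 469948737151175 (r 134 (n 7779 (551724837478030743022046162631482197~
  552533574321673905301934385751478605~1543~207151974266891479757731611329877~(r 7030454 (n 862
  (1716~o)))~~o))))~~o))))~~(r 36610664998 (r 95614273859315282288017141811631 (n 1302 ((r 354887 (f
  13274641602957291348586340640600597848742741))~~1461971655~1461971655~o))))~~o))))~~o
def ta18 : T := (r 10510886 (r 8020421788655552521333951175 (n 1302 ((r 518 (r 3527 (n 262 ((n 4115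
  (4645093221136261862541893170311995705911~(r 215823650578435 (r 46204756036 (n 39 (451~6213~451~
  o))))~~314874308221046011264672291055627~118886630449923804372001687741231~
  67595031284902463647990932005~(r 307552919931766795 (r 7147397188 (n 4356 (2211~o))))~~
  58264059906212794554637271983~(r 3623606598206245552677 (f 114594185763095011953459681092533))~~
  433797777301564972686513991297355892887~442024291457450052~167904085535279213~
  18545255373721260678241601677~609176997989706251~442024297356369988~3491640266395667062795~(r 6154
  (r 2085 (n 5120 (30547762178691~2509485~193274410098765~1271574930984061828~1312139903078410636~
  183248751577572~1330156491485129204~1595868897320513188~1168024570589038772~255262303635556~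
  1219774322301651178~248667917306252~170047198775692~253772481611876~148083702835700~o))))~~
  4644428444875730549087678326094891835397~(r 170085938540898989 (r 103784161348 (n 4100 (2083~
  o))))~~3048943292608743268363~116949667625373937354943204737197~129649231587885359~
  1701990243480369152805~2534283039122812739755~6820541108376002435401899~2059048714877975893942925~
  442024291457450052~1741312783947079860~1732302723205308812~1732303391574532492~442024297356369988~
  1741312789852758066~o))~~(r 11037190 (r 6791 (n 1286 ((r 5511 (n 1350
  (13275303777709936468950961439507684554723613~o)))~~o))))~~(r 2648582 (r 6663 (n 1094 (2566~646~
  646~73523555975~o))))~~o))))~~(r 518 (r 4615 (n 262 ((r 6352950466028320743623 (r 2694 (n 278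
  (7111~o))))~~550~o))))~~(r 14447143 (n 278 ((n 1286 ((r 5794951 (f
  13278581155608847531576101422754166874296991))~~o))~~o)))~~o))))~~(r 43059405350 (r
  75282980733023535807630443989071 (n 86 ((r 2222 (r 3807 (n 82 (2222~o))))~~(r 2648198 (r 6311 (n
  1094 (477115923328688751~(r 4455 (r 2694 (n 1110 (15019774745999437018127553032633786886637373~
  o))))~~o))))~~(r 2222 (r 6311 (n 1106 ((r 4439 (n 1110
  (1078097876770663504447941754281481282541341~o)))~~o))))~~(r 7207079 (n 82 ((n 1110
  (14235764226036596012580525909784985553131293~o))~~o)))~~o))))~~(r 1926447 (n 1106 ((r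
  267322137824182126151866272639639 (n 4176 ((r 223523858030655 (r 45936091316 (n 95 (211~6325~211~
  o))))~~91247679791456847~(r 54569680959 (r 1241718964 (n 4436 (2059~o))))~~(r 196404596326668 (r
  816299762603188749 (n 1302 (728962169039418095118866457482321983~o))))~~8794435324875985157497357~
  502877654886750283975~4508270990353897235247~3786461729877557700103~480197575344046260~
  23869048888633483~480201396354990260~3777093595056976356527~83889604223090868~237811611965464707~
  67577986431158819969908873538735~(r 6154 (r 11654015115 (n 5120 (205938120288387~9390251~
  46515445789~1271608053237172620~1919379282096892300~183246970734692~1158984521272961524~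
  1586862108067810860~142036932184244~246464196429924~1159010773587537548~170072158556076~
  170046657187380~148082092558732~142010591824372~o))))~~(r 338925834566025253 (r 103247061172 (n
  4420 (2699~o))))~~2968269~82754702491711~4023931338353726443407523~1768246284550979764~2967877~
  1777280424390467764~267485641645417991~480197575344046260~1741312096758579268~480201396354990260~
  1768343043459039500~83889604223090868~9716429~1777350243378831540~o)))~~(r 8937638 (r
  28004152789577466785141579609991211 (n 86 ((r 24279687 (r 2726 (n 82 (6487~o))))~~(r 16016071 (r
  45736943750 (n 82 (6487~o))))~~(r 122535240653915879432746887319 (r 678 (n 5167 ((r 9259222 (n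
  1134 (2260~o)))~~o))))~~174~o))))~~(r 2214 (r 706502400632594823 (n 82 ((r
  20202788885277590277418503 (r 134 (n 5987 (1239~(r 7030454 (n 862 (1716~o)))~~29778272622~o))))~~
  o))))~~o)))~~ta17
def ta19 : T := (r 409706 (r 45 (n 4112 ((r 32222254194749 (r 303154 (n 4107 (79~o))))~~(r
  46751427012 (r 251519796142251 (n 1491 (17060625771701156240975303~o))))~~50274672690~
  (§(§191459489886148~848997930~(r 1411172429 (r 103784136778 (n 5140 (2731~2219~(§1613~o)))))~~
  540158365328486836907~427481888367044~110261608498~(§(§103689658786~7147300394~o))))))))~~(r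
  434194 (r 172349498337451 (n 4115 ((r 131 (r 278602 (n 4100 (2691~(§2179~(§o))))))~~27055153283~
  208117776853418~(§(§26341944900~185962051350058~131~32187768588971~103785603524~452174997531282~
  (§(§7153665570~103953376810~o))))))))~~(r 50098348428 (r 42078945419 (n 5188 ((r 2202 (r
  67454978731 (n 1115 ((n 344 (2956~o))~~o))))~~(r 234 (r 33498251435 (n 1396 (2924~o))))~~9314458~
  (r 3724 (r 2524594829 (n 1155 (135522571331947~1666~1666~o))))~~15345818~15646954~9316506~(r 4748
  (r 2670755 (n 1155 (110920593385835~110953717877357~7150817538~o))))~~17311898~17344746~9316506~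
  17346188~15214746~15255786~9316506~o))))~~(r 205890699469196 (r 18986814713081474381816323 (n 4176
  (2818~o))))~~(r 26527396176268 (r 2836397614224388843651 (n 1475
  (908005817585192104258498990321255411~o))))~~(r 11730639806641065372871309 (r 1778459020 (n 4356
  (496212486864043763863~7615311726932442730866839~12304770~o))))~~(§(§(§(§(r 105697037566348 (r
  110836941597195 (n 1232 (3626~o))))~~444196788054835596~108656214742712716~(r 7284572864908 (r
  18984515125010286143201283 (n 1984 ((r 3571 (f 1125480176680069639670771257367423727))~~(§o)))))~~
  (r 6154 (r 2061 (n 5120 ((r 83973 (r 422418969602604 (n 5140 (2691~2179~(§10104354~o)))))~~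
  129622976083445803~7432784848973~(r 310442595068300 (r 172389888968843 (n 1479 (3071~o))))~~
  205918761036172~167305697208716~1186038968421001620~(§(§(§(§246469426204172~144234311141780~
  147650286504428~142010587106932~o))))))))~~(r 25206802 (r 30728053921215214073474590765 (n 4107
  ((r 223895 (r 11247642 (n 5120 (77~2219~(§14764428~o)))))~~35232598691~206444349106234~
  12274959395354~(§(§26536766055970~60164679804~(r 25280612 (r 1 (n 348 (6843~o))))~~
  452739953469958~103550558716~(§(§103555277186~25804941284~o))))))))~~(r
  8943992394689963649151279343 (r 103247396970 (n 5444 (27549704086611544125638474619068579~2603~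
  2059~2669~(§13159180~o)))))~~8907623532544487979423294103~(r 103248568716 (r 129509042275658243 (n
  195 (454330756338622955~1024129939875644075~3711402~26761644~26755498~3725700~3711402~o))))~~
  7106874996117658067340~1732223534073553292~(r 422901438292364 (r 7509312128138197656977923 (n 448
  ((r 3061 (f 195118903541697618612634143632111))~~(r 6517 (f
  2249129876750517253111530368963373207))~~o))))~~(§(§(§(§1732302703714943372~444196788054835596~
  108656214742712716~1732204291250241932~o))))))))
def ta20 : T := (r 714798 (r 18404907017696633101407412261 (n 4115 ((r 11214866 (r 15915821119 (n
  1042 ((r 692 (r 328192877811305866504942032904195 (n 82 (10643622~37145494190~(r 684 (r 1717 (n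
  338 (2214~o))))~~o))))~~(r 3022711342 (r 3765 (n 1110 (144184512111142~o))))~~(r 3637 (r 2606 (n
  1298 (5159~205520387229537235912260774744757~5159~o))))~~o))))~~(r 278602 (r
  29828790559777283836578422795 (n 83 (189296491522606~(r 682542 (r 40967755284687 (n 1298
  (9742075972~2094~o))))~~46215127726~(r 10797742 (r 1741 (n 1042
  (793399845266806097294180038803110950869~o))))~~46215088294~46213522094~(r 1741 (r 680622 (n 338
  (2759~2550911436913096953706124988298488527~10635398~o))))~~o))))~~(r 303154 (r
  29828677223720851508379656203 (n 1055 ((r 692 (r 4143 (n 82 (10643622~37145494190~(r 686 (r 1717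
  (n 338 (2214~o))))~~o))))~~(r 11323956 (r 3637 (n 95 (1299422062948834873056416241453817557~
  o))))~~(r 3637 (r 2606 (n 5440 (2723~o))))~~o))))~~2807052053917984147974~(r 29274811318668 (r
  32201621825599 (n 1308 (2971~o))))~~491163741580680645126~(r 29275738811308 (r 686300764182071359
  (n 1302 (64503063177382~2612~o))))~~(r 257620768244398 (r 26241803783 (n 1042 ((r 6299822 (r
  33503482767773813591649799 (n 82 (28531910820~63024284334~28125086382~o))))~~26522733102~
  60337343022~o))))~~(r 6340626 (r 502740390333913933827 (n 1043 ((r 1830853573053994713774 (r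
  80119773731128811547426676739 (n 82 (8699666566~3756~6868660~o))))~~249237159987758~
  249237159987758~o))))~~4321747197804524356270~539735171574155225771~4146025746837420952110~
  491582678042393758254~442024297356345418~2014175176348113675250222~(r 2877274794075622041637 (r
  103708538892 (n 5120 (2691~2731~11085930~2211~2595~9972108~o))))~~(r 469870152040466 (r
  104515455039 (n 1302 (1778254761278251694~o))))~~(r 424790150365258 (r
  12178971847449093776672743429 (n 1298 (2765~o))))~~(r 469870127128626 (r 65181466413099 (n 1298
  (3602225677055302933315530998962408743023~o))))~~1739940558037066124~1741627250178072972~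
  1739940461902315594~47168158919614456793583896619~1739940558041785868~7292811031989136343726~
  1741312122018873418~7329710396614420243118~1732865673158730124~1732866341527953804~
  442024297356345418~1741312789852758066~o))))~~(§(r 9362401326 (r 36634166775486134755560488349191
  (n 4112 ((r 109133854548031 (r 11214866 (n 4143 ((n 4430 (463~(§3237014~2079~o)))~~o))))~~(r
  27045218829 (r 278602 (n 4096 (2563~413~74124~(§2179~(§o))))))~~(r 109127578206755 (r 303154 (n
  4352 (2211~o))))~~(r 49427423628 (r 129649764607893895 (n 1235 (6488239012~o))))~~
  2212341760892680464984715~(r 7147372618 (r 137165496035331 (n 1235 (2980~o))))~~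
  447159010425743421~(§(§(§(§26593034551692~1304267112844~29275638247340~29275738812332~
  2174540259236956291~428011570282551~424790150365258~129587615984394295~425201965212044~
  423044245954956~425105830461514~425105830486066~(§(§(§(§105697037566348~29274805420428~
  108446481662026~108446481686578~o))))))))))))~~o)
def ta21 : T := (r 686 (r 6513639 (n 278 ((r 239468958343568871846636175934215 (n 4100 ((r
  250415856478357 (r 46070342204 (n 283 (955~6717~955~o))))~~13592057070113262248814755~
  7009871249906038881935499~9221443426133247369224561031~(r 701 (r 6476112444 (n 5120
  (54087323364288074480412213919~o))))~~4065243474844619556975~3316188024650412970240525~(r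
  612061060817734275 (f 933423795686842154205876373925663657511))~~755731462076645387~
  13591076942916666845079725~43706168656011~12350105114030089625321793927~138275373269509~
  3447515925209627806221~810138468029542189573~(r 6154 (r 2603 (n 5120 (641573~9874368677~661~
  1271574527259232684~177208548838324~1289615863263439852~1330156501549001708~1595866559214014116~
  1598110250123734668~1183745387038034148~1222058971494952684~249243471851436~249237161978284~
  167299359590796~148056429349268~o))))~~(r 26776945343 (r 103112876604 (n 4160 (2595~o))))~~
  810091355333085767~271390163285451277~918132034369631723661~134081331624690339~25915258323386507~
  13213990789677820823095813~787701429340096651~1730053122279188132~96981845241308921891~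
  1730051036502139108~1732305471984378284~1730053122280661018~1732303390903804300~
  1730051041334272026~o)))~~(r 10676774 (r 77500749336184219580041455671 (n 1302 ((r 19128383 (n
  5675 ((r 4441150 (n 538 (1084~o)))~~3039~172884869513611918420866647538152555247~1959~o)))~~
  o))))~~(r 45871196710 (r 407186958564653607 (n 1302 ((r 463915236717103 (n 5466 ((r 10734142 (n
  1306 (2620~o)))~~1085~149~o)))~~o))))~~o))))~~(r 8579622 (r 7137350306408800837643 (n 1302 ((r
  850971843976161413 (n 278 ((r 1026752968353047223 (n 4571 ((r 12307390 (n 1498 (3004~o)))~~2311~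
  o)))~~o)))~~550~o))))~~(r 35132205606 (r 1354774582238729327880215 (n 1302 ((r
  308419274497717877860327206093990311 (n 278 ((r 4205580263883700103407 (n 4598 (125~(r 10865246 (n
  1322 (2652~o)))~~o)))~~o)))~~550~o))))~~(r 8577710 (r 200163586571512715373605099593739 (n 1302
  ((r 2222 (r 66959180751383 (n 1042 ((r 4527 (n 1106 (14689355280230006293732031258746766920250069~
  o)))~~o))))~~(r 9101870 (r 5956843218446910513903 (n 274 (550~o))))~~(r 23753612911162016788539927
  (n 278 ((r 3269551 (n 5490 (3416597545120847147234880575445827701221~85~(r 2441814 (n 302 (596~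
  o)))~~o)))~~o)))~~o))))~~(r 8577198 (r 14386170723661447216884229 (n 4096 (122972018433466431~
  753275295471118407~4201470046429973473303~106198425970254818055~29274801389964~
  3537284404335690172963~809482774313644974731~453872654289625771~1819790999942777727526~
  33306372950087~503447977753296595101~106384242426252~29274815512972~106384226427276~
  106379528446348~1886307546352896550~425201963704884~136242456089772271~540212552552153729547~
  425201965212044~29274801389964~423043575226764~423038877245836~423065626519052~423063579574290~
  423063070351588~423063070351378~108465307001228~106384897155468~106384226427276~106379528446348~
  o))))~~o
def ta22 : T := (r 45871688230 (r 4743 (n 4100 (187607067304542854~1655614180~1644275940~(r 1581452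
  (r 2402087292018532616388749 (n 471 (2986~o))))~~6476112828~6477627498~6476406810~62887437828~
  26346536986~25837349092~1644275940~25838494092~25838493722~6477627498~6476406810~105285998596~
  105285435418~105453207658~103146725402~103147905420~6476112828~6477627498~6476406810~103152756228~
  26346536986~103152631914~25837314074~25838494092~25838493722~6477627498~6476406810~o))))~~(r 2214
  (r 12054663 (n 326 ((r 2811950 (n 4167 (34798807740~1655611620~45542154492~(r 9489154 (r 3393573
  (n 1302 (1188650~o))))~~13464349372~47279293156~45536518524~28535965218~28521899548~61808222436~
  451002620~28530753794~3128049954~38152880356~2593005948~114045761572~113877467194~105285993188~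
  111761957092~105453723906~11736195330~4354261348~12944161660~105822438946~28949102778~25837320420~
  2590097660~105453856420~2591179010~4354226404~4354226532~o)))~~(r 47176703697062 (r 1319 (n 1110
  ((r 8419454445974377128743 (n 18 (3715889157326842382089636490930060278754261~o)))~~
  18922760232392539123411759~o))))~~(r 40773907079 (n 1110 (134~134~134~(r 11968574548014 (r 4303 (n
  70 (14127923109177133814896545861648916080220479~o))))~~(r 5799 (r 714798 (n 70
  (20014944261230361391318309630554372208785725~o))))~~(r 5799 (n 70 ((n 5170 ((r 803014 (n 102
  (196~o)))~~3628793419708241667008524383851952162975~2295212331892899916210805637575185680997~o))~~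
  o)))~~o)))~~o))))~~(r 187922645541510 (r 231313771227159 (n 326 ((r 2255014 (r 3335 (n 1110 ((r
  714798 (r 97946691887 (n 1094 (2431~o))))~~2182~o))))~~(r 2779302 (r 26364760172555 (n 1110 ((r
  102250220689134477676316358791 (f 25995369527712718596959467048349650596121333))~~
  37893543991051951986010483495~2182~o))))~~(r 2777222 (r 1255 (n 1302 ((r 224179277292591 (n 6119
  (3826513806726865876569450435413835501501~15189606~o)))~~7976721329221323648167~(r 19165831 (r 550
  (n 4539 (13618014~(r 838 (n 618 (860~o)))~~o))))~~o))))~~o))))~~(r 8938118 (r 13660807 (n 326 ((r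
  11517749926 (r 5578385587721421841159 (n 1366 (2182~2182~32937507800143405866052229~(r
  927513315094129263 (r 11198510 (n 1094 ((n 7051 (13880614~24006374~157~o))~~o))))~~
  14048041857300255244217003~o))))~~(r 166 (r 383 (n 86 (2182~2182~2182~(r 9104038 (r 19823271 (n
  1094 (1374651251059874106404702382743482402601261~o))))~~(r 7975 (r 2222 (n 1094
  (20420517652513885965818903329839600603482223~o))))~~(r 7975 (n 1094 ((n 6587
  (5354962037610589242130518352945952572165~(r 17715430 (n 2166 (4324~o)))~~
  4985309841897480402816388117119365672189~o))~~o)))~~o))))~~(r 11517749926 (r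
  383343736372013699060119801700463 (n 18 ((r 9103910 (r 11658159 (n 278
  (4203224464484443547823760224828403893388381~o))))~~(r 7135983 (r 166 (n 278 (975~975~
  36565438713545950823530490153496281558145989~o))))~~(r 123057240111 (r 10641574 (n 278
  (12033078595016463763245267594335944485658077~o))))~~18871587787990625444488798959~
  8234375371726699895497327~103928511682642740890491939567~o))))~~o))))~~o
def ta23 : T := (r 43596276358 (r 49043918940182946215 (n 4100 ((r 11247642 (r
  124638397192018384560598372371095 (n 326 (11511515182~(r 518 (f 187642414851934894))~~(§(§2343100~
  501804196589725~o))))))~~(r 11411562 (r 593955394920522351 (n 6 ((r 228 (r 997 (n 70 (8577710~740~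
  o))))~~(§1984101~o)))))~~(r 401434 (r 26087976138746531 (n 6 ((r 228 (r 485 (n 1352 (2786~o))))~~
  (§6701565~o)))))~~(r 9978274 (r 41944858795 (n 7 ((r 908 (r 19429765 (n 70 (11521370158~o))))~~(r
  1767 (r 6510240262 (n 262 (7207~7207~1511~o))))~~3686796~o))))~~65736690769946~(r 9977962 (r
  106511821595944198215 (n 55 (1581452~(r 612 (r 1637 (n 448 (2658~o))))~~1622402~o))))~~(r
  40869699610 (r 2652306202202856317571 (n 4122 (406~o))))~~(§(§(§(§246606358258082~167426987270170~
  (r 60206628970 (r 147068480399431 (n 960 (3555~(§o)))))~~246606352228378~(r 103708375052 (r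
  333979148495499 (n 1042 ((r 19930201377197754463954955 (n 338 (550~o)))~~(§o)))))~~(r 103708368922
  (r 1325190547956703895 (n 344 (6803~o))))~~(r 103137984618 (r 1160807077254555661 (n 372 (6892~
  o))))~~13215614694812458643234957~424789504213410~424789480710170~27316050772074~26628831191066~
  (§(§(§(§422453190992290~422376245960730~27316050772074~26628831191066~o))))))))))))~~(r 10643590
  (r 4615 (n 4100 ((r 11247642 (r 436270801610157297230347 (n 1094 ((r 11198982 (r 9585173 (n 283
  ((r 19290685 (n 6 (289636578795744947024281537111455~o)))~~o))))~~16512090823615004~(r 2124422 (f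
  12825219754556))~~2787142278~9607766182~1028248338495553981~96747677949~o))))~~(r
  593964203862417451 (r 11411562 (n 4180 (2731~2595~628831217565182276~555~2091~3621~o))))~~(r
  42480289895 (r 401434 (n 5198 (2797~o))))~~(r 41005228932 (r 365403204035557122143738388857255 (n
  263 ((r 166 (r 18373255 (n 1350 (2734~o))))~~682630~11034758~(r 2811950 (r 31084549 (n 199
  (214838268361125945138229734146047~o))))~~(r 388 (f 202497686430628))~~o))))~~(r
  13283084316640373065780486660 (r 175692449046541 (n 212 (538~o))))~~
  214787639985520524857017651192363~(r 167264850649988 (r 710610414838751779 (n 1106 (1719~o))))~~(r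
  209380803068427 (r 116883313535622 (n 4372 (2731~2691~2337346~651~2571~4101~o))))~~
  181621988290554293225467859870371~(r 712746043812801029 (r 14696554 (n 5200
  (10106349249908165036196591~o))))~~2947622990195175464997~2818750197372164784646~
  2806804001528481432070~2929106004750112801286~2806815130105533055494~(r 103708375052 (r 17287181
  (n 6 (23708749909755861063583895~680454~25713156~o))))~~(r 288348478988351 (r 103708368922 (n 4432
  (45980655674~o))))~~35900803031111936539268703611405~13216276454304643881199747~
  1739937809258128260~1739937712988857220~107229729017810821771~3226737939931058937891~
  436148053452310050~1960408895998663436934~107229728977520738829~5281168062758297020547~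
  1739937809262846370~1739937732317814810~435750579998867562~432935143012179994~o))))~~(§(r
  45879421062 (r 16801903 (n 4100 ((r 11247642 (r 10108737796354227803693719 (n 11 (388995124025885~
  (r 37482504764 (r 23099911 (n 4602 (3014~502~o))))~~(§o)))))~~11961279891518631788587111~
  1043884862180640839~(r 10011042 (r 11621749229901933808460459 (n 6 (3817860~(r 932 (r 16663525 (n
  1479 (5159~o))))~~15637955206~o))))~~(r 1712154 (r 357238017849197373260928880486463 (n 6
  (2343324~(r 572 (r 15098493 (n 471 (7207~o))))~~204237071565446~o))))~~4690295252926326810755~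
  17513408210143906111971875~(§(§(§(§167976743085956~107896591460228~167304210327428~
  167264850651012~(r 103708375052 (r 289996575762445 (n 3399 (467131986763940~o))))~~(r 103708368922
  (r 288348478988351 (n 344 (6835~o))))~~5308502339811662801539~26617690949399879054672535~
  424789504213410~424789480710170~27316050772074~26628831191066~(§(§(§(§423063440729988~
  107896591460228~422453184997252~422351548295044~o))))))))))))~~o)
def ta24 : T := (r 11214866 (r 486744406000897616535 (n 4122 ((r 9388063 (r 11239518 (n 4174 (2583~
  535~(§1599~o)))))~~(r 1663000 (r 1731078672456097943 (n 18 ((r 45399376052 (r 16486679477 (n 474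
  (2494~o))))~~(r 566 (r 61044646551 (n 1242 (834867029065526200~o))))~~50300379310~
  (§(§118028721941143~3893686~o))))))~~(r 1900638 (r 1697909 (n 474 (2494~o))))~~(§(§67618562454~
  7801135198~(§(§(§(§(§(§26140571670~134106562643495~o))))))))))))~~(r 409706 (r 4299063732259 (n
  4119 ((r 278586 (r 480944171 (n 5456 ((r 298 (r 2603 (n 1368 (2762~o))))~~(§4891434~
  (§(§(§13282090~o))))))))~~(r 6511290531 (r 7013154890 (n 4176 (675~2723~(§(§o))))))~~(r 1712186 (f
  179954478074594))~~(§(§67177686562~26340467106~(§(§(§(§(§(§26365534626~979515426~o))))))))))))~~(r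
  434194 (r 7440132222416014505598979 (n 4106 ((r 516120 (r 1731177072919765103 (n 4146 ((r 494 (r
  239 (n 1353 (2794~o))))~~(§2025070~(§(§(§25618030~o))))))))~~(r 6822633520 (r
  1807330024630352784003 (n 474 (2494~o))))~~28044358576274~(§(§67618562454~2120311190~
  (§(§(§(§(§(§26140571670~26164158590~o))))))))))))~~(r 1581452 (r 10386887027471051754449035 (n
  5440 ((r 1097874 (r 29044331705580977662861443 (n 18 (12230964~(r 11223598 (r 1717 (n 1239
  (1074750884452675799970~o))))~~50105870894~(§(§7035061~10142636~o))))))~~(r 46951483563 (r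
  4329619690 (n 4479 (63~49203028246~o))))~~(r 9347730 (f 63921641401196))~~(r 1164 (r
  148185574711427 (n 5187 (28257689746~29734086890~8986858~(r 4236 (r 171 (n 471 (2468~o))))~~
  17352850~17352938~9349266~o))))~~(r 4768402 (r 150919079608491 (n 471 (2468~o))))~~
  66620403881527427~19531735698~(§(§(§(§(r 19451020 (r 186256157467267 (n 471 (2468~o))))~~
  79671380626~79671380714~53899864722~o))))))))~~(r 1622034 (r 2483038891 (n 4110 ((r 2125004850 (r
  10960959 (n 5396 ((n 61 (2746~o))~~o))))~~(r 110929084149843998 (r 127476536141722134317579723175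
  (n 4294 (50098758016~49576305056~50098757888~(§(§49592557984~50098758016~o))))))~~210463867002930~
  (r 9435179160 (r 26250062359 (n 858 (3646~o))))~~179359954591896~276966211134998~107228523127314~
  (§(§(§(§132061947414~2120316950~29377947067926~26139424790~o))))))))~~(r 26532362207338 (r
  1947429875778388811590187 (n 1479 (3074275957127065258372~1127~(§(§o))))))~~(r 6644211730 (r
  192691728195587 (n 18 ((r 2991 (r 174 (n 5406 (2997~o))))~~251550700233259~454332817931938327~
  (§(§110778860530219~35133776046~o))))))~~(§(§(§(§1127131523277398412~(r 25972752402 (r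
  762808878491756547 (n 19 (67163992926904845~(§10135082~(r 2100 (r 6197 (n 2000 (3475~(§o)))))~~
  10142122~(§1746474~o))))))~~435749796310302826~(r 106384394199058 (r 35873882284035 (n 1984 (1644~
  (r 3571 (n 5454 (126~o)))~~(§(§o))))))~~(§(§(§(§(§(§(§(§(§(§(§(§1732865673158730124~(r
  423063071539218 (r 3124564207731837493419 (n 4048 (6067~(§(§o))))))~~435749796310302826~
  1732866341024997394~o))))))))))))))))
def ta25 : T := (r 2252966 (r 26628411328750103 (n 1030 ((r 134 (r 9052683 (n 1350 ((r 2734 (n 18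
  ((r 715302 (r 207679052178311 (n 278 (2598~o))))~~ta21)))~~(r 11200678 (r 3367 (n 1110 ((r 686 (r
  22989418029679 (n 18 ((r 2598 (r 73318511413842873055139375639 (n 278 (2598~o))))~~(r 10643502 (r
  123449181976324799 (n 278 (5133582248396557660390206943900154013670493~o))))~~(r 109300467032767
  (r 2094 (n 1042 (21979110127870415993930055994839739687193527~o))))~~o))))~~(r 166 (r 8808590063
  (n 86 ((r 9101998 (r 106545013039 (n 70 (383~o))))~~134~o))))~~(r 11992329380006 (r
  643261606037446022874032903854155907 (n 1302 (1455~o))))~~(r 682118 (r 38096760999 (n 1094 ((r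
  17146929775 (n 86 ((r 42380615943 (f 10011840240621408269515882255618209061365021))~~o)))~~o))))~~
  o))))~~(r 3245349692119401914431 (n 4103 ((r 12826880663 (r 11247642 (n 18 (469~
  904795448192036947140080882731011799~6191~469~6191~469~o))))~~(r 558226911497570920519 (r
  46741760228 (n 119 ((r 2214 (n 70 (2182~o)))~~562127365474345090491635223545164836127~6373~6371~
  6279~o))))~~(r 61336237728487 (r 1644275940 (n 4372 (30408888529002975639342866679~o))))~~(r
  1832008915087591409197787819 (r 1581452 (n 18 (50097482660~1743~6191~6191~1743~6191~o))))~~(r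
  2982293975852004919430 (r 821528458338689821 (n 24 (898~o))))~~4817086029282047338932869~
  101957480270842245120631947520547~(r 424790096931294417665714606496040487 (r 28125046276 (n 4598
  (1108326~127108721545653608702407692019837~(r 3486 (n 1106 (15380098~o)))~~3333~o))))~~(r
  14384612377047936318711949 (r 26340337156 (n 4112 (45980655666~o))))~~469052486827657444~
  468944046151190756~(r 107896056104452 (r 5572529198262206054162987 (n 1094
  (912625285896108963641937765413798027~o))))~~24256473345849891523553026091~880975228025966864525~
  4819938240083212711837827~(r 6154 (r 2573 (n 5120 (35400534557~820973733927119403~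
  791559082145336047~1723021~37143926319165~1289589324126890988~1158982186286787468~
  1595869309637766660~84031~255260289814244~1159008712674684556~168011111214980~1159019593874327570~
  147512842833412~254296734476788~o))))~~(r 3132055 (r 25174042 (n 4176 (2563~o))))~~(r
  51996694946475 (r 431708135377030 (n 4116 (31036668049199302199682165245~o))))~~
  1849573345658105636867~9998149466749904145412113607181~2873631141316966115843~34943890137635~
  719636862993580163~202689901664492157819313975355533~549643916376793766445227~1732311521444668932~
  1730059695156209156~1732304902733481476~1730053102918280708~1732223539039610372~
  1729971734225987076~o)))~~ta22))))~~(§ta23)))))~~(§(§(§(§(§(§(§(§(§(r 187913511919750 (r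
  422650653990943 (n 4096 ta24)))~~(§(r 34999525542 (r 26487673862643863 (n 4119 ((r 11247642 (r
  1781637350335457927910124171 (n 18 ((r 431 (r 887983185737563951579140 (n 4160 (2731~2571~
  11447156~555~(§6510644~o)))))~~(§26786588207~(§(§(§o))))))))~~(§(r 270394 (r
  3226637171888247447555 (n 6 ((r 1851783 (r 802950 (n 5444 (2731~o))))~~(§110251913003399~
  (§(§(§o))))))))~~(r 1622434 (r 8773951396347546272780658829 (n 4160 ((r 11223186 (r 2179 (n 5391
  (185969981696406~o))))~~(§36306591875~(r 2701 (r 28488810786 (n 4416 (149~(§117~2723~o)))))~~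
  186094860116651~(§29730187410~(§(§(§(§(r 6961314 (f 47742467163350630425815426700))~~28278603922~
  (§29729825002~o)))))))))))~~(r 1712154 (r 1554604095 (n 4164 ((r 2603 (r 1098018 (n 4175
  (47413553844~12020478~o))))~~4507713770~(r 3791891098 (f 2846179891690981043068))~~651~(r
  28490049690 (f 3152349899584670026626))~~28119711978~114530571919514~(§(§(§(§28513542412~
  179936103637146~28119711978~105267077346~o))))))))~~(§(r 3226637171930869801023 (r 7013146682 (n
  8171 ((r 6110 (f 12917928203692925052494812))~~(§o)))))~~(§(§(§(§(r 106384400196002 (r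
  451621939791407619 (n 2007 (1012352026823641474~(§o)))))~~(r 458427500499312703 (r 26341941274 (n
  8155 ((r 8070 (n 2011 (722432099323455622~o)))~~(r 6110 (f 41087278898543532888494210475932))~~
  o))))~~(§1142896302036885562~(§(§(§(§(§(§(§(§(§(§(§(§435750580516954530~2271364687370788890~
  (§1739060302710054970~o))))))))))))))))))))))))~~o))))))))))
def ta26 : T := (r 11201158 (r 8774167 (n 18 ((r 174 (r 6466845335575 (n 82 ((r 686 (r 7004463 (n
  338 (2734~o))))~~(§(r 9101998 (r 106005455151 (n 338 (2222~o))))~~o)))))~~(§(r 2285742 (r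
  26567369237520407 (n 338 ((r 2606 (r 303 (n 274 (2606~o))))~~(§(r 10676398 (r 603010567851666127
  (n 82 (2222~o))))~~(r 10676398 (r 25878831 (n 274 ((r 8317238238094763942551 (n 1106 ((r 3887 (n
  1030 ((r 487 (r 134 (n 70 (1695~9153743040755108251557868576648812381085~1695~o))))~~(r 3615 (r
  518 (n 262 (927~7271~927~o))))~~6414823~(r 4255 (r 646 (n 6 (415~1567~415~o))))~~10383903~
  15331559~17198623~o)))~~o)))~~o))))~~(§174~o))))))~~(§(§(§(r 35133776046 (r 110117060260309295127
  (n 6 ((r 134 (r 2182432815905491137781765 (n 70 ((r 646 (r 3743 (n 326 (2694~o))))~~(§(r 26240671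
  (r 8938118 (n 326 (2182~o))))~~o)))))~~(§(r 2121862 (r 2185900659650697418025199 (n 1350 ((r 2566
  (r 2783 (n 262 (2566~o))))~~(§10512518~(r 2566 (r 4767 (n 70 (7839~o))))~~(§2182~o))))))~~(§(§(§(r
  34462523526 (r 31685597003430057479454320805 (n 1350 ((r 7229272292715450001571 (n 262 (2054~
  o)))~~(§134~(§(§(§13660903~o))))))))~~o))))))))~~o))))))))~~(r 11198598 (r 1597471 (n 70 ta14)))~~
  (§(r 2795694598 (r 388007 (n 6 ta16)))~~(§(§(§(r 45871030406 (r 25872064543 (n 18 ((r 174 (r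
  1132611975492713669031 (n 338 ta18)))~~(§(r 2285742 (r 251692443429527 (n 4099 ((r 11214866 (r
  29988334297093 (n 4126 (3096599~(r 12280214 (r 2519 (n 4174 (376~o))))~~7796908126~
  (§(§1123660382353844630~10281077~(r 2103 (r 25288728 (n 6114 ((r 3510 (n 5130 (2174~2454~o)))~~
  (§o)))))~~35805126741~423740367792646~104121303134~(§(§103449978390~104121303134~o))))))))~~
  ta19))))~~(r 2094 (r 25354319 (n 1362 ((r 43596144806 (r 541770200155378240402133088878703 (n 4112
  (2996906164~46204758084~1241721012~6486016428~312000940~1250181548~1241719212~62887306764~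
  25971206324~26508306500~1241721012~6486016428~312000940~1250181548~1241719212~103809079332~
  103809073170~1241798692~103784161330~6501319084~103280615852~1166164396~1241719212~25809704996~
  103286882322~1241798692~26508304434~6501319084~25971204524~1166164396~1241719212~o))))~~(r 9071150
  (r 9662639 (n 1298 ((r 10510886 (r 20606031 (n 1042 ((r 61048381975 (n 6511
  (831451714939202061752670371504779317~(r 19092022 (n 2334 (4660~o)))~~
  5280367535878321936483309609500247674957~o)))~~o))))~~2094~o))))~~(§(§(r 178570355992750 (r
  20081871 (n 1042 ((r 11857030475297165494347839 (n 1106 ((r 25391783 (n 1110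
  (3794492711571403847061023001753511391037~5951~o)))~~o)))~~(§2222~o)))))~~(r 10676398 (r
  55007474351 (n 1042 ((r 4143 (n 1106 ((r 39848210599 (r 8937638 (n 7279 (69777215678~(r 17518774
  (n 2142 (4276~o)))~~2127~2127~o))))~~o)))~~(§(r 6063 (n 1106
  (22033547792061327316747482723500061807665303~o)))~~o)))))~~o))))))~~ta20)))))~~(§ta25)))))
def ta27 : T := (r 103119069210 (r 8397315 (n 5380 ((r 4205242 (r 2211 (n 5124 ((r 16787554 (r
  8833059 (n 5140 (2211~o))))~~(§(r 68763002978 (r 167986581743651 (n 5140 (2179~o))))~~o)))))~~(r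
  4203106 (r 10410926627 (n 5124 ((r 81153539215706859679410341916 (r 2083 (n 5204 ((r
  530164373659692 (n 1311 (2196~2196~o)))~~1351895932037901090~(r 2338 (r 2723 (n 1895 (3651~o))))~~
  o))))~~(r 168511475427459 (r 16787842 (n 5204 (95071515298~2179~o))))~~(r 70423030146 (r
  41012045955 (n 1298 (29304196332486502887866428~2708~26722272156921315585581116~o))))~~o))))~~(§(r
  17217102434 (r 255621922009129507 (n 5124 ((r 17192994 (r 2083 (n 1298
  (10742172657809385889185852~2708~122478944982238422814673480364~o))))~~(§1117744108122284050~
  o)))))~~(§(§(§(§(r 5154 (r 9052835 (n 5204 ((r 2179 (r 352050460993602 (n 5124 (2179~o))))~~(§(r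
  9578690 (r 8923171 (n 5140 (2179~o))))~~o)))))~~(r 43529020035 (r 88091273868 (n 5460 ((r
  12825890234508 (n 4356 (643~o)))~~(§o)))))~~(§(r 85944969826 (r 203179545864739 (n 1362
  (3685499573923792537652~2708~(§(§o))))))~~o))))))))))~~(r 103656071234 (r 1820467747 (n 4164 ((r
  26 (n 5396 ((r 4336314 (r 2211 (n 5140 (2211~o))))~~(r 4334498 (r 15242764963 (n 5204 ((r 4898 (n
  4436 (248075954205252093187114350546963516098~o)))~~2083~o))))~~(§(§(r 9052835 (r 21112930 (n 4372
  (675~o))))~~547~o)))))~~(r 258 (r 27255905067683 (n 4100 ((r 272844821897772 (r 8528387 (n 1042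
  (7719470726934507931811900~2708~196~o))))~~(§(r 32252766978 (f
  486967189358540330148477104481148))~~o)))))~~(r 6299674 (r 515 (n 5140 ((r 1847609245944386707596
  (r 10494499 (n 4372 ((r 29896194 (n 1298 (31565658781266782270013532~2708~196~o)))~~120307852162~
  (r 930 (r 45133472259 (n 4436 (894350010341382806435183194779927812~o))))~~o))))~~(r 26889300546
  (r 688111940481984675 (n 5204 (3874~o))))~~(r 16918946 (r 10012835 (n 5204
  (149229363554073728079320637958~o))))~~o))))~~(r 258 (r 1624227 (n 5204 ((r 15608386 (r 2691 (n
  1298 (1921529581624095424572~2708~2756~o))))~~8894447952724261782022~(r 2370 (r 2083 (n 2971 ((r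
  4035 (n 1286 (2751~1764~o)))~~o))))~~o))))~~(§(§(r 258 (r 397 (n 4100 (1793118933824708636~(r
  26225026 (r 2107523 (n 1298 (7876578320242215914160220~2708~196~o))))~~(§o)))))~~o))))))~~(§(r
  433373509198018 (r 456587467003148116003 (n 5390 ((r 2806 (r 475247 (n 1298 (44907159757~
  33338226460323509386462521982~12806474465127741038467959462~o))))~~(§(r 3070 (r 27769346408559 (n
  5426 (488~2959~o))))~~(r 3094 (n 1310 (2710~o)))~~4287222~(§4287486~(§(§(§(§12677654~19360502~
  (§12676094~o)))))))))))~~o)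
def ta28 : T := (r 6430786 (r 442915 (n 4372 ((r 4205242 (r 2179 (n 4100 ((r 1581082 (r 1622147 (n
  4164 (2179~o))))~~(r 25174042 (r 2051 (n 5124 (2179~o))))~~(r 103114350618 (r 6652174467 (n 4164
  (2051~o))))~~o))))~~(r 4203394 (r 15242633891 (n 5124 ((r 1626097272781464062092 (r 1622147 (n
  5460 ((r 834 (n 31 (660~660~o)))~~(r 4770 (r 2179 (n 4420 (6498~o))))~~11809442~o))))~~(r 11018371
  (r 4098 (n 4164 (27780948365148803072903724~3~o))))~~(r 66622334626 (n 1298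
  (3122407941750554739252~2708~196~o)))~~o))))~~(r 4334498 (r 3719843 (n 5460 ((r
  6962726485332726909559314 (r 2105475 (n 4356 ((r 561693666064873514374034652267659282 (r 397 (n 79
  (564~564~o))))~~114320118938721046207161866144302~(r 6658 (r 36540787203 (n 5380
  (15417350717417819746547213587452~o))))~~o))))~~(r 52666444930 (r 36543408643 (n 4436
  (1039813439731780356855682950402563420~o))))~~(r 19540666 (n 4436 (198067823846146~o)))~~o))))~~(r
  27272194 (r 8923683 (n 4100 ((r 27258590863491 (r 1581082 (n 5188 (1216807694181214978~131~o))))~~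
  (r 150455814729818091993348751916 (r 2051 (n 5188 ((r 148613840899397270870972975642 (n 1359
  (2100~2100~o)))~~36887257373119014107095694~(r 2306 (r 2691 (n 2999 (3971~o))))~~o))))~~(r
  128897393026 (r 6652174467 (n 1298 (7196868326412354601052~2708~196~o))))~~o))))~~(r 27403298 (r
  2595 (n 5460 ((r 86448500998153335772140804360238 (r 8397315 (n 5124 ((r 386 (r 8921219 (n 4356
  (200609467378286512376383990160380~o))))~~(r 17178690 (r 3 (n 287 (2196~2196~o))))~~70373613634~
  o))))~~(r 18300283650 (r 203177765380739 (n 5396 (375615082504218629210014530423772~o))))~~(r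
  80038996666 (r 2957 (n 5396 (74952594172802~o))))~~o))))~~(r 111706907522 (r 62433836278435 (n
  4436 ((r 2563 (r 11248386 (n 5380 (1027612545455235612~2595~o))))~~(r 2882 (r 10494595 (n 1899
  (3811~o))))~~(r 834 (r 643 (n 3691 ((r 7395 (f 2977202670564219086979))~~o))))~~o))))~~(r
  112243909538 (r 15244337827 (n 5396 ((r 4467842 (r 8397315 (n 1298 (4668672360408595569688628~
  2708~196~o))))~~(r 19016378 (n 4436 (497169369408642~o)))~~(r 4467714 (r 49601847811 (n 2507
  (1070916473269673404~(r 7555 (f 2978832254551407911043))~~o))))~~o))))~~o))))~~(§(r 28488900802 (r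
  111471523789283363 (n 5460 ((r 4205242 (n 4100 ((r 401434 (r 2083 (n 4116 (2083~o))))~~(§(r
  8923171 (r 22134147915802 (n 4116 (2083~o))))~~(r 103113170970 (r 8398979 (n 5124 ((r 1321346 (r
  2445 (n 4116 (620884115806011012343888336375484~o))))~~2083~o))))~~(§35~o)))))~~(r 17761542722 (r
  621 (n 4116 ((r 5403844634 (r 515 (n 5380 ((r 14272162 (n 1298 (3397269257032556626524~2708~444~
  o)))~~(r 4610 (r 2179 (n 1655 (1251~o))))~~58034497186~o))))~~(r 5427437954 (r 34395400227 (n 5140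
  (4162~o))))~~(r 25305154 (r 1811949603 (n 5140 (162883461720450~o))))~~o))))~~(§(r 18885306 (r
  8632412195 (n 4436 ((r 4467842 (r 2539555 (n 1298 (6724~2708~6724~o))))~~(§90412328954050~o)))))~~
  (r 77891086914 (r 10930211 (n 5140 ((r 9709954 (r 10494499 (n 1298 (3123120939895590502964~2708~
  444~o))))~~94524156290~(r 5666 (r 8831011 (n 1298 (22689371766185251074588724~2708~196~o))))~~
  o))))~~(§(r 19540666 (n 4436 (1378888893128122924~(r 20068898 (r 2542115 (n 1298
  (12794472915980829474377564~2708~2738046387153102780451492~o))))~~(§o))))~~o))))))~~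
  (§(§(§(§ta27)))))
def ta29 : T := (r 11247682 (r 445059 (n 4100 ((r 1581082 (r 1622147 (n 4164 ((r 6824194 (r 643 (n
  4420 (2691~o))))~~(§(r 105267077378 (r 8921731 (n 4420 (2179~o))))~~o)))))~~(r 6299674 (r 515 (n
  4356 ((r 4203394 (r 3719811 (n 4420 (2691~o))))~~(r 27272194 (r 2563 (n 5380 (2691~o))))~~(r
  111706907522 (r 15244206723 (n 4420 (2563~o))))~~o))))~~(r 25804939290 (r 6645883011 (n 4164 ((r
  258 (r 2563 (n 4356 (2563~o))))~~(r 25698562 (r 10496131 (n 4356 ((r 28846466 (n 5188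
  (303972534137258408174617362462588~o)))~~o))))~~(r 25698562 (r 2179 (n 5188 ((r 7351042 (r
  10494595 (n 4420 (535322353143851115152186154740450~o))))~~o))))~~o))))~~(§(§(r 103119069210 (r
  8397315 (n 5380 ((r 1026 (r 2179 (n 5124 (2179~o))))~~(r 4203394 (r 15242633859 (n 4420 ((r
  28322690 (r 2691 (n 5124 (206359143816184408051207476361116~o))))~~o))))~~(§(§(r 8921731 (r
  6053034544925768206354 (n 4356 (643~o))))~~515~o))))))~~(r 422375708958746 (r 27247308185731 (n
  4164 ((r 258 (n 4356 (2051~o)))~~(r 258 (n 5124 ((r 7351170 (r 2691 (n 4356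
  (646892932175558812728054798908668~o))))~~o)))~~(§o)))))~~o))))))~~(§(r 46071423170 (r
  27214725259299 (n 5380 ((r 401434 (r 2595 (n 4116 ((r 6430786 (r 547 (n 4372 (2595~o))))~~(§(r
  103656071234 (r 8528419 (n 4372 (2083~o))))~~o)))))~~(§(r 22134147915802 (r 11020835 (n 5396 ((r
  2083 (r 1058 (n 4116 (2083~o))))~~(§(r 19016738 (r 8528419 (n 4372 (2083~o))))~~o)))))~~(r 4203106
  (r 10410271267 (n 4164 ((r 1319170 (r 3 (n 4100 ((r 29573262882 (n 1298 (4202008368279607296052~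
  2708~444~o)))~~8321773009404299365982252~(r 6146 (r 43528495139 (n 5124
  (7820161817162509355556774238116~o))))~~o))))~~(r 43520239747 (r 103113170970 (n 5124
  (57365242194306~2179~o))))~~(r 1456258 (r 10371 (n 1298 (37338205321757061545214004~2708~
  13458805060273863377700092~o))))~~o))))~~(§(r 1047429934784188654211 (r 22144888611426 (n 5390
  (623~(§399~o)))))~~(§(§(§(r 77355559522 (r 183387092951683 (n 5396 ((r 5909634 (r 2540035 (n 1298
  (12788392380699798290060028~2708~196~o))))~~(§276596710604509178315185347282950~o)))))~~(§(r
  51592047612 (r 3408787083739265509923 (n 1362 (14368561851550941596306018~2708~(§(§o))))))~~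
  o))))))))))~~(r 6299674 (r 515 (n 4356 ((r 4203106 (r 2540067 (n 4372 ((r 3809858 (r 3719843 (n
  4436 (2723~o))))~~(r 27402818 (r 2595 (n 5396 (2723~o))))~~(r 112243384898 (r 15244337827 (n 4436
  (2595~o))))~~o))))~~(§(r 17217102434 (r 62407689380387 (n 4436 ((r 11248194 (r 2691 (n 4420 (2691~
  o))))~~(§(r 11020835 (r 3418810 (n 4372 (2595~o))))~~(r 27402818 (r 11020835 (n 5444 ((r 4866 (n
  4420 (210730757583838119066964171278990~o)))~~643~o))))~~(§547~o))))))~~(r 27272194 (r 2563 (n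
  5380 ((r 18885218 (r 10930723 (n 5396 (2723~o))))~~(§(r 77355035234 (r 203179545864739 (n 5396
  (2691~o))))~~o)))))~~(r 111706907234 (r 10412368419 (n 4372 ((r 11248194 (r 2691 (n 5380 (2691~
  o))))~~(r 3809858 (r 15244731043 (n 4436 ((r 28453794 (r 2723 (n 5380
  (233432253103700893029179740114428~o))))~~o))))~~(r 3809858 (r 3719843 (n 4436 ((r
  8157676825610442320014 (r 11020835 (n 5396 (276081321930976996692171443391684~o))))~~o))))~~
  o))))~~(§(r 457551493210722 (r 255621927914709539 (n 5380 ((r 18885306 (n 4372 (643~o)))~~(r 4610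
  (n 4420 ((r 19290786 (r 2723 (n 5460 (2882~o))))~~o)))~~(§o)))))~~o))))))~~ta28)
def ta30 : T := (r 236 (r 3518801590758974513667 (n 6 ((r 2606 (n 18 ((r 558 (r 14870573 (n 274
  (2606~o))))~~(§(r 8577582 (r 1742438827274528899 (n 274 (2094~o))))~~o))))~~(r 166 (r 2277 (n 4170
  ((r 101110 (r 55949300247271 (n 5430 (10445031~(r 13527744 (r 2279 (n 4214 (358~6254~o))))~~3063~
  (§(§53404396256~79167941606~o))))))~~(r 3030556949 (r 11239710 (n 4474 (2079~2508957~o))))~~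
  1657575~(r 1060071221070357038 (r 37381909175 (n 1366 (319~o))))~~46811015831~197231678941215~
  476837307053728492~(§(§(§(§1945606271773675588262~12551748411623~433098564108574~433098564108574~
  o))))))))~~(r 45735242286 (r 260151883271413891 (n 18 ((r 558 (r 3631 (n 274 (2606~o))))~~(§(r
  8577582 (r 25355823 (n 274 (2094~o))))~~o)))))~~(r 45736815150 (r 1703 (n 4106 (8907510~
  45399376318~8905118~28295004818~8908438~6384062~8908310~106277445808~27746430~25420190~1695870~
  31581878~517782~6382014~6381694~o))))~~(r 2121894 (r 105979099112047 (n 4106 ((r 10715359878 (r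
  2277 (n 1353 (2794~o))))~~27529107286582~256740262513468038~250560111012024~439286946333671670~
  61176113566~27548299419794~1773867441110346286~1764900204052433542~485312246129054~
  430877831717010~424302376215058~545246507655826~103584228886~105199526302~o))))~~(r 35633834256942
  (r 1959235834765948842320023 (n 1356 (2804~o))))~~(r 47638959749221028796821580419 (r 2121862 (n
  4366 ((r 11493400 (n 5426 ((r 3046 (n 1110 (7851735210324750741685239~o)))~~o)))~~2837~2837~
  o))))~~(§(§(§(§(r 34462525998 (r 25847335 (n 18 ((r 14992903 (r 558 (n 5188
  (70216775503494124468412598827~o))))~~(§1850525662862598167~o)))))~~(r 106068613417603 (r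
  34462523558 (n 5136 (121447688760661692753422213375~o))))~~(r 141158506487942 (r 28415610743427 (n
  1356 (2804~o))))~~(r 106068613417603 (f 30936714806007263370964322863147))~~o))))))))~~(§(r
  16220290704014 (r 349240111748222478979 (n 1346 ((r 646 (r 330049676108318853 (n 79
  (1158186823215510366723~(r 756 (r 9421315 (n 1298 (2726~o))))~~2695924~80934231360562157~2697364~
  3098772~3098772~o))))~~(§(r 2810502 (r 13192839 (n 1356 (2794~o))))~~(r 678 (r 69624216076421 (n
  1286 (2606~o))))~~11081958062~(§11037358~o))))))~~(r 967310 (r 45473237618272620868236568579 (n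
  1346 ((r 11075084422 (r 19975325827 (n 1359 (715000500298637355~
  259066286557753109010980586393872387~150813793012460~800841706213138435~10561682~11454708~
  10561682~o))))~~(r 47152636125318 (r 4743909 (n 1110 (2443179690641422581666565693947450139541~
  o))))~~(r 686 (r 13551279 (n 115 ((r 231 (r 3926417652 (n 4420 (2603~o))))~~823761433947809835~(r
  862763 (f 297745286733239809185984139453303))~~26132679~12516804844~(r 6381 (r 960748 (n 4194
  (72691909300228241799067640451~o))))~~38422882540~o))))~~46637248440454~(r 149373923051102868 (r
  4749 (n 322 (680454~236~1940148624197374639~o))))~~186128962087430~(r 12694776044 (r 79671805615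
  (n 1356 (2794~o))))~~o))))~~(§(r 654 (r 6873359 (n 1346 ((r 862571097284709900422 (r
  17624928701636945084246147 (n 1148 (10561682~(§618~(§o))))))~~(r 12551643310 (r
  34279310225371769985888166443 (n 1407 ((r 1279 (r 646 (n 4100 (2219~o))))~~11446930~
  103220686262116395~13628149~45402245868~(r 4845 (r 2794 (n 4100 (2219~o))))~~44737407634~o))))~~
  (§191019153784596654~(r 47185291567764 (r 3300575340829638314677 (n 1356 (2794~o))))~~(§(r 756 (r
  4751 (n 322 (185138972123270~541222050403585119407614992670891~(§o)))))~~o))))))~~(§(§(§(§(r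
  16220288508558 (r 302537924420611173035 (n 322 ((r 2214 (r 7275260711684228080131 (n 1286 (2606~
  o))))~~9069190~(§2646702~479538083550282423~(§2810502~o))))))~~(r 3968393870 (r
  23960011126220437136080200196267 (n 322 (281931001771867064494~(r 3534813671474295065888942 (r
  2928757876312433502831 (n 1090 (8413350~2054~17747701~o))))~~47152636125318~(r 9245691668628 (r
  3309 (n 1356 (2794~o))))~~1911330835433216149~47152636125318~5167861~o))))~~(§(r 8970894 (r
  105468453135 (n 323 (645192051711363630~(r 157517592322222 (r 1158446980734013631019 (n 1356
  (2811~o))))~~(§(r 2292 (r 1167 (n 1090 (187881977211526~1220046916755422131835631890816739439~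
  (§o)))))~~862571097284709900422~95047458474629846950765321005099~(§o))))))~~o)))))))
def ta31 : T := (r 11427871 (n 1346 ((r 166 (r 11231503 (n 18 ((r 12214351 (n 4100 ((r 46070341692
  (r 12238917 (n 27 (38188859995~6537661~43923513916~(§(§2345020~8634940~o))))))~~(r 11411482 (n
  5443 ((r 163 (r 11215114 (n 5411 ((r 2978 (n 1532 (363~83~411~o)))~~o))))~~675~(r 4760300 (r 1 (n
  1352 (2291~o))))~~(§(§79637818034~79637818092~o)))))~~1854413~2763293~191634697249283~
  432970815401214012~(r 517 (r 25803465092 (n 4171 (44806160637~o))))~~(§(§(§(§1766088493662019644~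
  8397315~451100885107100~8405507~o)))))))~~(r 60911412111 (r 10641966 (n 274 (2997~6703~6703~
  o))))~~(r 26543344171 (r 45734847022 (n 274 (2983~6703~6703~o))))~~(§(§425400104283023~
  425400104340011~o))))))~~(r 37281751598 (r 4778679 (n 274 ((r 2983 (n 66
  (923288434770884605446759166987955349749~6287~6287~o)))~~12897191~21714103221~178569951240366~
  45734849070~4512303~4512303~o))))~~(r 4778741 (n 1090 ((r 748055 (r 2810022 (n 5460 (43958511802~
  301~(r 772 (n 1424 (307~o)))~~o))))~~12003066931246~(r 4239 (n 66 (37281783974~o)))~~o)))~~(§(§(r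
  79704943287 (r 187373023978126 (n 5522 ((r 438 (n 22 (423~o)))~~o))))~~(r 79704943349 (r 8970894
  (n 322 (6612663961348088769194985262343680385845~(n 1090 (187916202729646~o))~~
  273035957668989180153291013702965~o))))~~o)))))~~(§(r 37147435566 (r 4221631 (n 5134 ((r 9398910
  (r 575 (n 1353 ((r 2803 (n 1328 (498~o)))~~o))))~~(§(r 3795582 (r 2744895 (n 1362 (2190~
  (§750589908607361070~(§o))))))~~(r 37318910482 (r 4309535 (n 777 ((n 1054 (2190~o))~~o))))~~
  107240885414418~(§17660601239~(r 16870072 (r 703 (n 1054 (2190~o))))~~69097974398~(§69100759678~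
  283047352166930~69097975318~(§309435631233554~o))))))))~~(r 654 (r 4221671 (n 322 ((r 678 (r
  11231503 (n 274 ((r 2983 (r 2182 (n 1030 (987049965679464024066712175197080955389~4103~4103~
  o))))~~4508583~52013755317~36618528814~103854983211~4512303~4512303~o))))~~(r 5302967 (r
  11377238158 (n 5522 ((r 2358 (f 589585804775091112))~~1293~1173~o))))~~(r 5303029 (r 142 (n 5386
  ((r 100598 (n 5435 ((r 2786 (n 1079 (389~o)))~~o)))~~14522883275865005929566135287~(r 3792920 (n
  5431 (671~o)))~~o))))~~(r 37281753742 (r 105999198743 (n 1094 (2598~2972809971730486960262~o))))~~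
  (r 114052516491 (r 2702 (n 1346 (2743~2743~3223~o))))~~89037057255447~89037057509515~o))))~~(§(r
  4221925 (n 1030 ((r 2646566 (r 71927148990011259154396619295 (n 278 (52817586219~(r 711 (r 558 (n
  5830 ((r 2846 (n 4416 (2738~o)))~~o))))~~4516775~11201062~27419335~4520487~5929511~o))))~~(r 646
  (r 641268486813181981 (n 1350 (52054615215~11692735~(r 1295 (n 4160 (157~12280060256916~157~o)))~~
  47185291536526~11266855~13693575~(r 4743 (r 2702 (n 5450 (1008382~o))))~~o))))~~
  (§46910020000475182~(r 70976954991 (r 11036814 (n 6 (2254886~8544390~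
  198881616586466542983104441111674877~o))))~~(§(r 4103 (n 6 (35006210598~1721932382304594543~
  (§o))))~~o)))))~~(§(§(§(§(r 185723755979270 (r 77422684863 (n 1298 ((r 142 (r 79 (n 1346
  (13691765~(§13691637~o)))))~~(r 581678 (r 1103 (n 342 (2214~o))))~~12905397~(§(§2390942254~
  12905397~o))))))~~(r 45340451334 (r 77422684903 (n 1346 ((r 2743 (r 2726 (n 5522 ((r 2998 (n 1425
  (2995~o)))~~o))))~~5302967~13691637~(§(§36753269390~13691637~o))))))~~(§(r 8413702 (r 77422685157
  (n 6 ((r 11037222 (r 780831 (n 1292 (2803~(§716141152377638412484055661009215993~o)))))~~(r 944751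
  (r 2694 (n 5194 ((r 2806 (n 314 (10836353217104606621827750~o)))~~535~535~o))))~~(§(r 6316063 (n
  262 (185132529115790~9216443304611153021692447~(§o))))~~(§(§(§(§11037222~128950626927~(§(r 7687 (n
  262 (11037222~45200498822~(§o))))~~o))))))))))~~o)))))))
def ta32 : T := (r 4155426938632993316908 (r 9052163 (n 5204 ((r 8658962 (r 444547 (n 4100 ((r
  438001624286423556 (r 1622147 (n 4164 (2179~o))))~~(r 1730156451644752012 (r 2051 (n 5124 (2179~
  o))))~~(r 440649275925866636 (r 6652174467 (n 4164 (2051~o))))~~o))))~~(§(r 19966273273874 (r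
  27214725259299 (n 4100 ((r 53730222178 (r 2083 (n 4116 (2083~o))))~~(§8923171~(r 8398979 (r
  431147641315844 (n 5140 ((r 4482 (f 2281746097305285303776470006517287595868))~~o))))~~(§35~
  o))))))~~(r 1198777917044238990 (r 163 (n 4100 ((r 401412 (r 442403 (n 4116 (163~o))))~~(§(r
  1330580072434845690508 (r 27214725259299 (n 4116 (131~o))))~~o)))))~~(r 71446045326 (r 36180074531
  (n 5124 ((r 2702 (r 442531 (n 4116 (163~o))))~~(r 665731 (r 1583660 (n 4164 ((r 440011389936174 (n
  88 ((n 859 ((n 1055 (2196~o))~~o))~~o)))~~o))))~~(r 16787842 (r 41003526275 (n 5188 ((r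
  308072133175302 (r 163 (n 1103 (1829122634679162417374678226205040818~o))))~~o))))~~o))))~~(§(r
  292627439298754 (r 688073038821990563 (n 4180 ((n 5140 (2179~o))~~(r 103649911340 (r 442371 (n
  5140 ((r 9709954 (r 2179 (n 79 (2100~o))))~~o))))~~(§o)))))~~o))))))~~(r 106944730144812 (r
  175084894297432067 (n 4180 ((r 46071032324 (n 4100 ((r 60606293100 (n 1395 (252~252~o)))~~
  248268107981186~107582526506538~25174402~o)))~~143119754602627~11151491~11151395~581576835~2595~
  1919144370864138258~43657078787~11182627~6654929027~893271999635398850~o))))~~(r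
  5387678334142335986772586 (r 42745326477867 (n 4432 ((r 2566 (r 2105379 (n 4356 ((r 226 (n 4147
  (12750674189308189607118020~1340614827522675003374~53289348166542697403790412244~6254~6252~6254~
  6252~o)))~~(r 2434 (f 166411521725379539140724216179396))~~53221007366~27795682~25174914~
  18885388294~27272066~o))))~~(r 2858 (r 62440807604387 (n 356 (1220~o))))~~(r 810 (r 909 (n 4368
  (61524211331244973361809605940~6698~6698~o))))~~(r 6690 (r 187063039306283 (n 356 (1092~o))))~~(r
  6698 (r 2603 (n 5392 (61523153521144084847523547844~2986~2986~o))))~~27927338~27960106~o))))~~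
  (§(§4297478126440743916708491~(r 72010783490387804685600334382 (r 4298070728058755120407083 (n
  5392 ((r 5029934 (r 2211 (n 5440 (514860471239234278778585643843406596~o))))~~(r 5029932 (n 1346
  (402136209872341556~2612~649800832199901589~o)))~~(r 5947436 (r 2211 (n 1492 (1411~1100~o))))~~
  54981206062~54981208110~58739302444~58739304494~o))))~~(r 4155463392219457841158 (r 37088174083 (n
  5376 ((r 318148136608260 (r 2563 (n 4367 ((r 31541287858605649117241350 (r 2583 (n 4100 (11149475~
  (§9971810~(r 32123946 (r 2051 (n 350 (2708~(§2094~(§o))))))~~131045302370~(§1581154~o))))))~~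
  17171840772370435056134662~60458928905369625978623600782~(§(§115747560867846~
  1832749516864956162604~o))))))~~42650879576747~5447190455874247270542~(§(§237848521780106~
  474354939807050634~o))))))~~(r 31492883934262081720863238 (r 183489964157461 (n 5376 ((r
  7697342159936727040044 (r 7559519937027 (n 5391 ((r 80027904540 (r 8479255 (n 4356 ((r
  6090602702076801237530 (n 1310 (2710~o)))~~1450934668085437026~(§2499458~42643153232419~(§2499458~
  o))))))~~8325423164545997693068~5084942638898344888393868~(§(§303112620414590982~
  303086204113567750~o))))))~~36174219395~132049064877924926201694569004~(§(§1794811324478309558890~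
  7723325140464471419498~o))))))~~(r 183353999804451 (r 1307011289168707233932 (n 4368 (2691~
  41139972739~o))))~~(r 22067937947754634324189028882 (r 753269783149453867 (n 323
  (5346581862157358052592174~1307019601614824172078~38221668757~5686415~6794~6794~o))))~~
  (§(§2400494099260076761643~59193306198981510507100414507~o))))
def ta33 : T := (r 103253319698 (r 34529648643 (n 5123 ((r 1735118761303763502 (r
  2488836683566192173219 (n 4355 ((r 17750485646 (r 6677782531 (n 4180 ((r 131 (r 4580783974956 (n
  4100 (131~o))))~~(§(r 794914 (r 532515 (n 79 (557374899375199185640143117835485372~o))))~~o)))))~~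
  7466467647491~29261097539037264800557196~(§(§1982780313036039050~7143820380770612454282~o))))))~~
  (r 16820914 (r 2818491274791447773867 (n 4355 ((r 4852861494547999864416300 (r 112034600252874755
  (n 4367 ((r 31540697562795290411589638 (r 2583 (n 5380 (666275~(§9971810~(r 5154 (n 350 (2708~
  (§2094~(§o)))))~~20982370~(§12069474~o))))))~~8916295300754592196748~5418977397265952728606860~
  (§(§474429766755764878~425814136544244~o))))))~~10437664899~21904126312642836943301961868~
  (§(§7676631678264799568778~1821322401783455589258~o))))))~~(r 607565113442576427 (r
  19354226466081628674902534 (n 4164 (683~183944526602275~7116269926666442121442~o))))~~(r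
  7132762007966457440786 (r 36205676587 (n 1346 (122169458036920304001364871726~
  19860119784372819980929702~(r 193977710952611 (f 9195546865067341992330818306731))~~2292~
  2008124823796186197171563471554932970~4332~o))))~~(§(§11553397003823560339793963~(r
  2820653450482822981675 (f 176102620349099))~~(r 7107770753040244729862 (r 2818491732040418861187
  (n 4355 ((r 8970286 (r 27352197898243 (n 4100 ((r 35 (r 1644273806 (n 4116 (163~o))))~~(§(r 401794
  (r 27214725259299 (n 4116 (131~o))))~~o)))))~~(r 2738 (r 6677782531 (n 5135 ((r
  4748886740045150740486 (r 2583 (n 5380 (666147~(§3678818~(r 5250 (n 1118 (2708~(§558~(§o)))))~~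
  20982370~(§12069474~o))))))~~29263941349153317776310278~29264639127388072834974350~
  (§(§1744308610485174790~7959609781563738845889166~o))))))~~1822597155~12279121095186~
  (§(§16722209386~12242438892050~11182115~1744096257118749290~7145407843048603330700~
  (§(§16712639370~425899496874602~o))))))))~~(r 613961805564284512427 (r 29113539691108221625737774
  (n 4180 (2494954971964532769451~o))))~~(r 30540439130348885293549396622 (r
  47441179516934828292989003819 (n 92 (43334181049~2066~2066~o))))~~
  (§(§122147458202166289095585079814~51616819074736794694360148107~o))))))))~~(§(r
  119082159159510136813041279494 (r 141433441001475 (n 67 ((r 7095514115884810690566 (r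
  34407756908557 (n 1302 ((r 2606 (r 1946182457454882516942981 (n 274 (2094~2094~o))))~~(§2566~2606~
  (§2606~(§(§(§2606~(§2566~o))))))))))~~(r 1732303250947858478 (r 2363893378786865527138443 (n 18
  ((r 166 (r 493 (n 86 ((r 2759 (n 4415 (2165~o)))~~10513062~(r 1703 (f
  242456370145135639329934030425951))~~(§(§2779302~9069222~o))))))~~9236539950~(r 1583 (r 6341166 (n
  4415 (2165~o))))~~(§(§2793595438~25355823~o))))))~~(§28085666028~(r 1674 (r 203302485156365 (n
  1042 (166~o))))~~(§(r 130616648484495 (r 7095550234840071692942 (n 5438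
  (295080734796489179978591285233815~(§239~(§o))))))~~(§(§(§(§25732746~25732746~(§431723846886030~
  o)))))))))))~~(§(§(§(r 1732303253599068178 (r 579311375952814083 (n 5123 (41012348949~16988555373~
  (§(r 111487265524 (r 4147597 (n 5460 (2746~(§o)))))~~(§(§(§(r 4106 (r 1013 (n 4355 (10660491~
  31631750968205131959576970~(§32085098123670412883192426~(§(§(§o))))))))~~41012348949~
  42642257300139~(§19996838458677952375759502~(§(§(§o))))))))))))~~o))))
def ta34 : T := (r 7905523394720661506534030 (r 43192383219883 (n 4355 ((r 61954236422 (r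
  42615001227267 (n 4116 ((r 60599411206 (r 2219 (n 5136 ((r 2474 (r 171 (n 4176 (6314~o))))~~(r
  4266 (r 171 (n 4112 (426~o))))~~16951722~o))))~~(§9087107~(r 26249536006 (r 665731 (n 5136
  (536278481768451596413463291775099348~o))))~~(§8562691~(r 26264871430 (r 9086979 (n 5188 (4196~
  o))))~~(§696451~107580375966212~(§1568809378~o))))))))~~(r 292533474582597251518064861822982 (r
  10401882155 (n 4112 ((r 11214866 (r 547 (n 4100 ((r 2786 (n 1286 (465211401907453998~(r 11427871
  (n 66 (166~651151525647768897044~166~2702~o)))~~60389379402280784856231332006~o)))~~(r 2434 (f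
  286667688540006796158217832253634))~~26241149446~113853212778~27272066~26265264646~25174402~
  o))))~~(r 2474 (r 37088272555 (n 39 (183939603417287~1964~o))))~~(r 2474 (r 1622187 (n 4176
  (31966447001474172142789413058~6314~6314~o))))~~(r 6186 (r 37079885867 (n 103 (183935943076551~
  o))))~~(r 6186 (r 2091 (n 5136 (20204502833531439786509481636~2474~2474~o))))~~25338282~25338282~
  o))))~~(§2512756276980996949155883~(r 58321488778 (r 1049333110890740359211 (n 1292
  (209733892383267~174562941149315~57807112066589711094432475698~o))))~~(§(r 6212490 (r
  256169442424136331 (n 4416 ((r 38079214297219 (r 222797438036748 (n 5140 ((r 418 (f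
  42443582227044979135270334186))~~(§26248718854~(§o))))))~~(r 2738 (r 2269355 (n 304
  (3838972889830924210072980~68313948891627~(r 2547 (n 5164 (948~o)))~~o))))~~(§187063710952075~
  114524104722~(§(r 6794 (r 2699 (n 5440 (253176618419023952257755801103974958~2738~(§o)))))~~
  o))))))~~(r 149787337205751979 (r 1184816667083805893260 (n 5188 (2091~2091~o))))~~(r
  1378465199123672885266 (r 42606119657515 (n 66 (7802581368143692670509620~564~(r 18047260574371 (f
  49809871489987546433058734271147))~~32236105979896941102671380~2292~
  85260263008346718393985781381802~o))))~~(§(r 113630029842 (r 4147829 (n 5376 (177305555485187~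
  1309046847891259410~(§107005532449674~319603754969994~(§4293086525069047933546~o))))))~~
  832067252997505935~97693665543050~(§(r 113621549962 (r 861347803750777483 (n 4372 (2746~(§o)))))~~
  o))))))))~~(§(§(§(r 106246921691154 (r 861349302616891395 (n 4352 ((r 15236252181 (r
  79334698560004 (n 5204 ((r 60607612042 (n 5136 (2187~o)))~~(§(§o))))))~~(r 300165345938155566 (r
  3719789 (n 4160 ((r 15780492 (r 643 (n 1172 (204262971533038963357275902193554~o))))~~(r 7391886
  (n 274 (300~300~14719602678087579144448298~o)))~~(r 15778446 (r 643 (n 116 (3683~o))))~~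
  30291960462~30291829390~30291798668~30291829390~o))))~~(§(r 1340241042540649293930 (r 909 (n 4160
  ((r 2794115 (n 5631 ((r 27588734358 (f 4277951200019129761032185748187588405540))~~o)))~~(r 178 (r
  683 (n 368 (4328151426404502921714~258015982701812~(r 2931 (n 1298 (13998102089511662591306663~
  o)))~~o))))~~(§11444693131~25862322~(§(r 6282 (r 2187 (n 76 (746~746~o))))~~o))))))~~
  (§(§(§42615012207115~62407697934869~(§(r 1120737300121692302 (r 44899977867 (n 1302 (2751~(§2983~
  (§o))))))~~(§(§(§(r 27304970 (r 2571 (n 5376 (44772182925~904025948853676722~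
  (§1336100947318721268~(§(§(§o))))))))~~o))))))))))))~~(§(§(§(§(§(§(§(§(r 25208330 (r 8430091 (n
  5376 ((r 1034 (r 2211 (n 5123 ((r 79632045455966231683724919302 (r 177330978899971 (n 5204 ((r
  2179 (r 69742929986 (n 5124 (2179~o))))~~(§(r 9578690 (r 8923171 (n 5140 (2179~o))))~~o)))))~~
  (§51618811581822361459923003395~(§(§(§3076826791655157803051~o))))))))~~(r
  14608827930133078143590930 (r 36696545174019 (n 5120 ((r 1158622773087248526 (r 2051 (n 5204 ((r
  191004 (n 4111 ((r 398813871350412 (r 2071 (n 78 (2612~2190~2190~o))))~~1588512217308818062~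
  879751441815653004~(§(§52418789886~54030582268~o)))))~~(r 2626 (r 36182696483 (n 1616 (3107~1715~
  o))))~~(§11282722~(r 2114 (r 2723 (n 5188 (1183003389958457639610991830515756740~o))))~~(§9185570~
  o))))))~~183379769608235~4745619288236893988882~(§(§253237924374922~906623547345381770~o))))))~~
  (§(r 2937927642829088333406723 (r 1958531228184566899206 (n 4436 (2731~(§305578111790655494~
  (§o))))))~~(§(§(§391154231547792144835027499~(§(§(§(§(§(§(§(§(r 88240335366 (r 9052835 (n 4352
  (177305209094659~(§1675654376415052999559253208024539142~(§(§(§8130723448661809209874~o))))))))~~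
  (r 5806976215458475 (r 59829840346391344275110674572 (n 5631 ((r 12009478 (n 5439 (523~o)))~~
  (§o)))))~~(§(r 14606995132538426862152298 (r 124521335521406003715 (n 4416 (7218~(§o)))))~~
  (§(§(§1870081018426929434896939~o))))))))))))))))))))~~ta33)))))))))))
def ta35 : T := (r 6610657298 (r 2315427843 (n 1286 ((r 11264031 (n 82 ((r 2702 (r 79 (n 1346 ((r
  2190 (r 4778741 (n 66 (2190~o))))~~(§(r 79704943349 (r 8970894 (n 322 (2190~o))))~~o)))))~~(§(r
  11069998 (r 335 (n 1298 ((r 2094 (r 4385717 (n 18 (2094~o))))~~(§(r 8577582 (r 19065903 (n 274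
  (2094~o))))~~o)))))~~(r 11067950 (r 6479951 (n 1090 ((r 264885467931275 (r 654 (n 274 (2997~6703~
  6703~o))))~~(r 11199118 (r 17361653 (n 66 (133041080746408887964779804450677~o))))~~
  4444552536042063323787~o))))~~(§(r 11518142510 (r 1369775 (n 1362 ((r 1071 (n 18 (2094~o)))~~
  (§o)))))~~(§(§(§(r 45340615214 (r 103857446991 (n 66 (1084970871815725707~(§122015936195183~
  o)))))~~(§(r 5629470383 (r 9101998 (n 5456 ((r 68 (f 10638286490734049811507914))~~(r 2738 (f
  12176866445726632278575722))~~(§(§o))))))~~o)))))))))~~ta31))))~~(r 1546 (r 523 (n 4355 ((r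
  212543471691780 (r 8959115779 (n 4436 ((r 74509262790662 (r 2542211 (n 4356 ((r 17653309978 (r
  3719811 (n 4420 (2691~o))))~~(r 17676902938 (r 2563 (n 5380 (2691~o))))~~(r 72404595909146 (r
  15244206723 (n 4420 (2563~o))))~~o))))~~(§(r 341218741170479110 (r 62407689380387 (n 5380 ((r
  17652130330 (r 2595 (n 4372 (2595~o))))~~(§11020835~(r 2595 (r 52028254818 (n 4356 ((r 11805570 (n
  1311 (2708~o)))~~o))))~~(§2595~o))))))~~(r 296569227125563398 (r 2563 (n 5380 ((r 18885218 (r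
  10930723 (n 5396 (2723~o))))~~(§(r 77355035234 (r 203179545864739 (n 5396 (2691~o))))~~o)))))~~(r
  305578625403723782 (r 2542115 (n 5396 ((r 12702210 (r 643 (n 4356 (643~o))))~~(r 2632355 (r
  52028255106 (n 5444 ((r 1406154580973070990 (f 6160616899795931259862005462940183120562))~~o))))~~
  (r 19016610 (r 12110499 (n 5460 ((r 78436117250 (r 643 (n 1359 (56155994308422961996590219946674~
  o))))~~o))))~~o))))~~(§(r 1399260031044108951558 (r 62407689380387 (n 5460 ((r 12702210 (n 4372
  (643~o)))~~(r 52565256770 (r 2669 (n 4372 ((r 3416962 (r 2563 (n 1359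
  (20360979783358374551455713970~o))))~~o))))~~(§o)))))~~o))))))~~(§(r 5387669849871919079408234 (r
  717267490925063610883 (n 4372 ((r 215292382988826 (r 2731 (n 5456 ((r 810 (r 2603 (n 4368 (6698~
  o))))~~(r 4778 (r 683 (n 4368 (938~o))))~~19573546~o))))~~(§11184771~(r 52553229186 (r 11184771 (n
  4420 (1252~o))))~~(§10660355~(r 18214299306 (r 11184643 (n 5444 (3172~o))))~~(§2794115~
  74603621950338~(§10160841634~o))))))))~~(§(§(§(r 72109661639937641168569307931139 (r
  32860965571670469847510589998 (n 5460 ((r 52561095186 (n 5392 (2699~o)))~~(§(§o))))))~~(r 27304970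
  (r 2571 (n 5379 ((r 1302878735713839634 (r 177468386396675 (n 5380 ((r 2595 (r 44593857166 (n 5396
  (2723~o))))~~(§(r 12069474 (r 203179545864739 (n 1311 (2708~o))))~~o)))))~~
  (§51657506650476624566601034243~(§(§(§51659280387603283958386739309~o))))))))~~(r
  4937873354334733173571588 (r 2969057219259587520799363 (n 5376 ((r 7697346199509866301956 (r
  27352199995907 (n 4436 ((r 643 (r 27953209484 (n 4356 (643~o))))~~(§(r 3285698 (r 10538328707 (n
  4372 (643~o))))~~o)))))~~8831523~303086231899556458~(§(§350520413301354~303218147390303114~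
  o))))))~~(§(r 51763890353469391681393535627 (r 128982812275816972924578488838 (n 5379
  (43296146421~879656188057665540~(§114004904842~o)))))~~(§(§(§242448510653228329768804344703499~
  o))))))))))))~~(r 6332434 (r 8926014123 (n 4355 ta32)))~~(§ta34)
def ta36 : T := (r 46071423170 (r 27214725259299 (n 4356 ((r 401434 (r 2595 (n 4372 ((r 1058 (r
  6342691 (n 4116 (2083~o))))~~(r 25305154 (r 2083 (n 5140 (2595~o))))~~(r 27403298 (r 1549 (n 4116
  (2595~o))))~~o))))~~(§(r 11020835 (r 22134147915802 (n 4372 (2083~2083~o))))~~(r 1026 (r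
  25979527715 (n 4372 ((r 1090 (r 35 (n 4116 ((n 1515 (386~1250~o))~~6146~6178~o))))~~
  149671062415907~4471330~o))))~~(§1784723236980267688483~(r 103113170970 (r 10496131 (n 5188 ((r
  2402 (r 10012675 (n 4116 (1570~225842749907964599278747106923268~1570~o))))~~247124409722915~
  9842306~o))))~~(§34395922979~(r 27272194 (r 10627715 (n 635 (3171~7803~o))))~~(§16703824898~
  o))))))))~~(§(§(§(r 188723584180930 (r 1784833960654653235363 (n 4100 ((r 401434 (n 4116 ((r
  1712194 (r 2211 (n 4180 (2211~o))))~~(§10627235~(r 6178 (r 8530467 (n 4180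
  (166421785027090342184003239795036~o))))~~(§163~o)))))~~(§11020835~(§(§(§(r 4068 (r 8624021539 (n
  244 (1634~1634~(§o)))))~~(r 6146 (r 8399491 (n 5204 (2595~2595~o))))~~(§1980930~(§(§(§6699010~
  o))))))))))))~~(r 25174042 (r 2051 (n 5124 ((r 16787554 (r 8833059 (n 5460 ((r 11249954 (r
  10013219 (n 5140 (2595~o))))~~(§(r 13249314 (r 247156252485795 (n 5204 (2595~o))))~~o)))))~~(§(r
  68763002978 (r 167986581743651 (n 5204 ((r 11249730 (r 2691 (n 5188 (2691~o))))~~(§11020835~(r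
  3618 (r 11020835 (n 5188 (963986525957126007555074677529368444~o))))~~(§2083~o))))))~~(§(§(§(r
  36013878786 (r 4146593803611486562339 (n 1362 (39974327127858735517282648116~(r 2743 (n 1103
  (2580~o)))~~(§(§(§(§o))))))))~~o))))))))~~(r 25305154 (r 444451 (n 5460 ((r 16788154 (r 643 (n
  4420 ((r 258 (r 1622531 (n 4100 (515~o))))~~(§(r 4727554 (r 106384395870339 (n 4164 (515~o))))~~
  o)))))~~(r 70911764738 (r 41005621379 (n 4100 ((r 25438306 (r 397 (n 4164 ((n 443 (2338~o))~~1666~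
  o))))~~104192813154~10494595~106421278483075~26748418~o))))~~(r 71448635682 (r 2445 (n 5140 ((r
  9709954 (r 2179 (n 4100 (6530~1538~1538~o))))~~39776692610~(r 3618 (r 14731811 (n 5396
  (1018043150278932215709062532~o))))~~o))))~~(§(§(r 11545730 (r 43522730147 (n 5188 (2563~2563~
  o))))~~(r 11676834 (r 247156252485795 (n 2731 (2754~(r 3523 (n 5611 (2466~3042~o)))~~(§o)))))~~
  o))))))~~(§(r 105798312130 (r 111471549559087139 (n 5204 ((r 16788154 (n 4100 ((r 401434 (r 547 (n
  4116 (547~o))))~~(§2630179~(r 1538 (r 2237059 (n 4116 (620874370466187121519925991726684~o))))~~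
  (§35~o)))))~~(r 69301151810 (r 2157 (n 4116 ((r 1319298 (r 2051 (n 4164 ((n 3435 (6146~2402~o))~~
  1666~1666~o))))~~5408563586~(r 1570 (r 106379561935395 (n 4372 (204451148834606420363667632929500~
  o))))~~o))))~~(§(r 3586 (r 10496675 (n 4372 (643~643~o))))~~(r 3618 (r 60339702435 (n 2091
  (204543527750955113520990892866236~78442152483~6818~o))))~~(§(r 3746 (r 14731939 (n 5460
  (260320023487949588775486283316581380~42488134810675092838975654468~(§o)))))~~o))))))~~(§(§(§(r
  468549293449922 (r 1784833960654653235363 (n 1363 ((r 711 (n 31 (2771~o)))~~(r 2743 (n 1103 (2580~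
  o)))~~(§(§(§(§o))))))))~~o)))))))
def ta37 : T := (r 11215146 (r 397 (n 5392 ((r 74 (r 163 (n 5204 ((r 46081941762 (n 4303 ((r 3062 (f
  242452184648135431589974820997834))~~(r 3958 (f 305191614969254363499622277008106))~~(r 3956 (f
  57416202371184178957248299838020))~~111505525262~1522164~137144789132~1523692~o)))~~(r 47956107522
  (f 832899417130174523943053090382686922))~~(r 42983762595 (r 1698 (n 4436 (29472337026~o))))~~(r
  19540738 (f 189241979491077330803711658445546))~~(r 17443522 (r 2691 (n 1151 (2676~o))))~~
  292669846366466~8632412835~o))))~~(r 34932926979 (r 1066 (n 5903 ((r 3830 (f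
  74057986649553151344314723268))~~(r 3574 (f 51613371955432178657426950858))~~o))))~~(r 1066 (r
  1549 (n 5136 ((r 2236579 (r 74 (n 5444 ((r 2818 (f 22541707923632270429414433311434))~~(r 3202 (f
  167508664570115796113489163766474))~~o))))~~9054755~(r 4138 (n 1151 (2676~o)))~~o))))~~(r
  9169414147 (r 4138 (n 4368 ((r 104507517004 (f 137771921175348407409470032716))~~35~o))))~~(r 4138
  (n 4368 ((r 18569250 (f 532828319880060382059517165652714))~~76061746218~(r 1066 (r 1549 (n 1151
  (2676~o))))~~o)))~~(r 19049514 (f 401571898918056103041941415832130))~~(r 19049514 (r 60339429931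
  (n 1151 (2676~o))))~~o))))~~(§(§(r 46209344298 (r 1784834094107877089451 (n 5444 ((r 2306 (r 3 (n
  1151 (2676~o))))~~(§(r 1178 (r 2105475 (n 1151 (772~o))))~~(r 4098 (r 3 (n 1151 (2676~o))))~~
  17312002~(§11645570~o))))))~~(r 45940908842 (r 106384396034219 (n 66 (10961132~10961132~10961140~
  (r 2676 (r 781 (n 1376 ((r 73 (n 1375 ((r 2743 (n 271 (550~2574~o)))~~o)))~~o))))~~13420780~
  5030124~780285196689238182~11167884~968844~1001612~10963086~968846~968846~1001612~(r 2190 (r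
  105462679181 (n 1151 (2676~o))))~~o))))~~(r 469091001737356 (r 11020331 (n 5124 ((r 27250135277699
  (r 1777400266594247180 (n 4420 (2179~(r 6426 (n 1151 (2676~o)))~~o))))~~(§(r 9971202 (r
  45669687427 (n 1151 (2676~o))))~~(r 16894650 (n 1151 (2676~o)))~~(r 11149955 (r 69214579214 (n
  4164 (515~515~o))))~~(r 16894338 (r 2211 (n 1151 (2676~o))))~~(r 16894338 (r 41146821155 (n 1151
  (2676~o))))~~(§(§69170375042~69170375042~o)))))))~~(r 29817818095118125822451852 (r 2091 (n 5456
  ((r 46212866154 (r 8396835 (n 4436 ((r 6172 (n 1151 (2676~o)))~~104379982082~(r 290 (r 643 (n 1151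
  (2676~o))))~~(§(§3155074~4858658~o))))))~~(r 46214062154 (r 167993930162339 (n 1151 (2676~o))))~~
  (r 82529373287948141442160058386 (r 2445 (n 5136 ((r 104505419822 (f
  370520553999744643335154687232746))~~427916766914634~(r 3626 (r 14731819 (n 1151 (2676~o))))~~
  o))))~~(§(§189301267275882~(r 13282090 (r 247156252518571 (n 1151 (2676~o))))~~o))))))~~(r
  32235687658672004310034438 (r 27255905099907 (n 5188 ((r 2818 (r 3 (n 319 (2292~o))))~~(r 1538 (r
  643 (n 319 (2292~o))))~~9553538~283445192368134~(r 16891910 (r 515 (n 319 (2292~o))))~~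
  46081777682~79904645138~69203927046~69203927046~9547394~9555586~o))))~~(r 469090725701650 (r
  1624235 (n 5456 ((r 2754 (r 8396963 (n 1151 (2676~o))))~~(r 69435334674 (n 4112 ((r 106629834826
  (f 134722902233414584085720287476))~~1789479527385188398~(r 1578 (r 6341163 (n 1151 (2676~o))))~~
  o)))~~(r 2754 (r 8921251 (n 1151 (2676~o))))~~11283498~(r 3114 (r 14729771 (n 1151 (2676~o))))~~
  11283626~(r 3242 (r 3597 (n 1151 (2676~o))))~~o))))~~(§(§(r 1919152074024298602 (r 184901194916395
  (n 1151 (2676~o))))~~(r 1921395627501201426 (r 435750522664951979 (n 1151 (2676~o))))~~o))))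
def ta38 : T := (r 6154 (r 2059 (n 5120 ((r 282961614284940 (r 34728921091 (n 5124 ((r
  1161085002138624142 (r 8833059 (n 5140 ((r 2211 (r 10102850 (n 5204 (2723~o))))~~(§(r 14821794 (r
  41148360867 (n 5204 (2595~o))))~~o)))))~~(§(r 4755804188552229658766 (r 167986581743651 (n 5204
  ((r 2691 (r 2114 (n 5188 (2691~o))))~~(§2691~10627715~(§2083~o))))))~~(§(§(§(r 60171889026 (r
  4146593803611486562339 (n 3063 (3555~(§(§o))))))~~o))))))))~~(§(r 1158982186284687884 (r
  2488587267565414426627 (n 5124 ((r 2731 (r 4792727806066148001934 (n 5200 (2603~2603~o))))~~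
  11184259~(r 70422505858 (r 2179 (n 1151 (2676~o))))~~(§(§1161091815170910594~288450588715394~
  o))))))~~(§(§(§193833837076345430526651218962435~(§(§(§(§(§(§(§397047254245066373736212483~
  o)))))))))))))))~~(r 25206802 (r 34706465315 (n 5123 ((r 103431546884 (r 2760707 (n 4100 ((r
  424239891359750 (r 442403 (n 4436 ((r 547 (r 17473826 (n 4116 (547~o))))~~(§(r 4858658 (r 2236579
  (n 4180 (547~o))))~~o)))))~~(§(r 290414985093146 (r 27214725259299 (n 4164 ((r 547 (r 18882588 (n
  4116 (547~o))))~~2237059~(r 1666 (r 643 (n 4372 (643~o))))~~o))))~~(§(§(§(r 6482305122 (r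
  27771292229763 (n 6131 (3574~(§(§(§o)))))))~~o))))))))~~(r 1820778627 (r 1735337385472352780 (n
  5136 ((r 17091250 (n 1396 (4163~o)))~~o))))~~(r 81501746653564205571386689582 (r 148298442745899
  (n 5136 ((r 4138 (r 8396835 (n 4116 ((r 706 (r 3 (n 1343 (5282484282518355840409291999468~o))))~~
  286259605413934~(r 418 (f 11252173455035004750443311286978))~~(§(§1582594~6431138~o))))))~~
  688111931889952939~(r 2474 (r 10012843 (n 1343 (129610047739575192353654892788~o))))~~
  (§(§10137130~14854570~o))))))~~(§(§688636096309280899~29822210314037727198619666~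
  (§(§(§(§(§(§7107753476250432219530~3265052519175705723447402~o))))))))))))~~(§(r 103247421458 (r
  438123773425131523 (n 5120 ((r 4763325605236499859462 (r 26013517845 (n 4432 ((r 643 (r
  29380227465237157923448972 (n 4164 (515~515~o))))~~643~(r 106100336782 (r 1 (n 127 ((n 319 (2574~
  o))~~o))))~~(§(§1929096793102132386~472068785873706~o))))))~~(r 104910203570 (r 6350957 (n 4112
  ((r 140 (r 2083 (n 4100 ((r 2786 (n 383 (696473435099734448802892826091833876~(§2190~(§o)))))~~
  11018371~(§9973250~103550560262~(§6300034~o))))))~~2728534699~(r 426 (r 1622187 (n 127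
  (133478137461704790161534437908~2190~2190~o))))~~(§(§6463914~6463914~o))))))~~(§36180150435~(r
  10019221 (r 80070125091827423917545416846 (n 4432 (2083~o))))~~(§(r 309343052319114 (r
  106556227635339 (n 380 (959640355583236997874706719739682962~(§2154~(§o))))))~~
  (§(§(§(§60372895853~1760065983044169226~(§688522213146012171~o)))))))))))~~(§(§(§(r
  7208350126554214738446 (r 717374850421268483 (n 1282 (15235891820~46007511029~(§(r 7916687 (r
  25207692 (n 5454 (2799~o))))~~(§(§(§7685565740273574797838~29116353133498940092770446~
  (§53930283535~(§(§(§27304462~o))))))))))))~~(§(§(§(§(§(§(§(r 4709110736190315864067 (r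
  1732303253599068178 (n 5171 (46774801026~167996213964301~(§77509118964~(§(§17231830~3989~
  (§o))))))))~~o)))))))))))
def ta39 : T := (r 210288209469458 (r 2315427843 (n 258 ((r 15236252180 (r 54339781163 (n 1110 ((r
  449316423502676621 (n 1042 (2190~o)))~~(§(§o))))))~~(r 3719788 (r 280669916455565 (n 66 ((r 646 (r
  7357487 (n 1042 (2598~o))))~~(r 15911983 (n 18 (2252966~6191~6191~o)))~~(r 646 (r 7259183 (n 1110
  (2598~o))))~~2779278~30828719151~2648206~29733615759~o))))~~(§(r 908 (r 328339232989030423 (n 1090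
  ((r 2810502 (r 62923399703 (n 1046 ((r 2983 (f 40434404890270711960409401407))~~(§(r 1951 (f
  762667903728350727815295433600838147))~~(§o))))))~~(r 9134615 (r 686 (n 5426
  (3826487540171231373815~182948137093286~(r 3062 (n 1070 (2485~o)))~~o))))~~(§11037358~71647846935~
  (§(r 4239 (n 66 (9101998~9101998~(§o))))~~o))))))~~(§(§(§42615012223502~187894419868180~(§(r
  16855288462 (r 1876955338527164555 (n 342 (2751~(§2054~(§o))))))~~(§(§(§(r 2574 (r 27321359 (n
  1282 (44773722644~150540427772558~(§1337227036216707829~(§(§(§o))))))))~~o))))))))))))~~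
  (§(§(§(§(§(§(§(r 106246921691154 (r 35873882284035 (n 18 ((r 11296847 (n 1350 ((r 31 (n 66 ((r
  2574 (r 271 (n 258 (2574~o))))~~(r 10545294 (r 6799 (n 258 (498709535030438460259795698535071~
  o))))~~105469397131~o)))~~(§8972294~(§(§(§(r 799 (f 56926798448536889305995785293061))~~(r
  10848626830 (r 4103 (n 66 (526~526~o))))~~(§9564295~(§(§(§11661959~o)))))))))))~~(r 11231311 (n
  4110 ((r 2767 (r 36482492966 (n 5154 (503~(§503~719~o)))))~~203828923951270~(r 2126078502 (r 2767
  (n 1110 (414~o))))~~(§(§28457226693286~(r 67075826214 (r 2767 (n 1346 (2214~194339587711127~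
  (§(§o))))))~~(r 112583582392 (r 2071 (n 1366 ((n 1090 (2574~o))~~o))))~~46406002711~
  450119520184486~1735583382075238926~(§(§103991697846~15165847~o)))))))~~(§(r 79 (n 258 ((r 2810406
  (r 11428879 (n 2044 ((r 3571 (f 59480906313393901918414631562375))~~(r 3955 (f
  14526380785427977460477618743))~~(r 4051 (f 59452283114095095071252512861103))~~(§o)))))~~(r 686
  (r 1039 (n 338 ((r 2646054 (r 11692743 (n 1090 (886651615791364763333761860076227319~o))))~~
  54336318151~(r 3467959 (f 52850856343936319051492314231))~~9071278~23058306525207~10840337070~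
  91236617381911~o))))~~(§9230281230~(r 2812430 (r 27321359 (n 1346 (2598~o))))~~(§(r 111910275595
  (r 2574 (n 5406 (2991~o))))~~o)))))~~(§(§(§(r 11167790 (r 112309594223 (n 2044 (3571~(§4051~
  (§o))))))~~(r 106001295383 (r 2094 (n 1042 (2759~2983~4527~(§(§4527~4021~o))))))~~(§(r 2094 (r
  25354319 (n 1042 (150530115166246~453903664244813~(§43721582598~43730395310~(§(r 2606 (r 4021 (n
  4590 (3030~6254~o))))~~o))))))~~(§(§(§(r 103859177515 (r 2094 (n 1042 (2759~2743~(§(r 10543662 (n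
  5406 (2991~o)))~~(§(§(§o))))))))~~o))))))))))))~~ta38)))))))
def ta40 : T := (r 28163717257126412 (r 9517213632046867297031825451 (n 4179 ((r 2083 (r 729132 (n
  4180 (547~2595~(§(§o))))))~~(r 547 (r 82211175026156046 (n 4116 (555~2603~(§(§o))))))~~(r 729386
  (r 1 (n 1391 (2803~o))))~~(r 2603 (r 6996646 (n 4368 (2595~301~301~2723~o))))~~45978100267~
  11716911~30803697962~(§(§(§(§(r 25339434 (r 1 (n 4368 (2211~o))))~~105971892402~105971892522~
  108113109290~o))))))))~~(r 3959857170 (r 7106749088606108264491 (n 1026 (36180617236~(r 2574444 (r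
  25645615 (n 1356 (2171~o))))~~10545031188~(r 628 (r 436005600949264939 (n 258 (2779694~
  1886558836467614359~10510982~o))))~~36180617236~1022038829273926315~16803941~o))))~~(r 12198282 (r
  27808135522957 (n 4226 ((r 264 (r 45668147223 (n 1218 ((r 109911231367 (r 10053766 (n 5334 (4103~
  o))))~~(r 4111 (n 18 (143351617249718~(r 918 (r 79 (n 258 (43052982822~o))))~~141612013584007591~
  o)))~~1843808852768745863~(r 4111 (n 259 (176345026061206~(r 2606 (r 98720495320495169842937293483
  (n 1299 (37146553270~187372346174390~(r 31517741 (n 5134 ((n 4176 (2699~651~2187~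
  24435874589903844665378957~o))~~o)))~~o))))~~141784573837984647~o)))~~(§(§141433958180473223~
  o))))))~~(r 2015535 (r 4397129992 (n 5522 ((r 464 (n 4190 (139612050901783~o)))~~o))))~~
  5202955055~(§(§2334207260651630814090~4711407001907462466442~(§(§(§(§(§(§18034828829038~
  7647004669092943716778~o))))))))))))~~(r 1613842 (r 46003691523 (n 4110 (141308414409747247~(r
  28495064907820 (r 617263 (n 4226 (2015535~(§132497299008394~(§(§(§107616461166~o))))))))~~(r
  2050863 (r 8704392601644 (n 5396 (2731~o))))~~(§1042059012416170128~(§32548277039~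
  (§(§(§(§(§35898371586220198~(§48043212917~o))))))))))))~~(r 26664935908234 (r 159747592954639 (n
  4227 ((r 52915684418214 (r 4631617579 (n 4112 ((r 50 (r 35 (n 5470 (2334~o))))~~(r 1578 (r 555 (n
  5522 (1762067746371750709~o))))~~6463538~(§(§6469674~6463538~o))))))~~(r 28349982059421994 (r
  11231275 (n 348 (827~o))))~~188296410521621~47983010435~115545038962165442858~73190372006218406~
  36810180244~(§(§(§(§28165472321693452~2993739916~105428993804~2475247244~o))))))))~~(r 6610657298
  (r 188431120637955 (n 258 (10404520468~17958357941~36308541972~(r 2164 (r 1039 (n 1026 (10512942~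
  284661668302383~8940038~o))))~~10404520468~429746613340203~70892839197173~o))))~~(§(§(r
  115322093052493349030 (r 29526140682853516283256995 (n 1843 (2694~o))))~~4266281425350571761682~
  (§(§(r 447363486416277891084 (r 868339545181139232628877 (n 1026 (8831654~8834956~16695974~
  18934765~(§(§2778724~o))))))~~(r 1041563660751118354 (r 771840260022902787 (n 5523 (260~2738~
  o))))~~(§(§(§(§(§(§(§(§(§(§7246691047155885326442~7095550797655774240786~
  (§(§31301620658584587403174534~3161890077007927222275~o))))))))))))))))
def ta41 : T := (r 11214866 (r 3 (n 4110 ((r 24 (r 117 (n 258 (148892266553878~648133965930523310~(r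
  36342096414 (r 202739746432535 (n 1146 (50290330761128688~o))))~~(r 2166 (r 1039 (n 1026
  (43698481326~17489753467438~43462027284~o))))~~7682498745479441443093~465624225707680311~
  1187763463872681829909~o))))~~(r 34535632358039 (r 30106077129390 (n 4174 (239~o))))~~
  192831482708119~2239439173145170365079~7782518050888646975318674~141492582602590487~
  106932136788119~(§(§(§(§7147545744608131213446~7789578691789087377482386~423612961079447~
  106932136788119~o))))))))~~(§(r 434194 (r 172035 (n 1027 (152730857924628~(r 10545195116 (r
  47953472171820122028592685739 (n 1356 (2794~o))))~~(§(r 628 (r 4111 (n 259 (43053146758~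
  306227485395985560072036984556267523~(§o)))))~~152731294025748~196397620689209971914684957812779~
  (§o))))))~~(r 5034230026 (r 6108039715 (n 4099 ((r 3 (r 18 (n 4116 (2563~515~(§25175554~o)))))~~
  (§(r 434194 (r 8560643 (n 319 (2164~o))))~~(r 3286259868196361759406 (r 523 (n 147 (2308~2308~
  o))))~~(r 6332434 (r 10528803 (n 1807 (2274690065137966697258~o))))~~(§302425610~
  (§(§(§(§13460567822770268055194246~103253319698~(§25938016266~o)))))))))))~~(r 5034254482 (r
  248851644608062115 (n 4291 ((r 2179 (r 493559661483040204812 (n 4180 (643~2691~(§(§o))))))~~2179~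
  (r 45936451602 (r 16218165616683 (n 319 (2164~o))))~~2716977290749013959340~
  2716727798778856809132~26689094986374~62082031722~(§(§(§(§422590596294790~188257180622866~
  103253319786~1803593226~o))))))))~~(§(r 4463698066 (r 133805931114265225347 (n 1282 ((r 2810502 (r
  2983 (n 1408 (2355~(§658195150778735148381549046170035185~o)))))~~(r 10707095 (r 686 (n 5586 ((r
  2358 (n 1230 (438~o)))~~o))))~~(§(r 1197485760504413036555 (n 1026 (37289486894~
  7211537103660050293399~(§o))))~~(§(§(§(§11201158~86144934039~(§(r 5135 (n 5426 (2582646~8872566~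
  o)))~~o))))))))))~~(r 30105183003864759037309002275 (r 1822049555011385090694 (n 4352 (2691~
  (§11446930~675~2595~27304842~o)))))~~(r 148947463191187006871906034219 (r 1822051252803476318220
  (n 4180 ((r 570 (n 1807 (3147524323620933973265052~o)))~~o))))~~(§(r 1041572613610446866 (r
  2228240973073664715275 (n 1366 (2751~(§o)))))~~(r 38991741709 (r 20620211962122 (n 5140 ((n 4436
  (2731~(§2892474~2699~o)))~~o))))~~(r 25611234452139 (r 20643962724498 (n 5198
  (256216799843151315089328303443634421~115062679824022~28100224662~o))))~~(§(r 60785240350851 (r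
  115178306707602 (n 5454 (2799~2799~o))))~~(§(§(§(§(§(§(§(§118948844273042158213288093830~
  7463282294946066936297620~(§7246691047155884793874~(r 84460465512038666 (r 25018528998027 (n 3924
  (5923~(§o)))))~~(r 84874354324709522 (r 6115902101 (n 4164 (2618~260~o))))~~(§(r
  1768903931956469906 (r 11718988701827 (n 4543 (2421~o))))~~o))))))))))))))
def ta42 : T := (r 11214866 (r 3 (n 4110 ((r 24 (r 117 (n 1027 (152731296253972~35609241201371308~
  184076099209350~(r 2702 (r 156273073782075669955980830965 (n 1346 (43336329620118~43340357886126~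
  43338881327238~765228112715376774~35653213648767734~47358437653~(r 362046763358229 (n 7410 ((r
  7158 (n 6514 ((r 6926 (n 7986 ((n 4286 ((r 782 (n 4978 ((n 4146 ((n 4100 (2179~2563~6300034~2691~
  o))~~o))~~o)))~~o))~~o)))~~o)))~~(r 23549454 (n 6654 ((n 4274 ((n 1401 ((n 5746 ((n 318 ((n 4156
  ((n 6450 ((n 4100 (386~1538~386~6146~o))~~o))~~o))~~o))~~o))~~o))~~o))~~o)))~~(r 26695950 (n 5310
  ((n 1401 ((n 4412 ((n 28 ((n 1350 ((n 4406 ((n 1362 ((n 2179 (4231~4462~4374~4470~o))~~o))~~o))~~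
  o))~~o))~~o))~~o))~~o)))~~o)))~~o))))~~177508353021864108~3579847223413108458055798~
  4140142979439579850389~o))))~~2636051008003820308631~573902465579171991~(§(r 102006 (r 6373493 (n
  1026 (45341141150~247847774251126~60678302249289042038~73967759882306892983922380310~
  (§(§12788376548814966524823686~o))))))~~(§18992681402647~31543110918348115913918598~
  1870841991084984471~206912822900824064383853745717420~423591485587607~(§423612960426135~
  (§106932136788119~o))))))))~~(§(r 434194 (r 172035 (n 1027 (149982080976916~(r 45341141100 (r
  11432903338622620298068651 (n 319 (7183~o))))~~(§(r 2702 (r 8533330928843951964252399 (n 258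
  (43061011052~39387024846614255506463303703~(§(r 571333654634612847 (n 4110 ((r 751 (r 24 (n 4176
  (2051~o))))~~837274817056498582~833370313835701142~1049595870353321494~436965583550967414~
  123393691789324182~436877622619172470~50007893675636886~1734354147870275830~1881980214012044182~
  1734345351575446422~1745006214171523222~1738249852858431638~2285042317514007186~
  2197221162948831366~o)))~~43061010964~192733136732814~(§o))))))~~152731294025748~
  1178198798109459206691019656889557675~(§o))))))~~(r 1908403363583450604429581 (r
  17565295927733797130749897100 (n 4436 (2731~(§762050~(§(§(§13247162~2187~o))))))))~~(r
  2325641620998685112541867 (r 8283011942277775935871166476 (n 4160 (3~9429756050~(§15245546~3~2731~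
  o)))))~~(§(r 4296331604387516557963 (r 1046963634608410257420 (n 4160 (1231108~11217196~(§(r 3722
  (n 1087 (10493823002117957486594418~o)))~~2293~6863124~o)))))~~(§(§(§(r 106242089496180 (r
  8757878787 (n 1027 (9104014~11069614~(§3411643323740485796491~(§(§(§o))))))))~~(§(§(§(r
  435187391246970484 (r 1077522084730675203 (n 1366 (2751~(§(§o))))))~~
  495406572477050510626965861361675~2125131184490126490190965973519966359~
  (§72082277088448958249746604587~(r 119697615904616518797360816782 (r 1305602353557597780977667 (n
  5392 (4236~o))))~~(r 4288403949047859825402030 (r 420712732033183393835 (n 5198 (117~(§3702~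
  o)))))~~(§4786722566350469823766634~(§(§(§18084759655527021656711299~(§(§(§(r 1732303253599068178
  (r 579311375952814083 (n 6078 (4086~o))))~~o))))))))))))))))
def ta43 : T := (r 36148827316230 (r 106521866723351 (n 4099 ((r 11214866 (r 3 (n 4436 ((r 11247682
  (r 445059 (n 5444 ((r 258 (r 1624579 (n 4356 ((r 1026 (r 6342659 (n 4100 (2051~o))))~~(r 25174042
  (r 2051 (n 5124 (2563~o))))~~(r 27272194 (r 1549 (n 4100 (2563~o))))~~o))))~~(§(r 4727554 (r
  106384395870339 (n 4100 ((r 1581082 (r 2179 (n 4164 (2179~o))))~~(§10496131~(r 6658 (r 8399363 (n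
  4164 (162856517714426862352660111548284~o))))~~(§131~o))))))~~(r 4098 (r 643 (n 4420 ((r 258 (r
  1622531 (n 4100 (515~o))))~~(§(r 4727554 (r 106384395870339 (n 4164 (515~o))))~~o)))))~~(r
  17312002 (r 41011912835 (n 5124 ((r 1581082 (r 1622659 (n 4164 (643~o))))~~(r 3586 (r 2632195 (n
  4164 (174034843204852775908731671535484~o))))~~(r 3586 (r 60330879491 (n 5380
  (71187522069366428024607831737852~o))))~~o))))~~(§(r 79503567618 (r 1012352009644810883 (n 4420
  ((n 5188 (2563~o))~~(r 1622019 (n 5188 (203975931792769534414457241325692~o)))~~(§o)))))~~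
  o))))))~~(§ta36)))))~~(§(r 434194 (r 172035 (n 4432 ((r 11280458 (r 2691 (n 4420 ((r 258 (r
  1624579 (n 5380 ((r 1026 (r 6342659 (n 4100 (2051~o))))~~(r 4098 (r 515 (n 4100 (515~o))))~~(r
  18885634 (r 60339266051 (n 1151 (2676~o))))~~o))))~~(§(r 4727554 (r 106384395870339 (n 4100 ((r
  1581082 (r 2179 (n 4164 (2179~o))))~~(§10496131~(r 6658 (r 8399363 (n 1151 (2676~o))))~~(§131~
  o))))))~~(r 25174042 (r 2051 (n 5124 ((r 16787842 (r 10012803 (n 5188 (2691~o))))~~(§(r 14690690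
  (r 247156252354691 (n 1151 (2676~o))))~~o)))))~~(r 25698562 (r 1624195 (n 5444 ((r 4098 (r 515 (n
  4100 (515~o))))~~(r 3074 (r 515 (n 1151 (2676~o))))~~(r 3202 (r 3597 (n 1151 (2676~o))))~~o))))~~
  (§(r 113854915330 (r 106384395870339 (n 1151 (2676~o))))~~o))))))~~(r 11280682 (r 6654271619 (n
  4372 ((r 12066842 (n 4291 ((r 3062 (f 234364380932416105443201034824054))~~(r 3958 (f
  192881852565935627983451832404626))~~(r 3956 (f 211268171383484078499009176783506))~~111471970830~
  1522164~109730818188~7782284~o)))~~(r 2603 (r 476 (n 4368 (2091~2091~o))))~~(r 12067842 (r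
  435866337934844459 (n 1151 (2676~o))))~~(r 2083 (r 1066 (n 4116 ((r 3844482 (f
  181660363373380317525307489331828))~~2091~2091~o))))~~(r 4039714 (r 2269219 (n 1151
  (12367219100951989218519884~o))))~~(r 103653321002 (r 2083 (n 1151 (2676~o))))~~(r 184855436601387
  (r 25337930 (n 5140 (16894850~2603~2603~o))))~~(r 1955874 (r 45130721315 (n 1151 (2676~o))))~~
  457549346253098~(r 27436074 (r 2603 (n 1151 (2676~o))))~~16569738274~o))))~~ta37))))~~
  (§(§(§ta39))))))))~~(§(§(§(§(§(§(§(§(§(§(§(§(§(§(§(r 580437550804688902 (r 1733429428450942999 (n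
  66 ((r 271 (n 4099 ((r 606226 (r 114139479260815363 (n 6 ((r 3827775 (n 19 ((r 202723742179357 (n
  258 (2062~o)))~~(r 807 (n 1026 ((r 2606 (r 70835442360120401328884826627 (n 258 ((r 25623093 (n
  5386 ((r 24 (n 5270 ((n 4100 (547~2595~2563~24135931772318847381029541~o))~~o)))~~o)))~~o))))~~
  o)))~~(§o))))~~(r 14778708227311636 (r 1971382887 (n 1283 ((r 550 (r 49740442143 (n 1026 ((r 44 (r
  68930268173 (n 18 (26969462823~o))))~~o))))~~(r 10699282 (r 435766462764933285 (n 1027 ((r 213542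
  (r 6770221 (n 18 (6215~4070129306243068102755126988590882285623~o))))~~o))))~~(§(§526~(r 5135 (r
  18 (n 258 (10699302~o))))~~o))))))~~(§(r 7997570965607 (r 149748269713614860 (n 4372 (2691~131~
  (§4334276~2051~2437~o)))))~~(§(§(§o))))))))~~(§(r 16220279971858 (r 578222898679799357611 (n 259
  (2540052~8864364~(§(r 2164 (r 17425244783 (n 1026 (2566~2606~(§o)))))~~2540052~36174252590~
  (§o))))))~~(r 12198282 (r 11690123 (n 4226 ((r 1655047 (r 1138952 (n 4246 (2823~775~
  (§2326514937839698746303239~o)))))~~(§33816761786631~(§(§(§280792453407086~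
  (§(§(§(§(§(§(§440797024936214~o)))))))))))))))~~(r 1613842 (r 47882739715 (n 4290 ((r 1138952 (r
  263 (n 4110 ((r 2056309 (r 647192 (n 5396 (2731~o))))~~(§8428537751~(§(§(§26130595957~o))))))))~~
  (r 2015535 (r 4430002378747594816537100 (n 5396 (261~o))))~~(r 33539770212778 (r 8255463727 (n 510
  (2550~o))))~~(§(§132774286647599~280792447510286~(§(§(§(§(§(§561270857590542~19134340456814~
  o))))))))))))~~(§(r 6610657298 (r 196127702032387 (n 258 (36308435476~27594517429~(§(r 2164 (r
  1039 (n 1026 (10512942~249505077710895~(§o)))))~~168510561012262~460575891446253~(§o))))))~~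
  (§(§(§1932731618255350177810~(§(§(§(r 1041563660751118354 (r 803365457414496259 (n 5460 (156~
  (§2850~(§o))))))~~(§(§(§(§(§(§(§(§(§(§(§1932731618255350177810~(§(§(§3291017285523894083587~
  o)))))))))))))))))))))))))~~(r 271 (n 4096 ((r 11214866 (r 11231235 (n 4174 ((r 8423391349 (r
  2437430855049297610588340268 (n 5519 (183~197120018668021~56459836476207~o))))~~(r 1174200 (r 277
  (n 4110 ((r 139620247952525990 (r 117 (n 318 (2166~o))))~~(§2343471427864383531686~
  (§(§(§38230047790366180596508816~o))))))))~~1270165~(§1042127982617518726~(§4633223351~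
  (§(§(§(§(§1737942472846174342~(§19759373050102~o))))))))))))~~ta40)))~~(§(r 271 (n 4163 ta41))~~
  (§(§(§(r 271 (n 4096 ta42))~~(§(§(§(§(§(§(§o)))))))))))))))~~o)))))))))))))))
def ta44 : T := (r 188422 (r 450583 (n 22 ((r 2734 (r 31 (n 1362 ((r 2606 (r 303 (n 18 ((r 558 (r
  6479951 (n 274 (2606~o))))~~(§(r 8577582 (r 103857446991 (n 274 (2094~o))))~~o)))))~~(§(r 2285742
  (r 4907823 (n 18 ((r 2222 (r 1761359 (n 82 (2222~o))))~~(§(r 10676398 (r 56612807087 (n 82 (2222~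
  o))))~~(r 8579630 (r 103852728399 (n 82 ((r 2222 (r 30440968836859923911534763 (n 1106 ((r
  390223752734903 (n 4112 ((r 2189315 (r 11214866 (n 4207 ((n 4106 (309~1205~2591~309~o))~~o))))~~(r
  35779601027 (r 278602 (n 4194 ((n 4170 ((n 4096 (2187~2571~37273147600893810838948355~2699~o))~~
  o))~~o))))~~(r 757 (r 303154 (n 4194 (543~o))))~~66811247650955~22823961872523~118248765856721324~
  8969765677~9053229546844731951629~1066353939965815437~478624696976582188~1642816890783049763~
  118248771369485868~119935553303660076~119913014254814764~119913426169021996~112969599653~27574807~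
  1739940455896103596~445586046241323~1741627250079080844~1741627250179620882~1741233075259719754~
  30446173773021239~1732876808370046508~1732877220176799276~478624696976582188~1741321442601149996~
  1732788825959745068~1732789237771740716~118248765856720428~1741233481670927916~o)))~~o))))~~
  o))))~~(§174~o))))))~~(§(§(§(r 43730526894 (r 80241945391 (n 1106 ((r 6479951 (n 338 (2606~o)))~~
  (r 46 (r 7004463 (n 338 ((r 2606 (r 13820975 (n 18 ((r 2094 (r 308007812701080279463522709029015
  (n 4115 ((r 9054783 (r 11214866 (n 4399 ((n 4106 (309~671~2207~1077~o))~~o))))~~(r 870539 (r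
  278602 (n 4386 ((n 5402 ((n 4096 (651~2699~2571~13552219304387625634251397~o))~~o))~~o))))~~(r
  44000790693 (r 303154 (n 4160 (547~o))))~~7719305861~1886783~118248765856719788~151054581154359~
  8679170475284066306673325~346182654387333181~442587103864598060~8914915049059280734893~
  435752133277044268~435752545089039916~118248765856722476~444196788988227116~1924614680296024581~
  25479743~1739940455896103084~177986498240573~1732788825959744428~1732789237771740076~
  118248765856719788~1741233481670927276~1732868010129021100~1732868421936298156~442587103864600748~
  1741312646508132524~444273898047578508~444273898148118546~444196382577016906~1741312652413804594~
  o))))~~o))))~~o))))~~(§o)))))~~o))))))))~~(§ta26)))))~~(§(§(§(r 2382553094 (r 6677782551 (n 4099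
  ((r 11214866 (r 3 (n 4180 ta29)))~~(§(r 47043747858 (r 172035 (n 66 ((r 966804 (r
  661675970440374405 (n 1302 ((r 2606 (r 2973 (n 18 ((r 558 (r 805690132793051781 (n 274 (2606~
  o))))~~(§(r 425400102898347 (r 8577582 (n 274 (2094~o))))~~o)))))~~(§(r 10676742 (r 10170164213 (n
  262 (2054~2054~o))))~~(r 8577582 (r 12174343 (n 1046 ((r 269341633771383427 (n 274 ((r
  127443205328421037 (n 4100 (9995990939060133477182525~o)))~~2606~o)))~~2054~38~179117416931374~
  157702~o))))~~(§10875175124001286~(§(§(§(r 43729838598 (r 49880919079 (n 278 (2086~2086~o))))~~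
  (§(r 10676742 (r 182433687430125 (n 278 (2086~(§o)))))~~o))))))))))~~ta30))))~~
  (§(§(§ta35))))))))~~(§(§(§(§(§(§(§ta43))))))))))
def certOne : T := r 11165710 (r 11149323 (n 2 ((r 6 (r 23 (n 6 ((r 38 (r 417823 (n 1366 ((r 2598 (r
  295 (n 22 ((r 550 (r 6447175 (n 278 (2598~o))))~~(§(r 8544806 (r 103723196487 (n 278 (2086~o))))~~
  o)))))~~(§(r 2252966 (r 4875047 (n 1046 ((r 2214 (r 1728583 (n 86 (2214~o))))~~(§(r 10643622 (r
  134587265835683 (n 86 (2214~o))))~~(r 157862 (r 4135 (n 278 ((r 65118350728261237369531834519 (n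
  1110 ((r 27381800608659309548955661 (n 4103 ((r 9003701 (r 11247642 (n 4459 ((n 4106 (671~1085~
  2591~829~o))~~o))))~~(r 2607149 (r 401516 (n 4454 ((r 64 (n 5194 ((n 4112 (829~1085~1085~2731~
  o))~~o)))~~o))))~~(r 2199 (r 401434 (n 4416 (2083~o))))~~271548348415895691~39804594307~
  184455501334669~9324703~1631688238301997579~75139320996485~8533639309835~11421847~
  442024316047609380~442021541867834916~36451010789~2508951~1893099382135024291~1992179041962180781~
  12829213415~36886823445~1730572081704747428~1730572081030078884~508645~10600677~
  1742189669575214596~1739374919807942682~1032805~3033247~1730616072909898148~1730616072232608164~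
  109634804144021612~109634804144021530~o)))~~o)))~~o))))~~(§2214~o))))))~~(§(§(§(r 43596276390 (r
  80107694887 (n 342 ((r 71 (n 1110 (2598~o)))~~(r 38 (r 295 (n 1110 ((r 2598 (r 20082727 (n 22 ((r
  550 (r 9247323414273432733475467 (n 4103 ((r 2877485 (r 11247642 (n 5179 ((n 4106 (317~1597~317~
  2719~o))~~o))))~~(r 11789124267 (r 401516 (n 5158 ((r 64 (n 5150 ((n 4112 (317~1597~317~2731~o))~~
  o)))~~o))))~~(r 695 (r 401434 (n 4436 (2059~o))))~~127257233748224163~31098183238187~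
  6360377221163~11643437187~550824875214891555~259768692910219~17328962422855~11778171525~
  433500196057926052~433500195385354660~602533060936220717~639517~2172296708026690189~
  330257827635903~50338696702603~2844901~1730536888740633124~1730536888068061732~1551942187~8798877~
  1730616072909899428~1730616072232609444~1552425003~2738405~444836298211639684~442021548444368922~
  1730613991321247852~1730613991321247770~o))))~~o))))~~o))))~~(§o)))))~~o))))))))~~(§ta6)))))~~
  (§ta44))))
def tb0 : T := (r 14431830206553811874930303248952 (r 51272851577 (n 4153 ((r 8323572121 (n 4344 ((r
  474 (r 6880698403 (n 1447 ((r 48521191661 (n 1079 ((r 391 (n 33 ((n 234 ((n 5392 ((n 1042 ((n 5601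
  ((n 1121 ((n 376 ((n 5455 ((n 322 ((n 5510 ((n 1353 ((n 4242 ((n 1435 ((n 5512 (d~~o))~~o))~~o))~~
  o))~~o))~~o))~~o))~~o))~~o))~~o))~~o))~~o))~~(§o)))~~o)))~~o)))~~o))))~~524049583058343242288~(r
  2452 (n 246 ((r 12083685 (n 233 ((n 245 ((r 1999339 (n 1369 ((r 2363 (n 5533 ((n 1148 ((n 5537 ((n
  446 ((n 326 ((n 4226 ((n 1042 ((n 5392 ((n 1362 ((n 4440 ((n 1380 ((n 5536 (d~~o))~~o))~~o))~~
  o))~~o))~~o))~~o))~~o))~~o))~~o))~~o))~~o)))~~666~(§o))))~~o))~~o)))~~(§(§o)))))~~8364506~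
  16720346~16752898~10045338~(§(§(§(§27238874~27238874~7971074~26814450~o)))))))~~7106168~6582264~
  (§(§6789240~25659000~o))))))~~(r 3222017779394331050040 (r 210013675547263 (n 4110 ((r 3052 (f
  839218815919861567108105812906434812))~~15648278~16696854~(§(§6387830~25651094~o))))))~~(§(§(§(§(r
  6735853224080 (r 276003626262587 (n 76 ((r 2586 (r 2865 (n 264 (694~42209022320440939424701164214~
  10651166146613945006983367350~2616~o))))~~2586~10594512~20458659599854098~
  43764222353393752887695796254~10457971860730122047621304~42369055959274~43763991066~10594450~
  8978616~2194~(r 2200 (r 32708763 (n 1113 (2586~43764222136515030183670549016~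
  209652148726627083439745236830362~o))))~~45871646866~9011376~3123354~o))))~~(r 193103174797496 (r
  276415909560343 (n 77 (45879519390~(r 2590 (r 11758231 (n 265 (566~2622~3198382748402862115376~
  2616~o))))~~45879517340~2590~769569775826881170~11198622~(r 0 (f
  210603013980504065858715221772854))~~182~11201054~10608796~11201054~182~(r 0 (r 32733337 (n 1098
  (2222~2590~o))))~~12793651358~182668995002600~o))))~~(r 57560152879616271357668273784912 (r
  280401672773753 (n 4153 ((r 12550674 (f 1351242049546169319379790180353027465458))~~(§(r
  1900481432314177364377 (r 319975906909600464368976341008440 (n 6092 (16493976~6376954~14615562~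
  (§(§(§o)))))))~~28080248~29128824~(§25460728~o))))))~~(r 837805206580049807416 (r
  549051088951664761 (n 4153 ((r 1022 (f 734266220343721772226404358423439474))~~(§(r 2014 (f
  319926377476854449635966825949152))~~28080248~25682942~(§25659358~o))))))~~
  (§(§(§(§(§(§(§(§(§(§(§(§(r 27592246851373072 (r 2283749036455993403 (n 1369 ((r 11731227 (n 1288
  ((r 156499804059061024951464796859 (n 1032 (2104~o)))~~568~(§(§o)))))~~34487843655950994~
  (§(§(§(§o))))))))~~(r 790950629731959344 (r 2285437748843741207 (n 4110
  (64921817385123911859998993317194638~(§3990~(§(§(§212652799086565369058890232717294~o))))))))~~(r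
  217246020305492561277580753641552 (r 2301763434965475449 (n 4153
  (715901719104814105529482572084513728~(§4088~(§(§(§162580215573096911479133985209920~o))))))))~~(r
  2418116632 (f 12829100239061796518340688))~~o))))))))))))))))
def tb1 : T := (r 223888 (r 43 (n 13 ((r 3231260303592670920760 (r 193009757421591 (n 4153 ((r
  12345848 (r 249 (n 4217 (1784~(§1784~o)))))~~(§67753181688~(§(§(§105099264504~o))))))))~~(r
  786449469924933786 (r 50199109691 (n 73 ((r 11364892 (r 1174167 (n 4174 ((r 2702 (r 1270033 (n
  4301 (9472818~(r 376 (r 305 (n 178 ((r 11854185 (n 1352 ((n 66 ((n 1325 ((n 5529 ((n 22 ((n 5510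
  ((n 1449 ((n 5553 ((n 112 ((n 5392 ((n 1316 ((n 4242 ((n 1298 ((n 5400 (d~~o))~~o))~~o))~~o))~~
  o))~~o))~~o))~~o))~~o))~~o))~~o))~~o))~~o))~~o)))~~o))))~~7941944~1223048~1544090~7405962~
  (§(§(§(§26281904~7536936~7944594~26280200~o))))))))~~6737558~7261974~(§(§6912150~7436438~o))))))~~
  (r 47188240976 (r 49132317433 (n 5497 ((r 2752 (r 25295109464345 (n 5513 (11534650~(r 278 (r 283
  (n 182 ((r 11944199 (n 89 ((n 97 ((n 5516 ((n 48 ((n 5537 ((n 1422 ((n 1286 ((n 5506 ((n 82 ((n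
  5392 ((n 18 ((n 4256 ((n 1316 ((n 5400 (d~~o))~~o))~~o))~~o))~~o))~~o))~~o))~~o))~~o))~~o))~~o))~~
  o))~~o))~~o)))~~o))))~~11666306~14388096~5975448~56746412240~(§(§(§(§20679584~20024064~20032946~
  19991960~o))))))))~~308085825152729606~380002681693915652~(§(§13603576~14127864~o))))))~~
  51425506974171615335874159184~(r 51917180648386819376280306330 (r 15926939 (n 329
  (1405784891445685888175163548~9691177014242255756042832~2714~9700621797863010798611186~o))))~~
  1105280639437400762236958~4875175776669527408223388312~(r 11412208 (f
  50572757964012632889865912504))~~(§(§(§(§(r 3242042861046580445872 (r 548761972089115 (n 1113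
  (666~10750714776129577968806462~43754589150483871168741992594~o))))~~46542719120~193242258311320~
  46750696176~o))))))))~~(r 6736398966974 (r 50433982487 (n 5390 ((r 3519502878138966835214 (r
  7350059423 (n 4318 ((r 478 (n 1517 (98~(r 12353999 (n 109 ((r 339 (n 1487 ((n 5564 ((n 1352 ((n
  1474 ((n 5460 ((n 32 ((n 4272 ((n 1445 ((n 5558 ((n 70 ((n 100 ((n 5464 ((n 82 ((n 5522 (d~~o))~~
  o))~~o))~~o))~~o))~~o))~~o))~~o))~~o))~~o))~~o))~~o))~~o))~~o)))~~o)))~~o)))~~1960892~(r 2996 (r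
  447 (n 162 ((r 48386695367 (n 174 ((r 337 (n 1490 ((n 5575 ((n 5392 ((n 70 ((n 1336 ((n 1325 ((n
  32 ((n 5478 ((n 96 ((n 5536 ((n 1352 ((n 4260 ((n 155 ((n 5512 (d~~o))~~o))~~o))~~o))~~o))~~o))~~
  o))~~o))~~o))~~o))~~o))~~o))~~o))~~o)))~~2174802128340219882302076~o)))~~470~o))))~~1961910~
  8118750~8061224~7655350~(§(§(§(§8100278~1959870~8085800~8092086~o))))))))~~5164054~14599190~
  (§(§18967574~18967958~o))))))~~tb0))))~~(r 50736046154 (r 11182249 (n 5460 ((r 298 (n 5457 ((r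
  1122143788975249153006927856069707049134 (n 1403 (759429557730501519041711442165377264~802~(r
  47715557525 (n 1032 ((r 441 (n 312 ((r 85 (n 5581 ((n 329 ((n 1133 ((n 288 ((n 5410 ((n 1197 ((n
  5454 ((n 387 ((n 400 ((n 5525 ((n 1186 ((n 4230 ((n 1030 ((n 5396 (d~~o))~~o))~~o))~~o))~~o))~~
  o))~~o))~~o))~~o))~~o))~~o))~~o))~~o))~~o)))~~o)))~~55980295433374416962975629976~o)))~~
  185405400077701173847897963257956~(§(§(§(§(§o))))))))~~(r 1574984233423355456296 (f
  18371441211763724906106750614443423955929828))~~(§25793948522782738300152744~o))))~~(r 893218 (r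
  698915 (n 5396 ((r 12436514 (f 2537576213278745574993035062007163087997668))~~(§50954644514~
  o)))))~~(r 1653641482761855889497070017036265998946 (r 2211 (n 4116 (2012~6178~6178~o))))~~(r
  5557410 (r 151872898499107 (n 1428 (180649225465550333402471584696744~(r 801 (n 236
  (1102117945872701801007741914614926258~2992~o)))~~106804411101768668817199569117608~o))))~~(r
  6479375955176071826000402 (r 152293803172387 (n 220 (424~1749339591460725162686155315258412665658~
  2584~o))))~~(§(§(§(r 19016866 (f 2538134950388270346368474090973871022000312))~~91482632866~
  105770106050050537559179683864~o)))))))~~(r 3757729022024 (r 172201 (n 4177 ((r 5637573416 (r 163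
  (n 4112 ((r 3020 (n 231 (418~(r 209875255976271 (n 1491 ((r 1728527 (n 70 ((r 1065255 (n 1290 ((r
  401 (n 5510 ((n 144 ((n 5525 ((n 1514 ((n 72 ((n 5460 ((n 168 ((n 35 ((n 5475 ((n 1313 ((n 5378
  ((n 1288 ((n 5512 (d~~o))~~o))~~o))~~o))~~o))~~o))~~o))~~o))~~o))~~o))~~o))~~o))~~o)))~~o)))~~
  o)))~~2980~o)))~~418~898280550376486861745964875509287852~o)))~~10243618~10276394~(§(§25306666~
  6469674~o))))))~~(r 16066216 (f 10192313153603477468552692243563463353101270))~~(r 16082600 (f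
  14090588927767246703659499725188119530367958))~~(§(§134526703784~134593812648~o))))))~~(§(§(r
  278202918019146 (r 45669843113 (n 4177 ((r 199056300351690 (r 2603 (n 4369
  (14079633137895402926936901516576477025067574~6698~6696~o))))~~(r 3345848758362759266480 (f
  838910997966439186187322408065635942329060))~~(r 3790 (f
  10903466552636210469490414464291630153425078))~~28645546~28670120~32839850~7141544~o))))~~(r
  15391677403005000 (r 706904233 (n 4369 ((r 18532175018 (f
  6719152522557181078480739441220119506923478))~~(r 278643889119280 (n 4177 (3922~6314~6312~o)))~~(r
  3536 (f 4097686063083409547636287139815327623457706))~~30226984~30243368~31275560~6126120~o))))~~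
  (§(§(§(§(§(§(r 559677894735914 (r 187089448763561 (n 4116 (476~(§476~(§(§(§476~o))))))))~~
  10833218123954434183960549598341238131332~o))))))))
def tb2 : T := (r 368365154721211032 (r 2105475 (n 4100 ((r 845630177817927706 (r 45768419491 (n
  4164 ((r 65552173164111531161688441348 (r 163 (n 120 (185880873596094812955386850895956080~
  3480968445710129563734860346799492057444~o))))~~(r 7592066 (r 2179 (n 5188 (5916~o))))~~
  65571515978368263308739420678~o))))~~(r 829737870497317757181648295752640528 (r 9052707 (n 4164
  ((r 17182963018264 (f 11175064669668176259889493613217272521174780))~~32757890~33020034~o))))~~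
  (§(§(r 1133860514953789466 (r 187467447806115 (n 4164 ((r 3964 (r 163 (n 4180 ((r 3914 (f
  1266029386769960892360212512493181056813858))~~7649442~32888994~o))))~~(r 32757890 (r 2179 (n 5188
  (6012~o))))~~(r 33020034 (f 3541771508465166459523073205358320388898))~~o))))~~(r
  829621714070526019911682946861918224 (r 580921475 (n 4164 (587935071107214221848~30023361698~
  o))))~~(r 452726188157478 (r 187467445709315 (n 4164 (3362035653497878289161700334418506320159074~
  7842~6498~o))))~~(r 8516544568 (r 37079886339 (n 4164
  (11761089258860442638070848643974618095266042~6434~6404~o))))~~(§(§(r 38368382016510663062987398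
  (r 767866657080221859 (n 4164 (3964~8060~o))))~~(r 113972193277954 (r 141315 (n 4164
  (992030672747607377394775408211769303420~18133116141774854634371031193892474609350972~o))))~~
  o))))))))~~(r 16304014310002351030207110 (r 11309949059 (n 5124 ((r
  455862052763397586534025524597555206 (r 11173931 (n 4164 ((r 57930925186 (n 4436
  (6427394264759209875261923885330276925220172~6826~6818~o)))~~32757890~237354883753090~o))))~~(r
  289683101743223751777946592956399768 (r 35 (n 5188 ((r 1820 (f
  7638398217904301117688158838628707478413602))~~99271454370~16240770~o))))~~(§(§(r
  4644735147914110803974 (r 187467447675011 (n 4164 (32757890~33020034~o))))~~(r 610988054567682054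
  (r 35 (n 5188 ((r 3874 (r 178673500168867 (n 923 (322537897182105384555412399560334223108~
  983689272272611268917014572958099844796~1794~33729825091~o))))~~15872162~413163019839874~o))))~~(r
  347182188210182 (r 588329431151028355 (n 4356 (15998854409531454032887200009331514569906684~
  17442196297438132840583146929462997790893500~7676~o))))~~(r 36415180802 (f
  7648360117326425194017155467753930956984804))~~(§(§(r 16396322 (f
  17436582447843336243654030401049612688932920))~~(r 272852745988152 (f
  14844616232444148035110442391403110650599420))~~o))))))))~~(§(§(§(§(§(§(r
  25676247644444746184239750 (r 42992149123 (n 4113 ((r 86 (r 43 (n 1374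
  (933573736912628668787840142461436088~3644854425931465105662693471524~
  168142655236496418445519195180594490~o))))~~(r 424 (f
  29425964421449779286149907642651324786224080))~~144455462101656~(§(§1738280~1738280~
  (§(§(§(§(§(§1738280~25330088~o))))))))))))~~(r 25978479099348403477916294 (r 187097407824515 (n
  1353 (7880772386920~103455069912153764978489526290~(r 0 (r 5235108633 (n 1305 (9440929969~o))))~~
  (r 2232 (f 1704534191590586672854124511592417808))~~2744~(§(§(§(§3869827948169436826168~8978968~
  2426473144~2744~(§(§(§(§(§(§(§(§(§(§(§(§193145090966168~43361338008~177617173553808~2744~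
  o))))))))))))))))))))~~o))))))
def tb3 : T := (r 327445617976611343000 (r 2595 (n 5380 ((r 502658 (r 35 (n 4116 ((r 171 (n 8
  (19275690351385640727501597220~4593085441015294206911006~(r 3171267162007198083258 (f
  213286739917335355475936491315618))~~51483748894~(r 11806723408755773886333514 (r 6846750841 (n
  136 ((r 1162232840368649898259 (n 380 ((r 3366609609198848876665 (n 148 ((r 267 (n 1073 ((r 65 (n
  483 ((r 325 (n 5507 ((n 4258 ((n 5456 ((n 1470 ((n 315 ((n 5413 ((n 1046 ((n 5478 ((n 1114 ((n
  5393 ((n 1305 ((n 5513 (d~~o))~~o))~~o))~~o))~~o))~~o))~~o))~~o))~~o))~~o))~~o))~~o)))~~o)))~~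
  o)))~~o)))~~o)))~~(§o)))))~~(r 66281993216568 (f 80705801737752485654646516533674))~~
  66281993382032~239275165521026708055018342940738~273637420441348126~
  977624714952767719415414757199028650~1112027308890545432592~273804375607542296~273791228612977178~
  (§(§(§(§(§(§(§(§977685403723515911708254863792079504~847994496412788882~
  238643195619823497856237076324888~16316351100~14226986824099917225068562~197508810744098~
  273611415980935192~16310061180~o)))))))))))~~(r 172386748113512 (f
  5426562901222331377130589714286377432689276))~~(r 171834811228906 (r 45768417827 (n 4372 (1484~
  6698~1500~o))))~~(§(§136591844898~9403983132036260135056~o))))))~~(r 5884962 (r 2083 (n 4100 ((r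
  122 (r 35 (n 4116 (12863492350201868504469090143095700785481676~6186~6178~o))))~~(r 6178 (r
  45768419331 (n 5124 (4220~o))))~~505858~o))))~~(r 14664706 (r 547 (n 4372 ((r
  29635364404788269548243919504 (f 6122961217981030228095621979382794596461170))~~(r 476 (r
  45768419331 (n 4100 (6146~o))))~~(r 1484 (f 7810410960907691833549082806039425210032762))~~
  27056674~27122210~31218218~31316514~o))))~~(§(§(r 92824285730 (r 8397315 (n 268
  (6854433137544089804588467381362003509506~707817657633508752023953616025659544~
  725899417926228298875449653399751354~740302419477920738317999049609029818~
  740312561804610848324017682587330578~o))))~~(r 94434767362 (r 8397315 (n 4356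
  (4370218224940168216633937908033925759093370~122~7612~o))))~~o))))))~~(r 1559298 (r 163 (n 5380
  ((r 827742910338310170 (r 11173931 (n 5460 ((r 332 (r 169 (n 76 (820977436548243512~
  3387399544119761142430~(r 2616 (f 769920596543984964244724875470741754))~~184~(r 2744 (r
  4698743033 (n 1293 ((r 166068007674739 (n 1492 ((n 1341 ((r 209461663801387 (n 89 ((r 48588095705
  (n 26 ((r 93 (n 5392 ((n 5513 ((n 5393 ((n 34 ((n 1286 ((n 5414 ((n 96 ((n 5477 ((n 138 ((n 5504
  ((n 1443 ((n 4257 (d~~o))~~o))~~o))~~o))~~o))~~o))~~o))~~o))~~o))~~o))~~o))~~o)))~~o)))~~o)))~~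
  o))~~o)))~~o))))~~13622583915735723613905466~17328356057272~(r 2232 (f
  227987957043072176383764589279911994))~~328223097067218771998~12375750613658854350356778~
  38590324880~2232~2730128~(§(§(§(§(§(§(§(§56416018344949663543742497336~17216681091216~948535832~
  4020527800478~4203446968~26150213066896~184~11048427672~o))))))))))))~~(r 5557410 (f
  18490173698360623868536803737908006970166058))~~(r 73262610284895624760434505124098 (r 8553131 (n
  4180 (3916~6314~1884~o))))~~(§(§91482632866~133930142986195644966031376317426212~o))))))~~(r
  6016002 (r 11588534938275 (n 5124 ((r 7834960276120 (n 1399 (276033862700310974796800631128168~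
  83880266719922693723853943285370~232951281812433427662796948389926~323369987144833806304264230~
  1296821312391878012060489255648084322~o)))~~24891394~25153538~o))))~~(r 6278146 (n 4100 ((r
  33221666820 (f 21756613372513283009476716682688510825300386))~~33282050~4221791779337725731152016~
  o)))~~(§(§(r 93367315458 (r 12009461430362627 (n 4356
  (16913865512112771034076312551303399861893564~16013564255792149465246173693279036775307388~7676~
  o))))~~(r 94441057282 (r 8397315 (n 5124 (4217090908738147191081187391276024833980~
  30109242711846495252866351183945858818999932~6076~o))))~~o))))))~~(§(§tb2))
def tb4 : T := (r 53579878903182448546208079928 (r 51373506681 (n 4096 ((r 2694 (n 4297 (1190784~(r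
  1554721690 (r 2032031 (n 1497 ((r 50736242777 (n 108 ((r 15411167413 (n 103 ((n 1369 ((n 5470 ((n
  109 ((n 146 ((n 4256 ((n 1312 ((n 5413 ((n 1302 ((n 4486 ((n 1282 ((n 5250 ((n 136 ((n 5540 (d~~
  o))~~o))~~o))~~o))~~o))~~o))~~o))~~o))~~o))~~o))~~o))~~o))~~o))~~o)))~~o)))~~o))))~~(r 2870 (r 497
  (n 1497 ((r 7786438745 (n 1306 (68~(r 1728583 (n 222 ((r 198742465790255 (n 86 ((r 669 (n 5531 ((n
  5414 ((n 1509 ((n 1282 ((n 5510 ((n 66 ((n 5538 ((n 96 ((n 1353 ((n 4256 ((n 100 ((n 5192 (d~~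
  o))~~o))~~o))~~o))~~o))~~o))~~o))~~o))~~o))~~o))~~o))~~o)))~~o)))~~o)))~~o)))~~
  52702196343745007981784926518~(§40932275784933071440382781880~o)))))~~1583872~(r 384 (f
  68364877009981805442407613843368704))~~1144990106~1714432~7987456~15935384~15951768~2072960~
  16746752~8358386~16345080~(§(§(§(§(§(§(§(§7963008~7962880~7936400~26838934~2072960~7987456~
  26804730~26830832~o)))))))))))~~12468618~2050954~15615498~7294474~6332810~14723466~
  (§(§(§(§25208330~25208330~6332802~25207178~o))))))))~~(§(§(§(§(r 13250977093813982044848306 (r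
  276141031653403 (n 88 ((r 2337296 (r 2867 (n 265 (10616606357339886592967386~730~
  11192528891899918033528939226~2618~o))))~~2645435290441241846322~10712842864101558466060432~
  190224514883760~4759288912402711139865190576~736009864935306913239804389750147312~
  2487036926387471843633342~43931861528~723122~177023797142074~9150654~(r 2226 (r 32716953 (n 344
  (2200~182884044765840081520~o))))~~9150640~12401764510595939631333616~9117872~o))))~~(r
  14168923140453093875498321970 (r 1134450815485388855 (n 4126 ((r 12280336 (f
  19494036108113517414013985186260))~~(§(r 1187958011319198545468644102202482738 (f
  3541259405426115426664814275383692837292))~~28104758~29153334~(§33347638~o))))))~~(r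
  3169007425550263847056 (r 2345733890898274001017 (n 4153 (3046~(§4056~6264~6264~(§6264~o))))))~~(r
  53579878843222498511650086968 (r 280813956071545 (n 73 (10971286~10971382~10971382~(r 2678 (r
  12020473 (n 266 (167498945761742337183373909525176~2672~9983715189402945550779088~2584~o))))~~
  183655319145138~(r 2294 (f 47857575096596142640780433582710))~~(r 2198 (r 16195739 (n 1342
  (43427914431630324639132260360438~o))))~~616592~1009816~1009808~10971288~616600~1009808~616600~(r
  2200 (r 32995481 (n 1150 (2678~o))))~~o))))~~(§(§(§(§(§(§(§(§(§(§(§(§(r 13250977258575283894821048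
  (r 2284311848936898587 (n 1369 ((r 11739417 (n 265 (2072~o)))~~186~2590244018662339523650192~152~
  (§(§(§(§o))))))))~~(r 53773332262550690857849815100 (r 2278288252201009207 (n 4126
  (229288841264237966609319188229833654~(§4022~(§(§(§168769807370024037148404463001516~o))))))))~~
  12980254415053840042788880~(r 53734621313361404858024427568 (r 2303452147353223289 (n 1406 ((r
  12020473 (n 318 (2166~o)))~~(§(§o))))))~~o))))))))))))))))
def tb5 : T := (r 3235856037072205029434 (r 186505107570809 (n 4153 ((r 171970595357348 (r 249 (n
  4217 (1734~(§1734~o)))))~~(§1136630599271286948~(§(§(§8481375864~o))))))))~~(r 45197910168 (r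
  50232655899 (n 89 ((r 192870844351154 (r 11788983 (n 4190 ((r 437633641547314588475578 (r
  5336293681 (n 4316 (11709202~(r 472 (r 273 (n 1426 ((r 11591975 (n 163 ((r 2379 (n 1368 ((n 162
  ((n 5440 ((n 5513 ((n 1449 ((n 1312 ((n 4512 ((n 5526 ((n 1290 ((n 1316 ((n 4226 ((n 2 ((n 5384
  (d~~o))~~o))~~o))~~o))~~o))~~o))~~o))~~o))~~o))~~o))~~o))~~o))~~o)))~~o)))~~o))))~~16459544~
  9478568~1937330~7536938~(§(§(§(§26314520~8061322~8067506~8069546~o))))))))~~14993078~7655094~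
  (§(§25913014~25913142~o))))))~~(r 11389552 (r 1376985 (n 5481 ((r 9212111503560 (r 1417529 (n 5577
  (11537178~(r 2870 (r 315 (n 1446 ((r 11813159 (n 1353 ((n 1376 ((n 5532 ((n 32 ((n 5537 ((n 158
  ((n 22 ((n 5522 ((n 1346 ((n 5376 ((n 1282 ((n 4256 ((n 1316 ((n 5384 (d~~o))~~o))~~o))~~o))~~
  o))~~o))~~o))~~o))~~o))~~o))~~o))~~o))~~o))~~o)))~~o))))~~11545370~5475104~6007570~11759024~
  (§(§(§(§11537178~20548512~14355218~14259088~o))))))))~~317166775664757284~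
  15593409003011664626469528~(§(§19762392~19762520~o))))))~~273529154297270202073245758~(r
  2852907200211595712299672 (r 15935129 (n 344 (2744~709471985240776143127552210~
  13939588297051045705447973084~2712~o))))~~44383039281750274905830304432~1039075848602448231827568~
  (r 764600 (f 954783343472922566158928))~~(§(§(§(§(r 3205140365699369763480 (r 548899377479961 (n
  344 (2234~2234~o))))~~192829840885944~46649803448~11677714616~o))))))))~~(r
  220308297235637723646266041327666 (r 50433982519 (n 4126 ((r 239322798171168540846220374155310 (r
  7249584535 (n 4302 ((r 1016 (n 1210 ((r 48856719687 (n 189 ((r 2803 (n 1313 ((n 1503 ((n 5545 ((n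
  1368 ((n 4256 ((n 32 ((n 5380 ((n 1490 ((n 5542 ((n 70 ((n 100 ((n 4168 ((n 66 ((n 5506 (d~~o))~~
  o))~~o))~~o))~~o))~~o))~~o))~~o))~~o))~~o))~~o))~~o))~~o))~~o)))~~o)))~~
  43486198040164152043111408272~o)))~~2091932~(r 2964 (r 1638815 (n 178 ((r 48923435239 (n 1406 ((r
  11995569 (n 1286 ((n 5591 ((n 5379 ((n 86 ((n 1320 ((n 1325 ((n 32 ((n 5478 ((n 96 ((n 4272 ((n 88
  ((n 4260 ((n 139 ((n 4488 (d~~o))~~o))~~o))~~o))~~o))~~o))~~o))~~o))~~o))~~o))~~o))~~o))~~o))~~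
  o)))~~o)))~~470~o))))~~7963128~7987710~7930120~16172950~(§(§(§(§26838936~26829310~26804616~
  26830742~o))))))))~~5035851701937602261071783451247872548908~(r 1974 (f
  17434695725239375871648139626924))~~(§(§6518838~8091702~o))))))~~(r 53785742537904710998821142586
  (r 716698523531324025 (n 4153 ((r 3070 (r 34788969294355 (n 1509 ((r 126695082446331931 (n 96
  (807640811930577166530~o)))~~o))))~~(r 3704 (n 886 (1600~o)))~~10380920~(§(§6789240~6789240~
  o))))))~~tb4
def tb6 : T := (r 50400337926 (r 11051171 (n 4436 ((r 102767998949977328808127324144371912 (r 131 (n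
  4164 ((r 24507553303180 (n 128 ((r 299 (n 1456 ((r 1474753 (n 50 ((r 101 (n 126 ((r 2841 (n 1302
  ((n 5477 ((n 169 ((n 1289 ((n 4233 ((n 1434 ((n 5520 ((n 1056 ((n 5376 ((n 10 ((n 5414 ((n 1443
  ((n 5537 (d~~o))~~o))~~o))~~o))~~o))~~o))~~o))~~o))~~o))~~o))~~o))~~o))~~o)))~~o)))~~o)))~~2160~
  (§(§o)))))~~874~(§874~o))))~~7753354~16238210~(§(§6830218~6830210~o))))))~~(r 186249154110210 (r
  2179 (n 4180 ((r 1754 (f 1143558904682965592124429381601377989676868))~~7592066~7190690~o))))~~(r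
  26551562244607127079288971314 (r 643 (n 1476 (52492529487719975925425723001754~
  11947901702785135082114014366628~o))))~~(r 28563586 (r 141435599333539 (n 5204
  (14774077607550481309372552283442215881287898~3714~3746~o))))~~(r 28694690 (r 534691 (n 104
  (2881331513331535855094962362449919617592~276528334356157193719353316024513739588~o))))~~
  125588481154~126125483170~o))))~~(r 371618 (r 163 (n 5460 ((r 21715970304644 (r 565251 (n 4100 ((r
  3044 (n 243 ((r 207126644703557 (n 192 ((r 299 (n 1508 ((r 65 (n 96 ((r 361 (n 1325 ((r 441 (n
  5520 ((n 5537 ((n 1515 ((n 72 ((n 5440 ((n 139 ((n 50 ((n 5494 ((n 1302 ((n 5413 ((n 1289 ((n 5513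
  (d~~o))~~o))~~o))~~o))~~o))~~o))~~o))~~o))~~o))~~o))~~o))~~o)))~~o)))~~o)))~~3050~o)))~~o)))~~394~
  394~42350434132068844659620221864930~o)))~~2016770~10372610~(§(§25208322~6305794~o))))))~~(r
  50546092802 (f 1342707221961074295017315275644638674429212))~~(r 1581942472693547821746 (n 4180
  (1820~6274~6306~o)))~~(§(§207062567627522~2254151383758120264805042~o))))))~~(§(§(r
  276827857231878 (r 45267165347 (n 4372 ((r 54702793222 (r 2179 (n 4180
  (11977977573115866639332069735460845294723290~6274~6306~o))))~~(r 226089595775512 (r 8921603 (n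
  1394 (256271590199359227401681261363274~154379494269129052372545738915876~
  192894284771047735426348331655772~o))))~~(r 3034 (f
  14376117350847912072940766195923964879717442))~~30136834~29743778~31185410~4045346~o))))~~(r
  25502210240686768 (r 2236579 (n 4436 ((r 665655482818504740 (f
  15487088173696565737524381862297580924364740))~~(r 97954850711281714 (f
  10772699116553249611281105637881400025960028))~~(§(§(r 1314 (f
  14330239588674515319689092921959101817278428))~~(r 3362 (n 683
  (4844144303478293896609127114033903134966~2751731113197482411628334147902887019354~o)))~~28432546~
  26598050~(§(§5257858~5388962~o))))))))~~(§(§(§(§(§(§(r 556181661819298 (r 185440080634019 (n 24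
  (231579044524868346874729390416691742~(§59621975364458079984368510247474~
  (§(§(§580579020324668500204423218~o))))))))~~(r 6191791089186 (r 34932400291 (n 4075 (60~o))))~~
  o))))))))
def tb7 : T := (r 46540120248 (r 1802641 (n 4301 ((r 2067226 (r 10526739 (n 136 (2712~
  6463213401061705837604154006~43617698917297516634310865806008~
  (§708143073345900561713771132625789238~o)))))~~(r 7402020094925502515638870320 (n 4116
  (46205217432~(r 12222850 (r 131 (n 1353 ((r 313 (n 1030 ((r 192150975703993 (n 1390 (38~(r 893 (n
  1377 ((n 62 ((n 5580 ((n 4150 ((n 1306 ((n 4192 ((n 172 ((n 4249 ((n 160 ((n 82 ((n 5184 ((n 1408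
  ((n 5284 (d~~o))~~o))~~o))~~o))~~o))~~o))~~o))~~o))~~o))~~o))~~o))~~o))~~o)))~~o)))~~900~o)))~~
  o))))~~(r 2114 (r 411 (n 1353 ((r 313 (n 401 ((r 289 (n 1511 ((r 1425767 (n 5525 ((n 1494 ((n 169
  ((n 1324 ((n 5384 ((n 2 ((n 5558 ((n 1090 ((n 5456 ((n 98 ((n 5376 ((n 292 ((n 5480 (d~~o))~~o))~~
  o))~~o))~~o))~~o))~~o))~~o))~~o))~~o))~~o))~~o))~~o)))~~o)))~~o)))~~o))))~~25804122768~15343810~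
  26351927682~273954~(§(§(§(§25404986~6535330~25274298~25404962~o)))))))~~6051408778~
  54284925332508425694181787930~(r 16213912 (r 913 (n 249 (153873596915395171143405551659602~o))))~~
  271062142189834~271474426028296~(§(§(§(§135198742928~135265851792~134896761234~134997416336~
  o))))))))~~(r 10834234172521402085878576 (r 30243291357239 (n 4126 (1885750~(§8091702~o)))))~~(r
  3600932914 (f 2879831681477544033452862175693943122632))~~(r 238956277684976349406605363847832 (r
  256762574383651 (n 284 (939395856528701850288105767078978206~(r 82 (f
  26501939622199397348520225079882))~~188895688913555885382730810286768~(r 3998504 (f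
  56925564341509691336135246782538))~~67257855845290~146422592768696~814629308725895250~(r 2704 (f
  46232263649535105221546123338))~~55992356331849203997842563632~82~82~4006826~4006826~82~82~o))))~~
  (r 851337984000221234 (r 63323602999 (n 5150 ((r 2508 (f
  1135993468021941307731852508058097641038))~~10276918~10276918~o))))~~(r 263461027940991570 (f
  3815088967478480846296060103205978048744))~~832934394228350382851903130123313318~(r
  10682028279012560348479640 (r 276141031784849 (n 32 ((r 2771 (n 5436 (1002~o)))~~
  41906384815299061716456121288~40817180541400783796578975826~2598018920914065417865802~o))))~~(r
  554191147528587319 (r 130620367313275064 (n 4126 (7359290051061526008760867~o))))~~(r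
  2709959618048339673104 (r 278340591911001 (n 109 (219652420182457223880~2995480965505920314088~
  822~o))))~~(r 450075225164079543 (r 3115830640878521835704 (n 5150 ((r 4052 (f
  843273996259885807612053515931544528))~~o))))~~(§(§(§(§(§(§(§(§(r 190628340269592 (r
  426088942119459 (n 1049 ((r 2302616 (r 9031424789155523766795 (n 1358 (55~47~127~o))))~~
  379000465307587519128~11305200~199012957718578~7259981968~762967066541787186~21344546400432~2352~
  8978157005299102682460612658~9267920~12388402~41475049624~20930055317656~41508604208~44300994610~
  o))))~~(r 8985750570756496106403234352 (r 540376014356535 (n 4126 (172381572525622~(§7749337014~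
  o)))))~~3520423358515856169593766456~208744711135031345678450591760616~(r 96266512612558864 (r
  2284311848937030033 (n 1377 (79~2771~o))))~~8889579195179619409975~(r 348199784357931163824 (f
  3432839707340010514812870610389806916562))~~8927778412758749798455~o))))))))
def tb8 : T := (r 2898 (r 1278225 (n 4180 ((r 11283002 (f
  3498556196843495306692901458524157149374))~~(r 3206294522626 (r 3 (n 108 ((r 75 (n 50 ((r 103 (n
  1289 ((n 1366 ((r 2397 (n 5526 ((n 1445 ((n 5430 ((n 42 ((n 5408 ((n 1298 ((n 5376 ((n 132 ((n
  4516 ((n 168 ((n 5440 ((n 74 ((n 5513 (d~~o))~~o))~~o))~~o))~~o))~~o))~~o))~~o))~~o))~~o))~~o))~~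
  o))~~o)))~~o))~~o)))~~(r 10824687 (n 172 (347~o)))~~o)))~~2762~2191812220200808335632920~
  9738474963090785274593994~(§3910246399835615397316712~o)))))~~(r 3050728443735161768598 (r 155 (n
  1424 ((r 289 (n 226 ((r 12511829 (n 1305 ((n 1325 ((n 5604 ((n 1490 ((n 5376 ((n 36 ((n 4136 ((n
  70 ((n 5525 ((n 424 ((n 5513 ((n 1446 ((n 4230 ((n 66 ((n 5448 (d~~o))~~o))~~o))~~o))~~o))~~o))~~
  o))~~o))~~o))~~o))~~o))~~o))~~o))~~o))~~o)))~~o)))~~o))))~~(r 7065090 (f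
  784955409505225744064699991170599856938))~~250992421570618~209713167255720024595922852940034~
  8899399407053373318390344~(§(§(§(§129325742242~1535256226~133218154682~134310766266~o))))))))~~(r
  12646885554202082976260152 (r 21445051375799 (n 4190 (1363766~(§7043382~o)))))~~(r 189805619781688
  (f 46951634789544420818757994324306))~~(r 3966887005474615940817432 (r 1015679501602433699 (n 1372
  (4600555925476615272393406~(r 210 (f 34071335100107694820224672770256))~~
  181132031968164400476307247557310~(r 3484456 (f 3214449838626024451027937482))~~58459608490290~
  3527084688~1123724823404783380670~(r 690 (f 9091908712758536620567259346))~~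
  18843877070743068802953194160~44394940626~136046581597315213880~48623717160~199162779052190~
  56087218391280~943869067344475236562~o))))~~(r 56029367298207186334861814320 (r 63323603127 (n
  4190 ((r 2380 (f 3974997953547768454463330197846719948460))~~1366198~1366198~o))))~~(r
  207807798536906 (f 204483969340751720863131270254864536))~~18116738844281185513280528562~(r
  12498130320761770868277680 (r 267347085721873 (n 1376 ((r 2643 (n 5500 (874~o)))~~338~o))))~~(r
  1094491125480253751 (r 12646885556286481415440816 (n 4190 (3072267088549441696311851~o))))~~(r
  34111403113419007884208690102512 (f 908706658800742132849270627987786710))~~(r 11315378 (r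
  1062415208591624375 (n 1424 (4450996477670778024034642~o))))~~(§(§(§(§(§(§(§(§(r
  815333364801307160 (r 131860629017 (n 4180 ((r 90 (f 625707527967891661801262800436160342722))~~
  3142323119482438302374521120130123499576~1428162~15443618~15443618~15443618~15443618~
  (§(§(§(§25830914~6436898~25831042~25831074~o))))))))~~(r 815333399054090418 (r 531092562632887 (n
  4190 (7130806~(§7526604~o)))))~~3486436322538158753968~189840642220728~(r 5679809202 (r
  2248291850158047505 (n 1424 (33144741575425721437978930113~o))))~~9206699264499655082167~(r
  46341499056 (f 3499332415394325836860716801736343497514))~~3184565255692190154930~o))))))))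
def tb9 : T := (r 278615201316936 (r 2261161 (n 4433 ((r 296 (r 2718474283 (n 4369 ((r 3538 (n 13
  (11313330~320767416201149372578501111784120~390682770030943887922~8634102727671864~46339293232~
  77326821637688617054016996182578~410548168860721330~2107933558992~46340833360~671601406215659672~
  (r 338 (f 46154172875421974546692015024))~~189846413443120~189805745211928~
  320625436892827729865672228965042~851786610520449202~2107931459640~46347157552~163965185393456~
  5682954802~8634095849013328~189805755466320~815790486761079320~37447476272~8634089408102480~
  189839973122096~2096347415096~94851984334619192~35365115342526939192~777576274982961208~o)))~~(r
  31275560 (f 14719991294404556533472122356974145240345290))~~8806109734088919386920~o))))~~(r 296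
  (n 4369 ((r 280199498536468134434915851272936 (r 46875845632043 (n 736
  (1302661081105813212874286918633434026~940010467612798960632907057342508074~
  1008403804947591476101754993457994984874~3729821588209165662587994736252737072074~
  3729992243294372113402913840726414109258~941796468188837733542081994883902506~3114~o))))~~
  942357722321713498210044864692322504~605200850777122725541390637105304~o)))~~(§(§(r 3370 (r
  11868276865009833 (n 4177 (32848040~32864424~o))))~~(r 1192 (n 5201 ((r 3922 (r 46869401608235 (n
  269 (505841866~43389618617~7383616055~38815387449105410018406467632~5848257235597002661232688~
  3998874574358936739294898~18123655735~1539030454991868823576~229331691391548843723495043400376~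
  5408296~5465640~19119227048289139176309352~307566948414492873352782276887192~
  148331020425241177279963190733328~25803720651574041669154201778~8627354898047024~
  5699502679145469530505272~984690105570977974840~238826474206464536~2104937250896~
  127900578254215388643794149245008~1206~1427692533972532750864~1734387656589880~
  158948222619575345982654227440184~10715832~10715832~43220435608~9532181008~o))))~~(r 24457384 (f
  17847169485480627165747029181011893404469450))~~(r 410563054832424 (n 4177
  (11321588024165275702182776907907118195358034~o)))~~o)))~~(r 28653736 (r 768437821290752169 (n
  4369 (3538~2907487567951004662483051954726051623812178~7638~o))))~~(r 28670120 (r 2217 (n 4369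
  (3538~7634~35318002829525221232215527788714483234733142~o))))~~(§(§(r 5421736 (f
  10922031015032544316456937540343072509738320))~~(r 30767784 (r 2729 (n 657
  (3583170254480625852854131320411006527958~(r 135970088367 (n 3502 (7382~o)))~~o))))~~o))))))))~~
  (§(§(§(§(§(§(r 559892614250920 (r 2371495297193 (n 4096 ((r 2786 (f
  44343873599294896629250614403499866732912868))~~(r 2946 (f
  2534479408505782757930131408985677174819426))~~(r 3060 (r 565251 (n 448
  (10304213223613580799158898609503325986866~8223287294024778988177016403335120857588~
  59743549790329150862793166878583178~3204035989034356628171146~o))))~~(§(§(r 4068 (f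
  14724124365134341650114012289338426525786498))~~(r 4084 (f
  11801611752595636035379574266450487921387914))~~(§(§(§(§(§(§(r 8164 (f
  14767680508128313028847204630789974518151170))~~(r 2346801561083194845840 (f
  792833337881249284411263654454639716794260))~~o))))))))))))~~(r 2294446047878611016 (r 35033088169
  (n 5457 ((r 389691975363047099056 (r 2718474283 (n 1376
  (10780315379733630089489316655373210034286~10323421192045780959487710965200164520234~o))))~~(r 296
  (n 4369 ((r 3538 (f 1978768113684060374324773275827815359286))~~(r 3542 (n 5137 (6098~o)))~~
  147676742706079470627135750344~o)))~~(§(§(r 1322 (f 2613477234524270886843154167605484659402))~~(r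
  3368 (n 4177 (3591601996181126043742878253490362951506~8018~o)))~~
  (§(§(§(§(§(§4774431507261678354402830864~25191601428103550050787992~o))))))))))))~~o))))))
def tb10 : T := (r 50836701256 (r 169 (n 5457 ((r 296 (r 2718474283 (n 93 ((r 168529881521752816 (r
  10821721 (n 13 ((r 30 (r 10592657 (n 73 (10796664012815439207355638066~o))))~~(r 150 (r
  190780669421969 (n 1054 (38~447~o))))~~(r 30 (f 2220266887612205735553270))~~
  2030971117573979400561392~514263280~547441766451112439~(§(§(§(§506005520~
  8318819954830856847050082416~36240982160~4034986520~o))))))))~~(r 3295893554035784624744 (r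
  191179071905975 (n 4190 (1718~(§1718~o)))))~~tb8))))~~(r 5581992 (r 152431109906987 (n 4177 ((r
  65872232744 (r 171 (n 4416 ((r 2786 (f 5305276759834936471661462077831221706302802))~~11545314~
  959883861966948368~12593890~960050966265168560~11545314~3615978~28203018~28268554~3553930~3586186~
  5159434~5159434~3586698~5159562~o))))~~(r 6314 (f 18555797524807411450993267282912527256980170))~~
  32864424~o))))~~(r 4883240 (n 4177 ((r 16064808 (r 46869401608235 (n 89 (49935706532424~
  1103446233525725800~199562444353634606633195283973032~269423802524080~2460574912830069375544~
  234233323389360~66046443624876816732328461488~4639485752835137251403954~93906610325706~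
  12189294770~3742436691409209294904~31412412594~178~229995847882311435826124720646672~
  18512661232225894566813874~25270~10627785501394979758203496~5923669346888~
  18514764375473028197835184~163976853520528~269383335346840~346779296016171544~517978281573319352~
  816846355950699696~15401138~7679664~31422349490~9142968~1058404599671234800~o))))~~(r 32848040 (f
  3266300754462717853860728700692897258438834))~~(r 7698600 (r 2217 (n 5201 (5970~o))))~~o)))~~
  (§(§(r 91583320744 (r 185448811627177 (n 4433 (14715397482451105704391899723985245826758994~
  12452519956157997846142821287614179966286166~7510~o))))~~(r 152956469216746180289774948230400528
  (r 9077417 (n 1282 (1560525275536737670069120518599270566~(r 205333867326375 (n 70 (2734~o)))~~(r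
  418191 (n 22 (134~134~o)))~~683206536054334346420546278248343718~
  (§171713078741741556180989784548006~o)))))~~o))))))~~(§(§(r 67954180520 (r 572686505 (n 5457 ((r
  16 (r 2603 (n 4369 ((r 3542 (r 555 (n 4096 (483082840649496653126850732961727210~
  56068024646216791438318471694~(r 4667300480398355898392 (r 45667590283 (n 4416
  (4139879072247940762602000~3583106~12496733760148424835107480~3586178~3586186~3586698~3586698~
  o))))~~13689700658076012779684456~56063833376989312540253522584~
  774472918738720149544628093353362120~(r 132775399678026 (f
  13678565074134659271986441052137242917940042))~~28203018~28268554~29251594~29317130~32397322~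
  32462858~33445898~33511434~o))))~~(r 31275560 (f 8102441686480542674407938101796265354635978))~~
  10153512722145364653760707303969680949392~o))))~~(r 10657963 (n 4369 ((r 3542 (r 555 (n 93
  (14707221007080~4038659985846693068850~19013759454330597379284206002~(r 5647753264 (f
  189384103095425178916458364833746))~~190633038774320~239471886407162935723918540604970~
  19013607786039061427844753968~26806~240830059470898~310~3641022411600946719384~2358~
  51802500690312199298563866864~77840790582890067331350840683152~19116631309030139529093170~
  423968973032~3106751390489373730872~310~663741532144724624~310~40099315864~12507054539824~
  119929643963974200~14767482438200~847479344~310~5740628120~310~176336965175472~o))))~~(r 31275560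
  (f 3432026323635418761856745897032506939843382))~~(r 31291944 (f
  3049471727536503161145590955710140418358))~~o)))~~(§(§(r 90712504819728 (r 10660011 (n 9
  (380411986~142540178784931~7383613495~185407163138067~49761714577~(§(§(§(§815856799782764696~
  234377313462456~6382296043325592~2019623313~467946118391819~114882084919~423906997927955~
  115821609081~239255283676285464~7383613495~150497484113248336~103482360209~
  (§(§(§(§923802394394042520~12679548969528~26141716917260484690~777444339893995536~o))))))))))))~~
  (r 780813669125794448 (r 11452713129 (n 4177 ((r 6312 (f
  11238400071112113104244076192561446914965330))~~551324173893928~o))))~~(r 4778 (r 2271785 (n 4177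
  ((r 6998 (f 14763256894242682611102152757143684534020810))~~(r 8018 (f
  12449603174768133109164720060047610642475722))~~(r 8022 (f
  10017456804588889532000224034524214664145610))~~o))))~~(r 4264 (r 9303665193 (n 5393
  (10901912084110613083977585568178706897340432~20788264~98235904863489555976693648016~o))))~~(§(§(r
  7254964849629814965697544821641232714472 (r 732550320619686057 (n 5201 (1878~5974~o))))~~(r
  3199152263642667494032 (f 11793708992513746582251815680439893219782186))~~o))))))))~~tb9))
def tb11 : T := (r 11280458 (r 2697 (n 5440 ((r 14443639228858579191660810 (r 137 (n 5441 ((r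
  56522720297626 (n 130 ((r 1073453 (n 1302 ((r 12337223 (n 1425 ((r 299 (n 282 ((r 209 (n 1033 ((n
  99 ((n 5393 ((n 330 ((n 5481 ((n 1312 ((n 5532 ((n 169 ((n 4260 ((n 1182 ((n 5413 ((n 1286 ((n
  5510 (d~~o))~~o))~~o))~~o))~~o))~~o))~~o))~~o))~~o))~~o))~~o))~~o))~~o)))~~o)))~~o)))~~o)))~~2856~
  210751284057248258723418616548084~(§(§(§o))))))~~5336232~5729416~(§(§13275816~19434632~o))))))~~(r
  1340756195144176841682765013313954291778 (f 12012319294116110883456204056616789968725234))~~(r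
  5721226 (r 649 (n 4160 (18743242615237451440154412657227838886316036~32970890~2266629857037527786~
  o))))~~(§(§(r 824160873017953416 (f 2701212659728120750913812699965894403967592))~~
  106231318896834518912214837412~o))))))~~(r 332 (r 11045419 (n 4116 ((r 134009028705659586 (r 43 (n
  5392 (14492712~14500906~(§(§19049514~12759594~o))))))~~(r 229206082270906706744045101392006 (f
  10824821913751067214705346197226611973007996))~~5397604383242593373075230602973365936260~
  (§(§2641810211754746972473377140429824038~8011261474~o))))))~~(r 202904591016130 (n 5396 ((r
  34272833145360 (n 1368 (79868723546235953970298177028346~(r 45232652571 (n 25 ((r 12148759 (n 90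
  (2823~o)))~~o)))~~239279496403336674806967250960536~612285438969277540755649041417893947546~
  (§462720670547728910215698287227910595226~o))))~~415491340169349656~422246739476195856~
  (§(§93635882018~50948354594~o)))))~~(r 63424340042 (r 45242032803 (n 4160 ((r 266 (r 45804036233
  (n 4161 ((r 78451392095898244 (f 19928275553033212482123615497516005578672866))~~
  599131129890646725778914484023765636~7965288404030334016325858~28539016~28801160~6912136~7403656~
  o))))~~(r 3952 (f 2702623660556003882240276134706329130772104))~~(r 3956 (f
  14670738429628631719181110864103277840223882))~~28776586~28792970~32970890~32987274~o))))~~(r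
  63826960450 (r 172579 (n 5396 ((r 1058 (r 36643701387 (n 7 (11313708~
  301284624692930848095990385920132~14831302473075344462692908~4358069185219670854188~46339219494~
  59150607841063939755771438124~(r 1100 (f 5024643444143892304296457534916670800446))~~
  33927439085035080971465015462~46338949638~15472939858528137615262244~3778005669588503118372~
  8634054746325060~189811885891622~354381561505405410913426622967367812~3617938758451920486956~
  4358069185219670336076~46347083814~15432799908187109241539078~9330903588~8634086959104036~
  189837655695398~10109494420088945916273318~3777996691382861325348~8634089072508966~
  189837657268262~922114119715807782~225127799341604~35365220182376603716~777575044171194406~o))))~~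
  (r 3532 (f 8867113151618212697933282255295705554258850))~~(r 3548 (f
  14670915826198138917800416309335855858428834))~~21287586~(r 4770 (f
  3464878057107709795699365935252439390663746))~~22860322~22925858~o))))~~(r
  5206128016179273716652872601585779753496 (f 10127489970339402860703763594678261656789994))~~(r
  611443354846651968127404730657292312 (r 675 (n 1276 (5227075534909550300130483546397649838842~
  5227075534946929663653284098021127504540~981643976202263374436721265924485588700~
  704990772693666208538268217200517648~o))))~~(§(§(§(§(r 132143822890 (f
  13872052042054883745367027131586227980650722))~~(r 132565313058 (r 713171491 (n 40 (2712~2786~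
  2664~209710659500161246786622803850059452~o))))~~43624364940652112261851380480941460102906500~
  10671913492538997799454388302510643314820~o))))
def tb12 : T := (r 68485846114842 (r 14755513 (n 1293 ((r 11034686 (r 12708375 (n 267
  (8097821230725904157837969~(§(r 78908193615513 (f 1006052419837872260292507708866864117))~~
  30104091~11504858602010375376071194~(§256748070085634586~o))))))~~(r 17164753481984841412149881 (n
  5185 (196444969730738~5368952583050125007323283~12718115432~o)))~~9630769798~(§(§(r 17123869240 (r
  25513527929 (n 1328 (2954~o))))~~42366063051416~(r 696 (r 21729811 (n 265
  (589000786978054768863772~59344326795009868595327863408~(§7776389986592585035301685872~o)))))~~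
  197780600942305816~3205290693731821940048536~44705096216~(§(§210848276949896~
  2561919154654161647798840~o))))))))~~(r 484 (r 63323602967 (n 265 ((r 712758011036428316 (r
  13313049 (n 12 (5073664438636412190337065~(§(r 1661 (f 254828685575438359608579504155125))~~
  131894192151~829823005277692606~(§2546~o))))))~~449875278239343225~10879154050851390~
  (§(§12675293640143419134806584~62124287658600~174013186288146~49443113785474316195850209816~
  259563678943609448~42333087826616~(§(§43715127247512~752143475679888264~o))))))))~~(r
  280518034148524696 (r 72117837260387934534734717049 (n 5185 ((r 2858 (r 2291 (n 92 ((r 2099 (n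
  4164 (49444083952397974836891339370~o)))~~o))))~~143009678568810992~4146823503011219375147280~
  7022218~616072~265031830677130~6909576~20099216~9007752~19968240~9400464~17378952~9006728~
  17337994~17763976~o))))~~(r 863591760986343960 (r 116472811053183 (n 5177 ((r 472 (f
  964060366991225479549980040344521312))~~27357782208~16770654~19689592~10326142~17569406~16773240~
  o))))~~(§(§(r 4704259282627142522833000 (r 280401672765561 (n 4297 ((r 48966812060 (n 1476
  (57062989436259761714880751992~o)))~~(r 3878 (f 178959862352914856573748504962168121784))~~(r 3942
  (f 28366897850188457526485793122206))~~1956403342995341830~482043064058270~32668056~32930200~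
  o))))~~(r 174995087655440 (r 1017390240157395353 (n 1533 (3099~o))))~~(§(§(§(§(§(§(§(§(r
  8390663275034 (r 129176929977 (n 265 ((r 8464568 (r 3091 (n 1532 (12555220654217256604470152~
  12552497453060462894582386~(§(§o))))))~~511781048~42368647268370~568~(§(§2720312~664~43989985306~
  183766224175800~568~(§(§2327192~568~o))))))))~~(r 243074170877891425442264288133158 (r
  36350635542844932070926371 (n 1114 (670~670~(§o)))))~~(r 36987478375804742213443705 (r
  202550012615950771474270374658104 (n 5444 ((r 2346 (f 241178469518908906907920421716584))~~(r
  1289098 (n 5140 (3020~o)))~~59357561975775470329851379946~o))))~~(r 942246040 (r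
  2193369535053521017 (n 4217 (3782~(§7878~o)))))~~(§(§(r 2301763434965467257 (r 142999734471165976
  (n 5456 (856812899103001254~(r 2762 (n 504 (2554~o)))~~(§(§o))))))~~9428024155793306255481~
  o))))))))))))
def tb13 : T := (r 68461822894214 (r 2630179 (n 265 ((r 4128319235738177014328 (r 9405049 (n 5128
  (497449287421652239518783431757963322~1079890164283484344~(r 8626872 (f
  327817514780242679943281563599095914))~~23318658~17311970~24793114~1728361704006888962~o))))~~(r
  16909595447879879446520346 (r 38520578681 (n 4409 ((r 10248808 (f
  1906426682247245189123324712311587252338))~~4459774~16625552695302379168066104~28080248~29128824~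
  5241470~4463224~o))))~~(§(§(r 43889820188 (f 874366755948985959775170157250775944))~~(r
  283679651030705715052446852284434 (r 4269081 (n 1264 (200843854752513~165629175335395~(§(§914~
  o))))))~~(r 4127630748915545342492 (r 54628803609 (n 1114 (121276123824192708894012551168646~
  (§o)))))~~(r 219663722512536 (f 53102370693379534356443798447076))~~(r 16909595589567389605374470
  (f 457824384507215626568965738325256304))~~(§(§(r 1324270568252999475810 (f
  3204133441593280499925896))~~1004339430690488953~(r 1000968600804239378 (r 458739956293777 (n 1264
  (200809495014145~(§904~904~(§(§o)))))))~~(r 4127711793909265211410 (r 114882084887 (n 1037 ((r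
  4787 (n 1098 (4101~o)))~~o))))~~(r 140377443168518200 (f
  3624177399799367781895715016989683188634))~~(r 4127742881090891385368 (f
  1130005316848172308174614268333197930))~~(§(§7659582669430783969283~1738317988282073727~
  209201319750682~69251578465434161601244062236~323231870582753944~69252033645761844488255537692~
  (§(§1007222754449097368~16908625302003110786990610~o))))))))))))~~(§(§(§(§(r 19410082 (r 8397315
  (n 5124 ((r 14435902089191732700782618 (r 2315428515 (n 4356 ((r 7324 (f
  2711580768121915353596025933787294694515426))~~(§(r 7676 (f
  2701711522180954649034029165965869155234460))~~o)))))~~(r 293878222554483951896630884059672 (f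
  28727651130499261831341387611667817320885130))~~(§(r 49464543278116304156100166278 (f
  16910679319737234038623184025847333025000042))~~(r 94976750114 (f
  13857738876875204995938563493440004100304482))~~(§(r 23581058 (f
  310467836917433224531574496025624350438460))~~o))))))~~(r 46760209410 (r 43528495619 (n 4100 ((r
  15451650 (f 2711418616356009671113051125048672243930364))~~(r 3836 (f
  5488148463216344520080263928131575943385852))~~(r 16501890 (f
  5488933394151624657807385946801175755502844))~~101445784553602109110455143044~(§(§(§(§(r 7842 (f
  2713585256897433037776588055248500280513788))~~(r 7810 (r 565283 (n 3899
  (1204312582116789783229946669506367571708~1701986082516812164585416258549211174~o))))~~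
  1845880052163029510~33389109471876~o))))))))~~(§(r 857126636745664550 (r 184898920915459 (n 9 ((r
  386804498309522 (r 1018489 (n 1328 (407877243211588439265358745846328~o))))~~(r 386761548671516 (r
  4160842361 (n 25 (2611~o))))~~(§(§45499884088~6488755563573776163346~6489471601687397992466~
  6489471480707026750104~108863697904931198640632914456~(§(§36910105104~141975380658328~
  (§(§(§(§(§(§(§(§26580875103895664812173336~108863244548479731468482535992~11140827288~
  1237892270232~(§(§36286434084888~15763870275174936~o))))))))))))))))))~~o)))))
def tb14 : T := (r 1186 (r 2211 (n 5124 ((r 1203562943951768402210435047730194448 (r 565283 (n 5204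
  ((r 328063293994137204030153299587246724 (f 20191893242834934237290902249442242258971240))~~
  65711669538~65969204104~23908386~1899122094073519718061200131944972838~24432802~24498338~o))))~~
  (§(r 4718615011457302011930 (r 532515 (n 268 (917616986574938168~(r 115518731612037304 (f
  80031055524788489291656719673468))~~62556603677371865980979093528~(§(§3729699450855753359390~
  708130068061644330562383865622700050~296186057800984728~2405335661104324649630~(§(§(r
  72361510677144 (f 4895265065678274368225681549240647976090))~~(r 9565211290 (f
  4894381890208500299159016456100634987112))~~(r 3758639661905742940186 (f
  1441757654153620758560116952243416058472))~~115976212670816920~63068027235629685247381833880~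
  143138556446614168~(§(§71264526481751231942867124842~9655464823651218751725598~
  1213477530966529944602~614393674119398078~12071618508006996711279256~9574130334~
  (§(§22825155264577052742000910952~177168376767006~o))))))))))))~~(r 94976486562 (r 163 (n 4100
  (31513531774305972565536626107039918988558470~(§158406439346391235522314923010~o)))))~~(r
  456058281780227306095852621671044 (r 2083 (n 193 (1836207307325946137122570237560947186~3058~
  o))))~~(§(r 2920079110923379434118 (f 2712098999570035610170149794927006108341882))~~o))))))~~(r
  11412482 (r 547 (n 4100 ((r 3833373014938643505178 (r 565291 (n 4436 ((r 3274 (f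
  5501085205514138246955491420448257227891788))~~(r 3370 (f
  11359013907204783146200823867264291994608460))~~4971716647598082530540790964298629401314~5028522~
  30267938~5421738~30792354~o))))~~(r 4644903653392297402394 (r 172163 (n 4372 ((r 3274 (f
  10597833995530918627583500125318869051163724))~~(r 1484 (f
  2418931971001777509047823704278301968968610))~~(r 3036 (f
  13394317696654304983090620234327097788343362))~~5028514~30267938~6085154~4053538~o))))~~(r 4092 (r
  139395 (n 1032 (327378064479302679209123649289814182~55769104770~3324~(r 9142938 (f
  372720252243734267181034917604606858))~~11119160~(r 210019515114082 (f
  61820416868957003699069110370))~~113969543220378~114141382304282~323414346401286810~6881266330~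
  131403137308312338079435572480568~(r 0 (f 699023643108476630438586449213375740))~~36918493720~(r
  26575379333658 (f 89100002344373632868105817894140))~~254853060864016~762~3324~15346475064~
  1282496047646~3832595557442168203658~2399154322227093601011742~15183770~254878840528914~
  67016821402~444664986~62185376312~414256820414076204522280629078878264~35308276250~(r
  39539914158010783297362209306 (f 131401970224741506175503193588616))~~o))))~~(r 32233474 (r
  9484001486851 (n 635 (202663384842676630195320575836439138~1570~o))))~~(r 32495618 (f
  2721751183101465734206371682758201872755964))~~(r 33282050 (f
  2708693511392882162765831756690622925907196))~~(r 33544194 (f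
  3552374188794588769860181513985948493052))~~o))))~~(§tb13)
def tb15 : T := (r 861887237574402072 (r 1245465 (n 4096 ((r 10644394 (n 1409 ((r 51038298369 (n 208
  ((r 12329419 (n 1479 ((r 615 (n 1305 ((n 5509 ((n 1313 ((n 5420 ((n 18 ((n 5456 ((n 5460 ((n 1350
  ((n 5158 ((n 42 ((n 90 ((n 4260 ((n 1448 ((n 5529 (d~~o))~~o))~~o))~~o))~~o))~~o))~~o))~~o))~~
  o))~~o))~~o))~~o))~~o))~~o)))~~o)))~~o)))~~703069776840746710101138939787119010~
  (§28139994423756894319701175391259192~o))))~~(r 4441451434 (f 57336254432758254390634769130))~~(r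
  3044 (r 11214891 (n 4168 ((r 2726 (f 2866101207340495334670199617948736326434))~~(r 2786 (r 187 (n
  1366 ((r 11690247 (n 1408 ((r 257 (n 1305 ((n 1298 ((r 2991 (n 1404 ((r 115 (n 5509 ((n 5456 ((n
  36 ((n 34 ((n 5416 ((n 1464 ((n 5529 ((n 170 ((n 4246 ((n 82 ((n 5464 (d~~o))~~o))~~o))~~o))~~
  o))~~o))~~o))~~o))~~o))~~o))~~o)))~~174~o)))~~o))~~o)))~~o)))~~o))))~~12648632847132933631795304~
  6889281125116344956675443594~(§(§25699970~6928666~o))))))~~18797806808113621323284906~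
  276278244189064~(r 16664074 (f 2695959958662024244811594917732770089510))~~
  660732996642466944074913430780807570~(§(§(§(§135920657930~136189093386~136994399754~
  562228573021042~o))))))))~~(r 209644836510975731831215265177624 (r 20895429648535 (n 4174
  (16172694~(§7436566~o)))))~~(r 184076159484080 (f 1338028955925610689798469871596672690408))~~(r
  3376498950343238124056 (r 448286483825762323 (n 1356 (242019341080639948234946622644792~(r
  146657699111608 (f 51200861705310733811293543639786))~~1522576176517132380059673094~(r 11575568 (f
  202044310844024356517641400673032))~~824916332870936850~2608553039821546752696~743288152274313458~
  (r 2695736 (f 9713143070227093715799812842))~~1458367072335145621~51858651810360~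
  824879096242186776~13198461202~797191194975217822~906982383656933198512~906841074557858523294~
  o))))~~(r 424884828636017404592 (r 63323603095 (n 4174 ((r 3852 (f
  326516922936346169002816557868575466))~~1497238~7395478~o))))~~(r 125674 (r 2050910032780534950531
  (n 265 (676993093879529088359075145180981432~658~658~o))))~~139654928603637906~(r
  2370635519801903838626058 (r 258965364640049 (n 1474 (118~43523956915~1013372067725892351355510~
  o))))~~(r 509166144256672023 (r 169119633951498704025926985877520 (n 5198
  (72118008958638102691539755295~o))))~~(r 31575491838373906104477706553368 (f
  69778011833211989761142463225968))~~(r 744974793045508304 (f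
  793943519608925854046612622040752394))~~(§(§(§(§(§(§(§(§(r 13830139700605903362425368 (r
  129814308499 (n 4168 ((r 2786 (f 667980569746331582543346795746811289722))~~1166114~1559266~
  15443586~6792834~15443618~7448194~(§(§(§(§25830946~6305922~6961282~25699970~o))))))))~~(r
  13789409357973025022771728 (r 540376014356631 (n 4174 (30281394224~(§60479279032584~o)))))~~
  2108468298386~786475172248486552~(r 210423475929746 (r 2238970268424012057 (n 74 (2749~o))))~~
  9074001588923042726167~(r 862068391920861450 (r 2266306248667398393 (n 74 (2749~o))))~~
  3531032098261050098328~o))))))))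
def tb16 : T := (r 2410 (r 696451 (n 89 ((r 235001371845182448059965210436200 (r 43923112115 (n 162
  (50712732015~(§o)))))~~(r 387456126989178593318 (r 46674577975 (n 4141 (10625111~197285834172466~
  320137804273794897190162803362456~(§(§26499809330~18327537940528~o))))))~~(r
  4789497298230517360011664 (r 11739417 (n 5393 ((r 946 (r 45130853043 (n 288
  (3166954013139659695907030~o))))~~4358706~420698902091752336~(§(§19049512~19041320~o))))))~~(r
  269844066782045921426 (r 197779362766999 (n 5393 (2595~o))))~~3198291705232955607786~(r
  19352663995863598278424209976 (r 7518075360113322208436777 (n 4113 (9119763~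
  2756037153689615371818~2786012408950152793640~8464937~(r 489196397724048 (f
  13281405873557869349810372700982))~~33586087466~33579763240~o))))~~(r 1049448536170782871 (r
  27150085631620269678094375217808 (n 5198 (312799298137398351246669648576652~o))))~~(r 40576576234
  (f 2953830394035148105507233274272840018698))~~(r 10930275352723686913925688 (r
  1024689210155950633 (n 4202 (3814~o))))~~(r 9659154 (r 509728682329473707 (n 5393 (2595~o))))~~(r
  13555978059675479822639760 (f 224376758408995051898309798961214))~~87449251206105232~(r
  795507017493219568 (f 51198467770087841422651671609490))~~(§(§(§(§(§(§(§(§(r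
  149665707873021132976832585777 (r 199424427501720 (n 5393 (2571~o))))~~8926391598778773889175~
  104160494235615928~36567885158807843738124343~87282716401797272~4152707684546988773777014930~
  795463037028106482~3222058285538529181848~o))))))))))))~~(r 11971720 (r 150232220836363 (n 269 ((r
  95837631933162 (f 272548250188485121890119570382904))~~939650380555184786~
  53656992971216778578097152304~66542800569161734817271472816~8645644791284496~20137477137~
  21215570578~7671548965416773656~558170854714092022213126~1459600382954728680202~15439301175~
  192046118775448~1616657322798393028151952~467430879234691~67678612977146928445608140810256~
  1607312191118863598264~1015357513996392005808~2755730659048830501552~11289285373419246210745136~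
  35374280433914151576~786635320935547544~364878442879018122~5178002~89244767421112~
  786530156421939896~56534833005330~87046280676144~392570328315921040~786635329525482128~o))))~~(r
  27042871481663569778738888720 (n 4161 ((r 130980273294216 (r 10905886851 (n 9 ((r 22 (f
  1678279718437350837558800538212697546856))~~141491070072072808~26927541125132303232624921264~
  451910674570479514679107553220124976~22~30374043670~4188462869080586911820472~2070~
  124266121953426~500637372122368144~100188538278214886343622485237912~406~2029610993~379816082~
  150866951118173564205288322034192~534~34533519687826~468225938764873113744~141504295577616568~406~
  198463602131216~509028941500056216~1169562429477249157304~118~509057942487114264~6229289712320816~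
  141336756956070072~22~74346229236566040~o))))~~(r 32979080 (f
  43295050097624194022588389588491710510563432))~~(r 638170287444418648517657140167816 (r 2185 (n
  5185 (4620585265844710629500289923427261440145138~o))))~~o)))~~(§(§(r 49036169864 (r
  768611584938902153 (n 5185 ((r 3954 (f 1281176949753546453292561968347802936445142))~~(r 1910 (r
  2664587 (n 4417 (6316361184027742248616521287118239732546422~o))))~~(r 6000 (f
  5451677268663759317581051697912310085280566))~~o))))~~(r 6334247336811082844872 (r 8946313 (n 5185
  ((r 1906 (f 4282992706378878526296469530014004568298))~~(r 32048581416 (n 4417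
  (14714296295586292343031241044204005580946674~o)))~~(r 6002 (f
  32148834797847402779882722921350825874980968))~~o))))~~o))
def tb17 : T := (r 63657115720 (r 9294717065 (n 93 ((r 46548689608 (f
  39822958897785548709002310051992))~~1067498980019830962~(r 2374999854482616932837904 (f
  21328881872797266118044057802))~~(r 13462078 (f 1390627831274672783538))~~204355963841612488~
  3782179870652725144120~(r 242026214164587397730087838851640 (r 6522385 (n 1353 ((r 18123655831 (n
  90 (15231133~9724032842096703388361351326~2070~o)))~~o))))~~(r 1279776098051154455592 (r
  109427454337079 (n 796 (3805~o))))~~46540202544~223066624044714~57592994285097710762101188427792~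
  5659976316702892786648746~49927258572978~(r 923238347582310450 (f
  209650219280931197897375746189514))~~3371984038039970037172670145749385373880~12191563850~
  5215940008649737474597576~4063307227130945860400948802466131673992~14048579462103428581571526790~
  12182552728~260587242356888~14913268432150734565344432~2175671716207625783~55138550320~
  49893335565360~20779205272~84665384405168~23173587535305474331760042680~50112992029377208~o))))~~
  (r 67952083016 (r 9294717097 (n 13 (1066447671600830915000288767915098672~(r 563199131487791816 (f
  79909466914862588530115514034226))~~(r 46901189808925576 (f 172886506314955036378210501451928))~~
  387144305249216578686334641815193606~780813654764914770~(r 198587990575981633513132996756152 (f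
  606797317289799599202855837472982740022))~~324552336126680356254907841388945976~
  250203129520993054027335048724560~257186769372689~3788508711249847689776~
  15522363453545546263396912~924928837616238672~225821193764920~(r
  1311743808633634699108041937226246808 (f 163380666332695592350691210109360))~~
  391401550593536151301779822257318416~3788783792983331897392~3788641567472653795408~
  3788508711250391269802~15521116524264849531929480~924928846206140976~225814759178296~
  15519561698190749527016496~2889676203036238381624~924928846204076112~225823349637200~
  3788508784537021022776~924937219679126064~8481117569646640~924963609669337144~o))))~~(r
  4674868857639595573816 (r 169 (n 5441 ((r 2922 (f 6044083409806823529223508482405360079413906))~~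
  (r 874 (f 10879739975193661809896865663121940477324426))~~(r 1288 (r 137 (n 1614
  (283173548895483643325070397584171064~(r 12674057 (n 609 (19109000941472777180638486~o)))~~
  4446231158121011548514430649576~o))))~~11973258~(r 4744 (f
  6048742543500954559839434882066216313983222))~~13546120~(r 4744 (f
  5970839149113729132911869290972535383952648))~~o))))~~(r 23408808 (r 11725973891083 (n 4113 ((r
  542569587182632 (f 2741588788993791697797008604335205558086344))~~157572408650408315326658939440~
  9397235340528566075464~o))))~~(r 669169687446034211498028601745093199928 (n 4113 (7890~8146~
  31137421887304429621299723443768289945886646~o)))~~(r 7030863811628486527544 (r 178843017062569 (n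
  4113 (7890~17199331129324678804731914601300014348810454~8150~o))))~~(r 7035475497646911818296 (r
  2217 (n 4113 (7890~17204103125481422260954648056998883394099414~8146~o))))~~o
def tb18 : T := (r 3441832 (r 2821227049 (n 269 ((r 960957645640893112 (r 106617 (n 5393
  (46305421362~1428312191513336775250~16951378~76606804520~22884904~6445216025030812142288~o))))~~(r
  108235395390539828190445219900112 (r 47211580055 (n 4417 (3057810~3056274~3055762~28350710~
  3056274~30448374~o))))~~(§(§3936251346416602546744~(r 210474080363824 (r 223347329795257 (n 1113
  ((r 9005111 (n 5204 (3594~o)))~~o))))~~(r 55143786686 (r 71488533785143 (n 1534 (2383~3567~o))))~~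
  (r 951948794132857528 (r 3719501024098189904633 (n 5393 (895725605941648450163849850691201106~
  3506~o))))~~(r 65431856389758828370265662136 (r 221981360753303 (n 5498 (3166~o))))~~
  (§(§16122166267561643655858744~66048408557916112003860062824~(r 124952 (r 25264155 (n 1033
  (80273304119~3936790144638561749560~862067052822071352~(§(§57288132760~57288133272~
  225866563652248~177488052030640~56749689360~56751097912~(§(§36918495768~36920428600~o))))))))~~(r
  7113146996787341650569 (r 108235392670346196192049777311910 (n 4369
  (269399083863391039503064793547302~957097848753291826~26941992~29563432~o))))~~(r
  3936082495075502359248 (r 29742186030405971371068041 (n 1341 (2815~o))))~~(r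
  3936215520062330208976 (r 1763064159222137495 (n 4153 (6238~o))))~~(§(§960957634624849936~
  961130848374194328~210439712736438~13639622095061507373165080~3899357858238346396344~
  8395186605266188141207~(§(§234651514405432~234617825757720~o))))))))))))~~(§(§(§(§(§(§(r
  87288353448 (r 730322743882580521 (n 1305 ((r 2762 (r 89 (n 26 ((r 2729279559 (n 1350
  (15671665158727~o)))~~o))))~~46349806130~(r 503941810 (f 421583938143261203256519522028534))~~(r
  777647880117619250 (r 50199104055 (n 73 (49327088414531366951123091646~o))))~~2762~11315762~(r
  80677778482 (r 36674399604279827 (n 1113 (151~o))))~~55038437938~46338902680~189848705769528~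
  1353687020646992938~15489554324911729449403032~2762~11315762~(§(§(§(§(§(§(§(§225478571559096~
  225445821909048~776910014329358864~8618520~43790731288~25173801837679974006557258~
  592402753664551528~o))))))))))))~~(r 6002737827862507454992 (r 45239927337 (n 4113 ((r
  175261811237768 (r 43654455433 (n 4369 (17160035732384101174898662668706779756804690~970~1486~
  o))))~~(r 2326312323630477497077841906589717661752 (r 137 (n 4369 (7378~7634~7638~o))))~~(r
  67412722568 (f 3392680057287431940596648468939573119199638))~~(r 42253058952 (r 2217 (n 4369
  (25342072180374447112850675607586673426512466~970~25309583257391599829810878894124379917818824~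
  o))))~~(§(§(§(§(r 718294619782676486 (f 15060885988243214040677435521809251095863370))~~(r
  37281892569824125165797400 (r 137 (n 4369 ((r 7378 (f
  2736073230881777634698866752440430796565192))~~(r 7634 (f
  36469316768162556634254812982711696143248072))~~(r 7638 (f
  38550111012783502240439861044858770741299912))~~o))))~~(r 31629768 (f
  6187237636873876438571065039596952565842))~~(r 33682000264 (f
  2309135720028198971272830285956659342861294))~~o))))))))~~(§(§(r 48505728170 (r 723542983926385193
  (n 1289 (1535729580856543954~105538726415346895776557591096~(§(§515025610~339391819224240~9169586~
  1885259096328906~46732991952611944~(§(§11316010~189851154746008~(§(§(§(§(§(§(§(§22222032~21826226~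
  34639086096~44696701080~(§(§183118214563864~2389616754010011241064~o))))))))))))))))))~~(r
  1772599660641419350867762848473833488 (r 152293779999273 (n 4180 ((r 716 (r 2691 (n 5393
  (245369984727543838623415564110122543170~(§o)))))~~12042694021031762768005284~
  (§(§237627040374858344~402031461487037809032~(r 1538 (f
  4357271315402838267341102549769516534262))~~375398426~(r 1740 (f
  4496346714712173844630478705220600688194))~~301443173803399117951288440154808~
  (§(§2940466778224189669912~15574820~(§(§(§(§(§(§(§(§6305794~6305794~25976362~26074658~(§(§1367722~
  1334946~o))))))))))))))))))~~o))))))))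
def tb19 : T := (r 4533416 (r 152428961899145 (n 1373 ((r 225417768463050 (r 89 (n 4417
  (1210423218560037407536184160065590070002~5286546~228032846308392~28784776~28801160~5290632~
  4782728~o))))~~300277771407059506~(r 55067183666 (r 36946772249 (n 9 ((r 567 (f 48095136703))~~
  122936~8619117993730584~5225878056941747748594200~2116121592816~223384747368606~
  249105840745028637027470371489816~1169668320015478260274~3634017108833229930552~
  607990253758513310~311313406000955928~39480384487582~2116119102064~202666278572195998~o))))~~(r
  75508488594098 (r 13691355831 (n 1389 (1377313009697204691952~346991180681611978~o))))~~(r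
  46347681848 (r 39630766897 (n 90 ((r 2143 (f 2603384621761521633341))~~3088447100559508628006~
  1421275985984658891302~o))))~~(r 189805756097072 (r 162602499113655 (n 1050 (2718~o))))~~(r
  49171955084986154075726086328 (r 4424721 (n 4161 (40433690680~52217555090~267645893509264~
  255774836295826~29909755528~26655376~447400429290022~32585896~32602280~32970890~7305352~o))))~~(r
  20678697522 (r 223631300952631 (n 1628 (2762~o))))~~(r 144631717792456 (r 223631299150391 (n 49
  (2247~o))))~~(r 41912022573711089024208765464 (r 20270220057 (n 592
  (40363540480062026433920862922~40352272973525201181133186088~2654780174492656703669290~o))))~~(r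
  20682310322 (r 83026821350071 (n 1114 (1553~o))))~~12690725112376~777479561345728696~(r
  1411357931942434775730 (r 80312633499 (n 9 (28041783~10821688~830948640213631032~12124312~
  49662862008~12126800~12126832~139252092442944016~59233521965028944985813213720~20000999536~
  81949855285784~3738000~3738000~10029168~10029168~o))))~~(r 84302426270258 (r 329785180514871 (n
  1389 (79291650802809682084110215962808~300086877392636490~843~o))))~~(r 36921188408 (r 80849635417
  (n 348 (63485560052980930804990599326~39786348986925113758866498291774~
  57103038041728488266386449488~o))))~~259880873538925026684847516123704~(r 291957292337433 (f
  82463232691))~~1373892466086873783~189838503018680~777481760375670840~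
  657703216093640999813245750842892132880~1491010250084518455~153428221854392~1350874326123645527~
  1518605376171379897~3782353416493507773112~763549983798166192~3157327379634087299736~o))))~~(r
  3240 (r 649 (n 5137 tb17)))~~(§(§(r 3450026 (r 146976257591509545 (n 1037 ((r 959268828561506994
  (r 34395463801 (n 1342 (765224238254828438~175135749825439~o))))~~(r 3828640293711170297684664 (r
  723407631614446217 (n 5501 ((r 146 (f 270185651587826600782933095809038))~~21723283462~17369234~
  73269182478~19442322~13570704~o))))~~(§(§8640695905124408~(r 1105998577670288636216683971574039218
  (r 34802304697 (n 592 ((r 3147 (f 4151096802227406941891))~~(§3053981300901953494616680~o)))))~~(r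
  14394241326898839212354728 (r 6358713 (n 592 (171655563370793695025491812191442~(§1362~o)))))~~
  65922649420537691953556587160~(r 238880628374995608 (f 3375699431222398791805738))~~
  (§(§35392290433832419384~804645287575521432~(r 690 (r 80312633371 (n 9
  (49066456070450721601169220110~11345976~1051323088~(§(§514263440~752269397781086872~13304336~
  11254040766~13830864~13830864~(§(§2072063314032~256853615489182096~o))))))))~~
  4725196361972424729422514~6435156805639404146158282~1106009201983684202674641917465297048~
  (§(§196446613899928~16094759041159544017881480~1635652773743759033~4751050061379392858167~
  13678359883642979586837144~270058905224641055330343306946744~(§(§804645321942075920~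
  804645321943615640~o))))))))))))~~tb18))
def tb20 : T := (r 46551105592 (n 4161 ((r 1518472 (r 696451 (n 73 ((r
  129170907718309173385162809424513072 (r 10952825 (n 1306 (120111694494709728151362729518063830~(r
  157821528564663 (n 1134 (2741~o)))~~214~(§(§o))))))~~(r 795652112337774738 (r 193378631901335 (n
  4174 (1686~(§1686~o)))))~~tb15))))~~(r 16197256 (r 185408000893577 (n 281 (413232177768~(r
  8994436415629667720694034 (r 43926520241 (n 14 (2991~127~o))))~~(r 36833480605971108482364696622
  (r 1769881 (n 4417 (993891819614367036302027721171304722~6794~6792~o))))~~30418334485457~(r 753776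
  (f 2531576671398715908917565193795009636586))~~179959403056281~(r 2206 (r 20137477137 (n 5454
  (143248671130853115695240336418070~o))))~~49332720930782894487694248552~
  305671971757612010005266757356070~179923431556113~168674215887406~49324202427095266464475710128~
  241773652050897~(r 1280721853432266347594894297641715858 (f 150853024292842435124659748397298))~~
  (r 1256839190051625254857392 (f 235619049709579418980728941255233392))~~
  5253313529638662847501889123779971612914~2531812920936621642717219351774278344720~
  160899240325384323~837306573697428160784~1727788976144400~488150147629521~459066242073617~
  459066242073617~12182981304~202106449291202119678534949208622~744819484688220824~
  57562475764513999567334807273998~41105800528496~202074031207071738132357013758488~o))))~~(r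
  16213640 (r 649 (n 4417 ((r 5713032 (r 46877456244875 (n 265 (166439087418032~95700304964242~
  2792767879157604125458~(r 1910 (f 100203527258754900805559593405162))~~30~66417798418~
  2793317320546065131152~16214762~1114123222079078960~7824264~7826184~7824138~
  43754230116670507698589065808~2793129674560795912240~11439176521641846792333840~2794~
  192038560424594~32044608400~2202104449330986549936~1910~1910~5186834~
  46854263927749992304309496496~2794~364983583077369488~32056607496~32056607496~7706926711568~
  459336~o))))~~30882440~30898824~o))))~~(§(§(r 135082313352 (r 11684501029513 (n 4417
  (2733434464732915154089659832024878860905194~13883807063998217259459353005925676473720990~7542~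
  o))))~~(r 135130552456 (r 8946313 (n 70 (46~2598~(r 773672046272078087 (n 1302 (142~o)))~~
  174561702395165032025747911950230030~515935494715250792307037042827782~
  (§(§79912445431054251594117665546766~57100543633634891084570091558~o))))))~~o)))))~~(§(§(r 330 (r
  2728954409 (n 1373 ((r 9775818 (r 89 (n 4161 ((r 66343963474 (r 9571934859 (n 26 (2245~o))))~~(r
  16213640 (r 565897 (n 26 ((r 10734279 (n 1350 (2703~o)))~~o))))~~(§(§135063443592~135149422216~
  o))))))~~(r 3420236274717512297138 (r 3634751671 (n 5396 (90~2434~o))))~~(§(§199429156864183~(r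
  54530247195 (r 2226 (n 4369 (18561565738~24432043048~2091~(r 29194280 (f
  523422997043632547533966931520306))~~o))))~~(r 49054328908756544115763259416 (r 54731571895 (n
  5396 (90~869290173674969539177159056894208420~o))))~~(r 55067247193 (r 815869146830668392 (n 5400
  (12725260437335901215664312~o))))~~225418106208951~(§(§2751607244934366202570~83026955305655~
  (§(§(§(§(§(§(§(§364153512495643~353410195622583~366353072753241~
  131983983309074793659060510647552528~(§(§3295827280463162737336~9452783005726139604980697778~
  o))))))))))))))))))~~(r 296 (n 5441 tb16))~~tb19))
def tb21 : T := (r 4704354926187954741304 (r 51306397817 (n 5377 ((r 13272074 (r 3744371 (n 4113 ((r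
  63665907240 (r 2187 (n 1308 (2706~o))))~~8953899~4628549195696806898226~32323624~32340008~
  33372200~1898536~o))))~~(r 113430468661136 (r 10471156625 (n 1265 (2411~(§2411~(§o))))))~~(r
  273969695886066 (r 915 (n 1329 ((r 42022636201 (n 1217 (59268504532111681740260517803~o)))~~
  o))))~~(r 2190056 (r 45269058163 (n 1613 (2396090192604968856726~3310~o))))~~(§(§(r
  218727420880272 (r 523 (n 1473 (274934846134975320442374734842424~o))))~~192169526077982761~
  1490280714965418502~88233937650~79602084584~(§(§(r 21017584 (r 1011 (n 1329 (2952~o))))~~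
  24250514896333078352464440~o))))))))~~(r 1148524147840876562 (r 6845595671 (n 5389 (54368608786~
  42794025585~46877583890~(r 2806 (f 54074067217896934723463502637737070))~~(§(§(r 1046 (r 2140663
  (n 1276 (51221747450017968013929554160184~o))))~~21697034~12808744~19434218~19434230~(§(§20909042~
  92495375478~o))))))))~~(§(§(§(§(§(§(r 36836189896722 (r 1150213964069044247 (n 1369 (2771~2783~
  (§(§(§(§o))))))))~~(r 74424 (r 19607577 (n 9 ((r 1148524151901169694 (r 28041239 (n 12 ((r
  1119178757383850098 (r 6909 (n 342 (501396425079947395716812905069231~o))))~~(§168398991982704~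
  (§(§(§148597548580976~o))))))))~~(r 273256323950706 (r 4780202702360636000283 (n 25 ((r
  46138024606 (r 6871 (n 7194 (4118~4150~o))))~~(r 0 (r 441 (n 89 (6993~o))))~~780862~(§(§2326712~
  511959078~o))))))~~4586785650173565929630~(§(§4144171993322265739928~689228762673939000~
  (§(§(§(§(§(§4153431413777829691544~142835326192016~o))))))))))))~~(r 19269037777662711129253894 (r
  80513959959 (n 13 ((r 30 (r 7142366499627715330193 (n 1036 ((r 9108986799339872964774566 (r 4221
  (n 346 (5689774080526082762551194128477835438323~o))))~~(§2823039353640898338930~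
  (§(§(§608154181733255562~o))))))))~~(r 2346053566198434095800 (r 285840603971705 (n 25 (678~
  o))))~~161061155831455716759605696783032~(§(§168261520163480~148475140997688~
  (§(§(§(§(§(§2550366744~2552332344~o))))))))))))~~(r 1921426072 (r 81386375289 (n 13 ((r
  280401404274744 (r 4755 (n 1049 ((r 2353182 (r 1357698056797653033 (n 5244 (2928~o))))~~(r 2232 (r
  17107385 (n 1369 (4919~o))))~~3171121437270370486456~(§(§9144888~9144888~o))))))~~(r 458770 (r
  28041239 (n 1034 (2104~o))))~~(r 3137559 (r 19269037777798216299020306 (n 7498 (28012600~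
  45752514688~o))))~~(r 1851840613966252073 (f 127199109505234274689421486707))~~178024515829778~
  20493327603085462770715153~247011901114910~(§(§(§(§14756240~142800966451218~168423116603928~
  60406491632~o))))))))~~(r 78925978737467569765248739334 (r 1341798946942576777 (n 5124
  (12390476444~(r 956 (r 2577 (n 48 (4507474457110759552420226~1893208937946547742605976~
  17454439056740063390567298~o))))~~2401188352335675176110084~(§(§557495336648583554~
  575502177621970434~16921242~19910658~20697090~20959234~(§(§24891394~25153538~o))))))))~~(§(§(r
  574761392770268047416 (r 861068864482019449 (n 5457 (712~712~(§(§3242~2582~o))))))~~(r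
  323280810251850708098653395953670 (r 1305796536558913945 (n 5629 (1014~o))))~~(§(§(§(§(§(§(r
  9609437753543605073913912 (r 1725724792022730873 (n 2033 (1507~(§(§3563~(§(§o))))))))~~
  7066264495009705324057~o))))))))))))))
def tb22 : T := (r 19257836495601636336624016 (r 25264155 (n 1369 ((r 702 (r 19656729 (n 14 ((r
  1924023174203760687 (r 19297369670153855608446982 (n 5457 ((r 2774 (n 5185 (2569~o)))~~
  (§(§o))))))~~(r 2350341072209442202118 (r 57678726467202279569 (n 26
  (2051447179376049587763895376020267255~o))))~~(r 32279752235127482551011849 (r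
  4593702616149115559942 (n 4210 (623~o))))~~(§(§112195714666848318~32280194986882757936318993~
  (§(§(§(§(§(§27386701245974~37561883223858881959208480825~o))))))))))))~~(r
  12874951253446018522843160 (r 328961083410473 (n 1037 ((r 4086 (r 4215 (n 5246 (2934~o))))~~
  40938047640~16738968~(§(§9013784~10586264~o))))))~~323733861707375425981278237386904~(§(§(r
  11110968 (r 80305424601 (n 1033 (4851~542938195781126334~(§(§o))))))~~(r 80909011263 (f
  5740438067818160626355741131664597914425))~~(§(§(§(§(§(§45510527160~37457463960~o))))))))))))~~(r
  573813738332129302 (r 28047385 (n 2 ((r 2232771796161389552294 (r 3225494239995536760881 (n 22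
  (2214~(§1745512998~470969716082729~o)))))~~(§1790482038220564619910~(§(§(§33241947999068294~(r
  2566 (r 25223843 (n 1366 ((r 327964200505375 (n 1026 (5495860613905943095595088964646007695599~
  (§3055~(§(§(§89229188508625011108250834927~o)))))))~~(r 31148650067847814 (r 17098823 (n 974
  (3694~(§o)))))~~(r 3059025987679 (f 119957693453219580732179237575))~~(§(§80741165351~
  192717725268568383~(§(§(§(§(§(§45206891046~37155793446~o))))))))))))~~(r
  315676840062552297464529626292262 (r 25223271 (n 342 (32511958300283430324731959~o))))~~
  (§722272905951994406~(§(§(§438679172211171462~o))))))))))))~~(r 511803448 (r 103481974905 (n 4153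
  (5293146881460630677115966235567387673154~286689447023051362~4711541588045009617504~
  (§(§67686072824~67753181688~1323418353521880649112395681607983712~(r 1150533790530634432 (r
  5077798009976945 (n 1073 (6880~4047~o))))~~5421434989113933076044106485913612943970~(r 29123064 (f
  3410853474614697726609050403002875480760))~~(§(§136400832120~136472658424~o))))))))~~(r
  36342303384 (r 105086812281 (n 1033 ((r 9626997031621990845278230 (r 4147 (n 1094
  (160685190045946362618007~o))))~~(r 140091244707902 (r 4159 (n 25 ((r 6867 (n 346 (6853~o)))~~190~
  (§18807421844070991579545790~o)))))~~(r 70635219065 (r 9628324873079757830384184 (n 5496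
  (3231982202~17672898~11794754258~o))))~~167682242971670~40938070078~30000630522329695303587398278~
  210431899199609~(§(§(§(§246876607702544~60270141502~246881303200240~2814139556870991480984~
  o))))))))~~(§(§(r 2096347316280 (r 423862170386553 (n 1033 (10029168~8849808~(r 2448 (f
  69598041428626838162372265968))~~16993417483331017283494552~(§(§77059951607~10029592~8849944~
  10422808~10029592~(§(§60270119448~60270512664~o))))))))~~(r 4142011945798230182424 (r
  1170943115232358689289 (n 26 (61~2777~2487~6871~o))))~~(§(§(§(§(§(§(r 8586645050327096 (r
  1736139469231849593 (n 2045 (6129~o))))~~(r 142395749007416 (r 2303452147353223289 (n 5114 (3558~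
  (§(§7654~(§(§o))))))))~~o))))))))
def tb23 : T := (r 56 (r 11526265 (n 6 ((r 38 (r 272135250243043256441 (n 1073 ((r 30940553248871 (r
  9562227963742278887637488 (n 4353 (4885046~5180136~5933622~50804984799924318957291735531~29270642~
  3049~o))))~~(§(r 113277314990574 (r 16689249 (n 1998 (16442769~6226969~519360790816649865319~
  (§(§(§o)))))))~~(r 19673193 (n 49 (1001~(§2027~o))))~~2881288392816575176831~(§254029844123246~
  o))))))~~(r 4591397447110994133126 (r 2855255740605247064215 (n 1277 (494~
  11543975284825223005241625~494~o))))~~(r 859799163425005959 (r 2341444107658066624646 (n 5198 ((r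
  11231288 (f 1901135507047462363944))~~(r 2798 (n 281 (2739~o)))~~7786786846100368298903656~o))))~~
  (§(§2227625196976772507143~(r 438565914462412934 (r 68385531399 (n 1369 (2771~o))))~~(r
  39482437036166 (r 131466468214825601563198195857 (n 1026 ((r 452712 (r 7135461734394010034321 (n
  1110 (4829~o))))~~167716696156838~6687385992~(§(§10055190~14772726~o))))))~~(r 11383794310 (r
  123417591777096282127999691287 (n 1030 ((r 2750 (r 293297455122577 (n 22 (6749~o))))~~40946459022~
  1120946613646821878~(§(§14772630~254427132889494~o))))))~~(r 486911953084807 (f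
  518165251513222208734961832258161))~~9137318691298115693076614~(§(§3170972703617248682118~
  1796365985663948972166~o))))))))~~(§(§(r 503939128 (r 437878905 (n 5389 ((r 73308800223624 (r
  2556817 (n 1308 (2706~o))))~~(r 80728884709480 (r 3736177 (n 1278 (3061~1567~o))))~~(r 53859519218
  (f 377103761341400370378901795459000938))~~(r 13067272 (r 913 (n 4161 (30873159954~(r 3894 (f
  676997553140840172125445869573966568))~~66315026706~32716936~32733320~32979080~32995464~o))))~~
  (§(§(r 315553752182341865150936191107640 (r 10428931 (n 1073
  (1198884400326264626086068327599538568~o))))~~355210719965834~355608413376496~87797836530~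
  360006459885552~(§(§(r 23007754 (f 1698702996360975249460725611745421296))~~(r 14644112 (f
  534362743489988443099598269951543864))~~o))))))))~~(r 622648 (r 51373506681 (n 4365 ((r 13279762
  (r 10481109527 (n 4356 (3258~o))))~~(r 223650324211768 (r 3736177 (n 2 (148194124638447~(§(r
  8937510 (r 3045 (n 322 (2606~566~o))))~~63015241383~66847206536~(§550950~27940879~28203023~
  (§10840336390~25224711~2158~(§2446~o))))))))~~327207025965443602~(r 273832228119670 (r 913 (n 1329
  ((r 11299055 (n 1306 (2743~o)))~~42130961551707221589135100585~31799647046247~o))))~~(§(§(r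
  59764703762 (r 2105879 (n 1369 (1753455897607456333886~2718~(§(§o))))))~~504375464231442~
  62682642942487~457959110944872~34496759936944224916760728~(§(§2128788078151008786~(r 31422984 (r
  2569 (n 1369 (140670115942483250423776960574~2718~(§(§o))))))~~o))))))))~~(§(§(§(§(§(§(r
  2070577512504 (r 1148982667813421177 (n 1369 (2771~2783~(§(§(§(§o))))))))~~tb22))))))))
def tb24 : T := (r 2301929299325786120 (r 141295968878633 (n 4100 ((r 38613312111516427319943194 (r
  141433441394723 (n 4116 ((r 11313218 (f 44528970592967942581063487548514908697707052))~~(r 3012 (r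
  163 (n 1488 (648046917322745892422319447351688~10347418861583702808983137273972540408226~
  2526257660135391132215078890707231112~1996446384390646985646314415097299396~
  (§43323890616206337770917923863185860~o)))))~~(r 2522 (f
  44525790200805786649234962415425255573834658))~~(§(§(r 4036 (f
  44528028620636599852499228817253311169046946))~~44525869264657490653967806652937758576969732~
  (§(§(§(§(§(§(r 8132 (f 14678274122789616573897993754866056983972066))~~(r 6236 (f
  33495195499243872657899172357677443540821956))~~o))))))))))))~~(§(r 38613607259421606672769050 (r
  141433441361955 (n 7 (10871255382076765869442305451262327545960~(r 38626605979243554793728550 (r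
  11427943 (n 49 (609868268502409395796080765692802~o))))~~(§(§7885193140660358~
  158185998329501593824381009936~2082062876~1174410572893029820932~43712507964038~
  (§(§3126739058740085418500~36616430084~(§(§(§(§(§(§(§(§3534865365616327549606~28314513203718~
  10868524343334~34918193717286~(§(§9217075331110~9209055830534~o))))))))))))))))))~~(§(§(§(r
  4604904725909353368198 (r 141433307144227 (n 1847 ((§(§(§3293862735957224162050076~
  487573674393933808314414339303546~o)))))))~~(§(§(§(§(§(§(§(r 460678295281885200 (r 140883551330339
  (n 6 (115076~8145360904~(§(§28~103239008642~(§(§(§(§(§(§480272518~38619508594021228689238534~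
  (§(§(§(§(§(§(§(§(§(§(§(§(§(§562677325785094~o))))))))))))))))))))))))))~~o)))))))))))))))~~(r
  9434935490859395088398 (r 2956045735985193 (n 6 ((r 38 (r 607003134510129679 (n 25 ((r
  3193609085082119741529 (n 49 (226530472234548547911855123277425609~
  (§16529635950964878753290201599947~(§(§(§1760941506654824600~o)))))))~~(r 11135654 (r
  13099969148764815075147919 (n 5441 (2870~2792~(§(§(§(§(§(§o))))))))))~~(r 66439233813889433 (r 542
  (n 5593 (1157922~o))))~~8983100626221574774902~14289948632110854198493273~
  240062003249394573756393152938065~(§(§(§(§2633894909407544836505~9317366138564409712758~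
  1140165409729380441~43889953446~(§(§(§(§(§(§(§(§(§(§(§(§103483541017~583252987934632614~
  3089336376~35310428728~o))))))))))))))))))))~~(r 38 (r 481190015 (n 4154 ((r 1022 (f
  2885220015494656265152))~~4180572~(§(§15198718~15092196~(§(§(§(§(§(§27885828222~6707300~
  o))))))))))))~~(§(§(r 548902 (r 715098319546114439 (n 4354 (20853923230154523759107211910~
  12634644~148872833746497500288415359592~10963694~(§(§(r 3574 (r 33812710959599 (n 1366
  (10287910735621315638389447~2759~(§(§o))))))~~14207892~7773594333383698910077584~2185740~
  2051276357084571782~2579052~(§(§4250508~o))))))))~~(r 548902 (r 210831389778023 (n 1306 (2718~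
  2718~2718~(§2718~o)))))~~(§(§(§(§(§(§3185214282261452664890887~8691146790~
  (§(§(§(§(§(§(§(§(§(§(§(§(§(§141158496362534~141152053518854~o))))))))))))))))))))))))))~~o
def tb25 : T := (r 280538809663592 (r 8724709417 (n 1037 ((r 1148524151901167672 (r 121 (n 5177 ((r
  46618378306 (r 174723 (n 4420 (47815639070~767314811563299429491881100710390488~
  (§(§363693349409007216~3253402~28039170~28465290~3259010~(§(§5421706~3253402~o))))))))~~(r
  69992307884728 (r 45131726891 (n 1253 (9609435341345770362670018~634823614447289642504~
  10460016832169615462107528~39360245239691022165333511106~o))))~~(r 1862648 (r 249 (n 4217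
  (11381472~(r 2770 (r 730323250984714363 (n 1317 (13221557350877816861441356409470~o))))~~(r 246 (r
  8901306993 (n 1369 (161208398758293083323896689060448~o))))~~7614200~(r 3832 (f
  4038817362415265935926667426383285454534))~~29966436562~15696118~28588280~115838722752~26557176~
  1014520~7313658~7313656~7313648~26150648~o))))~~(§(§(r 1134941905969588920 (r 184865996636203 (n
  4100 (10657326178552636462620976034~(§43652415280906516638655512727484~6146~6146~(§6146~o))))))~~
  (r 277517032194112 (r 2588921 (n 1073 (518250~(r 1013560612434649176 (r 12493251 (n 1369
  (12854317090661997857585031244503~o))))~~8906858~(§(§(r 152186900211302 (r 37547720419811 (n 1369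
  (19185643893340771741521487366839~o))))~~(r 0 (f 162149117395352822707699314100920))~~2154~
  32159570948246625938439110760~2154~(§(§34005354888~8906858~o))))))))~~286091943717600~(r
  1172636241890503360 (n 4153 (660114383141744629096329930821310586~1018~454~(§(§6650~454~o)))))~~
  1279795879928891482~(r 76355701752 (r 2297 (n 1317 (334531322970919858011482882277874~o))))~~
  (§(§7010806184174924040282~(r 418269568142968 (r 10979577 (n 1369
  (1983780880474487542970282962852383390~o))))~~o))))))))~~(r 1148524151900962834 (r 47211577367 (n
  326 ((r 155754 (r 2797 (n 49 ((r 3051 (f 213927229399522836697897794054595))~~(§(r 4043 (f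
  10440638235496041007689697))~~28063849~29112425~(§279990799108202~o))))))~~(r 11266598 (r 263 (n
  1072 (106720980306034~168259276443144~27650885746~o))))~~(r 1493767 (r 166 (n 5490 (11487852~
  11488118~12020456~13167336~o))))~~(§(§21689428775~57649685639~(r 1051428870 (r 27973639 (n 1072
  (3011~(§4043~o)))))~~(r 28235783 (r 645947498 (n 5136 (11281068~11242184~
  29527326991897310346021545~(§16952010~o)))))~~116728029447~117801771271~(§(§189023760965766~
  46637005168774~o))))))))~~(§(§tb21))))))~~(r 1150212864288915470 (r 695919476777 (n 13 ((r 122936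
  (r 106617 (n 5177 ((r 627822253741677739500569240688888514 (r 1923620867 (n 25 (2266~730~(§(§2650~
  1323559567689820623246665793180902106~o))))))~~(r 175555580635714 (f
  13199238419501369148329674379254))~~(r 661404821838061893444965660011235904 (r 249 (n 1049 ((r 217
  (n 74 ((r 10146136407573639054559481 (n 37 (10458478515726224662998693087927~o)))~~o)))~~o))))~~
  (§(§4651351506821009082458~(r 67748464248 (r 2588921 (n 2046 (14544855~(r 1049 (n 1369
  (19220223681423273561000606~o)))~~(§(§11526716118013489009255096~o))))))~~285954538220250~(r
  659143296498760489049700720349382848 (n 345 ((r 11363039 (n 5496 (610~o)))~~o)))~~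
  1279910201228894392~4712118189603420627512~(§(§417994690236024~418269568142968~o))))))))~~
  tb23))))~~(§(§(§(§(§(§(§(§(§(§(§(§(§(§tb24))))))))))))))
def tb26 : T := (r 51305152904 (r 557097 (n 5380 ((r 860380774607003674 (r 565283 (n 4180 tb11)))~~
  (§(r 209218697322522 (r 532515 (n 9 ((r 14434694951103010064212024 (r 11501689 (n 4153 ((r
  12345408 (r 249 (n 53 (66013211642474~(n 4161 ((r 11217704 (n 1338 ((r 991463 (n 247 ((r
  48522789357 (n 5392 ((n 5499 ((n 19 ((n 1370 ((n 5393 ((n 222 ((n 4178 ((n 170 ((n 1408 ((n 5506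
  ((n 1420 ((n 5225 ((n 92 ((n 5444 (d~~o))~~o))~~o))~~o))~~o))~~o))~~o))~~o))~~o))~~o))~~o))~~o))~~
  o))~~o)))~~(r 11529181 (n 22 (175~o)))~~o)))~~70~(§70~o))))~~(r 808013917767756318 (r 630923 (n 74
  (2744~(r 983271 (n 86 ((r 199 (n 1510 (2702~(r 3037 (n 5392 ((n 5475 ((n 1306 ((n 5393 ((n 162 ((n
  1409 ((n 5440 ((n 1346 ((n 5448 ((n 1412 ((n 4248 ((n 168 ((n 5481 (d~~o))~~o))~~o))~~o))~~o))~~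
  o))~~o))~~o))~~o))~~o))~~o))~~o))~~o)))~~o)))~~o)))~~2744~o))))~~29672313620740250789464325989096~
  587675886550989077518925258526263560~30845529744~264462388472170~4134043880~
  (§(§(§(§433922838462642~28614099094~29855613162~28211872104~o))))))~~(r 7516480064 (r 26855022785
  (n 293 (11168354~187345504078314~2605666~30325313~2533984~12454498~2509416~o))))~~30822808068704~
  (r 7620930152 (r 16688705 (n 1338 ((r 2791 (n 1369 (130141119549204570468365124610615~o)))~~
  o))))~~2116454498~(§(§(§(§37223575942470512218474531~8660441268832~(r 2500714 (r 137095284289 (n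
  1369 (39024591411150432848875186835~o))))~~8668989245536~o))))))))~~(r 251130909434048 (r
  646873651028828793 (n 1531 (13196265973~o))))~~(r 67753181248 (r 1016441 (n 4409
  (3622616175764255974080~30177912~31226488~o))))~~(§(§2181870354344354016~(r 7623645304 (r
  4169630329 (n 1369 (40088223824195971759750566759070~o))))~~o))))))~~(r 3523439206593638662150 (r
  47110512761 (n 1291 ((r 3787448 (r 3494997507827004672945266815 (n 60 (2405176295043008702874~
  o))))~~(r 2083512 (r 50407629717 (n 205 (2666~o))))~~3787448~19675982589~18033003451~60066737141~
  (§(§(§(§12176056~53639359229~46045176346~77758311413~o))))))))~~(§(§(r 2719800 (r 210419408535673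
  (n 5434 ((r 2969 (r 3503343042478580195392 (n 4553 (2457~2457~o))))~~13370494~6032510~
  (§(§19393662~20942328~o))))))~~tb12))))))~~tb14)))))~~(r 210425614860302 (r 168329257 (n 5457 ((r
  11313224 (r 35 (n 5441 ((r 56686676389566595472917561528 (r 2691 (n 4096 ((r 139241235072721128 (r
  131 (n 13 (6211251088~9375928511190662476586363448~568017135234488772880~(r 8258521352 (r
  7249428535 (n 1476 ((r 257 (n 1354 ((r 2855 (n 22 ((r 47 (n 1527 ((r 367 (n 5557 ((n 4263 ((n 1194
  ((n 1342 ((n 5394 ((n 5474 ((n 32 ((n 5444 ((n 108 ((n 1352 ((n 5396 ((n 24 ((n 5528 (d~~o))~~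
  o))~~o))~~o))~~o))~~o))~~o))~~o))~~o))~~o))~~o))~~o))~~o)))~~o)))~~o)))~~o)))~~(§(§o))))))~~
  327952~1340852258194049257375153075044728646296~138519820781167288~136408724104618512~
  12479321694630517852938254~1520160498576~138519817165678856~325981277118930709681097254917185586~
  1008~(§(§(§(§(§(§(§(§4057131173815518539544956406709873248434~14432119319381846503663664~
  44328102034~743691422557348368~8330093106~139638561648615984~3193734010586972389522~
  59086035348254062906528038916~o))))))))))))~~(r 8310274 (f
  14374387180391608547476374200368651648821634))~~(r 8343050 (r 45667590667 (n 4352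
  (4282164025921502584385312043828033403495908~6666~6666~o))))~~(§(§136994399754~137243965450~
  o))))))~~(r 6583014098304574164075080 (r 45139665419 (n 4161 ((r 374 (r 139 (n 1342
  (1086759539111524518764814922~993767882019870243890074411335935734~
  1220483918705562144053428819448461256438~61661989347878743181248486803190~
  58036851342985118136244488786471536~242646422803850728397435948687946~
  722420207625641284828322958145388648~o))))~~38019020310728192381453000~1538184~o))))~~(r
  453716714462516437360713983473385528 (n 4161 ((r 31977679592 (r 149680189123211 (n 348
  (1677781175251461446347045921198937571594~1241000697790452845835499305213429938~
  899219421241420430441461509188053170~2098~1282732337349745136151409714876713008~o))))~~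
  553193054964424~105449180350324920~o)))~~(§(§(r 1545623665067459146 (f
  29885823415842246195566165315512550227484722))~~(r 825849722857619506 (r 8946313 (n 4417
  (5477916900518696651893775422187566953609586~7030~7538~o))))~~o))))))~~tb20))))~~
  (§(§(§(§(§(§tb25))))))
def certTwo : T := r 188611978952710 (r 187100183928841 (n 4097 ((r 46853070954 (r 11182121 (n 5444
  ((r 47188639770 (r 35 (n 4113 tb1)))~~tb3))))~~(r 47077294094 (r 41001 (n 4113 ((r 11313224 (r 35
  (n 4116 ((r 765055216795754534 (n 9 tb5))~~tb6))))~~(r 12394920 (r 45801939113 (n 5457 ((r 1212488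
  (r 171 (n 29 ((r 3198221904285859621528 (r 11346009 (n 4096
  (3166921596218417441560148028386010136682~5068497794~34364806867470~15615498~15681034~16664074~
  16729610~(§(§(§(§25208330~25208330~25208330~25208330~o))))))))~~(r 357525782585738995944 (r
  191179071381559 (n 4126 (1590~(§1590~o)))))~~tb7))))~~(r 1192 (r 2219 (n 4177 ((r 65868562504 (r
  171 (n 73 (125642~269419921353266~10742450~2762~16103904567243317940486320~
  134421812074485190416730802~383377073485473842~2107934081104~46340866104~31414510386~(r 0 (f
  2318282676669608286271251255381612291282))~~2762~2762~1271523804082494835357991183458043954~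
  33331192090682034~2107931427000~46347157560~65770168630~690~2762~2762~84800346096280~
  199149891060400~8634063644590128~189840106815568~31414513328~31409801400~2762~2762~o))))~~(r
  32848040 (f 43469230879841169521104031811474666545785546))~~(r 32864424 (f
  1297925601469831621410688899702460328650))~~o))))~~(r 1192 (r 683 (n 4177 ((r 3922 (n 4096 ((r
  2786 (f 2537345548219116110377719931636677847903542))~~16122194364210892396659432~(r
  861582859818934346 (f 5284051416788206272927436524671743357543112))~~
  26431133555871154755646163656~(r 1077755641932718154 (f
  11795275343586586362728831469954945711375882))~~3936678308467385993240~(r 1149813235970646090 (f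
  14071327760631416837820260877394833979510282))~~28203018~28268554~29251594~29317130~32397322~
  32462858~33445898~33511434~o)))~~(r 32848040 (f 13679669555630084068337399696222386388264246))~~
  18598247780656241969365632535461365180204712~o))))~~(§(§(r 13284010 (r 9077417 (n 4433 ((r
  28654248 (f 35280676001957029653411152487168088086325962))~~(r 6998 (f
  13680061024837361655910325163557433931131594))~~40895584951510540539948589036495912320533048~
  o))))~~(r 432746521406072780655786661412920 (r 9077417 (n 32
  (7208138659571935976852293713605546945270~4496140046286992411762135358990270106538~o))))~~
  o))))))~~tb10))))~~(§(§tb26)))))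
def tc0 : T := (r 840100594622955534 (r 10616969 (n 4117 ((r 60988123655596558 (f
  512098605680147072092298176823856636838644))~~(r 54083651683131954318023073848 (r 2694843017 (n
  5392 ((r 3026 (f 13481862735059911593294941136554419298320820))~~4533418~14502954~(§(§13284010~
  12759594~o))))))~~(r 8794428188489266174904371768 (f
  3553760907822042110850344131572426411991128))~~(r 510266880 (f
  3378576200455037526990376865094658157399742))~~3085279415797872722154~2020550673140449150988~(r
  700415478025289752 (f 2275886527788366141881173021626085161779444))~~
  625057476286521831824951478365251600~(r 7968884258 (f
  16152037608366754834820707391302778949157620))~~4676375306083781183502~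
  (§(§(§(§(§(§(§431172310546464~540822791657472~111707192166050~8962867942068953680396~
  2279414701058165394~558414977701888~2287834761678890530~560208663418912~o)))))))))))~~(§(r
  39348931082524911576926302667276 (r 137 (n 2 ((r 33954243627628 (f
  3943399778450425348381437261116486910708))~~(r 212227075812215627302734668046862 (r
  152170926366727 (n 258 (52324549645~(§15168234124~6681037452~(§4880909~203858175814284~(§4156044~
  51273845260~51281715852~(§12116620~o))))))))~~(r 6820416148 (r 256498473164847 (n 4161
  (2177181885389553170071095948~977030~6979750~8941192~15789704~25723046~28506248~27820166~26180232~
  6848678~25749160~550536~25781896~o))))~~(§(r 1663470 (f 8293772800001929024223890146288))~~(r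
  569728582569176893458 (f 242099597801846460029061954304246768))~~(§(§(§(§(§(§(§(r
  753967148298575894 (f 214445463172258848171433104703886))~~(r 753817889595107858 (f
  3943397154733114293904472955000446707726))~~(§(r 8864500 (f 12176904039549252147397014))~~
  27908405518728~(r 8288520204 (f 2024434508808583666198315400))~~(§3233509729796337747980~
  o))))))))))))))~~(§(§(§(r 4169657858375707820046 (r 11004253603977 (n 4161 (21348505749768~
  (§9530094~7530646~(§15788278~25729696~2717864~(§3111048~7370920~7534728~(§7403656~o))))))))~~(r
  170862524792846 (r 2130057 (n 3 ((r 16441366 (f 743166857633099801630391777578404264))~~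
  680506426775669898225375774369030190~(§(§133487969099822~(r 46591933732911 (f
  9078836255322009971282801040168841157157))~~(r 696052989607241750 (f
  44149557859542549905938531060))~~(r 67377389614 (f 166139418009279523477553907974772))~~(r
  67377392014 (f 1294995143090691254532177189669103534))~~(r 33118799886 (f
  318210449514685745549740145066612))~~275977797689390~275981522231342~(§(§(§(§1129947623812286478~
  26145385998~10542575118~o))))))))))~~(§(r 39314825062450368476515698794 (r 2130057 (n 2 ((r 450582
  (f 712174517521308878391264970513408140))~~(r 7954926 (f 1201589734561573444729552536743657612))~~
  (§(§(§(§274224770017390~(r 450582 (f 3044135311301960839671224148346623584270))~~(r 452630 (f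
  10778680435342225459176052))~~(§1513676654606~(r 133455204108302 (f
  52183706658394977592853317741300))~~(§54056600470756053148330672144~(§(§(§(§139076547394455566~
  139162302860544012~(§o)))))))))))))))~~(§(§(§(§(§(§(§(§(§(§(§(r 551550792525971470 (r 2686584865
  (n 2 (15277285773~1850838742351216678~(§(§(§(§33218566~(§1000052~(§(§(§(§(§(§(§(§(§25196590~
  o))))))))))))))))))~~(r 556054392153341966 (r 34496086153 (n 4112 (66845296994410~205894088597550~
  (§(§136107018156~557488172384272~(§(§(§(§(§(§(r 8100 (f
  12481711654493320499993351493844018256953796))~~25518002~o))))))))))))~~(§(r 2276014777182488072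
  (f 2211466073188265320971478875512030405533294))~~o)))))))))))))))))
def tc1 : T := (r 210180505632782 (r 148306362066941815305 (n 448 ((r 195857690936075 (f
  882752321727931351043716109362528801))~~(r 29837449298313 (f 40390365110501210899211758377))~~(§(r
  231050461611403 (f 924391140500190074978424114369430785))~~(r 33476742832114188 (r
  226537502431257997 (n 192 (7375241~7932169~1786133~(§(§284336151174045049228~
  574656648374054865290~8018315~4305149088689934641546~1792395~(§(§1040348425561385354~
  175112565205386~o))))))))~~(r 62658265618 (r 56508876179 (n 769 (14708271~14880267~15076459~
  6438537~157670101290504~29539857~1164914175516145123344~29769225~113726143925768~31884395~o))))~~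
  (r 65204217005461 (f 11199111856131087638842462352649517))~~(§(§794954618267184523~(r
  450813251592585 (f 215511157361424735207703870218889))~~(r 51769783615611366716743393292 (r
  110095391629 (n 259 (213653~(§2062~8471444~(§2935596018245881129868~
  292198067651539490538584123418636~28006543~(§26141431~284658527727756823434~1075804523192174230~
  (§60502393362~o))))))))~~(r 31997783536976117120909221904 (r 452017559478537 (n 4225 (41476555136~
  68622539557640~4531325200~38763397536~5074782640~40516485504~109147324672~108172804480~
  135418773888~109145286536~o))))~~(r 485166847402771 (f 508657873881594027302888894815021))~~
  (§(§1843026281727852905~52686364833435008110058578059~(r 18060824610529565804497802 (f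
  80025219502230846548429475589774))~~(r 513590346941835 (f 589641056901352038449647011890099))~~(r
  478584644347285 (f 717298496173457197346262715890490643))~~(§(§2157708706844190099~
  2012468170397885941~o)))))))))))~~(§(§(§(r 1148628051125372940 (r 9044489 (n 2 ((r
  716276070178414702 (r 768049872632340527 (n 12 (9013883~(§6382098~6382098~(§2332691~
  69605632907465825735586301968~(§9626671757613855682414610~6382098~6382098~(§6382098~o))))))))~~
  (§(§(r 7593872910860 (f 661580046788752427263038724485083022))~~(r 253916689787404 (f
  39329016011684848398524938651664))~~(§(§(r 370729070 (f
  2574582385168412464807869664100402285046))~~(r 717936157077727246 (r 1924350098524397615 (n 13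
  (10988275~(§6382098~6382098~(§27990035~3119219~(§4176883~6382098~6382098~(§6382098~o))))))))~~(§(r
  2933317407281512931726 (f 1342683387873439403744840759934264584810))~~(§(§(§27352197325324~(r
  1663500 (f 201892788436650767401426429766126))~~(§(r 133515335098892 (f
  825728497527803309979466231975936628))~~(§(§(§o))))))))))))))))~~(§(§(§(§(§(§(§(r
  7269748915672424538126 (r 151743887344137 (n 2 ((r 2964 (f
  3376564965686821832694790929894577610758))~~(§(§113723906790566412~(§10437132~
  (§(§(§(§(§(§(§(§(§31489582~(§(§3721612~o))))))))))))))))))~~(r 620405798807420598476612254081038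
  (r 45676003849 (n 2 ((r 432549219879028 (f 234208117485930230000444229845484))~~(r 43198453989550
  (f 327997987509259841569613869977471082))~~(§(r 174573641853452 (f
  622317140615071829377720464647156))~~715053637021395468~3085701527622949847184~
  (§(§107067329265710~(§(§(§(§(§(§8006020555276~(§438547806442152460~2390802478~o))))))))))))))~~
  (§(r 9028209681114700218382 (r 2954517301491063095817 (n 2 ((r 767902529349651093 (f
  681533065737786531258108265947161251))~~(§2229491549236977806~(r 860892592504635916 (f
  11933539528634956089522698897134))~~(r 51311995404 (f 57168782820934617896420575636))~~
  (§9131999074524522922126~2231145764483022990~(§(§(§(§(§(§(§2228726425114952204~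
  3525664924881567924366~535359286984846~(§o))))))))))))))~~(§(§(§(r 860785079178264590 (r
  45676003849 (n 2 ((r 2301543139012829294 (f 10355510575570245141713158073220723730962))~~
  (§(§2301366761783648780~(r 562269436437004 (f 525597429821375858595804669889044))~~(§(r
  32479076876 (f 36341541643792254532258420))~~(§(§(§(§(§(§(§(§(§(§535453950329356~555246629734412~
  (§(§o)))))))))))))))))))~~o))))))))))))))
def tc2 : T := (r 3700 (r 9055267 (n 4352 ((r 4709317488785766818824 (f
  991775685617789257912880438250251422856))~~(r 609339227658167314 (r 222979741099011 (n 1027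
  (2930336271~(§7914124~16304780~(§9072653~32390072338~(§175109918763114~2700~2700~(§16304780~
  o))))))))~~(§(§(§(§(r 4116646504200329569288 (f 462194321794420956478019914825109100))~~(r
  4701229296114160706568 (f 2175887624766216065922965879793552916))~~(r 2371319765045306469387 (f
  2945913485186444823719455986624546475525))~~(§(§(r 7951694074345569723528 (f
  292428897321601284892842767976946))~~(r 2086573289563923474 (r 222256676481547 (n 3 ((r 2703 (f
  1164538992145356754967131219845900471))~~(§3107061~42756260492~42756260492~(§115792201740~
  115792726028~(§2672652~2672652~(§2672652~o))))))))~~(§(§(§(§(§(§33779075493318174865171464~(r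
  1757193568617016763410 (f 2291059393782591797800898926806093332))~~o))))))))))))))))~~(§(r
  16338548 (r 621719599748172821 (n 4352 ((r 191471431468034 (f 59153506711049395664516467401956))~~
  (§(§(§747675214946536450~(r 209755637720066 (f 130763973772113951322357206895202))~~(§4925955~
  (§1876362791250568200~(r 502313643320450 (f 660639487055058290954424040409809636))~~(§(r 4893323
  (f 17124041381565301906416265))~~(§(§(§(§1876409657933702152~2010189441540727810~(§(r
  69655953187946 (f 315307864398581902072035287850004))~~o)))))))))))))))~~(§(§(§(§(§(§(§(r 3594 (r
  17717403147 (n 4352 ((r 477452112463799305 (f 163041664617883413272107284053121))~~(§(§(r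
  183914430252178 (f 532982140370557633374833356266458740))~~(§(§(§(§(§(§301111311969344138~
  (§(§1942257762201819658~(§(§(§(§(§(§293374602535557642~o))))))))))))))))))))~~(r 3594 (r
  37048958475 (n 4608 ((r 4706519524327496404138 (f 5084082235053790719822482))~~
  (§4709317374600404182152~(r 897490953663753226 (r 2063961566650475523 (n 3 (11225751~(§7914124~
  7914124~(§25843725~27883533~(§25215727~7914124~7914124~(§7914124~o))))))))~~
  (§(§(§(§(§4707086429745635042312~2031766898200323080~(§2049218253374923912~2939728537236466121226~
  (§(§(§(§(§2938043202925739680776~284950138135689738~o))))))))))))))))~~(§(r 465130013459000842 (r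
  151853741030923 (n 4352 ((r 12392612866 (f 11965895801520765587641419754))~~(§(r
  609198352730898538 (f 3259678780173662925625250141108766191596))~~(§(§(§41796478444552~(r
  1001205686490145794 (f 163861224340242145487063202415084))~~(§457416303458954~508781920822402~
  (§(§(§(§490399403645450~4710685368799356560386~(§69671009565194~o))))))))))))))~~(§(§(§(r 15158794
  (r 535866064716917 (n 1792 (15340683~37065641123~(§13317261~(§(§(§12700103726964164412483213~
  14300165~(§354797415216661~(§(§(§o))))))))))))~~(§(§(§(§(§(§(§o)))))))))))))))))))
def certThree : T := r 187647121817611 (n 4096 ((r 3222024540702875131916 (r 757352955765596169 (n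
  4097 tc0)))~~(§(§(§(r 753254114930008076 (r 729592623626461193 (n 4097 ((r 3525811482233221472270
  (r 11176577 (n 4160 ((r 47960367370 (r 169 (n 4177 (13758630696~
  941954569767229179154027804439390408~14812840~7138856~1240736~1240744~(§(§(§(§25855520~6461608~
  6985896~6985896~o))))))))~~(§39240378018~(r 15419018 (f
  16619800251490168375876238145404435000639764))~~(§(r 16197258 (f
  14036275498521631449079068827555474493751668))~~(§(§(§(§107985156234~107716589738~(§109346072202~
  o)))))))))))~~(§(§(r 1056246982019940366 (r 37055267337 (n 2 ((r 12501014 (f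
  555648367619932631239733621696326546))~~(§(r 42755252748 (f 39031986150234535466245174781486))~~
  (§175097599937036~(r 46566236780719 (f 9076020732182692152764860026283626773127))~~(r
  606500103949600788 (f 70100681657799101679787533878))~~(r 51304818796 (f
  792759401615618180969037711619965932))~~(r 16978733070 (f 32067338474292693667756232977974))~~
  (§(§859131173803714572~(r 51304817164 (f 204299498633827836429540124225038))~~210144537788940~
  210180338049548~(§(§26142624140~26685784972~o))))))))))~~(§tc1)))))))~~(§(§(§(§(§(§(§(§(§(§(r
  2347783370770787409932 (r 774910190517636571145 (n 768 tc2)))~~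
  (§(§(§(§(§(§(§(§(§(§(§(§(§(§(§(§(§(§(§(§(§(§(§(§(§(r 9621833673249339438342156 (r
  3175803135884304310083593 (n 3 ((r 11182767 (n 4097 (9429420909531838734342~(r 2302106226438758510
  (f 10735803352452421892971128903990461418000))~~(§(§(§(§9429736085502013399046~(r 139663981863310
  (f 2620772930464387873540898133528504726))~~(§(§(§(§(§(§(§(§(§(§(§(§9421102122066390736902~
  o)))))))))))))))))))~~(§(r 11152015 (n 4097 ((r 63134543079982 (f
  158197085432715981141747900012))~~(§(§(§4169657821522840182790~(r 1130860119716880430 (f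
  119240774193897654517520870926))~~(§(r 572774544920600974 (f 18806815264687342470782956))~~
  (§(§(§(§(§(§(§(§(§(§9335785930725483798534~9324798590213284225070~(§o))))))))))))))))))~~(§(§(§(r
  176926685610487 (f 3528588042571870395052851109493487802919075))~~
  (§(§(§(§(§(§(§(§(§(§(§(§(§(§(§(§(§(§o))))))))))))))))))))))))))~~
  o))))))))))))))))))))))))))))))))))))))))

end

end T

section Soundness

local notation "IF(" c "," x "," y ")" => @Bool.rec (fun _ => Bool) y x c

/-! ### Evaluation of the checker's combinators -/

theorem if_eq_cond (c x y : Bool) : IF(c, x, y) = bif c then x else y := by cases c <;> rfl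

theorem hasBit_eq (x c : Nat) : hasBit x c = x.testBit c := by
  change Nat.beq ((x >>> c) &&& 1) 1 = (1 &&& (x >>> c) != 0)
  rw [Nat.and_comm 1, Nat.and_one_is_mod]
  rcases Nat.mod_two_eq_zero_or_one (x >>> c) with h | h <;> rw [h] <;> rfl

theorem digit_eq (q i : Nat) : digit q i = q / 4 ^ i % 4 := by
  change (q >>> (2 * i)) &&& 3 = _
  rw [show (3 : Nat) = 2 ^ 2 - 1 from rfl, Nat.and_two_pow_sub_one_eq_mod,
    Nat.shiftRight_eq_div_pow, pow_mul]
  rfl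

theorem digit_xor (p q i : Nat) : digit (p ^^^ q) i = digit p i ^^^ digit q i := by
  change ((p ^^^ q) >>> (2 * i)) &&& 3 = ((p >>> (2 * i)) &&& 3) ^^^ ((q >>> (2 * i)) &&& 3)
  rw [Nat.shiftRight_xor_distrib, Nat.and_xor_distrib_right]

/-- Repeat the block `x` of width `w` periodically, `2 ^ k` times. -/
def repeated (w x : Nat) : Nat → Nat
  | 0 => x
  | k + 1 => repeated w x k ||| repeated w x k <<< (w * 2 ^ k)

theorem testBit_repeated {w x : Nat} (hx : x < 2 ^ w) (k c : Nat) :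
    (repeated w x k).testBit c = (decide (c < w * 2 ^ k) && x.testBit (c % w)) := by
  induction k generalizing c with
  | zero =>
    by_cases h : c < w
    · simp [repeated, h, Nat.mod_eq_of_lt h]
    · simp [repeated, h, Nat.testBit_lt_two_pow
        (hx.trans_le (Nat.pow_le_pow_right two_pos (not_lt.1 h)))]
  | succ k ih =>
    rw [repeated, Nat.testBit_or, Nat.testBit_shiftLeft, ih, ih, pow_succ, ← mul_assoc]
    by_cases h : c < w * 2 ^ k
    · have : c < w * 2 ^ k * 2 := by omega
      simp [h, this, not_le.2 h]
    · have h2 : (c - w * 2 ^ k < w * 2 ^ k) ↔ c < w * 2 ^ k * 2 := by omega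
      have h3 : (c - w * 2 ^ k) % w = c % w := by
        conv_rhs => rw [← Nat.sub_add_cancel (not_lt.1 h), Nat.add_mul_mod_self_left]
      simp [h, h2, h3, not_lt.1 h]

theorem testBit_digitMask {i l c : Nat} (hi : i < 6) (hl : l < 4) (hc : c < 8192) :
    (digitMask i l).testBit c = decide (digit c i = l) := by
  have key : ∀ i < 6, ∀ l < 4, digitMask i l =
      repeated (4 ^ (i + 1)) ((2 ^ 4 ^ i - 1) <<< (l * 4 ^ i)) (11 - 2 * i) := by decide +kernel
  rw [key i hi l hl, testBit_repeated, Nat.testBit_shiftLeft, Nat.testBit_two_pow_sub_one, digit_eq,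
    ← Bool.decide_and, ← Bool.decide_and, decide_eq_decide]
  · interval_cases i <;> interval_cases l <;> norm_num <;> omega
  · rw [Nat.shiftLeft_eq, pow_succ 4 i]
    calc (2 ^ 4 ^ i - 1) * 2 ^ (l * 4 ^ i) < 2 ^ 4 ^ i * 2 ^ (l * 4 ^ i) :=
          Nat.mul_lt_mul_of_pos_right (Nat.sub_lt (by positivity) one_pos) (by positivity)
      _ = 2 ^ ((l + 1) * 4 ^ i) := by rw [← pow_add]; congr 1; ring
      _ ≤ _ := Nat.pow_le_pow_right two_pos
        (by nlinarith [Nat.pow_pos (n := i) (show 0 < 4 by decide)])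

/-! ### Sided words -/

/-- A word with letters in `ℤ/4`, tagged by the code it belongs to; also used for cells. -/
abbrev Wd := Bool × (Fin 6 → Fin 4)

/-- The index of a word. -/
def idx (x : Wd) : Nat :=
  x.2 0 + 4 * x.2 1 + 16 * x.2 2 + 64 * x.2 3 + 256 * x.2 4 + 1024 * x.2 5 +
    4096 * (if x.1 then 1 else 0)

theorem idx_lt (x : Wd) : idx x < 8192 := by
  unfold idx; split <;> omega

theorem digit_idx (x : Wd) (i : Fin 6) : digit (idx x) i = x.2 i := by
  rw [digit_eq, idx]
  fin_cases i <;> simp <;> split <;> omega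

theorem digit_idx_side (x : Wd) : digit (idx x) 6 = if x.1 then 1 else 0 := by
  rw [digit_eq, idx]
  split <;> omega

/-- The word with a given index. -/
def ofIdx (q : Nat) : Wd := (decide (4096 ≤ q),
  fun i => ⟨q / 4 ^ (i : Nat) % 4, Nat.mod_lt _ (by decide)⟩)

theorem idx_ofIdx {q : Nat} (h : q < 8192) : idx (ofIdx q) = q := by
  simp only [idx, ofIdx]
  norm_num
  split <;> omega

/-- Move a word to the other code. -/
def flip (x : Wd) : Wd := (!x.1, x.2)

theorem idx_flip (x : Wd) : (idx x + 4096) % 8192 = idx (flip x) := by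
  have := idx_lt x
  obtain ⟨b, f⟩ := x
  cases b <;> simp [idx, flip] at * <;> omega

/-- The word `x` covers the cell `y`. -/
def Covers (x y : Wd) : Prop := x.1 = y.1 ∧ ∀ i, y.2 i = x.2 i ∨ y.2 i = x.2 i + 1

def prodM (f : Nat → Nat → Nat) (q : Nat) : Nat :=
  loMask f (q &&& 63) &&& hiMask f (q >>> 6)

theorem testBit_sideMask (s c : Nat) :
    (sideMask s).testBit c = decide (4096 * s ≤ c ∧ c < 4096 * (s + 1)) := by
  rw [sideMask, show ∀ m n, Nat.shiftLeft m n = m <<< n from fun _ _ => rfl, Nat.mul_eq,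
    Nat.testBit_shiftLeft, Nat.testBit_two_pow_sub_one, ← Bool.decide_and, decide_eq_decide]
  omega

theorem testBit_sideMask_idx (b : Bool) (x : Wd) :
    (sideMask (if b then 1 else 0)).testBit (idx x) = true ↔ x.1 = b := by
  have hx : idx x = idx (false, x.2) + 4096 * (if x.1 then 1 else 0) := by simp [idx]
  have : idx (false, x.2) < 4096 := by simp [idx]; omega
  rw [testBit_sideMask, decide_eq_true_iff, hx]
  cases b <;> cases x.1 <;> simp <;> omega

theorem testBit_prodM (f : Nat → Nat → Nat) (y x : Wd) :
    (prodM f (idx y)).testBit (idx x) = true ↔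
      x.1 = y.1 ∧ ∀ i : Fin 6, (f i (y.2 i)).testBit (idx x) = true := by
  have lo : ∀ i < 3, digit (idx y &&& 63) i = digit (idx y) i := by
    intro i hi
    rw [digit_eq, digit_eq, show (63 : Nat) = 2 ^ 6 - 1 from rfl, Nat.and_two_pow_sub_one_eq_mod]
    interval_cases i <;> omega
  have hi : ∀ i < 4, digit (idx y >>> 6) i = digit (idx y) (i + 3) := by
    intro i hi
    rw [digit_eq, digit_eq, Nat.shiftRight_eq_div_pow]
    interval_cases i <;> omega
  have d := digit_idx y
  change ((f 0 _ &&& (f 1 _ &&& f 2 _)) &&& (sideMask _ &&& (f 3 _ &&& (f 4 _ &&& f 5 _)))).testBit _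
    = true ↔ _
  simp only [lo, hi, Nat.testBit_and, Bool.and_eq_true, Fin.forall_fin_succ, Nat.reduceLT,
    Nat.reduceAdd, digit_idx_side, testBit_sideMask_idx]
  have d0 := d 0; have d1 := d 1; have d2 := d 2; have d3 := d 3; have d4 := d 4; have d5 := d 5
  simp only [Fin.isValue, Fin.val_zero, Fin.val_one, Fin.val_two] at d0 d1 d2
  change digit (idx y) 3 = _ at d3
  change digit (idx y) 4 = _ at d4
  change digit (idx y) 5 = _ at d5
  rw [d0, d1, d2, d3, d4, d5]
  constructor
  · rintro ⟨⟨h0, h1, h2⟩, h, h3, h4, h5⟩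
    exact ⟨h, h0, h1, h2, h3, h4, h5, fun i => i.elim0⟩
  · rintro ⟨h, h0, h1, h2, h3, h4, h5, -⟩
    exact ⟨⟨h0, h1, h2⟩, h, h3, h4, h5⟩

theorem testBit_digitMask_idx {i : Fin 6} {l : Nat} (hl : l < 4) (x : Wd) :
    (digitMask i l).testBit (idx x) = true ↔ (x.2 i : Nat) = l := by
  rw [testBit_digitMask i.2 hl (idx_lt x), digit_idx, decide_eq_true_iff]

theorem testBit_coverMask (i : Fin 6) (l : Fin 4) (x : Wd) :
    (coverMask i l).testBit (idx x) = true ↔ l = x.2 i ∨ l = x.2 i + 1 := by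
  change (digitMask i l ||| digitMask i ((l + 3) &&& 3)).testBit _ = true ↔ _
  rw [Nat.testBit_or, Bool.or_eq_true, testBit_digitMask_idx l.2,
    testBit_digitMask_idx (Nat.lt_succ_of_le Nat.and_le_right)]
  generalize x.2 i = m
  revert l m
  decide

theorem testBit_cellMask (i : Fin 6) (l : Fin 4) (x : Wd) :
    (cellMask i l).testBit (idx x) = true ↔ x.2 i = l ∨ x.2 i = l + 1 := by
  change (digitMask i l ||| digitMask i ((l + 1) &&& 3)).testBit _ = true ↔ _
  rw [Nat.testBit_or, Bool.or_eq_true, testBit_digitMask_idx l.2,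
    testBit_digitMask_idx (Nat.lt_succ_of_le Nat.and_le_right)]
  generalize x.2 i = m
  revert l m
  decide

theorem testBit_full (x : Wd) : full.testBit (idx x) = true := by
  rw [full, Nat.testBit_two_pow_sub_one]
  exact decide_eq_true (idx_lt x)

theorem testBit_nonOppMask (i : Fin 6) (l : Fin 4) (x : Wd) :
    (nonOppMask i l).testBit (idx x) = true ↔ x.2 i ≠ l + 2 := by
  change (full ^^^ digitMask i (l ^^^ 2)).testBit _ = true ↔ _
  have hl : (l : Nat) ^^^ 2 < 4 := Nat.xor_lt_two_pow (n := 2) l.2 (by decide)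
  have h := testBit_digitMask_idx (i := i) hl x
  rw [Nat.testBit_xor, testBit_full]
  simp only [Bool.true_xor, Bool.not_eq_true', ← Bool.not_eq_true, h]
  generalize x.2 i = m
  clear hl h
  revert l m
  decide

theorem testBit_cover (x y : Wd) :
    (prodM coverMask (idx y)).testBit (idx x) = true ↔ Covers x y := by
  simp only [testBit_prodM, testBit_coverMask, Covers]

theorem testBit_cell (x y : Wd) :
    (prodM cellMask (idx x)).testBit (idx y) = true ↔ Covers x y := by
  simp only [testBit_prodM, testBit_cellMask, Covers, eq_comm (a := y.1)]

theorem testBit_nonOpp (x y : Wd) :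
    (prodM nonOppMask (idx x)).testBit (idx y) = true ↔ y.1 = x.1 ∧ ∀ i, y.2 i ≠ x.2 i + 2 := by
  simp only [testBit_prodM, testBit_nonOppMask]

/-! ### Pairs of codes -/

def Opp (x y : Wd) : Prop := ∃ i, y.2 i = x.2 i + 2

def Twin (x y : Wd) : Prop := ∃ j, y.2 j = x.2 j + 2 ∧ ∀ i ≠ j, y.2 i = x.2 i

/-- The number of words of the first code with letter `l` at position `i`. -/
def letterCount (G : Finset Wd) (i : Fin 6) (l : Fin 4) : ℕ :=
  (G.filter fun x => x.1 = false ∧ x.2 i = l).card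

/-- `G` is the disjoint union of two equivalent codes of at most twelve words, without twin pairs
and without exceptional positions, in which non-dichotomous words of different codes differ in more
than `t` positions. -/
structure Good (t : ℕ) (G : Finset Wd) : Prop where
  card_le : ∀ b, (G.filter fun x => x.1 = b).card ≤ 12
  opp : ∀ x ∈ G, ∀ y ∈ G, x.1 = y.1 → x ≠ y → Opp x y
  not_twin : ∀ x ∈ G, ∀ y ∈ G, x.1 = y.1 → ¬ Twin x y
  far : ∀ x ∈ G, ∀ y ∈ G, x.1 ≠ y.1 → ¬ Opp x y →
    t < (Finset.univ.filter fun i => y.2 i ≠ x.2 i).card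
  cover : ∀ x ∈ G, ∀ y, Covers x y → ∃ x' ∈ G, Covers x' (flip y)
  regular : ∀ i, ∀ p q : Fin 4, q = p + 1 →
    ¬ (letterCount G i p = 5 ∧ letterCount G i (p + 2) = 5 ∧
      letterCount G i q = 1 ∧ letterCount G i (q + 2) = 1)

/-- A xor-difference of indices that is excluded for two words of a good family. -/
def Excluded (t p : ℕ) : Prop :=
  (digit p 6 = 0 ∧ ∃ j : Fin 6, digit p j = 2 ∧ ∀ i : Fin 6, i ≠ j → digit p i = 0) ∨
    (digit p 6 = 1 ∧ (∀ i : Fin 6, digit p i ≠ 2) ∧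
      (Finset.univ.filter fun i : Fin 6 => digit p i ≠ 0).card ≤ t)

theorem excluded_of_mem_bans0 : ∀ p ∈ bans0, Excluded 0 p := by
  unfold Excluded
  decide +kernel

theorem excluded_of_mem_bans1 : ∀ p ∈ bans1, Excluded 1 p := by
  unfold Excluded
  decide +kernel

theorem excluded_of_mem_bans2 : ∀ p ∈ bans2, Excluded 2 p := by
  unfold Excluded
  decide +kernel

theorem digit_idx_xor (x y : Wd) (i : Fin 6) :
    digit (idx x ^^^ idx y) i = (x.2 i : ℕ) ^^^ (y.2 i : ℕ) := by
  rw [digit_xor, digit_idx, digit_idx]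

theorem Good.not_excluded {t : ℕ} {G : Finset Wd} (hG : Good t G) {x y : Wd} (hx : x ∈ G)
    (hy : y ∈ G) : ¬ Excluded t (idx x ^^^ idx y) := by
  have two : ∀ a b : Fin 4, (a : ℕ) ^^^ (b : ℕ) = 2 ↔ b = a + 2 := by decide
  have zero : ∀ a b : Fin 4, (a : ℕ) ^^^ (b : ℕ) = 0 ↔ b = a := by decide
  have side : digit (idx x ^^^ idx y) 6 = if x.1 = y.1 then 0 else 1 := by
    rw [digit_xor, digit_idx_side, digit_idx_side]
    cases x.1 <;> cases y.1 <;> rfl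
  unfold Excluded
  simp only [digit_idx_xor, two, zero, side, ne_eq]
  rintro (⟨h, j, hj, hi⟩ | ⟨h, ho, hc⟩)
  · exact hG.not_twin x hx y hy (by by_contra h'; simp [h'] at h) ⟨j, hj, hi⟩
  · exact absurd (hG.far x hx y hy (by rintro h'; simp [h'] at h) fun ⟨i, hi⟩ => ho i hi)
      (not_lt.2 hc)

theorem Covers.eq_of_good {t : ℕ} {G : Finset Wd} (hG : Good t G) {x x' y : Wd} (hx : x ∈ G)
    (hx' : x' ∈ G) (h : Covers x y) (h' : Covers x' y) : x = x' := by
  by_contra hne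
  obtain ⟨i, hi⟩ := hG.opp x hx x' hx' (h.1.trans h'.1.symm) hne
  have := h.2 i
  have h2 := h'.2 i
  rw [hi] at h2
  revert this h2
  generalize x.2 i = a
  generalize y.2 i = b
  revert a b
  decide

/-! ### Permuting positions -/

/-- Exchange two positions. -/
def swapWd (i j : Fin 6) (x : Wd) : Wd := (x.1, x.2 ∘ Equiv.swap i j)

theorem swapWd_swapWd (i j : Fin 6) (x : Wd) : swapWd i j (swapWd i j x) = x := by
  simp [swapWd, Function.comp_def]

theorem swapWd_injective (i j : Fin 6) : Function.Injective (swapWd i j) :=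
  Function.LeftInverse.injective (swapWd_swapWd i j)

theorem swapWd_eq_self {i j : Fin 6} {x : Wd} (h : x.2 i = x.2 j) : swapWd i j x = x := by
  refine Prod.ext rfl (funext fun k => ?_)
  change x.2 (Equiv.swap i j k) = x.2 k
  rcases eq_or_ne k i with rfl | hi
  · rw [Equiv.swap_apply_left, h]
  rcases eq_or_ne k j with rfl | hj
  · rw [Equiv.swap_apply_right, h]
  rw [Equiv.swap_apply_of_ne_of_ne hi hj]

theorem covers_swapWd {i j : Fin 6} {x y : Wd} (h : Covers x y) :
    Covers (swapWd i j x) (swapWd i j y) := ⟨h.1, fun _ => h.2 _⟩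

theorem opp_swapWd {i j : Fin 6} {x y : Wd} : Opp (swapWd i j x) (swapWd i j y) ↔ Opp x y :=
  (Equiv.swap i j).exists_congr fun _ => Iff.rfl

theorem Good.image_swapWd {t : ℕ} {G : Finset Wd} (hG : Good t G) (i j : Fin 6) :
    Good t (G.image (swapWd i j)) := by
  have card_filter : ∀ (p : Wd → Prop) [DecidablePred p],
      ((G.image (swapWd i j)).filter p).card = (G.filter fun x => p (swapWd i j x)).card := by
    intro p _
    rw [Finset.filter_image, Finset.card_image_of_injective _ (swapWd_injective i j)]
  have count : ∀ k l, letterCount (G.image (swapWd i j)) k l =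
      letterCount G (Equiv.swap i j k) l := fun k l => card_filter _
  refine ⟨fun b => (card_filter _).trans_le (hG.card_le b), ?_, ?_, ?_, ?_, ?_⟩
  · simp only [Finset.forall_mem_image]
    exact fun x hx y hy h hne => opp_swapWd.2 (hG.opp x hx y hy h fun e => hne (e ▸ rfl))
  · simp only [Finset.forall_mem_image]
    rintro x hx y hy h ⟨k, hk, hne⟩
    refine hG.not_twin x hx y hy h ⟨Equiv.swap i j k, hk, fun m hm => ?_⟩
    have := hne (Equiv.swap i j m) fun e => hm (by rw [← e, Equiv.swap_apply_self])
    simpa [swapWd] using this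
  · simp only [Finset.forall_mem_image]
    intro x hx y hy h ho
    refine (hG.far x hx y hy h fun h => ho (opp_swapWd.2 h)).trans_eq ?_
    exact Finset.card_equiv (Equiv.swap i j) fun k => by
      rw [Finset.mem_filter, Finset.mem_filter]
      simp [swapWd]
  · simp only [Finset.forall_mem_image, Finset.exists_mem_image]
    intro x hx y hy
    have := covers_swapWd (i := i) (j := j) hy
    rw [swapWd_swapWd] at this
    obtain ⟨x', hx', h⟩ := hG.cover x hx _ this
    refine ⟨x', hx', ?_⟩
    have h := covers_swapWd (i := i) (j := j) h
    rwa [show swapWd i j (flip (swapWd i j y)) = flip y from swapWd_swapWd i j (flip y)] at h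
  · intro k p q hq
    simp only [count]
    exact hG.regular _ p q hq

theorem idx_swapWd_lt {i j : Fin 6} {x : Wd} (hij : i < j) (h : x.2 i < x.2 j) :
    idx (swapWd i j x) < idx x := by
  have h' : (x.2 i : ℕ) < x.2 j := h
  unfold idx swapWd
  fin_cases i <;> fin_cases j <;> first
    | exact absurd hij (by decide)
    | (simp [Equiv.swap_apply_def] at h' ⊢; omega)

/-! ### Soundness of the checker -/

/-- `G` is a good family containing the words of `R`. -/
def Extends (t : ℕ) (R : List Wd) (G : Finset Wd) : Prop := Good t G ∧ ∀ x ∈ R, x ∈ G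

/-- The state `s` describes the choice of the words of `R`. -/
structure Inv (t : ℕ) (s : St) (R : List Wd) : Prop where
  words : s.P = R.map idx
  nodup : R.Nodup
  avail : ∀ G, Extends t R G → ∀ x ∈ G, x ∉ R → s.A.testBit (idx x) = true
  not_avail : ∀ x ∈ R, s.A.testBit (idx x) = false
  covered : ∀ y, s.C.testBit (idx y) = true ↔ ∃ x ∈ R, Covers x y
  needed : ∀ y, s.D.testBit (idx y) = true ↔ ∃ x ∈ R, Covers x (flip y)
  count_false : s.m0 = R.countP fun x => x.1 = false
  count_true : s.m1 = R.countP fun x => x.1 = true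
  sym : ∀ e ∈ s.E, e.1 < e.2 ∧ e.2 < 6 ∧ ∀ x ∈ R, digit (idx x) e.1 = digit (idx x) e.2

theorem inv_init (t : ℕ) : Inv t init [] where
  words := rfl
  nodup := List.nodup_nil
  avail _ _ x _ _ := testBit_full x
  not_avail := by simp
  covered y := by simp [init]
  needed y := by simp [init]
  count_false := rfl
  count_true := rfl
  sym e he := by
    have : ∀ e ∈ swapPairs, e.1 < e.2 ∧ e.2 < 6 := by decide
    exact ⟨(this e he).1, (this e he).2, by simp⟩

theorem keepEq_eq (w : ℕ) (E : List (ℕ × ℕ)) (k : List (ℕ × ℕ) → Bool) :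
    keepEq w E k = k (E.filter fun e => Nat.beq (digit w e.1) (digit w e.2)) := by
  induction E generalizing k with
  | nil => rfl
  | cons e E ih =>
    change IF(Nat.beq (digit w e.1) (digit w e.2), keepEq w E fun E => k (e :: E), keepEq w E k) = _
    rw [if_eq_cond, ih, ih, List.filter_cons]
    cases Nat.beq (digit w e.1) (digit w e.2) <;> rfl

theorem skip_eq_false {w : ℕ} {E : List (ℕ × ℕ)} :
    skip w E = false ↔ ∀ e ∈ E, digit w e.2 ≤ digit w e.1 := by
  induction E with
  | nil => simp [show skip w [] = false from rfl]
  | cons e E ih =>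
    rw [List.forall_mem_cons, ← ih, ← Nat.ble_eq]
    change IF(Nat.ble (digit w e.2) (digit w e.1), skip w E, true) = false ↔ _
    rw [if_eq_cond]
    cases Nat.ble (digit w e.2) (digit w e.1) <;> simp

theorem testBit_killMask (w a c : ℕ) (ps : List ℕ) :
    (killMask w ps a).testBit c = true ↔ a.testBit c = true ∨ ∃ p ∈ ps, w ^^^ p = c := by
  induction ps generalizing a with
  | nil => simp [show killMask w [] a = a from rfl]
  | cons p ps ih =>
    change (killMask w ps (a ||| 1 <<< (w ^^^ p))).testBit c = true ↔ _
    rw [ih, Nat.testBit_or, Nat.one_shiftLeft, Nat.testBit_two_pow]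
    simp [or_assoc]

/-- The state after choosing the word of index `w`. -/
def putSt (ps : List ℕ) (w : ℕ) (s : St) : St :=
  ⟨s.t * 8209 + w, w :: s.P, s.A ^^^ (s.A &&& killMask w ps (prodM nonOppMask w)),
    s.C ||| prodM cellMask w, s.D ||| prodM cellMask ((w + 4096) % 8192), s.m0 + (1 - w >>> 12),
    s.m1 + w >>> 12, s.E.filter fun e => Nat.beq (digit w e.1) (digit w e.2), s.Q0, s.Q1⟩

theorem put_eq (ps : List ℕ) (w : ℕ) (s : St) (k : St → Bool) :
    put ps w s k = k (putSt ps w s) :=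
  keepEq_eq w s.E _

theorem idx_shiftRight (x : Wd) : idx x >>> 12 = if x.1 then 1 else 0 := by
  rw [Nat.shiftRight_eq_div_pow, idx]
  split <;> omega

theorem Inv.put {t : ℕ} {s : St} {R : List Wd} (h : Inv t s R) {ps : List ℕ}
    (hps : ∀ p ∈ ps, Excluded t p) {x : Wd} (hx : s.A.testBit (idx x) = true) :
    Inv t (putSt ps (idx x) s) (x :: R) where
  words := congrArg (idx x :: ·) h.words
  nodup := List.nodup_cons.2 ⟨fun hR => by simp [h.not_avail x hR] at hx, h.nodup⟩
  avail G hG y hy hyR := by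
    rw [List.mem_cons, not_or] at hyR
    have hxG : x ∈ G := hG.2 x List.mem_cons_self
    have hA := h.avail G ⟨hG.1, fun z hz => hG.2 z (List.mem_cons_of_mem _ hz)⟩ y hy hyR.2
    have : ¬ (killMask (idx x) ps (prodM nonOppMask (idx x))).testBit (idx y) = true := by
      rw [testBit_killMask, testBit_nonOpp]
      rintro (⟨hs, ho⟩ | ⟨p, hp, e⟩)
      · obtain ⟨i, hi⟩ := hG.1.opp x hxG y hy hs.symm (Ne.symm hyR.1)
        exact ho i hi
      · refine hG.1.not_excluded hxG hy ?_
        rw [← e, ← Nat.xor_assoc, Nat.xor_self, Nat.zero_xor]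
        exact hps p hp
    simp only [putSt, Nat.testBit_xor, Nat.testBit_and, hA, Bool.eq_false_iff.2 this]
    rfl
  not_avail y hy := by
    simp only [putSt, Nat.testBit_xor, Nat.testBit_and]
    rcases List.mem_cons.1 hy with rfl | hy
    · have : (killMask (idx y) ps (prodM nonOppMask (idx y))).testBit (idx y) = true := by
        rw [testBit_killMask, testBit_nonOpp]
        have : ∀ a : Fin 4, a ≠ a + 2 := by decide
        exact .inl ⟨rfl, fun i => this _⟩
      simp [this]
    · simp [h.not_avail y hy]
  covered y := by
    simp only [putSt, Nat.testBit_or, Bool.or_eq_true, h.covered, testBit_cell, List.mem_cons,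
      exists_eq_or_imp]
    exact or_comm
  needed y := by
    have : Covers (flip x) y ↔ Covers x (flip y) := by
      unfold Covers flip
      cases x.1 <;> cases y.1 <;> simp
    simp only [putSt, Nat.testBit_or, Bool.or_eq_true, h.needed, idx_flip, testBit_cell,
      List.mem_cons, exists_eq_or_imp, this]
    exact or_comm
  count_false := by
    rw [List.countP_cons, ← h.count_false, putSt, idx_shiftRight]
    cases x.1 <;> rfl
  count_true := by
    rw [List.countP_cons, ← h.count_true, putSt, idx_shiftRight]
    cases x.1 <;> rfl
  sym e he := by
    obtain ⟨he, hx⟩ := List.mem_filter.1 he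
    obtain ⟨h1, h2, h3⟩ := h.sym e he
    exact ⟨h1, h2, List.forall_mem_cons.2 ⟨Nat.eq_of_beq_eq_true hx, h3⟩⟩

theorem Inv.setQ {t : ℕ} {s : St} {R : List Wd} (h : Inv t s R) (sd : ℕ) (Q : List ℕ) :
    Inv t (setQ s sd Q) R := by
  cases sd <;> exact ⟨h.1, h.2, h.3, h.4, h.5, h.6, h.7, h.8, h.9⟩

theorem testBit_uncovered (C D c : ℕ) :
    (uncovered C D).testBit c = true ↔ D.testBit c = true ∧ C.testBit c = false := by
  change ((C ||| D) ^^^ C).testBit c = true ↔ _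
  rw [Nat.testBit_xor, Nat.testBit_or]
  cases C.testBit c <;> cases D.testBit c <;> decide

theorem flip_flip (x : Wd) : flip (flip x) = x := by simp [flip]

theorem Inv.exists_cover {t : ℕ} {s : St} {R : List Wd} (h : Inv t s R) {y : Wd}
    (hy : (uncovered s.C s.D).testBit (idx y) = true) {G : Finset Wd} (hG : Extends t R G) :
    ∃ x ∈ G, Covers x y ∧ x ∉ R ∧ (prodM coverMask (idx y) &&& s.A).testBit (idx x) = true := by
  obtain ⟨hD, hC⟩ := (testBit_uncovered _ _ _).1 hy
  obtain ⟨z, hz, hzy⟩ := (h.needed y).1 hD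
  obtain ⟨x, hx, hxy⟩ := hG.1.cover z (hG.2 z hz) _ hzy
  rw [flip_flip] at hxy
  have hxR : x ∉ R := fun hR => by simp [(h.covered y).2 ⟨x, hR, hxy⟩] at hC
  refine ⟨x, hx, hxy, hxR, ?_⟩
  rw [Nat.testBit_and, (testBit_cover x y).2 hxy, h.avail G hG x hx hxR]
  rfl

/-- Every good extension of `R` has `N - l` further words on side `b` among those of `used`. -/
def Picked (t : ℕ) (R : List Wd) (b : Bool) (N l used : ℕ) : Prop :=
  ∀ G, Extends t R G → ∃ K ⊆ G, K.card + l = N ∧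
    ∀ x ∈ K, x ∉ R ∧ x.1 = b ∧ used.testBit (idx x) = true

section Gather

variable {t : ℕ} {s : St} {R : List Wd} {b : Bool} {N tg : ℕ}

theorem tryCell_sound (h : Inv t s R) {l used c : ℕ} {no : Bool} {yes : ℕ → Bool}
    (hc : tryCell tg (uncovered s.C s.D &&& sideMask (if b then 1 else 0)) s.A used c no yes = true)
    (hp : Picked t R b N (l + 1) used) :
    no = true ∨ (∀ G, ¬ Extends t R G) ∨
      ∃ used', yes used' = true ∧ Picked t R b N l used' := by
  change IF(Nat.ble c 8191,
    IF(hasBit (uncovered s.C s.D &&& sideMask (if b then 1 else 0)) c,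
      IF(Nat.beq (prodM coverMask c &&& s.A) 0, true,
        IF(Nat.beq (prodM coverMask c &&& s.A &&& used) 0,
          yes (used ||| (prodM coverMask c &&& s.A)), no)), no), no) = true at hc
  simp only [if_eq_cond] at hc
  by_cases hno : no = true
  · exact .inl hno
  rw [Bool.not_eq_true] at hno
  subst hno
  simp only [Bool.cond_eq_true_distrib, Bool.cond_false_right, Bool.and_eq_true, Nat.ble_eq,
    hasBit_eq, Nat.testBit_and] at hc
  obtain ⟨hlt, ⟨hU, hb⟩, hc⟩ := hc
  obtain ⟨y, rfl⟩ : ∃ y, idx y = c := ⟨_, idx_ofIdx (Nat.lt_succ_of_le hlt)⟩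
  rw [testBit_sideMask_idx] at hb
  right
  cases h0 : Nat.beq (prodM coverMask (idx y) &&& s.A) 0 with
  | true =>
    left
    intro G hG
    obtain ⟨x, -, -, -, hx⟩ := h.exists_cover hU hG
    rw [Nat.eq_of_beq_eq_true h0, Nat.zero_testBit] at hx
    cases hx
  | false =>
    right
    simp only [h0] at hc
    obtain ⟨hd, hc⟩ := hc
    refine ⟨_, hc, fun G hG => ?_⟩
    obtain ⟨K, hK, hcard, hKp⟩ := hp G hG
    obtain ⟨x, hxG, hxy, hxR, hx⟩ := h.exists_cover hU hG
    have hxK : x ∉ K := fun hxK => by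
      have := congrArg (fun n => n.testBit (idx x)) (Nat.eq_of_beq_eq_true hd)
      simp only [Nat.testBit_and _ used, hx, (hKp x hxK).2.2, Nat.zero_testBit] at this
      cases this
    refine ⟨insert x K, Finset.insert_subset hxG hK, ?_, ?_⟩
    · rw [Finset.card_insert_of_notMem hxK]
      omega
    · intro z hz
      rw [Nat.testBit_or]
      rcases Finset.mem_insert.1 hz with rfl | hz
      · exact ⟨hxR, hxy.1.trans hb, by rw [hx, Bool.or_true]⟩
      · exact ⟨(hKp z hz).1, (hKp z hz).2.1, by rw [(hKp z hz).2.2, Bool.true_or]⟩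

theorem packOld_sound (h : Inv t s R) {k : ℕ → ℕ → List ℕ → Bool} (Q : List ℕ) {l used : ℕ}
    {L : List ℕ} (hk : packOld tg (uncovered s.C s.D &&& sideMask (if b then 1 else 0)) s.A k Q
      l used L = true) (hp : Picked t R b N l used) :
    (∀ G, ¬ Extends t R G) ∨ ∃ l used L, k l used L = true ∧ Picked t R b N l used := by
  induction Q generalizing l used L with
  | nil => exact .inr ⟨l, used, L, hk, hp⟩
  | cons c Q ih =>
    cases l with
    | zero => exact .inr ⟨0, used, L, hk, hp⟩
    | succ l =>
      rcases tryCell_sound h hk hp with hk | hG | ⟨used, hk, hp⟩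
      exacts [ih hk hp, .inl hG, ih hk hp]

theorem packNew_sound (h : Inv t s R) {k : ℕ → ℕ → List ℕ → Bool} {Q : List ℕ} {l used z base : ℕ}
    {L : List ℕ} (hk : packNew tg (uncovered s.C s.D &&& sideMask (if b then 1 else 0)) s.A base Q k
      l z used L = true) (hp : Picked t R b N l used) :
    (∀ G, ¬ Extends t R G) ∨ ∃ l used L, k l used L = true ∧ Picked t R b N l used := by
  induction l generalizing z used L with
  | zero => exact .inr ⟨0, used, L, hk, hp⟩
  | succ l ih =>
    change IF(Nat.beq z 0, packOld tg _ s.A k Q (l + 1) used L,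
      tryCell tg _ s.A used ((z &&& 4095) ^^^ base) false fun used => packNew tg _ s.A base Q k l
        (z >>> 12) used (((z &&& 4095) ^^^ base) :: L)) = true at hk
    rw [if_eq_cond] at hk
    cases hz : Nat.beq z 0 <;> simp only [hz, cond_true, cond_false] at hk
    · rcases tryCell_sound h hk hp with hk | hG | ⟨used, hk, hp⟩
      exacts [absurd hk Bool.false_ne_true, .inl hG, ih hk hp]
    · exact packOld_sound h Q hk hp

theorem gather_sound (h : Inv t s R) {k : ℕ → ℕ → List ℕ → Bool} {Q : List ℕ} {m lim z : ℕ}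
    (hk : gather s m (if b then 1 else 0) lim z Q k = true) :
    (∀ G, ¬ Extends t R G) ∨
      ∃ l used L, k l used L = true ∧ Picked t R b (lim - m) l used :=
  packNew_sound h hk fun _ _ => ⟨∅, Finset.empty_subset _, by simp, by simp⟩

end Gather

theorem Inv.sel_count {t : ℕ} {s : St} {R : List Wd} (h : Inv t s R) (b : Bool) :
    sel s.m0 s.m1 (if b then 1 else 0) = (R.toFinset.filter fun x => x.1 = b).card := by
  have : (R.toFinset.filter fun x => x.1 = b) = (R.filter fun x => x.1 = b).toFinset := by
    ext; simp
  rw [this, List.toFinset_card_of_nodup (h.nodup.filter _),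
    ← List.countP_eq_length_filter]
  cases b
  · exact h.count_false
  · exact h.count_true

theorem Extends.side_eq {t : ℕ} {R : List Wd} {G K : Finset Wd} {b : Bool} {n : ℕ}
    (hG : Extends t R G) (hK : K ⊆ G) (hKR : ∀ x ∈ K, x ∉ R ∧ x.1 = b) (hn : 12 ≤ n)
    (hcard : K.card = n - (R.toFinset.filter fun x => x.1 = b).card) :
    n = 12 ∧ ∀ x ∈ G, x ∉ R → x.1 = b → x ∈ K := by
  have hsub : K ∪ R.toFinset.filter (fun x => x.1 = b) ⊆ G.filter fun x => x.1 = b := by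
    refine Finset.union_subset (fun x hx => Finset.mem_filter.2 ⟨hK hx, (hKR x hx).2⟩) fun x hx => ?_
    rw [Finset.mem_filter, List.mem_toFinset] at hx
    exact Finset.mem_filter.2 ⟨hG.2 x hx.1, hx.2⟩
  have hdis : Disjoint K (R.toFinset.filter fun x => x.1 = b) := by
    rw [Finset.disjoint_left]
    intro x hx hxR
    rw [Finset.mem_filter, List.mem_toFinset] at hxR
    exact (hKR x hx).1 hxR.1
  have hle := Finset.card_le_card hsub
  have h12 := hG.1.card_le b
  rw [Finset.card_union_of_disjoint hdis] at hle
  refine ⟨by omega, fun x hx hxR hxb => ?_⟩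
  have hmem : x ∈ K ∪ R.toFinset.filter (fun x => x.1 = b) := by
    rw [Finset.eq_of_subset_of_card_le hsub
      (by rw [Finset.card_union_of_disjoint hdis]; omega)]
    exact Finset.mem_filter.2 ⟨hx, hxb⟩
  rcases Finset.mem_union.1 hmem with h | h
  · exact h
  · exact absurd (List.mem_toFinset.1 (Finset.mem_filter.1 h).1) hxR

theorem count_eq {R : List Wd} (hR : R.Nodup) (i : Fin 6) (l : Fin 4) :
    count i l (R.map idx) = (R.toFinset.filter fun x => x.1 = false ∧ x.2 i = l).card := by
  have side (x : Wd) : Nat.ble (idx x) 4095 = !x.1 := by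
    rw [Bool.eq_iff_iff, Nat.ble_eq, idx]
    cases x.1 <;> simp <;> omega
  have hcount : count i l (R.map idx) = R.countP fun x => x.1 = false ∧ x.2 i = l := by
    clear hR
    induction R with
    | nil => rfl
    | cons x R ih =>
      rw [List.countP_cons, ← ih]
      change @Bool.rec (fun _ => ℕ) (count i l (R.map idx)) (count i l (R.map idx) + 1)
        (Nat.ble (idx x) 4095 && Nat.beq (digit (idx x) i) l) = _
      have : (Nat.ble (idx x) 4095 && Nat.beq (digit (idx x) i) l) =
          decide (x.1 = false ∧ x.2 i = l) := by
        rw [side, digit_idx, Bool.eq_iff_iff]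
        cases x.1 <;> simp [Fin.ext_iff]
      rw [this]
      cases decide (x.1 = false ∧ x.2 i = l) <;> rfl
  have hfilter : (R.toFinset.filter fun x => x.1 = false ∧ x.2 i = l) =
      (R.filter fun x => x.1 = false ∧ x.2 i = l).toFinset := by
    ext; simp
  rw [hcount, hfilter, List.toFinset_card_of_nodup (hR.filter _), ← List.countP_eq_length_filter]

theorem exists_of_exceptional {P L : List ℕ} (h : exceptional P L = true) :
    ∃ i ∈ L, pattern P i 5 1 = true ∨ pattern P i 1 5 = true := by
  induction L with
  | nil => cases h
  | cons i L ih =>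
    change IF(pattern P i 5 1, true, IF(pattern P i 1 5, true, exceptional P L)) = true at h
    rw [if_eq_cond, if_eq_cond] at h
    cases h1 : pattern P i 5 1 with
    | true => exact ⟨i, List.mem_cons_self, .inl h1⟩
    | false =>
      cases h2 : pattern P i 1 5 with
      | true => exact ⟨i, List.mem_cons_self, .inr h2⟩
      | false =>
        rw [h1, h2] at h
        obtain ⟨j, hj, h⟩ := ih h
        exact ⟨j, List.mem_cons_of_mem _ hj, h⟩

theorem pattern_spec {P : List ℕ} {i x y : ℕ} (h : pattern P i x y = true) :
    count i 0 P = x ∧ count i 2 P = x ∧ count i 1 P = y ∧ count i 3 P = y := by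
  simp only [pattern, Bool.and_eq_true, Nat.beq_eq] at h
  tauto

theorem exceptional_sound {t : ℕ} {s : St} {R : List Wd} (h : Inv t s R) (hm : s.m0 = 12)
    (he : exceptional s.P [0, 1, 2, 3, 4, 5] = true) (G : Finset Wd) : ¬ Extends t R G := by
  intro hG
  have hcard := h.sel_count false
  have hmem := (hG.side_eq (b := false) (n := 12) (Finset.empty_subset G) (by simp) le_rfl
    (by rw [← hcard]; simp [sel, hm])).2
  have hcount (i : Fin 6) (l : Fin 4) : count i l s.P = letterCount G i l := by
    rw [h.words, count_eq h.nodup, letterCount]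
    congr 1
    ext x
    rw [Finset.mem_filter, Finset.mem_filter, List.mem_toFinset]
    refine and_congr_left fun hx => ⟨hG.2 x, fun hxG => ?_⟩
    by_contra hxR
    exact Finset.notMem_empty _ (hmem x hxG hxR hx.1)
  obtain ⟨i, hi, hpat⟩ := exists_of_exceptional he
  have hi : i < 6 := by
    revert i
    simp
  have h0 := hcount ⟨i, hi⟩ 0
  have h1 := hcount ⟨i, hi⟩ 1
  have h2 := hcount ⟨i, hi⟩ 2
  have h3 := hcount ⟨i, hi⟩ 3
  rcases hpat with hp | hp <;> obtain ⟨c0, c2, c1, c3⟩ := pattern_spec hp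
  · exact hG.1.regular ⟨i, hi⟩ 0 1 rfl ⟨h0.symm.trans c0, h2.symm.trans c2, h1.symm.trans c1,
      h3.symm.trans c3⟩
  · exact hG.1.regular ⟨i, hi⟩ 1 2 rfl ⟨h1.symm.trans c1, h3.symm.trans c3, h2.symm.trans c2,
      h0.symm.trans c0⟩

/-- If some good extension of `R` covers the cell `y`, then one covers it by a word that is not
skipped: take the word of least index. -/
theorem exists_not_skip {t : ℕ} {s : St} {R : List Wd} (h : Inv t s R) {y : Wd} {G : Finset Wd}
    (hG : Extends t R G) {x : Wd} (hx : x ∈ G) (hxy : Covers x y) :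
    ∃ G, Extends t R G ∧ ∃ x ∈ G, Covers x y ∧
      skip (idx x) (s.E.filter fun e => Nat.beq (digit (idx y) e.1) (digit (idx y) e.2)) = false := by
  induction hn : idx x using Nat.strong_induction_on generalizing x G with
  | _ n ih =>
    subst hn
    by_contra hcon
    have hs : ¬ skip (idx x)
        (s.E.filter fun e => Nat.beq (digit (idx y) e.1) (digit (idx y) e.2)) = false :=
      fun hs => hcon ⟨G, hG, x, hx, hxy, hs⟩
    rw [skip_eq_false] at hs
    push Not at hs
    obtain ⟨⟨a, b⟩, he, hlt⟩ := hs
    obtain ⟨he, hey⟩ := List.mem_filter.1 he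
    obtain ⟨hab, hb, hR⟩ := h.sym _ he
    have hey := Nat.eq_of_beq_eq_true hey
    simp only at hab hb hR hey hlt
    obtain ⟨i, rfl⟩ : ∃ i : Fin 6, (i : ℕ) = a := ⟨⟨a, hab.trans hb⟩, rfl⟩
    obtain ⟨j, rfl⟩ : ∃ j : Fin 6, (j : ℕ) = b := ⟨⟨b, hb⟩, rfl⟩
    simp only [digit_idx, ← Fin.ext_iff] at hR hey hlt
    have hcov := covers_swapWd (i := i) (j := j) hxy
    rw [swapWd_eq_self hey] at hcov
    refine hcon (ih _ (idx_swapWd_lt hab hlt) ⟨hG.1.image_swapWd i j, fun z hz => ?_⟩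
      (Finset.mem_image_of_mem _ hx) hcov rfl)
    exact Finset.mem_image.2 ⟨z, hG.2 z hz, swapWd_eq_self (hR z hz)⟩

theorem Inv.restrict {t : ℕ} {s : St} {R : List Wd} (h : Inv t s R) {b : Bool} {used : ℕ}
    (hp : Picked t R b (12 - sel s.m0 s.m1 (if b then 1 else 0)) 0 used) :
    Inv t (withA s (s.A &&& (used ||| sideMask (1 - if b then 1 else 0)))) R where
  words := h.words
  nodup := h.nodup
  avail G hG x hx hxR := by
    obtain ⟨K, hK, hcard, hKp⟩ := hp G hG
    rw [h.sel_count] at hcard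
    have hmem := (hG.side_eq hK (fun x hx => ⟨(hKp x hx).1, (hKp x hx).2.1⟩) le_rfl hcard).2
    have hside : (1 - if b then 1 else 0) = if !b then 1 else 0 := by cases b <;> rfl
    simp only [withA, Nat.testBit_and, Nat.testBit_or, h.avail G hG x hx hxR, hside, Bool.true_and,
      Bool.or_eq_true, testBit_sideMask_idx]
    by_cases hb : x.1 = b
    · exact .inl (hKp x (hmem x hx hxR hb)).2.2
    · exact .inr (Bool.eq_not_of_ne hb)
  not_avail x hx := by
    simp [withA, h.not_avail x hx]
  covered := h.covered
  needed := h.needed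
  count_false := h.count_false
  count_true := h.count_true
  sym := h.sym

theorem exists_side (z : ℕ) : ∃ b : Bool, z &&& 1 = if b then 1 else 0 := by
  rw [Nat.and_one_is_mod]
  rcases Nat.mod_two_eq_zero_or_one z with h | h
  · exact ⟨false, h⟩
  · exact ⟨true, h⟩

theorem testBit_drop {X w c : ℕ} (h : X.testBit c = true) (hne : c ≠ w) :
    (X ^^^ 1 <<< w).testBit c = true := by
  rw [Nat.testBit_xor, h, Nat.one_shiftLeft, Nat.testBit_two_pow, decide_eq_false hne.symm]
  rfl

theorem chk_sound {t : ℕ} {ps : List ℕ} (hps : ∀ p ∈ ps, Excluded t p) (c : T) :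
    ∀ {s : St} {R : List Wd} {F : List (ℕ × ℕ)} {X : ℕ}, Inv t s R → chk ps c s F X = true →
      ∀ G, Extends t R G → ∀ x ∈ G, X.testBit (idx x) = true → skip (idx x) F = true := by
  induction c with
  | o =>
    intro s R F X _ hc G _ x _ hX
    rw [Nat.eq_of_beq_eq_true hc, Nat.zero_testBit] at hX
    cases hX
  | kid body sib ihb ihs =>
    intro s R F X h hc G hG x hx hX
    obtain ⟨w, hc⟩ : ∃ w, IF(hasBit s.A w, IF(put ps w s fun s' => chk ps body s' [] (1 <<< w),
      chk ps sib s F (X ^^^ 1 <<< w), false), false) = true := ⟨_, hc⟩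
    simp only [if_eq_cond, Bool.cond_false_right, Bool.and_eq_true, hasBit_eq, put_eq] at hc
    obtain ⟨hA, hbody, hsib⟩ := hc
    by_cases hw : idx x = w
    · subst hw
      have := ihb (h.put hps hA) hbody G ⟨hG.1, List.forall_mem_cons.2 ⟨hx, hG.2⟩⟩ x hx (by
        rw [Nat.one_shiftLeft, Nat.testBit_two_pow_self])
      cases this
    · exact ihs h hsib G hG x hx (testBit_drop hX hw)
  | s sib ih =>
    intro s R F X h hc G hG x hx hX
    obtain ⟨w, hc⟩ : ∃ w, IF(skip w F, chk ps sib s F (X ^^^ 1 <<< w), false) = true := ⟨_, hc⟩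
    simp only [if_eq_cond, Bool.cond_false_right, Bool.and_eq_true] at hc
    by_cases hw : idx x = w
    · rw [hw, hc.1]
    · exact ih h hc.2 G hG x hx (testBit_drop hX hw)
  | r z body ih =>
    intro s R F X h hc G hG x hx hX
    obtain ⟨b, hb⟩ := exists_side z
    change gather s (sel s.m0 s.m1 (z &&& 1)) (z &&& 1) 12 z (sel s.Q0 s.Q1 (z &&& 1))
      (fun l used L => @Nat.rec (fun _ => Bool)
        (chk ps body (setQ (withA s (s.A &&& (used ||| sideMask (1 - (z &&& 1))))) (z &&& 1) L) F X)
        (fun _ _ => chk ps body (setQ s (z &&& 1) L) F X) l) = true at hc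
    rw [hb] at hc
    obtain hno | ⟨l, used, L, hc, hp⟩ := gather_sound h hc
    · exact absurd hG (hno G)
    · cases l with
      | zero => exact ih ((h.restrict hp).setQ _ _) hc G hG x hx hX
      | succ l => exact ih (h.setQ _ _) hc G hG x hx hX
  | f z =>
    intro s R F X h hc G hG x hx hX
    obtain ⟨b, hb⟩ := exists_side z
    change gather s (sel s.m0 s.m1 (z &&& 1)) (z &&& 1) 13 z (sel s.Q0 s.Q1 (z &&& 1))
      (fun l _ _ => Nat.beq l 0) = true at hc
    rw [hb] at hc
    obtain hno | ⟨l, used, L, hc, hp⟩ := gather_sound h hc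
    · exact absurd hG (hno G)
    · obtain rfl := Nat.eq_of_beq_eq_true hc
      obtain ⟨K, hK, hcard, hKp⟩ := hp G hG
      rw [h.sel_count] at hcard
      have := (hG.side_eq hK (fun x hx => ⟨(hKp x hx).1, (hKp x hx).2.1⟩) (by decide) hcard).1
      cases this
  | n c kids ih =>
    intro s R F X h hc G hG x hx hX
    change IF(Nat.ble c 8191 && hasBit (uncovered s.C s.D) c, keepEq c s.E fun F =>
      chk ps kids s F (prodM coverMask c &&& s.A), false) = true at hc
    simp only [if_eq_cond, Bool.cond_false_right, Bool.and_eq_true, hasBit_eq, keepEq_eq,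
      Nat.ble_eq] at hc
    obtain ⟨⟨hlt, hU⟩, hc⟩ := hc
    obtain ⟨y, rfl⟩ : ∃ y, idx y = c := ⟨_, idx_ofIdx (Nat.lt_succ_of_le hlt)⟩
    obtain ⟨x', hx', hxy, -⟩ := h.exists_cover hU hG
    obtain ⟨G', hG', x', hx', hxy, hs⟩ := exists_not_skip h hG hx' hxy
    obtain ⟨z, hz, hzy, -, hbit⟩ := h.exists_cover hU hG'
    obtain rfl := hxy.eq_of_good hG'.1 hx' hz hzy
    exact absurd (ih h hc G' hG' x' hx' hbit) (by simp [hs])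
  | d =>
    intro s R F X h hc G hG x hx hX
    change (Nat.beq s.m0 12 && exceptional s.P [0, 1, 2, 3, 4, 5]) = true at hc
    rw [Bool.and_eq_true] at hc
    exact absurd hG (exceptional_sound h (Nat.eq_of_beq_eq_true hc.1) hc.2 G)

theorem root_sound {t : ℕ} {ps : List ℕ} (hps : ∀ p ∈ ps, Excluded t p) {k : St → Bool}
    {P : List Wd} {s : St} {R : List Wd} (h : Inv t s R)
    (hk : root ps (P.map idx) k s = true) (hav : ∀ x ∈ P, x ∉ R)
    (hP : P.Nodup) {G : Finset Wd} (hG : Extends t R G) (hPG : ∀ x ∈ P, x ∈ G) :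
    ∃ s R, Inv t s R ∧ k s = true ∧ Extends t R G := by
  induction P generalizing s R with
  | nil => exact ⟨s, R, h, hk, hG⟩
  | cons x P ih =>
    obtain ⟨hxP, hP⟩ := List.nodup_cons.1 hP
    obtain ⟨hx, hPG⟩ := List.forall_mem_cons.1 hPG
    obtain ⟨hxR, hav⟩ := List.forall_mem_cons.1 hav
    change put ps (idx x) s (fun s => root ps (P.map idx) k s) = true at hk
    rw [put_eq] at hk
    refine ih (h.put hps (h.avail G hG x hx hxR)) hk (fun y hy => ?_) hP
      ⟨hG.1, List.forall_mem_cons.2 ⟨hx, hG.2⟩⟩ hPG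
    rw [List.mem_cons, not_or]
    exact ⟨fun e => hxP (e ▸ hy), hav y hy⟩

theorem not_good_of_chk {t : ℕ} {ps : List ℕ} (hps : ∀ p ∈ ps, Excluded t p) {c : T} {P : List Wd}
    (hc : root ps (P.map idx) (fun s => chk ps c s [] 1) init = true) (hP : P.Nodup)
    {G : Finset Wd} (hG : Good t G) (hPG : ∀ x ∈ P, x ∈ G) : (false, 0) ∉ G := by
  intro h0
  obtain ⟨s, R, h, hk, hGR⟩ := root_sound hps (inv_init t) hc (by simp) hP ⟨hG, by simp⟩ hPG
  exact Bool.false_ne_true (chk_sound hps c h hk G hGR _ h0 (by decide))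

theorem card_side_eq {G : Finset Wd}
    (hopp : ∀ x ∈ G, ∀ y ∈ G, x.1 = y.1 → x ≠ y → Opp x y)
    (hcover : ∀ x ∈ G, ∀ y, Covers x y → ∃ x' ∈ G, Covers x' (flip y)) (b : Bool) :
    (G.filter fun x => x.1 = b).card = (G.filter fun x => x.1 = !b).card := by
  let cells (b : Bool) : Finset (Fin 6 → Fin 4) :=
    (G.filter fun x => x.1 = b).biUnion fun x => Fintype.piFinset fun i => {x.2 i, x.2 i + 1}
  have mem_cells (b : Bool) (y : Fin 6 → Fin 4) : y ∈ cells b ↔ ∃ x ∈ G, Covers x (b, y) := by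
    simp [cells, Covers, and_assoc]
  have card_cells (b : Bool) : (cells b).card = (G.filter fun x => x.1 = b).card * 64 := by
    have card_two : ∀ p : Fin 4, ({p, p + 1} : Finset (Fin 4)).card = 2 := by decide
    rw [Finset.card_biUnion, Finset.sum_const_nat]
    · intro x _
      simp [Fintype.card_piFinset, card_two]
    · intro x hx y hy hne
      rw [Finset.mem_coe, Finset.mem_filter] at hx hy
      obtain ⟨i, hi⟩ := hopp x hx.1 y hy.1 (hx.2.trans hy.2.symm) hne
      refine Finset.disjoint_left.2 fun z hz hz' => ?_
      have h := Fintype.mem_piFinset.1 hz i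
      have h' := Fintype.mem_piFinset.1 hz' i
      rw [hi] at h'
      revert h h'
      generalize x.2 i = p
      generalize z i = q
      revert p q
      decide
  have sub (b : Bool) : cells b ⊆ cells (!b) := by
    intro y hy
    obtain ⟨x, hx, hxy⟩ := (mem_cells b y).1 hy
    exact (mem_cells _ y).2 (hcover x hx _ hxy)
  have h : cells b = cells (!b) := (sub b).antisymm (by simpa using sub (!b))
  have := congrArg Finset.card h
  rw [card_cells, card_cells] at this
  omega

end Soundness

/-! ### Verification of the certificates -/

theorem chk_distance_one : root bans0 [0, 4097] (fun s => chk bans0 T.certOne s [] 1) init = true := by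
  decide +kernel

theorem chk_distance_two : root bans1 [0, 4101] (fun s => chk bans1 T.certTwo s [] 1) init = true := by
  decide +kernel

theorem chk_distance_three : root bans2 [0] (fun s => chk bans2 T.certThree s [] 1) init = true := by
  decide +kernel

/-! ### Encoding codes over a four-letter alphabet -/

section Encoding

variable {c : S → S}

theorem exists_letter_equiv (hinv : Function.Involutive c) (hfix : ∀ s, c s ≠ s) {a b : S}
    (hS : ∀ s : S, s = a ∨ s = c a ∨ s = b ∨ s = c b) {p q : S} (hqp : q ≠ p) (hqp' : q ≠ c p) :
    ∃ e : S ≃ Fin 4, (∀ s, e (c s) = e s + 2) ∧ e p = 0 ∧ e q = 1 := by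
  have hp := hinv p
  have hq := hinv q
  have hpq : p ≠ c q := fun h => hqp' (by rw [h, hinv])
  have hcc : c p ≠ c q := fun h => hqp (hinv.injective h).symm
  have hfun : ∀ k, ![p, q, c p, c q] (k + 2) = c (![p, q, c p, c q] k) := by
    intro k
    fin_cases k <;> simp [hp, hq]
  have hinj : Function.Injective ![p, q, c p, c q] := by
    intro i j h
    have := hfix p
    have := hfix q
    fin_cases i <;> fin_cases j <;> first | rfl | (simp at h; grind)
  have hsurj : Function.Surjective ![p, q, c p, c q] := by
    intro s
    have : s = p ∨ s = q ∨ s = c p ∨ s = c q := by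
      have := hinv a
      have := hinv b
      rcases hS p with h | h | h | h <;> rcases hS q with h' | h' | h' | h' <;>
        rcases hS s with h'' | h'' | h'' | h'' <;> grind
    rcases this with rfl | rfl | rfl | rfl
    exacts [⟨0, rfl⟩, ⟨1, rfl⟩, ⟨2, rfl⟩, ⟨3, rfl⟩]
  let f := Equiv.ofBijective _ ⟨hinj, hsurj⟩
  refine ⟨f.symm, fun s => ?_, f.symm_apply_eq.2 rfl, f.symm_apply_eq.2 rfl⟩
  rw [Equiv.symm_apply_eq]
  refine ((hfun _).trans (congrArg c ?_)).symm
  exact f.apply_symm_apply s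

/-- Encode a word, after permuting its positions by `σ`. -/
def encode (e : Fin 6 → S ≃ Fin 4) (σ : Equiv.Perm (Fin 6)) :
    (Fin 6 → S) ≃ (Fin 6 → Fin 4) :=
  (Equiv.arrowCongr σ.symm (Equiv.refl S)).trans (Equiv.piCongrRight e)

theorem encode_apply (e : Fin 6 → S ≃ Fin 4) (σ : Equiv.Perm (Fin 6)) (v : Fin 6 → S) (k : Fin 6) :
    encode e σ v k = e k (v (σ k)) := rfl

theorem exists_encode (hinv : Function.Involutive c) (hfix : ∀ s, c s ≠ s) {a b : S} (hba : b ≠ a)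
    (hba' : b ≠ c a) (hS : ∀ s : S, s = a ∨ s = c a ∨ s = b ∨ s = c b) [DecidableEq S]
    {v w : Fin 6 → S} (hvw : ¬ Dicho c v w) :
    ∃ (e : Fin 6 → S ≃ Fin 4) (σ : Equiv.Perm (Fin 6)), (∀ k s, e k (c s) = e k s + 2) ∧
      encode e σ v = 0 ∧ encode e σ w = fun k : Fin 6 =>
        if (k : ℕ) < (Finset.univ.filter fun i => w i ≠ v i).card then 1 else 0 := by
  have hother : ∀ p : S, ∃ q, q ≠ p ∧ q ≠ c p := by
    intro p
    have := hinv a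
    rcases hS p with rfl | rfl | rfl | rfl
    · exact ⟨b, hba, hba'⟩
    · exact ⟨b, hba', by rwa [this]⟩
    · exact ⟨a, hba.symm, fun h => hba' (by rw [h, hinv])⟩
    · exact ⟨a, fun h => hba' (by rw [h, hinv]), by rw [hinv]; exact hba.symm⟩
  set D := Finset.univ.filter fun i => w i ≠ v i with hD
  have mem_D : ∀ i, i ∈ D ↔ w i ≠ v i := by simp [hD]
  have hcard : Fintype.card {k : Fin 6 // (k : ℕ) < D.card} = Fintype.card {i // i ∈ D} := by
    rw [Fintype.card_coe, Fintype.card_subtype]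
    have : D.card ≤ 6 := card_finset_fin_le D
    interval_cases D.card <;> rfl
  let ε := Fintype.equivOfCardEq hcard
  have hex : ∀ k : Fin 6, ∃ e : S ≃ Fin 4, (∀ s, e (c s) = e s + 2) ∧
      e (v (ε.extendSubtype k)) = 0 ∧
      e (w (ε.extendSubtype k)) = if (k : ℕ) < D.card then 1 else 0 := by
    intro k
    by_cases hk : (k : ℕ) < D.card
    · have hmem := ε.extendSubtype_mem k hk
      rw [mem_D] at hmem
      obtain ⟨e, h, h0, h1⟩ := exists_letter_equiv hinv hfix hS hmem fun h => hvw ⟨_, h⟩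
      exact ⟨e, h, h0, by rw [h1, if_pos hk]⟩
    · have hmem := ε.extendSubtype_not_mem k hk
      rw [mem_D, not_not] at hmem
      obtain ⟨q, hq, hq'⟩ := hother (v (ε.extendSubtype k))
      obtain ⟨e, h, h0, -⟩ := exists_letter_equiv hinv hfix hS hq hq'
      exact ⟨e, h, h0, by rw [hmem, h0, if_neg hk]⟩
  choose e he h0 h1 using hex
  exact ⟨e, ε.extendSubtype, he, funext h0, funext h1⟩

open Classical in
/-- The family of encoded words of `V` and `W`. -/
noncomputable def family (φ : (Fin 6 → S) ≃ (Fin 6 → Fin 4)) (V W : Set (Fin 6 → S)) : Finset Wd :=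
  Finset.univ.filter fun x => φ.symm x.2 ∈ cond x.1 W V

theorem mem_family {φ : (Fin 6 → S) ≃ (Fin 6 → Fin 4)} {V W : Set (Fin 6 → S)} {b : Bool}
    {v : Fin 6 → S} : (b, φ v) ∈ family φ V W ↔ v ∈ cond b W V := by
  simp [family]

theorem forall_mem_family {φ : (Fin 6 → S) ≃ (Fin 6 → Fin 4)} {V W : Set (Fin 6 → S)}
    {p : Wd → Prop} : (∀ x ∈ family φ V W, p x) ↔ ∀ b, ∀ v ∈ cond b W V, p (b, φ v) := by
  constructor
  · exact fun h b v hv => h _ (mem_family.2 hv)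
  · rintro h ⟨b, x⟩ hx
    obtain ⟨v, rfl⟩ := φ.surjective x
    exact h b v (mem_family.1 hx)

theorem card_filter_family {φ : (Fin 6 → S) ≃ (Fin 6 → Fin 4)} {V W : Set (Fin 6 → S)}
    (p : Wd → Prop) [DecidablePred p] :
    ((family φ V W).filter fun x => x.1 = false ∧ p x).card =
      {v | v ∈ V ∧ p (false, φ v)}.ncard := by
  have hinj : Function.Injective fun v => ((false, φ v) : Wd) :=
    fun v w h => φ.injective (congrArg Prod.snd h)
  rw [← Set.ncard_image_of_injective _ hinj, ← Set.ncard_coe_finset]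
  congr 1
  ext ⟨b, x⟩
  obtain ⟨v, rfl⟩ := φ.surjective x
  simp only [Finset.coe_filter, Set.mem_ofPred_eq, mem_family, Set.mem_image, Prod.mk.injEq,
    EmbeddingLike.apply_eq_iff_eq]
  constructor
  · rintro ⟨hv, rfl, hp⟩
    exact ⟨v, ⟨hv, hp⟩, rfl, rfl⟩
  · rintro ⟨v', ⟨hv, hp⟩, rfl, rfl⟩
    exact ⟨hv, rfl, hp⟩

theorem good_family (hinv : Function.Involutive c) {a b : S}
    (hS : ∀ s : S, s = a ∨ s = c a ∨ s = b ∨ s = c b) {V W : Set (Fin 6 → S)}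
    (hV : PolyboxCode c V) (hW : PolyboxCode c W) (heq : EquivCodes c V W)
    (hVt : NoTwinPair c V) (hWt : NoTwinPair c W)
    (hdist : ∀ i : Fin 6,
      ¬ ((Subcode V i a).ncard = 5 ∧ (Subcode V i (c a)).ncard = 5 ∧
          (Subcode V i b).ncard = 1 ∧ (Subcode V i (c b)).ncard = 1) ∧
      ¬ ((Subcode V i a).ncard = 1 ∧ (Subcode V i (c a)).ncard = 1 ∧
          (Subcode V i b).ncard = 5 ∧ (Subcode V i (c b)).ncard = 5))
    (hle : V.ncard ≤ 12) [DecidableEq S] {t : ℕ}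
    (hfar : ∀ v ∈ V, ∀ w ∈ W, ¬ Dicho c v w → t < (Finset.univ.filter fun i => w i ≠ v i).card)
    {e : Fin 6 → S ≃ Fin 4} (σ : Equiv.Perm (Fin 6)) (he : ∀ k s, e k (c s) = e k s + 2) :
    Good t (family (encode e σ) V W) := by
  have hkey : ∀ k (u v : Fin 6 → S),
      encode e σ v k = encode e σ u k + 2 ↔ v (σ k) = c (u (σ k)) := by
    intro k u v
    rw [encode_apply, encode_apply, ← he, EmbeddingLike.apply_eq_iff_eq]
  have hopp : ∀ b b' (u v : Fin 6 → S), Opp (b, encode e σ u) (b', encode e σ v) ↔ Dicho c u v := by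
    intro b b' u v
    exact σ.exists_congr fun k => hkey k u v
  have hdich : ∀ x ∈ family (encode e σ) V W, ∀ y ∈ family (encode e σ) V W,
      x.1 = y.1 → x ≠ y → Opp x y := by
    simp only [forall_mem_family, hopp]
    rintro b u hu _ v hv rfl hne
    have huv : u ≠ v := fun h => hne (by rw [h])
    cases b
    · exact hV u hu v hv huv
    · exact hW u hu v hv huv
  have hcover : ∀ x ∈ family (encode e σ) V W, ∀ y, Covers x y →
      ∃ x' ∈ family (encode e σ) V W, Covers x' (flip y) := by
    simp only [forall_mem_family]
    rintro b v hv ⟨_, y⟩ ⟨rfl, hy⟩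
    let pt : Fin 6 → Set S := fun i =>
      {s | y (σ.symm i) = e (σ.symm i) s ∨ y (σ.symm i) = e (σ.symm i) s + 1}
    have hpt : ∀ u, pt ∈ Realize c u ↔
        ∀ k, y k = encode e σ u k ∨ y k = encode e σ u k + 1 := by
      intro u
      constructor
      · intro h k
        have := (h (σ k)).2
        simpa [pt, encode_apply] using this
      · intro h i
        refine ⟨fun s => ?_, ?_⟩
        · have : ∀ p q : Fin 4, Xor (p = q ∨ p = q + 1) (p = q + 2 ∨ p = q + 2 + 1) := by
            unfold Xor
            decide
          change Xor (s ∈ pt i) (c s ∈ pt i)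
          simpa only [pt, Set.mem_ofPred_eq, he] using this _ _
        · simpa [encode_apply, pt] using h (σ.symm i)
    have hmem : pt ∈ RealizeSet c (cond b W V) := Set.mem_biUnion hv ((hpt v).2 hy)
    have hflip : pt ∈ RealizeSet c (cond (!b) W V) := by
      cases b
      · exact heq ▸ hmem
      · exact heq.symm ▸ hmem
    obtain ⟨u, hu, hpu⟩ := Set.mem_iUnion₂.1 hflip
    exact ⟨(!b, encode e σ u), mem_family.2 hu, rfl, (hpt u).1 hpu⟩
  refine ⟨?_, hdich, ?_, ?_, hcover, ?_⟩
  · have hfalse : ((family (encode e σ) V W).filter fun x => x.1 = false).card ≤ 12 := by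
      have := card_filter_family (φ := encode e σ) (V := V) (W := W) fun _ => True
      simp only [and_true, Set.ofPred_mem_eq] at this
      rwa [this]
    rintro (_ | _)
    · exact hfalse
    · rwa [card_side_eq hdich hcover]
  · simp only [forall_mem_family]
    rintro b u hu _ v hv rfl ⟨k, hk, hne⟩
    have htwin : TwinPair c u v := by
      refine ⟨σ k, (hkey k u v).1 hk, fun i hi => ?_⟩
      have := hne (σ.symm i) fun h => hi (by rw [← h, Equiv.apply_symm_apply])
      simpa [encode_apply] using this
    cases b
    · exact hVt u hu v hv htwin
    · exact hWt u hu v hv htwin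
  · simp only [forall_mem_family, hopp]
    have hcard : ∀ u v : Fin 6 → S,
        (Finset.univ.filter fun k => encode e σ v k ≠ encode e σ u k).card =
        (Finset.univ.filter fun i => v i ≠ u i).card := fun u v =>
      Finset.card_equiv σ fun k => by
        rw [Finset.mem_filter, Finset.mem_filter]
        simp [encode_apply]
    have hsymm : ∀ u v : Fin 6 → S, Dicho c u v → Dicho c v u := by
      rintro u v ⟨j, hj⟩
      exact ⟨j, by rw [hj, hinv]⟩
    intro b u hu b' v hv hne hd
    rw [hcard]
    cases b <;> cases b'
    · exact absurd rfl hne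
    · exact hfar u hu v hv hd
    · simp only [ne_comm (a := v _)]
      exact hfar v hv u hu fun h => hd (hsymm _ _ h)
    · exact absurd rfl hne
  · rintro k p _ rfl
    have hcount : ∀ l, letterCount (family (encode e σ) V W) k l =
        (Subcode V (σ k) ((e k).symm l)).ncard := by
      intro l
      refine (card_filter_family _).trans ?_
      simp only [encode_apply, Subcode, Equiv.eq_symm_apply]
    have htwo : ∀ l, (e k).symm (l + 2) = c ((e k).symm l) := by
      intro l
      rw [Equiv.symm_apply_eq, he, Equiv.apply_symm_apply]
    simp only [hcount, htwo]
    have hne : (e k).symm (p + 1) ≠ (e k).symm p ∧ (e k).symm (p + 1) ≠ c ((e k).symm p) := by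
      rw [← htwo, ne_eq, ne_eq, EmbeddingLike.apply_eq_iff_eq, EmbeddingLike.apply_eq_iff_eq]
      revert p
      decide
    obtain ⟨h1, h2⟩ := hdist (σ k)
    have ha := hinv a
    have hb := hinv b
    rcases hS ((e k).symm p) with h | h | h | h <;>
      rcases hS ((e k).symm (p + 1)) with h' | h' | h' | h' <;>
      rw [h, h'] at hne ⊢ <;> grind

theorem twelve_lt_ncard (hinv : Function.Involutive c) (hfix : ∀ s, c s ≠ s) {a b : S}
    (hba : b ≠ a) (hba' : b ≠ c a) (hS : ∀ s : S, s = a ∨ s = c a ∨ s = b ∨ s = c b)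
    {V W : Set (Fin 6 → S)} (hVne : V.Nonempty) (hV : PolyboxCode c V) (hW : PolyboxCode c W)
    (hdisj : Disjoint V W) (heq : EquivCodes c V W)
    (hVt : NoTwinPair c V) (hWt : NoTwinPair c W)
    (hdist : ∀ i : Fin 6,
      ¬ ((Subcode V i a).ncard = 5 ∧ (Subcode V i (c a)).ncard = 5 ∧
          (Subcode V i b).ncard = 1 ∧ (Subcode V i (c b)).ncard = 1) ∧
      ¬ ((Subcode V i a).ncard = 1 ∧ (Subcode V i (c a)).ncard = 1 ∧
          (Subcode V i b).ncard = 5 ∧ (Subcode V i (c b)).ncard = 5)) :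
    12 < V.ncard := by
  classical
  by_contra hlt
  have good {t : ℕ} := good_family (t := t) hinv hS hV hW heq hVt hWt hdist (not_lt.1 hlt)
  have h0 : ∀ v ∈ V, ∀ w ∈ W, ¬ Dicho c v w →
      0 < (Finset.univ.filter fun i => w i ≠ v i).card := by
    intro v hv w hw _
    by_contra h
    rw [Nat.pos_iff_ne_zero, not_not, Finset.card_eq_zero, Finset.filter_eq_empty_iff] at h
    have : w = v := funext fun i => not_not.1 (h (Finset.mem_univ i))
    exact Set.disjoint_left.1 hdisj hv (this ▸ hw)
  have far_succ {t : ℕ} {ps : List ℕ} (hps : ∀ p ∈ ps, Excluded t p) {T' : T}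
      (hroot : root ps ([((false, 0) : Wd),
        (true, fun k : Fin 6 => if (k : ℕ) < t + 1 then 1 else 0)].map idx) (fun s => chk ps T' s [] 1) init = true)
      (hfar : ∀ v ∈ V, ∀ w ∈ W, ¬ Dicho c v w →
        t < (Finset.univ.filter fun i => w i ≠ v i).card) :
      ∀ v ∈ V, ∀ w ∈ W, ¬ Dicho c v w →
        t + 1 < (Finset.univ.filter fun i => w i ≠ v i).card := by
    intro v hv w hw hvw
    refine lt_of_le_of_ne' (hfar v hv w hw hvw) fun hcard => ?_
    obtain ⟨e, σ, he, hev, hew⟩ := exists_encode hinv hfix hba hba' hS hvw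
    rw [hcard] at hew
    have hv' : ((false, 0) : Wd) ∈ family (encode e σ) V W := hev ▸ mem_family.2 hv
    refine not_good_of_chk hps hroot (by simp) (good hfar σ he) ?_ hv'
    simp only [List.forall_mem_cons, List.not_mem_nil, false_imp_iff, implies_true, and_true]
    exact ⟨hv', hew ▸ mem_family.2 hw⟩
  have h1 := far_succ excluded_of_mem_bans0 chk_distance_one h0
  have h2 := far_succ excluded_of_mem_bans1 chk_distance_two h1
  obtain ⟨v, hv⟩ := hVne
  have hvv : ¬ Dicho c v v := fun ⟨j, hj⟩ => hfix _ hj.symm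
  obtain ⟨e, σ, he, hev, -⟩ := exists_encode hinv hfix hba hba' hS hvv
  have hv' : ((false, 0) : Wd) ∈ family (encode e σ) V W := hev ▸ mem_family.2 hv
  exact not_good_of_chk excluded_of_mem_bans2 (P := [(false, 0)]) chk_distance_three (by simp)
    (good h2 σ he)     (by simpa using hv') hv'

end Encoding

end Cube

theorem dim6_card_gt_twelve [Fintype S] (c : S → S)
    (hinv : Function.Involutive c) (hfix : ∀ s, c s ≠ s)
    (a b : S) (hba : b ≠ a) (hba' : b ≠ c a)
    (hS : ∀ s : S, s = a ∨ s = c a ∨ s = b ∨ s = c b)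
    (V W : Set (Fin 6 → S))
    (hVne : V.Nonempty) (hWne : W.Nonempty)
    (hV : PolyboxCode c V) (hW : PolyboxCode c W)
    (hdisj : Disjoint V W) (heq : EquivCodes c V W)
    (hVt : NoTwinPair c V) (hWt : NoTwinPair c W)
    (hdist : ∀ i : Fin 6,
      ¬ ((Subcode V i a).ncard = 5 ∧ (Subcode V i (c a)).ncard = 5 ∧
          (Subcode V i b).ncard = 1 ∧ (Subcode V i (c b)).ncard = 1) ∧
      ¬ ((Subcode V i a).ncard = 1 ∧ (Subcode V i (c a)).ncard = 1 ∧
          (Subcode V i b).ncard = 5 ∧ (Subcode V i (c b)).ncard = 5)) :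
    12 < V.ncard :=
  Cube.twelve_lt_ncard hinv hfix hba hba' hS hVne hV hW hdisj heq hVt hWt hdist
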